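/- Let n ≥ 1, s, m ∈ ℝ and 0 < p, q ≤ ∞. Let a ∈ S^m(ℝ^n), let φ ∈ Φ^2 satisfy the SND condition, and set σ(x,ξ) = (1 − ψ_0(ξ)) a(x,ξ). Then there exists a constant C such that for every Schwartz function f on ℝ^n one has ‖T_σ^φ f‖_{B^s_{p,q}} ≤ C ‖f‖_{B^{s+m−m_c(p)}_{p,q}}. -/

import Mathlib

noncomputable section

open MeasureTheory Complex
open scoped ENNReal NNReal InnerProductSpace

/-- Euclidean space `ℝ^n`. -/
abbrev Rn (n : ℕ) := EuclideanSpace ℝ (Fin n)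

/-- The Fourier transform `f̂(ξ) = ∫ e^{-i x·ξ} f(x) dx`. -/
def ftransform (n : ℕ) (f : Rn n → ℂ) (ξ : Rn n) : ℂ :=
  ∫ x : Rn n, Complex.exp (-(Complex.I * ((⟪x, ξ⟫_ℝ : ℝ) : ℂ))) * f x

/-- The Fourier integral operator `T_a^φ f(x) = (2π)^{-n} ∫ a(x,ξ) e^{iφ(x,ξ)} f̂(ξ) dξ`. -/
def fio (n : ℕ) (a : Rn n → Rn n → ℂ) (φ : Rn n → Rn n → ℝ) (f : Rn n → ℂ) (x : Rn n) : ℂ :=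
  ((((2 * Real.pi) ^ n)⁻¹ : ℝ) : ℂ) *
    ∫ ξ : Rn n, a x ξ * Complex.exp (Complex.I * ((φ x ξ : ℝ) : ℂ)) * ftransform n f ξ

/-- The Littlewood–Paley pieces `ψ_j` built from `ψ_0`. -/
def lpPiece (n : ℕ) (ψ0 : Rn n → ℝ) (j : ℕ) (ξ : Rn n) : ℝ :=
  if j = 0 then ψ0 ξ
  else ψ0 ((2 : ℝ) ^ (-(j : ℤ)) • ξ) - ψ0 ((2 : ℝ) ^ (-(j : ℤ) + 1) • ξ)

/-- Hypotheses on the base function `ψ_0` of a Littlewood–Paley partition of unity. -/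
def IsLPBase (n : ℕ) (ψ0 : Rn n → ℝ) : Prop :=
  ContDiff ℝ (⊤ : ℕ∞) ψ0 ∧ (∀ ξ : Rn n, ‖ξ‖ ≤ 1 → ψ0 ξ = 1) ∧ (∀ ξ : Rn n, 2 < ‖ξ‖ → ψ0 ξ = 0)

/-- Inverse Fourier transform of a real-valued function. -/
def invFT (n : ℕ) (h : Rn n → ℝ) (x : Rn n) : ℂ :=
  ((((2 * Real.pi) ^ n)⁻¹ : ℝ) : ℂ) *
    ∫ ξ : Rn n, Complex.exp (Complex.I * ((⟪x, ξ⟫_ℝ : ℝ) : ℂ)) * ((h ξ : ℝ) : ℂ)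

/-- The operator `h(D) g`: convolution of `g` with the inverse Fourier transform of `h`. -/
def smoothOp (n : ℕ) (h : Rn n → ℝ) (g : Rn n → ℂ) (x : Rn n) : ℂ :=
  ∫ y : Rn n, invFT n h (x - y) * g y

/-- `ℓ^q`-norm of a sequence in `ℝ≥0∞`, for `0 < q ≤ ∞`. -/
def lqSum (q : ℝ≥0∞) (u : ℕ → ℝ≥0∞) : ℝ≥0∞ :=
  if q = ∞ then ⨆ j, u j else (∑' j, u j ^ q.toReal) ^ (1 / q.toReal)

/-- Besov–Lipschitz quasi-norm `‖g‖_{B^s_{p,q}}`. -/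
def besovNorm (n : ℕ) (ψ0 : Rn n → ℝ) (s : ℝ) (p q : ℝ≥0∞) (g : Rn n → ℂ) : ℝ≥0∞ :=
  lqSum q fun j =>
    ENNReal.ofReal ((2 : ℝ) ^ ((j : ℝ) * s)) * eLpNorm (smoothOp n (lpPiece n ψ0 j) g) p volume

/-- Triebel–Lizorkin quasi-norm `‖g‖_{F^s_{p,q}}`. -/
def tlNorm (n : ℕ) (ψ0 : Rn n → ℝ) (s : ℝ) (p q : ℝ≥0∞) (g : Rn n → ℂ) : ℝ≥0∞ :=
  if p = ∞ then
    essSup (fun x : Rn n => lqSum q fun j =>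
      ENNReal.ofReal ((2 : ℝ) ^ ((j : ℝ) * s)) *
        (‖smoothOp n (lpPiece n ψ0 j) g x‖₊ : ℝ≥0∞)) volume
  else
    (∫⁻ x : Rn n, (lqSum q fun j =>
      ENNReal.ofReal ((2 : ℝ) ^ ((j : ℝ) * s)) *
        (‖smoothOp n (lpPiece n ψ0 j) g x‖₊ : ℝ≥0∞)) ^ p.toReal ∂volume) ^ (1 / p.toReal)

/-- Critical order `m_c(p) = -(n-1)|1/p - 1/2|`. -/
def criticalOrder (n : ℕ) (p : ℝ≥0∞) : ℝ := -((n : ℝ) - 1) * |p⁻¹.toReal - 1 / 2|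

/-- The symbol class `S^m(ℝ^n)`. -/
def SymbolClass (n : ℕ) (m : ℝ) (a : Rn n → Rn n → ℂ) : Prop :=
  ContDiff ℝ (⊤ : ℕ∞) (fun p : Rn n × Rn n => a p.1 p.2) ∧
  ∀ k l : ℕ, ∃ C : ℝ, ∀ x ξ : Rn n,
    ‖iteratedFDeriv ℝ k (fun ξ' => iteratedFDeriv ℝ l (fun x' => a x' ξ') x) ξ‖ ≤
      C * (1 + ‖ξ‖ ^ 2) ^ ((m - (k : ℝ)) / 2)

/-- Smoothness away from `ξ = 0` and positive homogeneity of degree 1 in `ξ` of a phase. -/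
def PhaseSmoothHomog (n : ℕ) (φ : Rn n → Rn n → ℝ) : Prop :=
  ContDiffOn ℝ (⊤ : ℕ∞) (fun p : Rn n × Rn n => φ p.1 p.2) {p : Rn n × Rn n | p.2 ≠ 0} ∧
  ∀ (x ξ : Rn n) (t : ℝ), 0 < t → φ x (t • ξ) = t * φ x ξ

/-- The phase class `Φ^k`. -/
def PhaseClass (n : ℕ) (k : ℕ) (φ : Rn n → Rn n → ℝ) : Prop :=
  PhaseSmoothHomog n φ ∧
  ∀ a b : ℕ, k ≤ a + b → ∃ C : ℝ, ∀ x ξ : Rn n, ξ ≠ 0 →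
    ‖ξ‖ ^ ((a : ℝ) - 1) *
      ‖iteratedFDerivWithin ℝ a
        (fun ξ' => iteratedFDeriv ℝ b (fun x' => φ x' ξ') x) {ξ' : Rn n | ξ' ≠ 0} ξ‖ ≤ C

/-- Determinant of the mixed Hessian `(∂²φ/∂x_i∂ξ_k)`. -/
def mixedHessianDet (n : ℕ) (φ : Rn n → Rn n → ℝ) (x ξ : Rn n) : ℝ :=
  Matrix.det (Matrix.of fun i k : Fin n =>
    fderiv ℝ (fun x' => fderiv ℝ (fun ξ' => φ x' ξ') ξ (EuclideanSpace.single k 1)) x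
      (EuclideanSpace.single i 1))

/-- The strong non-degeneracy (SND) condition. -/
def SNDCondition (n : ℕ) (φ : Rn n → Rn n → ℝ) : Prop :=
  ∃ δ : ℝ, 0 < δ ∧ ∀ x ξ : Rn n, ξ ≠ 0 → δ ≤ |mixedHessianDet n φ x ξ|

/-- Non-degeneracy of the phase on a compact set `K`. -/
def NonDegenerateOn (n : ℕ) (φ : Rn n → Rn n → ℝ) (K : Set (Rn n)) : Prop :=
  ∀ x ∈ K, ∀ ξ : Rn n, ξ ≠ 0 → mixedHessianDet n φ x ξ ≠ 0

/-! ### Families of smooth functions with uniform derivative bounds -/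

section UniformBounds

variable {ι κ X Y F G H : Type*} [NormedAddCommGroup X] [NormedSpace ℝ X]
  [NormedAddCommGroup Y] [NormedSpace ℝ Y]
  [NormedAddCommGroup F] [NormedSpace ℝ F] [NormedAddCommGroup G] [NormedSpace ℝ G]
  [NormedAddCommGroup H] [NormedSpace ℝ H]

/-- A family of smooth functions whose `k`-th derivatives are bounded by `C_k * w * ρ ^ k`,
uniformly in the family. -/
def UBd (f : ι → X → G) (w ρ : ι → X → ℝ) : Prop :=
  (∀ i, ContDiff ℝ (⊤ : ℕ∞) (f i)) ∧
    ∀ k : ℕ, ∃ C : ℝ, 0 ≤ C ∧ ∀ i v, ‖iteratedFDeriv ℝ k (f i) v‖ ≤ C * (w i v * ρ i v ^ k)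

theorem UBd.smooth {f : ι → X → G} {w ρ : ι → X → ℝ} (h : UBd f w ρ) (i : ι) :
    ContDiff ℝ (⊤ : ℕ∞) (f i) := h.1 i

theorem UBd.smooth' {f : ι → X → G} {w ρ : ι → X → ℝ} (h : UBd f w ρ) (i : ι) (k : ℕ) :
    ContDiff ℝ k (f i) := (h.1 i).of_le (by exact_mod_cast le_top)

theorem UBd.norm_le {f : ι → X → G} {w ρ : ι → X → ℝ} (h : UBd f w ρ) :
    ∃ C : ℝ, 0 ≤ C ∧ ∀ i v, ‖f i v‖ ≤ C * w i v := by
  obtain ⟨C, hC, h⟩ := h.2 0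
  exact ⟨C, hC, fun i v => by simpa using h i v⟩

theorem UBd.mono {f : ι → X → G} {w ρ w' ρ' : ι → X → ℝ} (h : UBd f w ρ) (K : ℝ)
    (hK : 0 ≤ K) (hw : ∀ i v, 0 ≤ w i v) (hw' : ∀ i v, w i v ≤ K * w' i v)
    (hρ : ∀ i v, 0 ≤ ρ i v) (hρ' : ∀ i v, ρ i v ≤ ρ' i v) : UBd f w' ρ' := by
  refine ⟨h.1, fun k => ?_⟩
  obtain ⟨C, hC, h⟩ := h.2 k
  refine ⟨C * K, by positivity, fun i v => (h i v).trans ?_⟩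
  rw [mul_assoc, ← mul_assoc K]
  refine mul_le_mul_of_nonneg_left ?_ hC
  have := hρ i v
  have := hw i v
  have := hw' i v
  exact mul_le_mul this (pow_le_pow_left₀ (hρ i v) (hρ' i v) k) (by positivity) (by linarith)

theorem UBd.reindex {f : ι → X → G} {w ρ : ι → X → ℝ} (h : UBd f w ρ) (τ : κ → ι) :
    UBd (fun j => f (τ j)) (fun j => w (τ j)) (fun j => ρ (τ j)) :=
  ⟨fun _ => h.1 _, fun k => let ⟨C, hC, h⟩ := h.2 k; ⟨C, hC, fun _ v => h _ v⟩⟩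

theorem UBd.add {f g : ι → X → G} {w ρ : ι → X → ℝ} (hf : UBd f w ρ) (hg : UBd g w ρ) :
    UBd (fun i v => f i v + g i v) w ρ := by
  refine ⟨fun i => (hf.1 i).add (hg.1 i), fun k => ?_⟩
  obtain ⟨C, hC, h⟩ := hf.2 k
  obtain ⟨C', hC', h'⟩ := hg.2 k
  refine ⟨C + C', by positivity, fun i v => ?_⟩
  have e : iteratedFDeriv ℝ k (fun v => f i v + g i v) v
      = iteratedFDeriv ℝ k (f i) v + iteratedFDeriv ℝ k (g i) v :=
    iteratedFDeriv_add_apply (hf.smooth' i k).contDiffAt (hg.smooth' i k).contDiffAt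
  rw [e, add_mul]
  exact (norm_add_le _ _).trans (add_le_add (h i v) (h' i v))

theorem UBd.zero (w ρ : ι → X → ℝ) : UBd (fun (_ : ι) (_ : X) => (0 : G)) w ρ := by
  refine ⟨fun i => contDiff_const, fun k => ⟨0, le_rfl, fun i v => ?_⟩⟩
  have : iteratedFDeriv ℝ k (fun _ : X => (0 : G)) v = 0 := by
    rw [iteratedFDeriv_fun_zero]; rfl
  simp [this]

theorem UBd.sum {σ : Type*} (s : Finset σ) {f : σ → ι → X → G} {w ρ : ι → X → ℝ}
    (hf : ∀ a ∈ s, UBd (f a) w ρ) : UBd (fun i v => ∑ a ∈ s, f a i v) w ρ := by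
  classical
  induction s using Finset.induction_on with
  | empty => simpa using UBd.zero w ρ
  | insert a s ha ih =>
    simp only [Finset.sum_insert ha]
    exact (hf a (Finset.mem_insert_self _ _)).add
      (ih fun b hb => hf b (Finset.mem_insert_of_mem hb))

theorem UBd.bilin (B : F →L[ℝ] G →L[ℝ] H) {f : ι → X → F} {g : ι → X → G}
    {w w' ρ : ι → X → ℝ} (hf : UBd f w ρ) (hg : UBd g w' ρ)
    (hw : ∀ i v, 0 ≤ w i v) (hρ : ∀ i v, 0 ≤ ρ i v) :
    UBd (fun i v => B (f i v) (g i v)) (fun i v => w i v * w' i v) ρ := by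
  refine ⟨fun i => B.isBoundedBilinearMap.contDiff.comp ((hf.1 i).prodMk (hg.1 i)), fun k => ?_⟩
  choose C hC h using hf.2
  choose C' hC' h' using hg.2
  refine ⟨‖B‖ * ∑ j ∈ Finset.range (k + 1), (k.choose j : ℝ) * C j * C' (k - j), ?_, ?_⟩
  · exact mul_nonneg (norm_nonneg B) (Finset.sum_nonneg fun j _ =>
      mul_nonneg (mul_nonneg (by positivity) (hC j)) (hC' _))
  intro i v
  refine (B.norm_iteratedFDeriv_le_of_bilinear (hf.smooth' i k) (hg.smooth' i k) v le_rfl).trans ?_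
  rw [mul_assoc]
  refine mul_le_mul_of_nonneg_left ?_ (norm_nonneg B)
  rw [Finset.sum_mul]
  refine Finset.sum_le_sum fun j hj => ?_
  have hjk : j ≤ k := by simpa [Nat.lt_succ_iff] using hj
  have e : ρ i v ^ k = ρ i v ^ j * ρ i v ^ (k - j) := by rw [← pow_add]; congr 1; omega
  have h1 := h j i v
  have h2 := h' (k - j) i v
  calc (k.choose j : ℝ) * ‖iteratedFDeriv ℝ j (f i) v‖ * ‖iteratedFDeriv ℝ (k - j) (g i) v‖
      ≤ (k.choose j : ℝ) * (C j * (w i v * ρ i v ^ j)) * (C' (k - j) * (w' i v * ρ i v ^ (k - j))) := by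
        have := hρ i v
        have := hw i v
        have := hC j
        gcongr
    _ = _ := by rw [e]; ring

theorem UBd.clm_comp (L : G →L[ℝ] H) {f : ι → X → G} {w ρ : ι → X → ℝ} (hf : UBd f w ρ) :
    UBd (fun i v => L (f i v)) w ρ := by
  refine ⟨fun i => L.contDiff.comp (hf.1 i), fun k => ?_⟩
  obtain ⟨C, hC, h⟩ := hf.2 k
  refine ⟨‖L‖ * C, by positivity, fun i v => ?_⟩
  refine (L.norm_iteratedFDeriv_comp_left (hf.smooth' i k).contDiffAt le_rfl).trans ?_
  rw [mul_assoc]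
  exact mul_le_mul_of_nonneg_left (h i v) (norm_nonneg _)

theorem UBd.neg {f : ι → X → G} {w ρ : ι → X → ℝ} (hf : UBd f w ρ) :
    UBd (fun i v => - f i v) w ρ := by
  simpa using hf.clm_comp (-(ContinuousLinearMap.id ℝ G))

theorem norm_iteratedFDeriv_comp_affine_le {f : X → G} {k : ℕ} (hf : ContDiff ℝ k f)
    (A : Y →L[ℝ] X) (b : X) (v : Y) :
    ‖iteratedFDeriv ℝ k (fun y => f (A y + b)) v‖ ≤ ‖iteratedFDeriv ℝ k f (A v + b)‖ * ‖A‖ ^ k := by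
  have h1 : ContDiff ℝ k (fun z => f (z + b)) := hf.comp (contDiff_id.add contDiff_const)
  have e : iteratedFDeriv ℝ k (fun y => f (A y + b)) v =
      (iteratedFDeriv ℝ k (fun z => f (z + b)) (A v)).compContinuousLinearMap fun _ => A :=
    A.iteratedFDeriv_comp_right h1 v le_rfl
  rw [e, iteratedFDeriv_comp_add_right]
  refine (ContinuousMultilinearMap.norm_compContinuousLinearMap_le _ _).trans ?_
  simp

theorem UBd.comp_affine {f : ι → X → G} {w ρ : ι → X → ℝ} (hf : UBd f w ρ)
    (hw : ∀ i v, 0 ≤ w i v) (hρ : ∀ i v, 0 ≤ ρ i v)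
    (τ : κ → ι) (A : κ → Y →L[ℝ] X) (b : κ → X) (r : κ → ℝ) (hr : ∀ j, ‖A j‖ ≤ r j) :
    UBd (fun j y => f (τ j) (A j y + b j)) (fun j y => w (τ j) (A j y + b j))
      (fun j y => ρ (τ j) (A j y + b j) * r j) := by
  refine ⟨fun j => (hf.1 _).comp ((A j).contDiff.add contDiff_const), fun k => ?_⟩
  obtain ⟨C, hC, h⟩ := hf.2 k
  refine ⟨C, hC, fun j v => ?_⟩
  refine (norm_iteratedFDeriv_comp_affine_le (hf.smooth' _ k) (A j) (b j) v).trans ?_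
  rw [mul_pow, ← mul_assoc, ← mul_assoc, mul_assoc C]
  have := hw (τ j) (A j v + b j)
  have := hρ (τ j) (A j v + b j)
  exact mul_le_mul (h _ _) (pow_le_pow_left₀ (norm_nonneg _) (hr j) k) (by positivity)
    (by positivity)

theorem UBd.fderiv_bound {f : ι → X → G} {w ρ : ι → X → ℝ} (hf : UBd f w ρ) :
    UBd (fun i v => fderiv ℝ (f i) v) (fun i v => w i v * ρ i v) ρ := by
  refine ⟨fun i => (hf.1 i).fderiv_right (by simp), fun k => ?_⟩
  obtain ⟨C, hC, h⟩ := hf.2 (k + 1)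
  refine ⟨C, hC, fun i v => ?_⟩
  have := h i v
  rw [← norm_iteratedFDeriv_fderiv] at this
  refine this.trans_eq ?_
  rw [pow_succ]; ring

theorem UBd.lineDeriv_bound {f : ι → X → G} {w ρ : ι → X → ℝ} (hf : UBd f w ρ) (e : X) :
    UBd (fun i v => _root_.fderiv ℝ (f i) v e) (fun i v => w i v * ρ i v) ρ :=
  hf.fderiv_bound.clm_comp (ContinuousLinearMap.apply ℝ G e)

/-- Composition with an outer function whose derivatives are bounded on the ranges. -/
theorem UBd.of_comp {g : G → H} (hg : ContDiff ℝ (⊤ : ℕ∞) g) {f : ι → X → G} {ρ : ι → X → ℝ}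
    (hρ : ∀ i v, 0 ≤ ρ i v) (hf : ∀ i, ContDiff ℝ (⊤ : ℕ∞) (f i))
    (hb : ∀ k : ℕ, 1 ≤ k → ∃ C : ℝ, 0 ≤ C ∧ ∀ i v, ‖iteratedFDeriv ℝ k (f i) v‖ ≤ C * ρ i v ^ k)
    (hgb : ∀ k : ℕ, ∃ C : ℝ, 0 ≤ C ∧ ∀ i v, ‖iteratedFDeriv ℝ k g (f i v)‖ ≤ C) :
    UBd (fun i v => g (f i v)) (fun _ _ => 1) ρ := by
  refine ⟨fun i => hg.comp (hf i), fun k => ?_⟩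
  choose! C hC h using hb
  choose C' hC' h' using hgb
  set D : ℝ := 1 + ∑ j ∈ Finset.Icc 1 k, C j with hD
  have hsum : 0 ≤ ∑ j ∈ Finset.Icc 1 k, C j :=
    Finset.sum_nonneg fun j hj => hC j (Finset.mem_Icc.1 hj).1
  have hD1 : 1 ≤ D := by linarith
  have hCD : ∀ j, 1 ≤ j → j ≤ k → C j ≤ D ^ j := by
    intro j h1 h2
    have : C j ≤ ∑ j ∈ Finset.Icc 1 k, C j :=
      Finset.single_le_sum (f := C) (fun j hj => hC j (Finset.mem_Icc.1 hj).1)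
        (Finset.mem_Icc.2 ⟨h1, h2⟩)
    calc C j ≤ D := by linarith
      _ ≤ D ^ j := le_self_pow₀ hD1 (by omega)
  set M : ℝ := ∑ j ∈ Finset.range (k + 1), C' j
  refine ⟨k.factorial * M * D ^ k, ?_, fun i v => ?_⟩
  · have : 0 ≤ M := Finset.sum_nonneg fun j _ => hC' j
    positivity
  have key := norm_iteratedFDeriv_comp_le (𝕜 := ℝ) (g := g) (f := f i) (n := k) (N := (k : ℕ∞))
    (hg.of_le (by exact_mod_cast le_top)) ((hf i).of_le (by exact_mod_cast le_top)) le_rfl v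
    (C := M) (D := D * ρ i v)
    (fun j hj => (h' j i v).trans
      (Finset.single_le_sum (f := C') (fun j _ => hC' j) (Finset.mem_range.2 (by omega))))
    (fun j h1 h2 => (h j h1 i v).trans (by
      rw [mul_pow]; exact mul_le_mul_of_nonneg_right (hCD j h1 h2) (pow_nonneg (hρ i v) j)))
  refine key.trans_eq ?_
  rw [mul_pow]; ring

theorem UBd.of_comp_bdd [ProperSpace G] {g : G → H} (hg : ContDiff ℝ (⊤ : ℕ∞) g) {f : ι → X → G}
    {ρ : ι → X → ℝ} (hρ : ∀ i v, 0 ≤ ρ i v) (hf : UBd f (fun _ _ => 1) ρ) :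
    UBd (fun i v => g (f i v)) (fun _ _ => 1) ρ := by
  refine UBd.of_comp hg hρ hf.1 (fun k _ => ?_) fun k => ?_
  · obtain ⟨C, hC, h⟩ := hf.2 k
    exact ⟨C, hC, fun i v => by simpa using h i v⟩
  · obtain ⟨R, hR, h⟩ := hf.norm_le
    obtain ⟨C, hC⟩ := (isCompact_closedBall (0 : G) R).exists_bound_of_continuousOn
      (hg.continuous_iteratedFDeriv (m := k) (by exact_mod_cast le_top)).continuousOn
    refine ⟨max C 0, le_max_right _ _, fun i v => (hC _ ?_).trans (le_max_left _ _)⟩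
    simpa using h i v

theorem UBd.cexp {f : ι → X → ℝ} {ρ : ι → X → ℝ}
    (hρ : ∀ i v, 0 ≤ ρ i v) (hf : ∀ i, ContDiff ℝ (⊤ : ℕ∞) (f i))
    (hb : ∀ k : ℕ, 1 ≤ k → ∃ C : ℝ, 0 ≤ C ∧ ∀ i v, ‖iteratedFDeriv ℝ k (f i) v‖ ≤ C * ρ i v ^ k) :
    UBd (fun i v => Complex.exp (I * (f i v : ℂ))) (fun _ _ => 1) ρ := by
  have hs : ContDiff ℝ (⊤ : ℕ∞) (fun t : ℝ => Complex.exp (I * (t : ℂ))) :=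
    (contDiff_const.mul Complex.ofRealCLM.contDiff).cexp
  refine UBd.of_comp (g := fun t : ℝ => Complex.exp (I * (t : ℂ))) hs hρ hf hb fun k => ?_
  have hd : ∀ k : ℕ, iteratedDeriv k (fun t : ℝ => Complex.exp (I * (t : ℂ))) =
      fun t : ℝ => I ^ k * Complex.exp (I * (t : ℂ)) := by
    intro k
    induction k with
    | zero => simp
    | succ k ih =>
      rw [iteratedDeriv_succ, ih]
      funext t
      have h1 : HasDerivAt (fun t : ℝ => Complex.exp (I * (t : ℂ))) (Complex.exp (I * t) * (I * 1)) t :=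
        ((Complex.ofRealCLM.hasDerivAt (x := t)).const_mul I).cexp
      rw [(h1.const_mul (I ^ k)).deriv, pow_succ]; ring
  refine ⟨1, zero_le_one, fun i v => ?_⟩
  rw [norm_iteratedFDeriv_eq_norm_iteratedDeriv, hd]
  simp [Complex.norm_exp]

theorem UBd.const_fun {g : X → G} {w ρ : ι → X → ℝ} (hg : ContDiff ℝ (⊤ : ℕ∞) g)
    (h : ∀ k : ℕ, ∃ C : ℝ, 0 ≤ C ∧ ∀ v, ∀ i, ‖iteratedFDeriv ℝ k g v‖ ≤ C * (w i v * ρ i v ^ k)) :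
    UBd (fun _ : ι => g) w ρ :=
  ⟨fun _ => hg, fun k => let ⟨C, hC, h⟩ := h k; ⟨C, hC, fun i v => h v i⟩⟩

theorem UBd.of_hasCompactSupport {g : X → G} (hg : ContDiff ℝ (⊤ : ℕ∞) g)
    (hc : HasCompactSupport g) :
    UBd (fun _ : ι => g) (fun _ _ => 1) (fun _ _ => 1) := by
  refine UBd.const_fun hg fun k => ?_
  obtain ⟨C, hC⟩ := (hc.iteratedFDeriv (𝕜 := ℝ) k).exists_bound_of_continuous
    (hg.continuous_iteratedFDeriv (m := k) (by exact_mod_cast le_top))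
  exact ⟨max C 0, le_max_right _ _, fun v _ => by
    simpa using (hC v).trans (le_max_left C 0)⟩

theorem UBd.const (c : ι → G) (K : ℝ) (hK : ∀ i, ‖c i‖ ≤ K) :
    UBd (fun i (_ : X) => c i) (fun _ _ => 1) (fun _ _ => 1) := by
  refine ⟨fun i => contDiff_const, fun k => ?_⟩
  rcases Nat.eq_zero_or_pos k with rfl | hk
  · exact ⟨max K 0, le_max_right _ _, fun i v => by simpa using (hK i).trans (le_max_left K 0)⟩
  · refine ⟨0, le_rfl, fun i v => ?_⟩
    rw [iteratedFDeriv_const_of_ne (by omega)]; simp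

end UniformBounds

/-! ### Slices, parametric integrals -/

section Slices

variable {ι V X G : Type*} [NormedAddCommGroup X] [NormedSpace ℝ X]
  [NormedAddCommGroup V] [NormedSpace ℝ V] [NormedAddCommGroup G] [NormedSpace ℝ G]

theorem iteratedFDeriv_slice {f : V × X → G} {k : ℕ} (hf : ContDiff ℝ k f) (v : V) (x : X) :
    iteratedFDeriv ℝ k (fun y => f (v, y)) x =
      (iteratedFDeriv ℝ k f (v, x)).compContinuousLinearMap
        fun _ => ContinuousLinearMap.inr ℝ V X := by
  have h1 : ContDiff ℝ k (fun z => f (z + (v, 0))) := hf.comp (contDiff_id.add contDiff_const)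
  have e := (ContinuousLinearMap.inr ℝ V X).iteratedFDeriv_comp_right h1 x le_rfl
  rw [iteratedFDeriv_comp_add_right] at e
  have e2 : ((fun z => f (z + (v, 0))) ∘ (ContinuousLinearMap.inr ℝ V X)) = fun y => f (v, y) := by
    funext y; simp
  rw [e2] at e
  simpa using e

theorem norm_iteratedFDeriv_slice_le {f : V × X → G} {k : ℕ} (hf : ContDiff ℝ k f)
    (v : V) (x : X) :
    ‖iteratedFDeriv ℝ k (fun y => f (v, y)) x‖ ≤ ‖iteratedFDeriv ℝ k f (v, x)‖ := by
  rw [iteratedFDeriv_slice hf]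
  refine (ContinuousMultilinearMap.norm_compContinuousLinearMap_le _ _).trans ?_
  refine mul_le_of_le_one_right (norm_nonneg _) (Finset.prod_le_one (fun _ _ => norm_nonneg _)
    fun _ _ => ?_)
  exact ContinuousLinearMap.opNorm_le_bound _ zero_le_one fun y => by simp

theorem continuous_iteratedFDeriv_slice {f : V × X → G} {k : ℕ} (hf : ContDiff ℝ k f) :
    Continuous fun p : V × X => iteratedFDeriv ℝ k (fun y => f (p.1, y)) p.2 := by
  simp_rw [iteratedFDeriv_slice hf]
  exact (ContinuousMultilinearMap.compContinuousLinearMapL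
    (fun _ : Fin k => ContinuousLinearMap.inr ℝ V X)).continuous.comp
      (hf.continuous_iteratedFDeriv (m := k) le_rfl)

theorem UBd.slice {f : ι → V × X → G} {w ρ : ι → V × X → ℝ} (hf : UBd f w ρ) :
    UBd (fun (i : ι × V) y => f i.1 (i.2, y)) (fun i y => w i.1 (i.2, y))
      (fun i y => ρ i.1 (i.2, y)) := by
  refine ⟨fun i => (hf.1 i.1).comp (contDiff_const.prodMk contDiff_id), fun k => ?_⟩
  obtain ⟨C, hC, h⟩ := hf.2 k
  exact ⟨C, hC, fun i v => (norm_iteratedFDeriv_slice_le (hf.smooth' i.1 k) _ _).trans (h _ _)⟩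

end Slices

section ParametricIntegral

variable {S X G : Type*} [MeasurableSpace S] [NormedAddCommGroup X] [NormedSpace ℝ X]
  [ProperSpace X] [NormedAddCommGroup G] [NormedSpace ℝ G] [CompleteSpace G]

/-- Differentiation under the integral sign to all orders. -/
theorem contDiff_integral_and_bound {ν : Measure S} {F : S → X → G}
    (hF : ∀ s, ContDiff ℝ (⊤ : ℕ∞) (F s))
    (hm : ∀ (k : ℕ) (x : X), AEStronglyMeasurable (fun s => iteratedFDeriv ℝ k (F s) x) ν)
    {g : ℕ → S → ℝ} {ω : ℕ → X → ℝ} (hg : ∀ k, Integrable (g k) ν)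
    (hω : ∀ k, Continuous (ω k)) (hg0 : ∀ k s, 0 ≤ g k s)
    (hb : ∀ k s x, ‖iteratedFDeriv ℝ k (F s) x‖ ≤ g k s * ω k x) :
    ContDiff ℝ (⊤ : ℕ∞) (fun x => ∫ s, F s x ∂ν) ∧
      ∀ (k : ℕ) (x : X), ‖iteratedFDeriv ℝ k (fun x => ∫ s, F s x ∂ν) x‖ ≤
        (∫ s, g k s ∂ν) * ω k x := by
  set p : X → FormalMultilinearSeries ℝ X G :=
    fun x k => ∫ s, iteratedFDeriv ℝ k (F s) x ∂ν with hp
  have hintg : ∀ k x, Integrable (fun s => iteratedFDeriv ℝ k (F s) x) ν := fun k x =>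
    ((hg k).mul_const (ω k x)).mono' (hm k x) (Filter.Eventually.of_forall fun s => hb k s x)
  have hder : ∀ (k : ℕ) (x : X), HasFDerivAt (fun y => p y k) (p x (k + 1)).curryLeft x := by
    intro k x
    obtain ⟨B, hB⟩ := (isCompact_closedBall x 1).exists_bound_of_continuousOn (hω (k + 1)).continuousOn
    have hcurry : ∀ s y, HasFDerivAt (iteratedFDeriv ℝ k (F s))
        (iteratedFDeriv ℝ (k + 1) (F s) y).curryLeft y := by
      intro s y
      have hd : DifferentiableAt ℝ (iteratedFDeriv ℝ k (F s)) y :=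
        ((hF s).differentiable_iteratedFDeriv (m := k) (by exact_mod_cast WithTop.coe_lt_top _)) y
      have := hd.hasFDerivAt
      rwa [show _root_.fderiv ℝ (iteratedFDeriv ℝ k (F s)) y =
        (iteratedFDeriv ℝ (k + 1) (F s) y).curryLeft from rfl] at this
    let Lc := (continuousMultilinearCurryLeftEquiv ℝ (fun _ : Fin (k + 1) => X) G)
    have h := hasFDerivAt_integral_of_dominated_of_fderiv_le (𝕜 := ℝ) (μ := ν)
      (F := fun y s => iteratedFDeriv ℝ k (F s) y)
      (F' := fun y s => (iteratedFDeriv ℝ (k + 1) (F s) y).curryLeft) (x₀ := x)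
      (bound := fun s => g (k + 1) s * B) (s := Metric.closedBall x 1)
      (Metric.closedBall_mem_nhds x one_pos)
      (Filter.Eventually.of_forall fun y => hm k y) (hintg k x)
      (Lc.continuous.comp_aestronglyMeasurable (hm (k + 1) x))
      (Filter.Eventually.of_forall fun s y hy => by
        have e : ‖(iteratedFDeriv ℝ (k + 1) (F s) y).curryLeft‖ =
          ‖iteratedFDeriv ℝ (k + 1) (F s) y‖ := ContinuousMultilinearMap.curryLeft_norm _
        rw [e]
        refine (hb (k + 1) s y).trans (mul_le_mul_of_nonneg_left ?_ (hg0 _ _))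
        exact (le_abs_self _).trans (hB y hy))
      ((hg (k + 1)).mul_const B)
      (Filter.Eventually.of_forall fun s y _ => hcurry s y)
    have e : (p x (k + 1)).curryLeft =
        ∫ s, (iteratedFDeriv ℝ (k + 1) (F s) x).curryLeft ∂ν := by
      let L : (ContinuousMultilinearMap ℝ (fun _ : Fin (k + 1) => X) G) →L[ℝ]
          (X →L[ℝ] ContinuousMultilinearMap ℝ (fun _ : Fin k => X) G) :=
        Lc.toContinuousLinearEquiv.toContinuousLinearMap
      have := ContinuousLinearMap.integral_comp_comm (𝕜 := ℝ)
        (E := ContinuousMultilinearMap ℝ (fun _ : Fin (k + 1) => X) G)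
        (Fₗ := X →L[ℝ] ContinuousMultilinearMap ℝ (fun _ : Fin k => X) G) L (hintg (k + 1) x)
      exact this.symm
    rw [e]; exact h
  have hTS : HasFTaylorSeriesUpTo (⊤ : ℕ∞) (fun x => ∫ s, F s x ∂ν) p := by
    refine ⟨fun x => ?_, fun k _ x => hder k x, fun k _ => ?_⟩
    · have := (ContinuousMultilinearMap.apply ℝ (fun _ : Fin 0 => X) G 0).integral_comp_comm (hintg 0 x)
      simp only [hp, ContinuousMultilinearMap.curry0]
      rw [show (∫ s, iteratedFDeriv ℝ 0 (F s) x ∂ν) 0 =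
        ContinuousMultilinearMap.apply ℝ (fun _ : Fin 0 => X) G 0
          (∫ s, iteratedFDeriv ℝ 0 (F s) x ∂ν) from rfl, ← this]
      rfl
    · exact continuous_iff_continuousAt.2 fun x => (hder k x).continuousAt
  refine ⟨hTS.contDiff, fun k x => ?_⟩
  rw [← hTS.eq_iteratedFDeriv (m := k) (by exact_mod_cast le_top), ← integral_mul_const]
  exact norm_integral_le_of_norm_le ((hg k).mul_const _)
    (Filter.Eventually.of_forall fun s => hb k s x)

end ParametricIntegral

/-! ### From mixed partial bounds to joint bounds -/

section MixedPartials

variable {E₁ E₂ : Type} [NormedAddCommGroup E₁] [NormedSpace ℝ E₁]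
  [NormedAddCommGroup E₂] [NormedSpace ℝ E₂]

theorem iteratedFDeriv_congr_nhds {X G : Type*} [NormedAddCommGroup X] [NormedSpace ℝ X]
    [NormedAddCommGroup G] [NormedSpace ℝ G] {f g : X → G} {x : X}
    (h : ∀ᶠ y in nhds x, f y = g y) (k : ℕ) :
    iteratedFDeriv ℝ k f x = iteratedFDeriv ℝ k g x := by
  rw [← iteratedFDerivWithin_univ, ← iteratedFDerivWithin_univ]
  exact Filter.EventuallyEq.iteratedFDerivWithin_eq (by rwa [nhdsWithin_univ]) h.self_of_nhds k

/-- Partial derivative in the first variable. -/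
def partialFst {G : Type} [NormedAddCommGroup G] [NormedSpace ℝ G] (g : E₁ → E₂ → G)
    (x : E₁) (ξ : E₂) : E₁ →L[ℝ] G := fderiv ℝ (fun x' => g x' ξ) x

/-- Partial derivative in the second variable. -/
def partialSnd {G : Type} [NormedAddCommGroup G] [NormedSpace ℝ G] (g : E₁ → E₂ → G)
    (x : E₁) (ξ : E₂) : E₂ →L[ℝ] G := fderiv ℝ (fun η => g x η) ξ

/-- Norm of a mixed partial derivative. -/
def mixedNorm {G : Type} [NormedAddCommGroup G] [NormedSpace ℝ G] (a b : ℕ) (g : E₁ → E₂ → G)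
    (x : E₁) (ξ : E₂) : ℝ :=
  ‖iteratedFDeriv ℝ a (fun ξ' => iteratedFDeriv ℝ b (fun x' => g x' ξ') x) ξ‖

/-- Joint smoothness over `E₁ × U`. -/
def SmoothOver {G : Type} [NormedAddCommGroup G] [NormedSpace ℝ G] (U : Set E₂)
    (g : E₁ → E₂ → G) : Prop :=
  ContDiffOn ℝ (⊤ : ℕ∞) (fun p : E₁ × E₂ => g p.1 p.2) (Prod.snd ⁻¹' U)

variable {G : Type} [NormedAddCommGroup G] [NormedSpace ℝ G] {U : Set E₂}

theorem SmoothOver.contDiffAt {g : E₁ → E₂ → G} (hg : SmoothOver U g) (hU : IsOpen U)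
    {x : E₁} {ξ : E₂} (hξ : ξ ∈ U) :
    ContDiffAt ℝ (⊤ : ℕ∞) (fun p : E₁ × E₂ => g p.1 p.2) (x, ξ) :=
  ContDiffOn.contDiffAt hg ((hU.preimage continuous_snd).mem_nhds hξ)

theorem SmoothOver.hasFDerivAt {g : E₁ → E₂ → G} (hg : SmoothOver U g) (hU : IsOpen U)
    (x : E₁) {ξ : E₂} (hξ : ξ ∈ U) :
    HasFDerivAt (fun p : E₁ × E₂ => g p.1 p.2)
      (fderiv ℝ (fun p : E₁ × E₂ => g p.1 p.2) (x, ξ)) (x, ξ) :=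
  ((hg.contDiffAt hU hξ).differentiableAt (by simp)).hasFDerivAt

theorem SmoothOver.partialFst_eq {g : E₁ → E₂ → G} (hg : SmoothOver U g) (hU : IsOpen U)
    (x : E₁) {ξ : E₂} (hξ : ξ ∈ U) :
    partialFst g x ξ = (fderiv ℝ (fun p : E₁ × E₂ => g p.1 p.2) (x, ξ)).comp
      (ContinuousLinearMap.inl ℝ E₁ E₂) :=
  HasFDerivAt.fderiv (HasFDerivAt.comp (f := fun x' => (x', ξ)) x (hg.hasFDerivAt hU x hξ)
    (hasFDerivAt_prodMk_left x ξ))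

theorem SmoothOver.partialSnd_eq {g : E₁ → E₂ → G} (hg : SmoothOver U g) (hU : IsOpen U)
    (x : E₁) {ξ : E₂} (hξ : ξ ∈ U) :
    partialSnd g x ξ = (fderiv ℝ (fun p : E₁ × E₂ => g p.1 p.2) (x, ξ)).comp
      (ContinuousLinearMap.inr ℝ E₁ E₂) :=
  HasFDerivAt.fderiv (HasFDerivAt.comp (f := fun ξ' => (x, ξ')) ξ (hg.hasFDerivAt hU x hξ)
    (hasFDerivAt_prodMk_right x ξ))

theorem SmoothOver.fderiv_eq {g : E₁ → E₂ → G} (hg : SmoothOver U g) (hU : IsOpen U)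
    (x : E₁) {ξ : E₂} (hξ : ξ ∈ U) :
    fderiv ℝ (fun p : E₁ × E₂ => g p.1 p.2) (x, ξ) =
      (partialFst g x ξ).comp (ContinuousLinearMap.fst ℝ E₁ E₂) +
      (partialSnd g x ξ).comp (ContinuousLinearMap.snd ℝ E₁ E₂) := by
  rw [hg.partialFst_eq hU x hξ, hg.partialSnd_eq hU x hξ]
  refine ContinuousLinearMap.ext fun v => ?_
  simp [← map_add]

theorem SmoothOver.partialFst {g : E₁ → E₂ → G} (hg : SmoothOver U g) (hU : IsOpen U) :
    SmoothOver U (partialFst g) := by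
  have h : ContDiffOn ℝ (⊤ : ℕ∞) (fderiv ℝ (fun p : E₁ × E₂ => g p.1 p.2)) (Prod.snd ⁻¹' U) :=
    ContDiffOn.fderiv_of_isOpen hg (hU.preimage continuous_snd) (by simp)
  have h2 := h.clm_comp (contDiffOn_const (c := ContinuousLinearMap.inl ℝ E₁ E₂))
  exact h2.congr fun p hp => hg.partialFst_eq hU p.1 hp

theorem SmoothOver.partialSnd {g : E₁ → E₂ → G} (hg : SmoothOver U g) (hU : IsOpen U) :
    SmoothOver U (partialSnd g) := by
  have h : ContDiffOn ℝ (⊤ : ℕ∞) (fderiv ℝ (fun p : E₁ × E₂ => g p.1 p.2)) (Prod.snd ⁻¹' U) :=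
    ContDiffOn.fderiv_of_isOpen hg (hU.preimage continuous_snd) (by simp)
  have h2 := h.clm_comp (contDiffOn_const (c := ContinuousLinearMap.inr ℝ E₁ E₂))
  exact h2.congr fun p hp => hg.partialSnd_eq hU p.1 hp

theorem SmoothOver.partial_comm {g : E₁ → E₂ → G} (hg : SmoothOver U g) (hU : IsOpen U)
    (x : E₁) {ξ : E₂} (hξ : ξ ∈ U) :
    _root_.partialFst (_root_.partialSnd g) x ξ =
      (_root_.partialSnd (_root_.partialFst g) x ξ).flip := by
  set f := fun p : E₁ × E₂ => g p.1 p.2 with hf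
  have hs : IsSymmSndFDerivAt ℝ f (x, ξ) :=
    (hg.contDiffAt hU hξ).isSymmSndFDerivAt (by
      rw [minSmoothness_of_isRCLikeNormedField]
      exact WithTop.coe_le_coe.2 (le_top : (2 : ℕ∞) ≤ ⊤))
  have hd : DifferentiableAt ℝ (fderiv ℝ f) (x, ξ) :=
    ((hg.contDiffAt hU hξ).fderiv_right (m := 1) (by
      exact WithTop.coe_le_coe.2 (le_top : (1 + 1 : ℕ∞) ≤ ⊤))).differentiableAt (by simp)
  have h1 : _root_.partialFst (_root_.partialSnd g) x ξ =
      fderiv ℝ (fun x' => (fderiv ℝ f (x', ξ)).comp (ContinuousLinearMap.inr ℝ E₁ E₂)) x := by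
    unfold _root_.partialFst
    congr 1
    funext x'
    exact hg.partialSnd_eq hU x' hξ
  have h2 : _root_.partialSnd (_root_.partialFst g) x ξ =
      fderiv ℝ (fun ξ' => (fderiv ℝ f (x, ξ')).comp (ContinuousLinearMap.inl ℝ E₁ E₂)) ξ := by
    unfold _root_.partialSnd
    refine Filter.EventuallyEq.fderiv_eq ?_
    filter_upwards [hU.mem_nhds hξ] with ξ' h'
    exact hg.partialFst_eq hU x h'
  have d1 : HasFDerivAt (fun x' => fderiv ℝ f (x', ξ)) ((fderiv ℝ (fderiv ℝ f) (x, ξ)).comp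
      (ContinuousLinearMap.inl ℝ E₁ E₂)) x :=
    HasFDerivAt.comp (f := fun x' => (x', ξ)) x hd.hasFDerivAt (hasFDerivAt_prodMk_left x ξ)
  have d2 : HasFDerivAt (fun ξ' => fderiv ℝ f (x, ξ')) ((fderiv ℝ (fderiv ℝ f) (x, ξ)).comp
      (ContinuousLinearMap.inr ℝ E₁ E₂)) ξ :=
    HasFDerivAt.comp (f := fun ξ' => (x, ξ')) ξ hd.hasFDerivAt (hasFDerivAt_prodMk_right x ξ)
  rw [h1, h2]
  have e1 := d1.clm_comp (hasFDerivAt_const (ContinuousLinearMap.inr ℝ E₁ E₂) x)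
  have e2 := d2.clm_comp (hasFDerivAt_const (ContinuousLinearMap.inl ℝ E₁ E₂) ξ)
  rw [e1.fderiv, e2.fderiv]
  ext u v
  simp
  exact hs _ _

theorem mixedNorm_congr {g g' : E₁ → E₂ → G} (hU : IsOpen U)
    (h : ∀ x, ∀ ξ ∈ U, g x ξ = g' x ξ) (a b : ℕ) (x : E₁) {ξ : E₂} (hξ : ξ ∈ U) :
    mixedNorm a b g x ξ = mixedNorm a b g' x ξ := by
  unfold mixedNorm
  congr 1
  refine iteratedFDeriv_congr_nhds ?_ a
  filter_upwards [hU.mem_nhds hξ] with η hη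
  congr 1
  funext y
  exact h y η hη

/-- Uncurrying of the last variable of a multilinear map. -/
def multilinearUncurryIsometry (b : ℕ) :
    ContinuousMultilinearMap ℝ (fun _ : Fin b => E₁) (E₁ →L[ℝ] G) ≃ₗᵢ[ℝ]
      ContinuousMultilinearMap ℝ (fun _ : Fin (b + 1) => E₁) G :=
  (continuousMultilinearCurryRightEquiv' ℝ b E₁ G).symm

theorem mixedNorm_succ_right (a b : ℕ) (g : E₁ → E₂ → G) (x : E₁) (ξ : E₂) :
    mixedNorm a (b + 1) g x ξ = mixedNorm a b (partialFst g) x ξ := by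
  unfold mixedNorm
  have : (fun ξ' => iteratedFDeriv ℝ (b + 1) (fun x' => g x' ξ') x) =
      (multilinearUncurryIsometry (E₁ := E₁) (G := G) b) ∘
        fun ξ' => iteratedFDeriv ℝ b (fun x' => partialFst g x' ξ') x := by
    funext ξ'
    rw [iteratedFDeriv_succ_eq_comp_right]
    rfl
  rw [this]
  have key := LinearIsometryEquiv.norm_iteratedFDeriv_comp_left
    (multilinearUncurryIsometry (E₁ := E₁) (G := G) b)
    (fun ξ' => iteratedFDeriv ℝ b (fun x' => partialFst g x' ξ') x) ξ a
  exact key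

theorem mixedNorm_zero_right (a : ℕ) (g : E₁ → E₂ → G) (x : E₁) (ξ : E₂) :
    mixedNorm a 0 g x ξ = ‖iteratedFDeriv ℝ a (fun ξ' => g x ξ') ξ‖ := by
  unfold mixedNorm
  have : (fun ξ' => iteratedFDeriv ℝ 0 (fun x' => g x' ξ') x) =
      (continuousMultilinearCurryFin0 ℝ E₁ G).symm ∘ fun ξ' => g x ξ' := by
    funext ξ'
    rw [iteratedFDeriv_zero_eq_comp]
    rfl
  rw [this, LinearIsometryEquiv.norm_iteratedFDeriv_comp_left]

/-- Post-composition of multilinear maps with a linear isometric equivalence. -/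
def multilinearPostcompIsometry {H : Type} [NormedAddCommGroup H] [NormedSpace ℝ H]
    (L : G ≃ₗᵢ[ℝ] H) (b : ℕ) :
    ContinuousMultilinearMap ℝ (fun _ : Fin b => E₁) G ≃ₗᵢ[ℝ]
      ContinuousMultilinearMap ℝ (fun _ : Fin b => E₁) H where
  __ := (L.toContinuousLinearEquiv.continuousMultilinearMapCongrRight
    (fun _ : Fin b => E₁)).toLinearEquiv
  norm_map' f := L.toLinearIsometry.norm_compContinuousMultilinearMap f

theorem mixedNorm_isometry {H : Type} [NormedAddCommGroup H] [NormedSpace ℝ H]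
    (L : G ≃ₗᵢ[ℝ] H) (a b : ℕ) (g : E₁ → E₂ → G) (x : E₁) (ξ : E₂) :
    mixedNorm a b (fun x ξ => L (g x ξ)) x ξ = mixedNorm a b g x ξ := by
  unfold mixedNorm
  have : (fun ξ' => iteratedFDeriv ℝ b (fun x' => L (g x' ξ')) x) =
      (multilinearPostcompIsometry (E₁ := E₁) L b) ∘ fun ξ' => iteratedFDeriv ℝ b (fun x' => g x' ξ') x := by
    funext ξ'
    exact L.toContinuousLinearEquiv.iteratedFDeriv_comp_left
  rw [this, LinearIsometryEquiv.norm_iteratedFDeriv_comp_left]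

theorem mixedNorm_partialSnd (b : ℕ) : ∀ {G : Type} [NormedAddCommGroup G] [NormedSpace ℝ G]
    {U : Set E₂} {g : E₁ → E₂ → G} (_ : SmoothOver U g) (_ : IsOpen U) (a : ℕ) (x : E₁) {ξ : E₂}
    (_ : ξ ∈ U), mixedNorm a b (partialSnd g) x ξ = mixedNorm (a + 1) b g x ξ := by
  induction b with
  | zero =>
    intro G _ _ U g hg hU a x ξ hξ
    rw [mixedNorm_zero_right, mixedNorm_zero_right, ← norm_iteratedFDeriv_fderiv]
    rfl
  | succ b ih =>
    intro G _ _ U g hg hU a x ξ hξ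
    rw [mixedNorm_succ_right, mixedNorm_succ_right, ← ih (hg.partialFst hU) hU a x hξ,
      mixedNorm_congr hU (fun x ξ hξ => hg.partial_comm hU x hξ) a b x hξ]
    have key := mixedNorm_isometry (G := E₂ →L[ℝ] E₁ →L[ℝ] G) (H := E₁ →L[ℝ] E₂ →L[ℝ] G)
      (ContinuousLinearMap.flipₗᵢ ℝ E₂ E₁ G) a b
      (_root_.partialSnd (_root_.partialFst g)) x ξ
    exact key

theorem joint_bound_of_mixed {ι : Type} {U A : Set E₂} (hU : IsOpen U) (hA : A ⊆ U) (k : ℕ) :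
    ∀ {G : Type} [NormedAddCommGroup G] [NormedSpace ℝ G] {g : ι → E₁ → E₂ → G}
    (_ : ∀ i, SmoothOver U (g i))
    (_ : ∀ a b : ℕ, ∃ C : ℝ, ∀ i x, ∀ ξ ∈ A, mixedNorm a b (g i) x ξ ≤ C),
    ∃ C : ℝ, 0 ≤ C ∧ ∀ i x, ∀ ξ ∈ A,
      ‖iteratedFDeriv ℝ k (fun p : E₁ × E₂ => g i p.1 p.2) (x, ξ)‖ ≤ C := by
  induction k with
  | zero =>
    intro G _ _ g hg hb
    obtain ⟨C, hC⟩ := hb 0 0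
    refine ⟨max C 0, le_max_right _ _, fun i x ξ hξ => ?_⟩
    have := hC i x ξ hξ
    rw [mixedNorm_zero_right] at this
    simp only [norm_iteratedFDeriv_zero] at this ⊢
    exact this.trans (le_max_left _ _)
  | succ k ih =>
    intro G _ _ g hg hb
    obtain ⟨C1, hC1, h1⟩ := ih (g := fun i => partialFst (g i)) (fun i => (hg i).partialFst hU)
      (fun a b => by
        obtain ⟨C, hC⟩ := hb a (b + 1)
        exact ⟨C, fun i x ξ hξ => by rw [← mixedNorm_succ_right]; exact hC i x ξ hξ⟩)
    obtain ⟨C2, hC2, h2⟩ := ih (g := fun i => partialSnd (g i)) (fun i => (hg i).partialSnd hU)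
      (fun a b => by
        obtain ⟨C, hC⟩ := hb (a + 1) b
        exact ⟨C, fun i x ξ hξ => by
          rw [mixedNorm_partialSnd b (hg i) hU a x (hA hξ)]; exact hC i x ξ hξ⟩)
    let L1 : (E₁ →L[ℝ] G) →L[ℝ] (E₁ × E₂ →L[ℝ] G) :=
      (ContinuousLinearMap.compL ℝ (E₁ × E₂) E₁ G).flip (ContinuousLinearMap.fst ℝ E₁ E₂)
    let L2 : (E₂ →L[ℝ] G) →L[ℝ] (E₁ × E₂ →L[ℝ] G) :=
      (ContinuousLinearMap.compL ℝ (E₁ × E₂) E₂ G).flip (ContinuousLinearMap.snd ℝ E₁ E₂)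
    refine ⟨‖L1‖ * C1 + ‖L2‖ * C2, by positivity, fun i x ξ hξ => ?_⟩
    rw [← norm_iteratedFDeriv_fderiv]
    have e : iteratedFDeriv ℝ k (fderiv ℝ (fun p : E₁ × E₂ => g i p.1 p.2)) (x, ξ) =
        iteratedFDeriv ℝ k (fun p : E₁ × E₂ => L1 (partialFst (g i) p.1 p.2)
          + L2 (partialSnd (g i) p.1 p.2)) (x, ξ) := by
      refine iteratedFDeriv_congr_nhds ?_ k
      filter_upwards [(hU.preimage continuous_snd).mem_nhds (show (x, ξ) ∈ _ from hA hξ)] with p hp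
      exact (hg i).fderiv_eq hU p.1 hp
    have c1 : ContDiffAt ℝ k (fun p : E₁ × E₂ => partialFst (g i) p.1 p.2) (x, ξ) :=
      (((hg i).partialFst hU).contDiffAt hU (hA hξ)).of_le (by exact_mod_cast le_top)
    have c2 : ContDiffAt ℝ k (fun p : E₁ × E₂ => partialSnd (g i) p.1 p.2) (x, ξ) :=
      (((hg i).partialSnd hU).contDiffAt hU (hA hξ)).of_le (by exact_mod_cast le_top)
    rw [e]
    have e2 : iteratedFDeriv ℝ k (fun p : E₁ × E₂ => L1 (partialFst (g i) p.1 p.2)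
          + L2 (partialSnd (g i) p.1 p.2)) (x, ξ) =
        iteratedFDeriv ℝ k (L1 ∘ fun p : E₁ × E₂ => partialFst (g i) p.1 p.2) (x, ξ) +
        iteratedFDeriv ℝ k (L2 ∘ fun p : E₁ × E₂ => partialSnd (g i) p.1 p.2) (x, ξ) :=
      iteratedFDeriv_add_apply (L1.contDiff.contDiffAt.comp _ c1) (L2.contDiff.contDiffAt.comp _ c2)
    rw [e2]
    refine (norm_add_le _ _).trans (add_le_add ?_ ?_)
    · refine (L1.norm_iteratedFDeriv_comp_left c1 le_rfl).trans ?_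
      exact mul_le_mul_of_nonneg_left (h1 i x ξ hξ) (norm_nonneg _)
    · refine (L2.norm_iteratedFDeriv_comp_left c2 le_rfl).trans ?_
      exact mul_le_mul_of_nonneg_left (h2 i x ξ hξ) (norm_nonneg _)

/-- Cutting off in the second variable turns local bounds into global ones. -/
theorem UBd.of_cutoff {ι : Type} {U : Set E₂} (hU : IsOpen U) {c : E₂ → ℝ}
    (hc : ContDiff ℝ (⊤ : ℕ∞) c) (hcs : HasCompactSupport c) (hcU : tsupport c ⊆ U)
    {g : ι → E₁ → E₂ → G} (hg : ∀ i, SmoothOver U (g i))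
    (hb : ∀ a b : ℕ, ∃ C : ℝ, ∀ i x, ∀ ξ ∈ tsupport c, mixedNorm a b (g i) x ξ ≤ C) :
    UBd (fun i (p : E₁ × E₂) => c p.2 • g i p.1 p.2) (fun _ _ => 1) (fun _ _ => 1) := by
  have hc2 : ContDiff ℝ (⊤ : ℕ∞) (fun p : E₁ × E₂ => c p.2) := hc.comp contDiff_snd
  have hzero : ∀ i, ∀ p : E₁ × E₂, p.2 ∉ tsupport c →
      ∀ᶠ q in nhds p, c q.2 • g i q.1 q.2 = 0 := by
    intro i p hp
    have : (Prod.snd ⁻¹' (tsupport c)ᶜ : Set (E₁ × E₂)) ∈ nhds p :=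
      ((isClosed_tsupport c).isOpen_compl.preimage continuous_snd).mem_nhds hp
    filter_upwards [this] with q hq
    rw [image_eq_zero_of_notMem_tsupport hq, zero_smul]
  refine ⟨fun i => contDiff_iff_contDiffAt.2 fun p => ?_, fun k => ?_⟩
  · by_cases hp : p.2 ∈ tsupport c
    · exact hc2.contDiffAt.smul ((hg i).contDiffAt hU (hcU hp))
    · exact (contDiffAt_const (c := (0 : G))).congr_of_eventuallyEq (hzero i p hp)
  · choose Cg hCg0 hCg using fun k => joint_bound_of_mixed hU hcU k hg hb
    have hcu : UBd (fun (_ : Unit) => c) (fun _ _ => 1) (fun _ _ => 1) :=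
      UBd.of_hasCompactSupport hc hcs
    have hcu2 := hcu.comp_affine (fun _ _ => zero_le_one) (fun _ _ => zero_le_one)
      (fun _ : Unit => ()) (fun _ => ContinuousLinearMap.snd ℝ E₁ E₂) (fun _ => 0) (fun _ => 1)
      (fun _ => ContinuousLinearMap.norm_snd_le ℝ E₁ E₂)
    choose Cc hCc0 hCc using hcu2.2
    simp only [ContinuousLinearMap.coe_snd', add_zero, mul_one, one_pow] at hCc
    refine ⟨∑ j ∈ Finset.range (k + 1), (k.choose j : ℝ) * Cc j * Cg (k - j),
      Finset.sum_nonneg fun j _ => mul_nonneg (mul_nonneg (by positivity) (hCc0 _)) (hCg0 _),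
      fun i p => ?_⟩
    by_cases hp : p.2 ∈ tsupport c
    · have hgp := ((hg i).contDiffAt hU (hcU hp) (x := p.1))
      obtain ⟨u, hu, hgu⟩ := (hgp.of_le (show ((k : ℕ∞) : WithTop ℕ∞) ≤ _ by
        exact_mod_cast le_top)).contDiffOn (m := k) le_rfl (by simp)
      obtain ⟨t, htu, hto, hpt⟩ := mem_nhds_iff.1 hu
      have key := norm_iteratedFDerivWithin_smul_le (𝕜 := ℝ) (n := k) (N := (k : ℕ∞))
        (f := fun p : E₁ × E₂ => c p.2)
        (g := fun p : E₁ × E₂ => g i p.1 p.2) (s := t)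
        (hc2.contDiffOn.of_le (by exact_mod_cast le_top)) (hgu.mono htu) hto.uniqueDiffOn hpt le_rfl
      simp only [iteratedFDerivWithin_of_isOpen _ hto hpt] at key
      refine key.trans ?_
      simp only [one_pow, mul_one]
      refine Finset.sum_le_sum fun j _ => ?_
      have h1 := hCc j () p
      have h2 := hCg (k - j) i p.1 p.2 hp
      have := hCc0 j
      gcongr
    · rw [iteratedFDeriv_congr_nhds (hzero i p hp) k, iteratedFDeriv_fun_zero]
      simp only [Pi.zero_apply, norm_zero, one_pow, mul_one]
      exact Finset.sum_nonneg fun j _ => mul_nonneg (mul_nonneg (by positivity) (hCc0 _)) (hCg0 _)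

end MixedPartials

/-! ### Non-stationary phase -/

section Support

variable {ι X G : Type*} [NormedAddCommGroup X] [NormedSpace ℝ X]
  [NormedAddCommGroup G] [NormedSpace ℝ G]

theorem UBd.of_support {f : ι → X → G} {w ρ w' ρ' : ι → X → ℝ} (h : UBd f w ρ) (S : ι → Set X)
    (hS : ∀ i, IsClosed (S i)) (hf : ∀ i, ∀ v ∉ S i, f i v = 0) (K : ℝ) (hK : 0 ≤ K)
    (hw : ∀ i v, 0 ≤ w i v) (hρ : ∀ i v, 0 ≤ ρ i v)
    (hw0 : ∀ i v, 0 ≤ w' i v) (hρ0 : ∀ i v, 0 ≤ ρ' i v)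
    (hw' : ∀ i, ∀ v ∈ S i, w i v ≤ K * w' i v)
    (hρ' : ∀ i, ∀ v ∈ S i, ρ i v ≤ K * ρ' i v) : UBd f w' ρ' := by
  refine ⟨h.1, fun k => ?_⟩
  obtain ⟨C, hC, hb⟩ := h.2 k
  refine ⟨C * (K * K ^ k), by positivity, fun i v => ?_⟩
  have h1 := hw0 i v
  have h2 := hρ0 i v
  by_cases hv : v ∈ S i
  · refine (hb i v).trans ?_
    have h3 := hρ i v
    have h4 := hw i v
    calc C * (w i v * ρ i v ^ k) ≤ C * ((K * w' i v) * (K * ρ' i v) ^ k) := by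
          gcongr
          · exact hw' i v hv
          · exact hρ' i v hv
      _ = _ := by rw [mul_pow]; ring
  · have : ∀ᶠ y in nhds v, f i y = (fun _ => (0 : G)) y := by
      filter_upwards [(hS i).isOpen_compl.mem_nhds hv] with y hy using hf i y hy
    have e : iteratedFDeriv ℝ k (f i) v = iteratedFDeriv ℝ k (fun _ => (0 : G)) v := by
      rw [← iteratedFDerivWithin_univ, ← iteratedFDerivWithin_univ]
      exact Filter.EventuallyEq.iteratedFDerivWithin_eq (by rwa [nhdsWithin_univ])
        this.self_of_nhds k
    rw [e, iteratedFDeriv_fun_zero]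
    simp only [Pi.zero_apply, norm_zero]
    positivity

end Support

section NonStationary

variable {n : ℕ} {ι P : Type*} [NormedAddCommGroup P] [NormedSpace ℝ P]

theorem Rn.sum_single (v : Rn n) : ∑ l, v l • EuclideanSpace.single l (1 : ℝ) = v := by
  have := (EuclideanSpace.basisFun (Fin n) ℝ).sum_repr v
  simpa using this

theorem exists_nsp_step {B : ι → Rn n × P → ℂ} {V : ι → Rn n × P → Rn n}
    {Θ : ι → Rn n × P → ℝ} {w : ι → Rn n × P → ℝ}
    (hB : UBd B w (fun _ _ => 1)) (hV : UBd V (fun _ _ => 1) (fun _ _ => 1))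
    (hw : ∀ i p, 0 ≤ w i p) (hwi : ∀ i η, Integrable fun v => w i (v, η))
    (hΘ : ∀ i, ContDiff ℝ (⊤ : ℕ∞) (Θ i))
    (hΘb : ∀ i η, ∃ C : ℝ, ∀ v, ‖fderiv ℝ (fun v' => Θ i (v', η)) v‖ ≤ C)
    (S : ι → Set (Rn n × P)) (hS : ∀ i, IsClosed (S i)) (hBS : ∀ i, ∀ p ∉ S i, B i p = 0)
    (hnd : ∀ i, ∀ p ∈ S i, fderiv ℝ (fun v' => Θ i (v', p.2)) p.1 (V i p) = 1) :
    ∃ B' : ι → Rn n × P → ℂ, (∀ w' : ι → Rn n × P → ℝ, UBd B w' (fun _ _ => 1) →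
        UBd B' w' (fun _ _ => 1)) ∧ (∀ i, ∀ p ∉ S i, B' i p = 0) ∧
      ∀ i η (κ : ℝ), κ ≠ 0 →
        ∫ v, B i (v, η) * Complex.exp (I * ((κ * Θ i (v, η) : ℝ) : ℂ)) =
          (κ : ℂ)⁻¹ * ∫ v, B' i (v, η) * Complex.exp (I * ((κ * Θ i (v, η) : ℝ) : ℂ)) := by
  have hgw : ∀ (l : Fin n) (w' : ι → Rn n × P → ℝ), UBd B w' (fun _ _ => 1) →
      UBd (fun i p => (V i p l) • B i p) w' (fun _ _ => 1) := by
    intro l w' hB'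
    have h1 := hV.clm_comp (EuclideanSpace.proj l : Rn n →L[ℝ] ℝ)
    have h2 := h1.bilin (ContinuousLinearMap.lsmul ℝ ℝ : ℝ →L[ℝ] ℂ →L[ℝ] ℂ) hB'
      (fun _ _ => zero_le_one) (fun _ _ => zero_le_one)
    simpa using h2
  have hg := fun l => hgw l w hB
  set g : Fin n → ι → Rn n × P → ℂ := fun l i p => (V i p l) • B i p with hgdef
  have hgw' : ∀ (l : Fin n) (w' : ι → Rn n × P → ℝ), UBd B w' (fun _ _ => 1) →
      UBd (fun i p => fderiv ℝ (g l i) p (EuclideanSpace.single l 1, 0)) w' (fun _ _ => 1) := by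
    intro l w' hB'
    have := (hgw l w' hB').lineDeriv_bound (EuclideanSpace.single l (1 : ℝ), (0 : P))
    simp only [mul_one] at this
    exact this
  have hg' := fun l => hgw' l w hB
  refine ⟨fun i p => I * ∑ l, fderiv ℝ (g l i) p (EuclideanSpace.single l 1, 0), ?_, ?_, ?_⟩
  · intro w' hB'
    have := (UBd.sum Finset.univ (fun l _ => hgw' l w' hB')).clm_comp
      (ContinuousLinearMap.mul ℝ ℂ I)
    exact this
  · intro i p hp
    have : ∀ l, fderiv ℝ (g l i) p = 0 := by
      intro l
      have h0 : g l i =ᶠ[nhds p] fun _ => (0 : ℂ) := by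
        filter_upwards [(hS i).isOpen_compl.mem_nhds hp] with q hq
        simp [hgdef, hBS i q hq]
      rw [h0.fderiv_eq]; simp
    simp [this]
  · intro i η κ hκ
    set E : Rn n → ℂ := fun v => Complex.exp (I * ((κ * Θ i (v, η) : ℝ) : ℂ)) with hE
    have hΘs : ContDiff ℝ (⊤ : ℕ∞) (fun v => Θ i (v, η)) :=
      (hΘ i).comp (contDiff_id.prodMk contDiff_const)
    have hEd : ∀ v, HasFDerivAt E ((E v * (I * κ)) •
        (Complex.ofRealCLM.comp (fderiv ℝ (fun v' => Θ i (v', η)) v))) v := by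
      intro v
      have h1 := (hΘs.differentiable (by simp) v).hasFDerivAt
      have h2 := ((Complex.ofRealCLM.hasFDerivAt.comp v (h1.const_mul κ)).const_mul I).cexp
      refine h2.congr_fderiv ?_
      ext u
      simp [hE]; ring
    have hEc : Continuous E := continuous_iff_continuousAt.2 fun v => (hEd v).continuousAt
    have hE1 : ∀ v, ‖E v‖ = 1 := by
      intro v; simp only [hE]; rw [mul_comm]; exact Complex.norm_exp_ofReal_mul_I _
    have hgs : ∀ l, ContDiff ℝ (⊤ : ℕ∞) (fun v => g l i (v, η)) := fun l =>
      ((hg l).smooth i).comp (contDiff_id.prodMk contDiff_const)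
    have hgd : ∀ l v, fderiv ℝ (fun v => g l i (v, η)) v (EuclideanSpace.single l 1) =
        fderiv ℝ (g l i) (v, η) (EuclideanSpace.single l 1, 0) := by
      intro l v
      have h1 := (((hg l).smooth i).differentiable (by simp) (v, η)).hasFDerivAt
      have h2 : HasFDerivAt (fun v => g l i (v, η)) _ v := 
        HasFDerivAt.comp (f := fun v => (v, η)) v h1 (hasFDerivAt_prodMk_left v η)
      rw [h2.fderiv]; rfl
    have int_w : ∀ (h : Rn n → ℂ), Continuous h → (∃ C, ∀ v, ‖h v‖ ≤ C * w i (v, η)) →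
        Integrable h := by
      rintro h hc ⟨C, hC⟩
      exact ((hwi i η).const_mul C).mono' hc.aestronglyMeasurable (Filter.Eventually.of_forall hC)
    obtain ⟨CΘ, hCΘ⟩ := hΘb i η
    have hgb := fun l => (hg l).norm_le
    have hgb' := fun l => (hg' l).norm_le
    have hgdc : ∀ l, Continuous fun v => fderiv ℝ (g l i) (v, η) (EuclideanSpace.single l 1, 0) :=
      fun l => ((hg' l).smooth i).continuous.comp (by fun_prop)
    have I1 : ∀ l, Integrable fun v =>
        fderiv ℝ (fun v => g l i (v, η)) v (EuclideanSpace.single l 1) * E v := by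
      intro l
      obtain ⟨C, _, hC⟩ := hgb' l
      simp_rw [hgd]
      refine int_w _ ((hgdc l).mul hEc) ⟨C, fun v => ?_⟩
      rw [norm_mul, hE1, mul_one]; exact hC i (v, η)
    have hEd' : ∀ l v, fderiv ℝ E v (EuclideanSpace.single l 1) = 
        E v * (I * κ) * ((fderiv ℝ (fun v' => Θ i (v', η)) v (EuclideanSpace.single l 1) : ℝ) : ℂ) := by
      intro l v; rw [(hEd v).fderiv]; simp
    have hΘc : ∀ u, Continuous fun v => fderiv ℝ (fun v' => Θ i (v', η)) v u := fun u =>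
      (hΘs.continuous_fderiv (by simp)).clm_apply continuous_const
    have I2 : ∀ l, Integrable fun v =>
        g l i (v, η) * fderiv ℝ E v (EuclideanSpace.single l 1) := by
      intro l
      obtain ⟨C, hC0, hC⟩ := hgb l
      simp_rw [hEd']
      refine int_w _ ((hgs l).continuous.mul ((hEc.mul continuous_const).mul
        (Complex.continuous_ofReal.comp (hΘc _)))) ⟨C * (|κ| * CΘ), fun v => ?_⟩
      have h1 := hC i (v, η)
      have h2 : ‖fderiv ℝ (fun v' => Θ i (v', η)) v (EuclideanSpace.single l 1)‖ ≤ CΘ := by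
        refine (ContinuousLinearMap.le_of_opNorm_le _ (hCΘ v) _).trans ?_
        simp
      have h3 : 0 ≤ CΘ := (norm_nonneg _).trans h2
      rw [norm_mul, norm_mul, norm_mul, norm_mul, hE1, Complex.norm_I, Complex.norm_real,
        Complex.norm_real, one_mul, one_mul, Real.norm_eq_abs κ]
      have h4 := hw i (v, η)
      calc _ ≤ (C * w i (v, η)) * (|κ| * CΘ) := by gcongr
        _ = _ := by ring
    have I3 : ∀ l, Integrable fun v => g l i (v, η) * E v := by
      intro l
      obtain ⟨C, hC0, hC⟩ := hgb l
      refine int_w _ ((hgs l).continuous.mul hEc) ⟨C, fun v => ?_⟩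
      rw [norm_mul, hE1, mul_one]; exact hC i (v, η)
    have ibp : ∀ l, ∫ v, g l i (v, η) * fderiv ℝ E v (EuclideanSpace.single l 1) =
        - ∫ v, fderiv ℝ (fun v => g l i (v, η)) v (EuclideanSpace.single l 1) * E v := fun l =>
      integral_mul_fderiv_eq_neg_fderiv_mul_of_integrable (I1 l) (I2 l) (I3 l)
        (fun v _ => (hgs l).differentiable (by simp) v) (fun v _ => (hEd v).differentiableAt)
    have key : ∀ v, ∑ l, g l i (v, η) * fderiv ℝ E v (EuclideanSpace.single l 1) =
        (I * κ) * (B i (v, η) * E v) := by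
      intro v
      by_cases hv : (v, η) ∈ S i
      · have h1 := hnd i (v, η) hv
        have h2 : ∑ l, V i (v, η) l * fderiv ℝ (fun v' => Θ i (v', η)) v
            (EuclideanSpace.single l 1) = 1 := by
          have h4 := congrArg (fderiv ℝ (fun v' => Θ i (v', η)) v) (Rn.sum_single (V i (v, η)))
          rw [map_sum] at h4
          simp only [map_smul, smul_eq_mul] at h4
          exact h4.trans h1
        have h3 : ((∑ l, V i (v, η) l * fderiv ℝ (fun v' => Θ i (v', η)) v
            (EuclideanSpace.single l 1) : ℝ) : ℂ) = 1 := by rw [h2]; simp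
        rw [← mul_one ((I * κ) * (B i (v, η) * E v)), ← h3]
        push_cast
        rw [Finset.mul_sum]
        refine Finset.sum_congr rfl fun l _ => ?_
        rw [hEd']
        simp only [hgdef, Complex.real_smul]
        ring
      · simp [hgdef, hBS i _ hv]
    have e1 : (I * κ) * ∫ v, B i (v, η) * E v =
        - ∫ v, ∑ l, fderiv ℝ (g l i) (v, η) (EuclideanSpace.single l 1, 0) * E v := by
      rw [← integral_const_mul]
      simp_rw [← key]
      rw [integral_finsetSum _ (fun l _ => I2 l), integral_finsetSum]
      · rw [← Finset.sum_neg_distrib]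
        refine Finset.sum_congr rfl fun l _ => ?_
        rw [ibp l]
        simp_rw [hgd]
      · intro l _
        have := I1 l
        simp_rw [hgd] at this
        exact this
    have hκ' : (κ : ℂ) ≠ 0 := by exact_mod_cast hκ
    have e2 : ∫ v, (I * ∑ l, fderiv ℝ (g l i) (v, η) (EuclideanSpace.single l 1, 0)) * E v =
        I * ∫ v, ∑ l, fderiv ℝ (g l i) (v, η) (EuclideanSpace.single l 1, 0) * E v := by
      rw [← integral_const_mul]
      congr 1; funext v
      rw [← Finset.sum_mul, mul_assoc]
    rw [e2]
    have e3 := congrArg (fun z => -(I * z)) e1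
    simp only [mul_neg, neg_neg] at e3
    rw [← e3]
    field_simp
    linear_combination ((∫ v, B i (v, η) * E v)) * I_sq

theorem exists_nsp_forall_weight {B : ι → Rn n × P → ℂ} {V : ι → Rn n × P → Rn n}
    {Θ : ι → Rn n × P → ℝ} {w : ι → Rn n × P → ℝ}
    (hB : UBd B w (fun _ _ => 1)) (hV : UBd V (fun _ _ => 1) (fun _ _ => 1))
    (hw : ∀ i p, 0 ≤ w i p) (hwi : ∀ i η, Integrable fun v => w i (v, η))
    (hΘ : ∀ i, ContDiff ℝ (⊤ : ℕ∞) (Θ i))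
    (hΘb : ∀ i η, ∃ C : ℝ, ∀ v, ‖fderiv ℝ (fun v' => Θ i (v', η)) v‖ ≤ C)
    (S : ι → Set (Rn n × P)) (hS : ∀ i, IsClosed (S i)) (hBS : ∀ i, ∀ p ∉ S i, B i p = 0)
    (hnd : ∀ i, ∀ p ∈ S i, fderiv ℝ (fun v' => Θ i (v', p.2)) p.1 (V i p) = 1) (N : ℕ) :
    ∃ B' : ι → Rn n × P → ℂ, (∀ w' : ι → Rn n × P → ℝ, UBd B w' (fun _ _ => 1) →
        UBd B' w' (fun _ _ => 1)) ∧ (∀ i, ∀ p ∉ S i, B' i p = 0) ∧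
      ∀ i η (κ : ℝ), κ ≠ 0 →
        ∫ v, B i (v, η) * Complex.exp (I * ((κ * Θ i (v, η) : ℝ) : ℂ)) =
          ((κ : ℂ)⁻¹) ^ N *
            ∫ v, B' i (v, η) * Complex.exp (I * ((κ * Θ i (v, η) : ℝ) : ℂ)) := by
  induction N with
  | zero => exact ⟨B, fun _ h => h, hBS, fun i η κ _ => by simp⟩
  | succ N ih =>
    obtain ⟨B1, h1, h2, h3⟩ := ih
    obtain ⟨B2, h4, h5, h6⟩ := exists_nsp_step (h1 w hB) hV hw hwi hΘ hΘb S hS h2 hnd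
    refine ⟨B2, fun w' h => h4 w' (h1 w' h), h5, fun i η κ hκ => ?_⟩
    rw [h3 i η κ hκ, h6 i η κ hκ, pow_succ, mul_assoc]

theorem exists_nsp {B : ι → Rn n × P → ℂ} {V : ι → Rn n × P → Rn n}
    {Θ : ι → Rn n × P → ℝ} {w : ι → Rn n × P → ℝ}
    (hB : UBd B w (fun _ _ => 1)) (hV : UBd V (fun _ _ => 1) (fun _ _ => 1))
    (hw : ∀ i p, 0 ≤ w i p) (hwi : ∀ i η, Integrable fun v => w i (v, η))
    (hΘ : ∀ i, ContDiff ℝ (⊤ : ℕ∞) (Θ i))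
    (hΘb : ∀ i η, ∃ C : ℝ, ∀ v, ‖fderiv ℝ (fun v' => Θ i (v', η)) v‖ ≤ C)
    (S : ι → Set (Rn n × P)) (hS : ∀ i, IsClosed (S i)) (hBS : ∀ i, ∀ p ∉ S i, B i p = 0)
    (hnd : ∀ i, ∀ p ∈ S i, fderiv ℝ (fun v' => Θ i (v', p.2)) p.1 (V i p) = 1) (N : ℕ) :
    ∃ B' : ι → Rn n × P → ℂ, UBd B' w (fun _ _ => 1) ∧ (∀ i, ∀ p ∉ S i, B' i p = 0) ∧
      ∀ i η (κ : ℝ), κ ≠ 0 →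
        ∫ v, B i (v, η) * Complex.exp (I * ((κ * Θ i (v, η) : ℝ) : ℂ)) =
          ((κ : ℂ)⁻¹) ^ N *
            ∫ v, B' i (v, η) * Complex.exp (I * ((κ * Θ i (v, η) : ℝ) : ℂ)) := by
  obtain ⟨B', h1, h2⟩ := exists_nsp_forall_weight hB hV hw hwi hΘ hΘb S hS hBS hnd N
  exact ⟨B', h1 w hB, h2⟩

end NonStationary

section Sharp

variable {n : ℕ}

/-- The vector representing a linear functional. -/
def sharp (n : ℕ) : (Rn n →L[ℝ] ℝ) →L[ℝ] Rn n :=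
  ∑ l : Fin n, (ContinuousLinearMap.apply ℝ ℝ (EuclideanSpace.single l (1 : ℝ))).smulRight
    (EuclideanSpace.single l (1 : ℝ))

theorem sharp_apply (L : Rn n →L[ℝ] ℝ) (l : Fin n) :
    sharp n L l = L (EuclideanSpace.single l 1) := by
  simp [sharp, Finset.sum_apply, Pi.single_apply]

theorem inner_sharp (L : Rn n →L[ℝ] ℝ) (v : Rn n) : ⟪sharp n L, v⟫_ℝ = L v := by
  have h := congrArg L (Rn.sum_single v)
  rw [map_sum] at h
  rw [← h, PiLp.inner_apply]
  refine Finset.sum_congr rfl fun l _ => ?_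
  rw [sharp_apply, map_smul]
  simp

theorem norm_sharp (L : Rn n →L[ℝ] ℝ) : ‖sharp n L‖ = ‖L‖ := by
  apply le_antisymm
  · by_cases h : ‖sharp n L‖ = 0
    · rw [h]; exact norm_nonneg _
    · have h1 : ‖sharp n L‖ * ‖sharp n L‖ ≤ ‖L‖ * ‖sharp n L‖ := by
        rw [← real_inner_self_eq_norm_mul_norm, inner_sharp]
        exact (le_abs_self _).trans (L.le_opNorm _)
      exact le_of_mul_le_mul_right h1 (lt_of_le_of_ne (norm_nonneg _) (Ne.symm h))
  · refine L.opNorm_le_bound (norm_nonneg _) fun v => ?_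
    rw [← inner_sharp]
    exact norm_inner_le_norm _ _

end Sharp

section Normalize

/-- A smooth function equal to `1 / s` for `s ≥ c`. -/
def smoothRecip (c : ℝ) (s : ℝ) : ℝ := Real.smoothTransition (2 * s / c - 1) / s

theorem smoothRecip_of_le {c s : ℝ} (hc : 0 < c) (h : c ≤ s) : smoothRecip c s = 1 / s := by
  rw [smoothRecip, Real.smoothTransition.one_of_one_le]
  rw [le_sub_iff_add_le, le_div_iff₀ hc]; linarith

theorem contDiff_smoothRecip {c : ℝ} (hc : 0 < c) : ContDiff ℝ (⊤ : ℕ∞) (smoothRecip c) := by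
  refine contDiff_iff_contDiffAt.2 fun s => ?_
  by_cases h : s = 0
  · have : smoothRecip c =ᶠ[nhds s] fun _ => 0 := by
      filter_upwards [Iio_mem_nhds (show s < c / 2 by rw [h]; linarith)] with t ht
      rw [smoothRecip, Real.smoothTransition.zero_of_nonpos, zero_div]
      rw [sub_nonpos, div_le_one hc]; linarith [Set.mem_Iio.1 ht]
    exact contDiffAt_const.congr_of_eventuallyEq this
  · refine ContDiffAt.div ?_ contDiffAt_id h
    exact Real.smoothTransition.contDiff.contDiffAt.comp s (by fun_prop)

variable {n : ℕ} {ι X : Type*} [NormedAddCommGroup X] [NormedSpace ℝ X]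

theorem UBd.exists_normalize {W : ι → X → Rn n} (hW : UBd W (fun _ _ => 1) (fun _ _ => 1))
    {c : ℝ} (hc : 0 < c) (S : ι → Set X) (hS : ∀ i, ∀ p ∈ S i, c ≤ ‖W i p‖) :
    ∃ V : ι → X → Rn n, UBd V (fun _ _ => 1) (fun _ _ => 1) ∧
      ∀ i, ∀ p ∈ S i, ⟪W i p, V i p⟫_ℝ = 1 := by
  have hg : ContDiff ℝ (⊤ : ℕ∞) (fun v : Rn n => smoothRecip (c ^ 2) (‖v‖ ^ 2) • v) :=
    ((contDiff_smoothRecip (by positivity)).comp (contDiff_norm_sq ℝ)).smul contDiff_id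
  refine ⟨_, hW.of_comp_bdd hg (fun _ _ => zero_le_one), fun i p hp => ?_⟩
  have h1 := hS i p hp
  rw [smoothRecip_of_le (by positivity) (by gcongr), inner_smul_right,
    real_inner_self_eq_norm_sq]
  have : ‖W i p‖ ≠ 0 := by linarith
  field_simp

end Normalize

section FourierDecay

variable {n : ℕ} {ι : Type*}

theorem integrable_weight (n : ℕ) {M : ℕ} (hM : n < M) :
    Integrable (fun v : Rn n => ((1 + ‖v‖) ^ M)⁻¹) := by
  have := integrable_one_add_norm (E := Rn n) (μ := volume) (r := M) (by
    simpa using hM)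
  refine this.congr (Filter.Eventually.of_forall fun v => ?_)
  simp only
  rw [Real.rpow_neg (by positivity), Real.rpow_natCast]

theorem inv_pow_mul_le_of_one_le {t Q A : ℝ} (ht : 1 ≤ t) (hA : 0 ≤ A) (hQ : Q ≤ A) (N : ℕ) :
    t⁻¹ ^ N * Q ≤ 2 ^ N * A * ((1 + t) ^ N)⁻¹ := by
  have ht0 : 0 < t := by linarith
  rw [← div_eq_mul_inv _ ((1 + t) ^ N), le_div_iff₀ (by positivity), inv_pow,
    mul_assoc, inv_mul_le_iff₀ (by positivity)]
  calc Q * (1 + t) ^ N ≤ A * (2 * t) ^ N := by gcongr; linarith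
    _ = _ := by rw [mul_pow]; ring

theorem fourier_decay {B : ι → Rn n → ℂ} (hB : UBd B (fun _ _ => 1) (fun _ _ => 1)) (R : ℝ)
    (hR : ∀ i v, R < ‖v‖ → B i v = 0) (N : ℕ) :
    ∃ C : ℝ, 0 ≤ C ∧ ∀ i (ξ : Rn n),
      ‖∫ v, B i v * Complex.exp (I * ((⟪ξ, v⟫_ℝ : ℝ) : ℂ))‖ ≤ C * ((1 + ‖ξ‖) ^ N)⁻¹ := by
  set w : Rn n → ℝ := fun v => ((1 + ‖v‖) ^ (n + 1))⁻¹ with hw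
  have hwi : Integrable w := integrable_weight n (Nat.lt_succ_self n)
  have hw0 : ∀ v, 0 ≤ w v := fun v => by positivity
  have hB1 : UBd B (fun _ v => w v) (fun _ _ => 1) := by
    refine hB.of_support (fun _ => Metric.closedBall 0 (max R 0)) (fun _ => Metric.isClosed_closedBall)
      (fun i v hv => hR i v ?_) ((1 + max R 0) ^ (n + 1)) (by positivity) (fun _ _ => zero_le_one)
      (fun _ _ => zero_le_one) (fun _ v => hw0 v) (fun _ _ => zero_le_one) (fun i v hv => ?_)
      (fun i v hv => ?_)
    · simp only [Metric.mem_closedBall, dist_zero_right, not_le] at hv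
      exact (le_max_left _ _).trans_lt hv
    · simp only [Metric.mem_closedBall, dist_zero_right] at hv
      simp only [hw]
      rw [← div_eq_mul_inv, le_div_iff₀ (by positivity), one_mul]
      gcongr
    · rw [mul_one]; exact one_le_pow₀ (by linarith [le_max_right R 0])
  let J := ι × {e : Rn n // ‖e‖ = 1}
  have hB2 : UBd (fun (j : J) (p : Rn n × ℝ) => B j.1 p.1) (fun _ p => w p.1) (fun _ _ => 1) := by
    have := hB1.comp_affine (fun _ v => hw0 v) (fun _ _ => zero_le_one) (fun j : J => j.1)
      (fun _ => ContinuousLinearMap.fst ℝ (Rn n) ℝ) (fun _ => 0) (fun _ => 1)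
      (fun _ => ContinuousLinearMap.norm_fst_le ℝ (Rn n) ℝ)
    simpa using this
  have hV : UBd (fun (j : J) (_ : Rn n × ℝ) => (j.2 : Rn n)) (fun _ _ => 1) (fun _ _ => 1) :=
    UBd.const (fun j : J => (j.2 : Rn n)) 1 fun j => j.2.2.le
  have hd : ∀ (e v : Rn n), HasFDerivAt (fun v' : Rn n => ⟪e, v'⟫_ℝ) (innerSL ℝ e) v :=
    fun e v => (innerSL ℝ e).hasFDerivAt
  obtain ⟨B', hB', -, hintg⟩ := exists_nsp hB2 hV (Θ := fun j p => ⟪(j.2 : Rn n), p.1⟫_ℝ)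
    (fun _ p => hw0 p.1) (fun _ _ => hwi)
    (fun j => contDiff_const.inner ℝ contDiff_fst)
    (fun j _ => ⟨‖innerSL ℝ (j.2 : Rn n)‖, fun v => by rw [(hd j.2 v).fderiv]⟩)
    (fun _ => Set.univ) (fun _ => isClosed_univ) (fun _ p hp => absurd (Set.mem_univ p) hp)
    (fun j p _ => by
      rw [(hd j.2 p.1).fderiv, innerSL_apply_apply, real_inner_self_eq_norm_sq, j.2.2, one_pow]) N
  obtain ⟨C0, hC0, hb0⟩ := hB1.norm_le
  obtain ⟨C1, hC1, hb1⟩ := hB'.norm_le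
  have nexp : ∀ t : ℝ, ‖Complex.exp (I * (t : ℂ))‖ = 1 := fun t => by
    rw [mul_comm]; exact Complex.norm_exp_ofReal_mul_I _
  set A := ∫ v, w v with hA
  have hA0 : 0 ≤ A := integral_nonneg hw0
  refine ⟨2 ^ N * ((C0 + C1) * A), by positivity, fun i ξ => ?_⟩
  by_cases hξ : ‖ξ‖ ≤ 1
  · have h1 : ‖∫ v, B i v * Complex.exp (I * ((⟪ξ, v⟫_ℝ : ℝ) : ℂ))‖ ≤ C0 * A := by
      rw [hA, ← integral_const_mul]
      refine norm_integral_le_of_norm_le (hwi.const_mul _) (Filter.Eventually.of_forall fun v => ?_)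
      rw [norm_mul, nexp, mul_one]; exact hb0 i v
    refine h1.trans ?_
    rw [← div_eq_mul_inv, le_div_iff₀ (by positivity)]
    calc C0 * A * (1 + ‖ξ‖) ^ N ≤ ((C0 + C1) * A) * 2 ^ N := by
          gcongr
          · linarith
          · linarith
      _ = _ := by ring
  · push Not at hξ
    have hξ0 : ‖ξ‖ ≠ 0 := by linarith
    obtain ⟨j, rfl, hj⟩ : ∃ j : J, j.1 = i ∧ (j.2 : Rn n) = ‖ξ‖⁻¹ • ξ :=
      ⟨(i, ⟨‖ξ‖⁻¹ • ξ, by rw [norm_smul, norm_inv, norm_norm, inv_mul_cancel₀ hξ0]⟩), rfl, rfl⟩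
    have h1 := hintg j 0 ‖ξ‖ hξ0
    have h2 : ∀ v : Rn n, ‖ξ‖ * ⟪(j.2 : Rn n), v⟫_ℝ = ⟪ξ, v⟫_ℝ := by
      intro v
      rw [hj]
      rw [real_inner_smul_left, ← mul_assoc, mul_inv_cancel₀ hξ0, one_mul]
    simp only [h2] at h1
    rw [h1, norm_mul, norm_pow, norm_inv, Complex.norm_real, norm_norm]
    have h3 : ‖∫ v, B' j (v, 0) * Complex.exp (I * ((⟪ξ, v⟫_ℝ : ℝ) : ℂ))‖ ≤ C1 * A := by
      rw [hA, ← integral_const_mul]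
      refine norm_integral_le_of_norm_le (hwi.const_mul _) (Filter.Eventually.of_forall fun v => ?_)
      rw [norm_mul, nexp, mul_one]; exact hb1 j (v, 0)
    have h5 : C1 * A ≤ (C0 + C1) * A := mul_le_mul_of_nonneg_right (by linarith) hA0
    have h6 := h3.trans h5
    clear_value A
    generalize ‖∫ v, B' j (v, 0) * Complex.exp (I * ((⟪ξ, v⟫_ℝ : ℝ) : ℂ))‖ = Q at h6 ⊢
    exact inv_pow_mul_le_of_one_le hξ.le (by positivity) h6 N

end FourierDecay

section Hadamard

variable {E : Type*} [NormedAddCommGroup E]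

theorem isCoveringMap_of_uniform {F : E → E} (hF : Continuous F) {r c : ℝ} (hr : 0 < r) (hc : 0 < c)
    (hA : ∀ x, ∀ a ∈ Metric.closedBall x r, ∀ b ∈ Metric.closedBall x r,
      c * dist a b ≤ dist (F a) (F b))
    (hS : ∀ x ε, 0 ≤ ε → ε ≤ r →
      Set.SurjOn F (Metric.closedBall x ε) (Metric.closedBall (F x) (c * ε))) :
    IsCoveringMap F := by
  have hex : ∀ y z, F z ∈ Metric.ball y (c * (r / 4)) → ∃ x, F x = y ∧ dist x z ≤ r / 4 := by
    intro y z hz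
    obtain ⟨x, hx, hxy⟩ := hS z (r / 4) (by positivity) (by linarith)
      (show y ∈ _ by rw [Metric.mem_closedBall, dist_comm]; exact (Metric.mem_ball.1 hz).le)
    exact ⟨x, hxy, hx⟩
  have hopen : IsOpenMap F := by
    refine isOpenMap_iff_nhds_le.2 fun x => ?_
    intro s hs
    obtain ⟨ε, hε, hεs⟩ := Metric.nhds_basis_closedBall.mem_iff.1 (Filter.mem_map.1 hs)
    have := hS x (min ε r) (by positivity) (min_le_right _ _)
    refine Filter.mem_of_superset (Metric.closedBall_mem_nhds (F x)
      (mul_pos hc (lt_min hε hr))) fun y hy => ?_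
    obtain ⟨z, hz, rfl⟩ := this hy
    exact hεs (Metric.closedBall_subset_closedBall (min_le_left _ _) hz)
  have hinj : ∀ x, Set.InjOn F (Metric.closedBall x r) := fun x a ha b hb hab => by
    have := hA x a ha b hb
    rw [hab, dist_self] at this
    exact dist_le_zero.1 (by nlinarith [dist_nonneg (x := a) (y := b)])
  let tI : ∀ x, TopologicalSpace (F ⁻¹' {x}) := fun _ => ⊥
  have dI : ∀ x, @DiscreteTopology (F ⁻¹' {x}) (tI x) := fun _ => ⟨rfl⟩
  have hsub : ∀ x : E, Metric.ball x (r / 2) ⊆ Metric.closedBall x r := fun x =>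
    Metric.ball_subset_closedBall.trans (Metric.closedBall_subset_closedBall (by linarith))
  have hcl : IsClosed (Set.range F) := by
    refine ⟨Metric.isOpen_iff.2 fun y hy => ⟨c * (r / 4), by positivity, ?_⟩⟩
    rintro _ hz ⟨z, rfl⟩
    obtain ⟨x, hx, -⟩ := hex y z hz
    exact hy ⟨x, hx⟩
  refine @IsCoveringMap.mk' E E _ _ F (fun x => F ⁻¹' {x}) tI dI (fun y hy => ?_) hcl
  have : Nonempty (F ⁻¹' {y}) := ⟨⟨hy.choose, hy.choose_spec⟩⟩
  have hsurj : ∀ i : F ⁻¹' {y}, Set.SurjOn F (Metric.ball (i : E) (r / 2))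
      (Metric.ball y (c * (r / 4))) := by
    rintro ⟨x, rfl⟩ z hz
    obtain ⟨w, hw, rfl⟩ := hS x (r / 4) (by positivity) (by linarith)
      (Metric.ball_subset_closedBall hz)
    exact ⟨w, Metric.closedBall_subset_ball (by linarith) hw, rfl⟩
  refine ⟨@IsOpen.trivializationDiscrete E E _ _ F ⟨fun _ => hy.choose⟩ (F ⁻¹' {y}) this (tI y) (dI y)
    (fun x => Metric.ball (x : E) (r / 2)) (Metric.ball y (c * (r / 4))) Metric.isOpen_ball
    ?_ ?_ ?_ ?_ ?_, ?_⟩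
  · intro i W hW
    refine ⟨fun h => (h.preimage hF).inter Metric.isOpen_ball, fun h => ?_⟩
    have := hopen _ h
    convert this using 1
    refine Set.Subset.antisymm (fun z hz => ?_) ?_
    · obtain ⟨w, hw, rfl⟩ := hsurj i (hW hz)
      exact ⟨w, ⟨hz, hw⟩, rfl⟩
    · rintro _ ⟨w, hw, rfl⟩
      exact hw.1
  · exact fun i => (hinj i).mono (hsub _)
  · exact hsurj
  · rintro ⟨a, ha⟩ ⟨b, hb⟩ hab
    refine Set.disjoint_left.2 fun z hz hz' => hab (Subtype.ext ?_)
    simp only [Metric.mem_ball] at hz hz'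
    refine hinj a (Metric.mem_closedBall_self hr.le) ?_ (ha.trans hb.symm)
    rw [Metric.mem_closedBall]
    calc dist b a ≤ dist z b + dist z a := by rw [dist_comm z b]; exact dist_triangle _ _ _
      _ ≤ r := by linarith
  · intro z hz
    obtain ⟨x, hx, hxz⟩ := hex y z hz
    refine Set.mem_iUnion.2 ⟨⟨x, hx⟩, ?_⟩
    rw [Metric.mem_ball, dist_comm]; linarith
  · exact Metric.mem_ball_self (by positivity)

variable [NormedSpace ℝ E]

theorem antilipschitz_of_uniform {F : E → E} (hF : Continuous F) {r c : ℝ} (hr : 0 < r) (hc : 0 < c)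
    (hA : ∀ x, ∀ a ∈ Metric.closedBall x r, ∀ b ∈ Metric.closedBall x r,
      c * dist a b ≤ dist (F a) (F b))
    (hS : ∀ x ε, 0 ≤ ε → ε ≤ r →
      Set.SurjOn F (Metric.closedBall x ε) (Metric.closedBall (F x) (c * ε))) (a b : E) :
    c * dist a b ≤ dist (F a) (F b) := by
  have hcov := isCoveringMap_of_uniform hF hr hc hA hS
  obtain ⟨G, ⟨hG0, hG⟩, -⟩ := hcov.existsUnique_continuousMap_lifts (ContinuousMap.id E) (F a) a rfl
  have hGF : G ∘ F = id := by
    refine hcov.eq_of_comp_eq (G.continuous.comp hF) continuous_id ?_ a (by simpa using hG0)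
    funext z
    exact congrFun hG (F z)
  have hstep : ∀ z y, dist y (F z) ≤ c * r → c * dist (G y) z ≤ dist y (F z) := by
    intro z y hy
    obtain ⟨x, hx, rfl⟩ := hS z (dist y (F z) / c) (by positivity)
      (by rw [div_le_iff₀ hc]; linarith)
      (show y ∈ _ by rw [Metric.mem_closedBall]; field_simp; exact le_rfl)
    have h1 : G (F x) = x := congrFun hGF x
    rw [h1]
    rw [Metric.mem_closedBall, le_div_iff₀ hc] at hx
    linarith
  obtain ⟨N, hN⟩ := exists_nat_gt (dist (F b) (F a) / (c * r))
  have hN0 : (0 : ℝ) < N := lt_of_le_of_lt (by positivity) hN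
  rw [div_lt_iff₀ (by positivity)] at hN
  set y : ℕ → E := fun k => F a + ((k : ℝ) / N) • (F b - F a) with hy
  have hyd : ∀ k, dist (y (k + 1)) (y k) = dist (F b) (F a) / N := by
    intro k
    simp only [hy, dist_eq_norm, Nat.cast_add, Nat.cast_one]
    rw [show F a + (((k : ℝ) + 1) / N) • (F b - F a) - (F a + ((k : ℝ) / N) • (F b - F a)) =
      (1 / (N : ℝ)) • (F b - F a) by
        rw [add_div, add_smul]; abel, norm_smul, Real.norm_of_nonneg (by positivity)]
    ring
  have hFG : ∀ w, F (G w) = w := fun w => congrFun hG w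
  have hd : ∀ k, c * dist (G (y k)) (G (y (k + 1))) ≤ dist (F b) (F a) / N := by
    intro k
    have h1 := hstep (G (y k)) (y (k + 1))
    rw [hFG, hyd, dist_comm (G (y (k + 1)))] at h1
    refine h1 ?_
    rw [div_le_iff₀ hN0]; linarith
  have hsum := dist_le_range_sum_dist (fun k => G (y k)) N
  have e0 : G (y 0) = a := by simp only [hy]; simp; exact congrFun hGF a
  have e1 : G (y N) = b := by
    simp only [hy]; rw [div_self hN0.ne', one_smul, add_sub_cancel]; exact congrFun hGF b
  simp only [e0, e1] at hsum
  calc c * dist a b ≤ c * ∑ i ∈ Finset.range N, dist (G (y i)) (G (y (i + 1))) := by gcongr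
    _ = ∑ i ∈ Finset.range N, c * dist (G (y i)) (G (y (i + 1))) := Finset.mul_sum _ _ _
    _ ≤ ∑ i ∈ Finset.range N, dist (F b) (F a) / N := Finset.sum_le_sum fun k _ => hd k
    _ = dist (F a) (F b) := by
      rw [Finset.sum_const, Finset.card_range, nsmul_eq_mul, dist_comm (F a)]; field_simp

/-- Hadamard's global inverse theorem in quantitative form. -/
theorem antilipschitz_of_fderiv [FiniteDimensional ℝ E] {F : E → E} (hF : Differentiable ℝ F)
    {c K : ℝ} (hc : 0 < c) (hK : 0 ≤ K) (hlow : ∀ x v, c * ‖v‖ ≤ ‖fderiv ℝ F x v‖)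
    (hlip : ∀ x x', ‖fderiv ℝ F x - fderiv ℝ F x'‖ ≤ K * ‖x - x'‖) (a b : E) :
    c / 2 * ‖a - b‖ ≤ ‖F a - F b‖ := by
  have : CompleteSpace E := FiniteDimensional.complete ℝ E
  set r : ℝ := c / (2 * (K + 1)) with hr
  have hr0 : 0 < r := by positivity
  have hKr : K * r ≤ c / 2 := by
    rw [hr, mul_div_assoc', div_le_iff₀ (by positivity)]; nlinarith
  have happ : ∀ x, ∀ u ∈ Metric.closedBall x r, ∀ v ∈ Metric.closedBall x r,
      ‖F u - F v - fderiv ℝ F x (u - v)‖ ≤ c / 2 * ‖u - v‖ := by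
    intro x u hu v hv
    refine (convex_closedBall x r).norm_image_sub_le_of_norm_fderiv_le' (fun z _ => hF z)
      (fun z hz => ?_) hv hu
    refine (hlip z x).trans (le_trans ?_ hKr)
    gcongr
    rwa [← dist_eq_norm]
  simp only [← dist_eq_norm]
  refine antilipschitz_of_uniform hF.continuous hr0 (by positivity) (fun x u hu v hv => ?_)
    (fun x ε hε hεr => ?_) a b
  · have h1 := happ x u hu v hv
    have h2 := hlow x (u - v)
    have h3 := norm_sub_norm_le (fderiv ℝ F x (u - v)) (F u - F v)
    rw [norm_sub_rev (fderiv ℝ F x (u - v)) (F u - F v)] at h3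
    rw [dist_eq_norm, dist_eq_norm]
    linarith
  · have hinj : Function.Injective (fderiv ℝ F x) := by
      refine (injective_iff_map_eq_zero _).2 fun v hv => ?_
      have := hlow x v
      rw [hv, norm_zero] at this
      exact norm_le_zero_iff.1 (by nlinarith [norm_nonneg v])
    have hsur := LinearMap.injective_iff_surjective (f := (fderiv ℝ F x).toLinearMap) |>.1 hinj
    choose g hg using hsur
    let R : (fderiv ℝ F x).NonlinearRightInverse :=
      { toFun := g
        nnnorm := (Real.toNNReal c)⁻¹
        bound' := fun y => by
          have := hlow x (g y)
          rw [show fderiv ℝ F x (g y) = y from hg y] at this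
          rw [NNReal.coe_inv, Real.coe_toNNReal _ hc.le, inv_mul_eq_div, le_div_iff₀ hc]
          linarith
        right_inv' := hg }
    have hA : ApproximatesLinearOn F (fderiv ℝ F x) (Metric.closedBall x r)
        (Real.toNNReal (c / 2)) := fun u hu v hv => by
      rw [Real.coe_toNNReal _ (by positivity)]; exact happ x u hu v hv
    have := hA.surjOn_closedBall_of_nonlinearRightInverse R hε
      (Metric.closedBall_subset_closedBall hεr)
    have e : ((R.nnnorm : ℝ)⁻¹ - (Real.toNNReal (c / 2) : ℝ)) = c / 2 := by
      rw [Real.coe_toNNReal _ (by positivity), NNReal.coe_inv, Real.coe_toNNReal _ hc.le, inv_inv]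
      ring
    rwa [e] at this

end Hadamard

section PhaseFacts

variable {n : ℕ} {φ : Rn n → Rn n → ℝ}

theorem isOpen_ne_zero : IsOpen {ξ : Rn n | ξ ≠ 0} := isOpen_compl_singleton

theorem PhaseClass.smoothOver {k : ℕ} (hφ : PhaseClass n k φ) :
    SmoothOver {ξ : Rn n | ξ ≠ 0} φ := hφ.1.1

theorem PhaseClass.mixedNorm_le {k : ℕ} (hφ : PhaseClass n k φ) (a b : ℕ) (hab : k ≤ a + b) :
    ∃ C : ℝ, 0 ≤ C ∧ ∀ x ξ : Rn n, ξ ≠ 0 → mixedNorm a b φ x ξ ≤ C * ‖ξ‖ ^ (1 - (a : ℝ)) := by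
  obtain ⟨C, hC⟩ := hφ.2 a b hab
  refine ⟨max C 0, le_max_right _ _, fun x ξ hξ => ?_⟩
  have h := hC x ξ hξ
  rw [iteratedFDerivWithin_of_isOpen a isOpen_ne_zero hξ] at h
  have hξ' : 0 < ‖ξ‖ := norm_pos_iff.2 hξ
  rw [show (1 - (a : ℝ)) = -((a : ℝ) - 1) by ring, Real.rpow_neg hξ'.le, ← div_eq_mul_inv,
    le_div_iff₀ (Real.rpow_pos_of_pos hξ' _), mul_comm]
  exact h.trans (le_max_left _ _)

theorem PhaseSmoothHomog.partialFst_smul (hφ : PhaseSmoothHomog n φ) (x ξ : Rn n)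
    {t : ℝ} (ht : 0 < t) : partialFst φ x (t • ξ) = t • partialFst φ x ξ := by
  unfold partialFst
  simp_rw [hφ.2 _ ξ t ht]
  exact congrFun (fderiv_const_smul_field (𝕜 := ℝ) (R := ℝ) (f := fun x' => φ x' ξ) t) x

theorem PhaseSmoothHomog.partialSnd_smul (hφ : PhaseSmoothHomog n φ) (x : Rn n) {ξ : Rn n}
    {t : ℝ} (ht : 0 < t) : partialSnd φ x (t • ξ) = partialSnd φ x ξ := by
  unfold partialSnd
  have h1 : fderiv ℝ (fun ξ' => φ x (t • ξ')) ξ = t • fderiv ℝ (fun ξ' => φ x ξ') (t • ξ) :=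
    fderiv_comp_smul (f := fun ξ' => φ x ξ') t
  simp_rw [hφ.2 x _ t ht] at h1
  have h2 : fderiv ℝ (fun ξ' => t * φ x ξ') ξ = t • fderiv ℝ (fun ξ' => φ x ξ') ξ :=
    congrFun (fderiv_const_smul_field (𝕜 := ℝ) (R := ℝ) (f := fun ξ' => φ x ξ') t) ξ
  rw [h2] at h1
  exact (smul_right_injective _ ht.ne' h1).symm

theorem PhaseSmoothHomog.euler_partialFst (hφ : PhaseSmoothHomog n φ) (x : Rn n) {ξ : Rn n}
    (hξ : ξ ≠ 0) : partialSnd (partialFst φ) x ξ ξ = partialFst φ x ξ := by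
  have hs : SmoothOver {ξ : Rn n | ξ ≠ 0} φ := hφ.1
  have h1 := (hs.partialFst isOpen_ne_zero).hasFDerivAt isOpen_ne_zero x hξ
  have hd : HasFDerivAt (fun ξ' => partialFst φ x ξ') (partialSnd (partialFst φ) x ξ) ξ := by
    have := HasFDerivAt.comp (f := fun ξ' => (x, ξ')) ξ h1 (hasFDerivAt_prodMk_right x ξ)
    exact this.differentiableAt.hasFDerivAt
  have h2 : HasDerivAt (fun t : ℝ => t • ξ) ξ 1 := by
    simpa using (hasDerivAt_id (1 : ℝ)).smul_const ξ
  have h3 : HasDerivAt (fun t : ℝ => partialFst φ x (t • ξ)) (partialSnd (partialFst φ) x ξ ξ) 1 := by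
    rw [← one_smul ℝ ξ] at hd
    have := hd.comp_hasDerivAt (1 : ℝ) h2
    rw [one_smul] at this
    exact this
  have h4 : HasDerivAt (fun t : ℝ => t • partialFst φ x ξ) (partialFst φ x ξ) 1 := by
    simpa using (hasDerivAt_id (1 : ℝ)).smul_const (partialFst φ x ξ)
  refine h3.unique (h4.congr_of_eventuallyEq ?_)
  filter_upwards [lt_mem_nhds (show (0 : ℝ) < 1 by norm_num)] with t ht
  exact hφ.partialFst_smul x ξ ht

theorem PhaseSmoothHomog.euler (hφ : PhaseSmoothHomog n φ) (x : Rn n) {ξ : Rn n}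
    (hξ : ξ ≠ 0) : partialSnd φ x ξ ξ = φ x ξ := by
  have hs : SmoothOver {ξ : Rn n | ξ ≠ 0} φ := hφ.1
  have h1 := hs.hasFDerivAt isOpen_ne_zero x hξ
  have hd : HasFDerivAt (fun ξ' => φ x ξ') (partialSnd φ x ξ) ξ := by
    have := HasFDerivAt.comp (f := fun ξ' => (x, ξ')) ξ h1 (hasFDerivAt_prodMk_right x ξ)
    exact this.differentiableAt.hasFDerivAt
  have h2 : HasDerivAt (fun t : ℝ => t • ξ) ξ 1 := by
    simpa using (hasDerivAt_id (1 : ℝ)).smul_const ξ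
  have h3 : HasDerivAt (fun t : ℝ => φ x (t • ξ)) (partialSnd φ x ξ ξ) 1 := by
    rw [← one_smul ℝ ξ] at hd
    have := hd.comp_hasDerivAt (1 : ℝ) h2
    rw [one_smul] at this
    exact this
  have h4 : HasDerivAt (fun t : ℝ => t * φ x ξ) (φ x ξ) 1 := by
    simpa using (hasDerivAt_id (1 : ℝ)).mul_const (φ x ξ)
  refine h3.unique (h4.congr_of_eventuallyEq ?_)
  filter_upwards [lt_mem_nhds (show (0 : ℝ) < 1 by norm_num)] with t ht
  exact hφ.2 x ξ t ht

theorem mixedNorm_zero_zero {G : Type} [NormedAddCommGroup G] [NormedSpace ℝ G]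
    (g : Rn n → Rn n → G) (x ξ : Rn n) : mixedNorm 0 0 g x ξ = ‖g x ξ‖ := by
  rw [mixedNorm_zero_right, norm_iteratedFDeriv_zero]

theorem PhaseClass.norm_partialSnd_partialFst_le (hφ : PhaseClass n 2 φ) :
    ∃ C : ℝ, 0 ≤ C ∧ ∀ x ξ : Rn n, ξ ≠ 0 → ‖partialSnd (partialFst φ) x ξ‖ ≤ C := by
  obtain ⟨C, hC, h⟩ := hφ.mixedNorm_le 1 1 (by norm_num)
  refine ⟨C, hC, fun x ξ hξ => ?_⟩
  have := h x ξ hξ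
  rw [mixedNorm_succ_right, ← mixedNorm_partialSnd 0 (hφ.smoothOver.partialFst isOpen_ne_zero)
    isOpen_ne_zero 0 x hξ, mixedNorm_zero_zero] at this
  simpa using this

theorem PhaseClass.norm_partialFst_partialSnd_le (hφ : PhaseClass n 2 φ) :
    ∃ C : ℝ, 0 ≤ C ∧ ∀ x ξ : Rn n, ξ ≠ 0 → ‖partialFst (partialSnd φ) x ξ‖ ≤ C := by
  obtain ⟨C, hC, h⟩ := hφ.mixedNorm_le 1 1 (by norm_num)
  refine ⟨C, hC, fun x ξ hξ => ?_⟩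
  have := h x ξ hξ
  rw [← mixedNorm_partialSnd 1 hφ.smoothOver isOpen_ne_zero 0 x hξ, mixedNorm_succ_right,
    mixedNorm_zero_zero] at this
  simpa using this

theorem PhaseClass.norm_partialFst_partialFst_partialSnd_le (hφ : PhaseClass n 2 φ) :
    ∃ C : ℝ, 0 ≤ C ∧ ∀ x ξ : Rn n, ξ ≠ 0 → ‖partialFst (partialFst (partialSnd φ)) x ξ‖ ≤ C := by
  obtain ⟨C, hC, h⟩ := hφ.mixedNorm_le 1 2 (by norm_num)
  refine ⟨C, hC, fun x ξ hξ => ?_⟩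
  have := h x ξ hξ
  rw [← mixedNorm_partialSnd 2 hφ.smoothOver isOpen_ne_zero 0 x hξ, mixedNorm_succ_right,
    mixedNorm_succ_right, mixedNorm_zero_zero] at this
  simpa using this

theorem PhaseClass.norm_partialFst_le (hφ : PhaseClass n 2 φ) :
    ∃ C : ℝ, 0 ≤ C ∧ ∀ x ξ : Rn n, ξ ≠ 0 → ‖partialFst φ x ξ‖ ≤ C * ‖ξ‖ := by
  obtain ⟨C, hC, h⟩ := hφ.norm_partialSnd_partialFst_le
  refine ⟨C, hC, fun x ξ hξ => ?_⟩
  rw [← hφ.1.euler_partialFst x hξ]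
  exact ((partialSnd (partialFst φ) x ξ).le_opNorm ξ).trans
    (mul_le_mul_of_nonneg_right (h x ξ hξ) (norm_nonneg _))

theorem exists_rpow_bound {K : Set (Rn n)} (hK : IsCompact K) (hK0 : ∀ ξ ∈ K, ξ ≠ 0) (s : ℝ) :
    ∃ C : ℝ, 0 ≤ C ∧ ∀ ξ ∈ K, ‖ξ‖ ^ s ≤ C := by
  obtain ⟨C, hC⟩ := hK.exists_bound_of_continuousOn (f := fun ξ : Rn n => ‖ξ‖ ^ s)
    (fun ξ hξ => (continuous_norm.continuousAt.rpow_const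
      (Or.inl (norm_ne_zero_iff.2 (hK0 ξ hξ)))).continuousWithinAt)
  exact ⟨max C 0, le_max_right _ _, fun ξ hξ =>
    ((le_abs_self _).trans (hC ξ hξ)).trans (le_max_left _ _)⟩

theorem PhaseClass.UBd_partialFst (hφ : PhaseClass n 2 φ) {c : Rn n → ℝ}
    (hc : ContDiff ℝ (⊤ : ℕ∞) c) (hcs : HasCompactSupport c) (hcU : tsupport c ⊆ {ξ | ξ ≠ 0}) :
    UBd (fun (_ : Unit) (p : Rn n × Rn n) => c p.2 • partialFst φ p.1 p.2)
      (fun _ _ => 1) (fun _ _ => 1) := by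
  refine UBd.of_cutoff (g := fun _ => partialFst φ) isOpen_ne_zero hc hcs hcU
    (fun _ => hφ.smoothOver.partialFst isOpen_ne_zero) fun a b => ?_
  have hp : ∃ C : ℝ, 0 ≤ C ∧ ∀ x ξ : Rn n, ξ ≠ 0 →
      mixedNorm a (b + 1) φ x ξ ≤ C * ‖ξ‖ ^ (1 - (a : ℝ)) := by
    by_cases hab : 2 ≤ a + (b + 1)
    · exact hφ.mixedNorm_le a (b + 1) hab
    · obtain ⟨rfl, rfl⟩ : a = 0 ∧ b = 0 := by omega
      obtain ⟨C, hC, h⟩ := hφ.norm_partialFst_le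
      refine ⟨C, hC, fun x ξ hξ => ?_⟩
      rw [mixedNorm_succ_right, mixedNorm_zero_zero]
      simpa using h x ξ hξ
  obtain ⟨C, hC, h⟩ := hp
  obtain ⟨C', hC', h'⟩ := exists_rpow_bound hcs hcU (1 - (a : ℝ))
  refine ⟨C * C', fun _ x ξ hξ => ?_⟩
  rw [← mixedNorm_succ_right]
  exact (h x ξ (hcU hξ)).trans (mul_le_mul_of_nonneg_left (h' ξ hξ) hC)

theorem PhaseClass.UBd_partialSnd_partialSnd (hφ : PhaseClass n 2 φ) {c : Rn n → ℝ}
    (hc : ContDiff ℝ (⊤ : ℕ∞) c) (hcs : HasCompactSupport c) (hcU : tsupport c ⊆ {ξ | ξ ≠ 0}) :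
    UBd (fun (_ : Unit) (p : Rn n × Rn n) => c p.2 • partialSnd (partialSnd φ) p.1 p.2)
      (fun _ _ => 1) (fun _ _ => 1) := by
  have hs := hφ.smoothOver.partialSnd isOpen_ne_zero
  refine UBd.of_cutoff (g := fun _ => partialSnd (partialSnd φ)) isOpen_ne_zero hc hcs hcU
    (fun _ => hs.partialSnd isOpen_ne_zero) fun a b => ?_
  obtain ⟨C, hC, h⟩ := hφ.mixedNorm_le (a + 1 + 1) b (by omega)
  obtain ⟨C', hC', h'⟩ := exists_rpow_bound hcs hcU (1 - ((a + 1 + 1 : ℕ) : ℝ))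
  refine ⟨C * C', fun _ x ξ hξ => ?_⟩
  rw [mixedNorm_partialSnd b hs isOpen_ne_zero a x (hcU hξ),
    mixedNorm_partialSnd b hφ.smoothOver isOpen_ne_zero _ x (hcU hξ)]
  exact (h x ξ (hcU hξ)).trans (mul_le_mul_of_nonneg_left (h' ξ hξ) hC)

/-- The gradient `∇_ξ φ(x, ξ)` as a function of `x`. -/
def phaseGrad (φ : Rn n → Rn n → ℝ) (ξ x : Rn n) : Rn n := sharp n (partialSnd φ x ξ)

theorem PhaseClass.hasFDerivAt_phaseGrad (hφ : PhaseClass n 2 φ) {ξ : Rn n} (hξ : ξ ≠ 0)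
    (x : Rn n) : HasFDerivAt (phaseGrad φ ξ) ((sharp n).comp (partialFst (partialSnd φ) x ξ)) x := by
  have hs := hφ.smoothOver.partialSnd isOpen_ne_zero
  have h1 := HasFDerivAt.comp (f := fun x' => (x', ξ)) x (hs.hasFDerivAt isOpen_ne_zero x hξ)
    (hasFDerivAt_prodMk_left x ξ)
  have h2 : HasFDerivAt (fun x' => partialSnd φ x' ξ) (partialFst (partialSnd φ) x ξ) x :=
    h1.differentiableAt.hasFDerivAt
  exact (sharp n).hasFDerivAt.comp x h2

theorem det_phaseGrad (x ξ : Rn n) :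
    ((sharp n).comp (partialFst (partialSnd φ) x ξ)).det =
      Matrix.det (Matrix.of fun i k : Fin n => partialFst (partialSnd φ) x ξ
        (EuclideanSpace.single i 1) (EuclideanSpace.single k 1)) := by
  rw [← Matrix.det_transpose]
  unfold ContinuousLinearMap.det
  rw [← LinearMap.det_toMatrix (EuclideanSpace.basisFun (Fin n) ℝ).toBasis]
  congr 1
  ext k i
  rw [LinearMap.toMatrix_apply]
  simp [sharp_apply]

theorem PhaseClass.det_phaseGrad_eq (hφ : PhaseClass n 2 φ) {ξ : Rn n} (hξ : ξ ≠ 0) (x : Rn n) :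
    ((sharp n).comp (partialFst (partialSnd φ) x ξ)).det = mixedHessianDet n φ x ξ := by
  rw [det_phaseGrad, mixedHessianDet]
  congr 2
  funext i k
  have hs := hφ.smoothOver.partialSnd isOpen_ne_zero
  have h1 := HasFDerivAt.comp (f := fun x' => (x', ξ)) x (hs.hasFDerivAt isOpen_ne_zero x hξ)
    (hasFDerivAt_prodMk_left x ξ)
  have h2 : HasFDerivAt (fun x' => partialSnd φ x' ξ) (partialFst (partialSnd φ) x ξ) x :=
    h1.differentiableAt.hasFDerivAt
  have h3 := ((ContinuousLinearMap.apply ℝ ℝ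
    (EuclideanSpace.single k (1 : ℝ))).hasFDerivAt.comp x h2).fderiv
  have h4 : fderiv ℝ (fun x' => partialSnd φ x' ξ (EuclideanSpace.single k (1 : ℝ))) x = _ := h3
  exact (congrArg (fun L => L (EuclideanSpace.single i (1 : ℝ))) h4).symm

theorem exists_lower_bound_of_det {E : Type*} [NormedAddCommGroup E] [NormedSpace ℝ E]
    [FiniteDimensional ℝ E] (C : ℝ) {δ : ℝ} (hδ : 0 < δ) :
    ∃ c : ℝ, 0 < c ∧ ∀ L : E →L[ℝ] E, ‖L‖ ≤ C → δ ≤ |L.det| → ∀ v, c * ‖v‖ ≤ ‖L v‖ := by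
  have : ProperSpace E := FiniteDimensional.proper ℝ E
  have : ProperSpace (E →L[ℝ] E) := FiniteDimensional.proper ℝ _
  set S : Set ((E →L[ℝ] E) × E) := ({L | ‖L‖ ≤ C} ∩ {L | δ ≤ |L.det|}) ×ˢ Metric.sphere 0 1
  have hS : IsCompact S := by
    refine IsCompact.prod ?_ (isCompact_sphere 0 1)
    refine IsCompact.inter_right ?_ ?_
    · have h : {L : E →L[ℝ] E | ‖L‖ ≤ C} = Metric.closedBall 0 C :=
        Set.ext fun L => (mem_closedBall_zero_iff (a := L) (r := C)).symm
      rw [h]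
      exact isCompact_closedBall (0 : E →L[ℝ] E) C
    · exact isClosed_le continuous_const ContinuousLinearMap.continuous_det.abs
  have hf : ContinuousOn (fun p : (E →L[ℝ] E) × E => ‖p.1 p.2‖) S :=
    (by fun_prop : Continuous fun p : (E →L[ℝ] E) × E => ‖p.1 p.2‖).continuousOn
  have hpos : ∀ p ∈ S, 0 < ‖p.1 p.2‖ := by
    rintro ⟨L, v⟩ ⟨⟨-, hL⟩, hv⟩
    refine norm_pos_iff.2 fun h => ?_
    have hdet : IsUnit (LinearMap.det (L : E →ₗ[ℝ] E)) := by
      refine isUnit_iff_ne_zero.2 fun h0 => ?_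
      have : L.det = 0 := h0
      rw [Set.mem_ofPred_eq, this, abs_zero] at hL
      linarith
    have hinj := (LinearMap.isUnit_iff_ker_eq_bot _).1 ((LinearMap.isUnit_iff_isUnit_det _).2 hdet)
    have h0 : v = 0 := LinearMap.ker_eq_bot'.1 hinj v h
    simp [h0] at hv
  obtain ⟨c, hc, hcS⟩ : ∃ c : ℝ, 0 < c ∧ ∀ p ∈ S, c ≤ ‖p.1 p.2‖ := by
    rcases S.eq_empty_or_nonempty with h | h
    · exact ⟨1, one_pos, by simp [h]⟩
    · obtain ⟨p, hp, hmin⟩ := hS.exists_isMinOn h hf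
      exact ⟨_, hpos p hp, fun q hq => hmin hq⟩
  refine ⟨c, hc, fun L hL hd v => ?_⟩
  by_cases hv : v = 0
  · simp [hv]
  · have h := hcS (L, ‖v‖⁻¹ • v) ⟨⟨hL, hd⟩, by
      simp [norm_smul, inv_mul_cancel₀ (norm_ne_zero_iff.2 hv)]⟩
    have hv' : 0 < ‖v‖ := norm_pos_iff.2 hv
    simp only [map_smul, norm_smul, norm_inv, norm_norm] at h
    rw [inv_mul_eq_div, le_div_iff₀ hv'] at h
    exact h

theorem PhaseClass.exists_phaseGrad_lower (hφ : PhaseClass n 2 φ) (hs : SNDCondition n φ) :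
    ∃ c : ℝ, 0 < c ∧ ∀ x ξ : Rn n, ξ ≠ 0 → ∀ v,
      c * ‖v‖ ≤ ‖(sharp n).comp (partialFst (partialSnd φ) x ξ) v‖ := by
  obtain ⟨δ, hδ, hd⟩ := hs
  obtain ⟨C, hC, hb⟩ := hφ.norm_partialFst_partialSnd_le
  obtain ⟨c, hc, h⟩ := exists_lower_bound_of_det (E := Rn n) C hδ
  refine ⟨c, hc, fun x ξ hξ => h _ ?_ ?_⟩
  · refine ContinuousLinearMap.opNorm_le_bound _ hC fun v => ?_
    rw [ContinuousLinearMap.comp_apply, norm_sharp]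
    exact (ContinuousLinearMap.le_opNorm _ v).trans
      (mul_le_mul_of_nonneg_right (hb x ξ hξ) (norm_nonneg _))
  · rw [hφ.det_phaseGrad_eq hξ]; exact hd x ξ hξ

theorem PhaseClass.exists_partialFst_lower (hφ : PhaseClass n 2 φ) (hs : SNDCondition n φ) :
    ∃ c : ℝ, 0 < c ∧ ∀ x ξ : Rn n, ξ ≠ 0 → c * ‖ξ‖ ≤ ‖partialFst φ x ξ‖ := by
  obtain ⟨c, hc, h⟩ := hφ.exists_phaseGrad_lower hs
  refine ⟨c, hc, fun x ξ hξ => ?_⟩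
  set L := (sharp n).comp (partialFst (partialSnd φ) x ξ) with hL
  have hinj : Function.Injective L := by
    refine (injective_iff_map_eq_zero _).2 fun v hv => ?_
    have := h x ξ hξ v
    rw [hv, norm_zero] at this
    exact norm_le_zero_iff.1 (by nlinarith [norm_nonneg v])
  obtain ⟨v, hv⟩ := (LinearMap.injective_iff_surjective (f := L.toLinearMap) |>.1 hinj) ξ
  replace hv : L v = ξ := hv
  have h1 : partialFst φ x ξ v = ‖ξ‖ ^ 2 := by
    rw [← hφ.1.euler_partialFst x hξ]
    have h2 := hφ.smoothOver.partial_comm isOpen_ne_zero x hξ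
    have h3 : partialSnd (partialFst φ) x ξ ξ v = partialFst (partialSnd φ) x ξ v ξ := by
      rw [h2]; rfl
    rw [h3, ← inner_sharp]
    have : sharp n (partialFst (partialSnd φ) x ξ v) = ξ := hv
    rw [this, real_inner_self_eq_norm_sq]
  have h2 := h x ξ hξ v
  rw [← hL, hv] at h2
  have h3 : ‖ξ‖ ^ 2 ≤ ‖partialFst φ x ξ‖ * ‖v‖ := by
    rw [← h1]
    exact (le_abs_self _).trans ((partialFst φ x ξ).le_opNorm v)
  have hξ' : 0 < ‖ξ‖ := norm_pos_iff.2 hξ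
  have h4 : c * ‖ξ‖ ^ 2 ≤ ‖partialFst φ x ξ‖ * ‖ξ‖ := by
    calc c * ‖ξ‖ ^ 2 ≤ c * (‖partialFst φ x ξ‖ * ‖v‖) := by gcongr
      _ = ‖partialFst φ x ξ‖ * (c * ‖v‖) := by ring
      _ ≤ _ := by gcongr
  rw [pow_two, ← mul_assoc] at h4
  exact le_of_mul_le_mul_right h4 hξ'

theorem PhaseClass.exists_phaseGrad_antilipschitz (hφ : PhaseClass n 2 φ) (hs : SNDCondition n φ) :
    ∃ c : ℝ, 0 < c ∧ ∀ ξ : Rn n, ξ ≠ 0 → ∀ x z,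
      c * ‖x - z‖ ≤ ‖phaseGrad φ ξ x - phaseGrad φ ξ z‖ := by
  obtain ⟨c, hc, h⟩ := hφ.exists_phaseGrad_lower hs
  obtain ⟨K, hK, hb⟩ := hφ.norm_partialFst_partialFst_partialSnd_le
  refine ⟨c / 2, by positivity, fun ξ hξ x z => ?_⟩
  have hd := fun x => hφ.hasFDerivAt_phaseGrad hξ x
  refine antilipschitz_of_fderiv (fun x => (hd x).differentiableAt) hc hK (fun x v => ?_)
    (fun x x' => ?_) x z
  · rw [(hd x).fderiv]; exact h x ξ hξ v
  · rw [(hd x).fderiv, (hd x').fderiv, ← ContinuousLinearMap.comp_sub]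
    have h1 : ‖partialFst (partialSnd φ) x ξ - partialFst (partialSnd φ) x' ξ‖ ≤ K * ‖x - x'‖ := by
      have hs2 := (hφ.smoothOver.partialSnd isOpen_ne_zero).partialFst isOpen_ne_zero
      refine convex_univ.norm_image_sub_le_of_norm_fderiv_le (𝕜 := ℝ)
        (f := fun x => partialFst (partialSnd φ) x ξ) (fun y _ => ?_)
        (fun y _ => hb y ξ hξ) (Set.mem_univ _) (Set.mem_univ _)
      exact (HasFDerivAt.comp (f := fun x' => (x', ξ)) y (hs2.hasFDerivAt isOpen_ne_zero y hξ)
        (hasFDerivAt_prodMk_left y ξ)).differentiableAt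
    refine ContinuousLinearMap.opNorm_le_bound _ (by positivity) fun v => ?_
    rw [ContinuousLinearMap.comp_apply, norm_sharp]
    exact (ContinuousLinearMap.le_opNorm _ v).trans (mul_le_mul_of_nonneg_right h1 (norm_nonneg _))

end PhaseFacts

section Cutoffs

variable {n : ℕ}

/-- A smooth cutoff equal to `1` on `r₁ ≤ ‖ξ‖ ≤ r₂` and supported in `r₁ / 2 ≤ ‖ξ‖ ≤ 2 r₂`. -/
def annCut (n : ℕ) (r₁ r₂ : ℝ) (ξ : Rn n) : ℝ :=
  Real.smoothTransition ((4 * ‖ξ‖ ^ 2 / r₁ ^ 2 - 1) / 3) *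
    Real.smoothTransition ((4 * r₂ ^ 2 - ‖ξ‖ ^ 2) / (3 * r₂ ^ 2))

theorem contDiff_annCut (r₁ r₂ : ℝ) : ContDiff ℝ (⊤ : ℕ∞) (annCut n r₁ r₂) := by
  have h := contDiff_norm_sq (E := Rn n) ℝ (n := ((⊤ : ℕ∞) : WithTop ℕ∞))
  refine ContDiff.mul (Real.smoothTransition.contDiff.comp ?_)
    (Real.smoothTransition.contDiff.comp ?_)
  · exact (((contDiff_const.mul h).div_const _).sub contDiff_const).div_const _
  · exact (contDiff_const.sub h).div_const _

theorem annCut_eq_one {r₁ r₂ : ℝ} (h₁ : 0 < r₁) (h₂ : 0 < r₂) {ξ : Rn n} (h : r₁ ≤ ‖ξ‖)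
    (h' : ‖ξ‖ ≤ r₂) : annCut n r₁ r₂ ξ = 1 := by
  have e1 : r₁ ^ 2 ≤ ‖ξ‖ ^ 2 := by gcongr
  have e2 : ‖ξ‖ ^ 2 ≤ r₂ ^ 2 := by gcongr
  rw [annCut, Real.smoothTransition.one_of_one_le, Real.smoothTransition.one_of_one_le, one_mul]
  · rw [le_div_iff₀ (by positivity)]; linarith
  · rw [le_div_iff₀ (by norm_num), le_sub_iff_add_le, le_div_iff₀ (by positivity)]; linarith

theorem annCut_eq_zero {r₁ r₂ : ℝ} (h₁ : 0 < r₁) (h₂ : 0 < r₂) {ξ : Rn n}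
    (h : ‖ξ‖ ≤ r₁ / 2 ∨ 2 * r₂ ≤ ‖ξ‖) : annCut n r₁ r₂ ξ = 0 := by
  rw [annCut, mul_eq_zero]
  rcases h with h | h
  · left
    refine Real.smoothTransition.zero_of_nonpos (div_nonpos_of_nonpos_of_nonneg ?_ (by norm_num))
    have : ‖ξ‖ ^ 2 ≤ (r₁ / 2) ^ 2 := by gcongr
    rw [sub_nonpos, div_le_one (by positivity)]; linarith
  · right
    refine Real.smoothTransition.zero_of_nonpos (div_nonpos_of_nonpos_of_nonneg ?_ (by positivity))
    have : (2 * r₂) ^ 2 ≤ ‖ξ‖ ^ 2 := by gcongr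
    linarith

theorem hasCompactSupport_annCut {r₁ r₂ : ℝ} (h₁ : 0 < r₁) (h₂ : 0 < r₂) :
    HasCompactSupport (annCut n r₁ r₂) :=
  HasCompactSupport.of_support_subset_isCompact (isCompact_closedBall 0 (2 * r₂)) fun ξ hξ => by
    rw [mem_closedBall_zero_iff]
    by_contra! h
    exact hξ (annCut_eq_zero h₁ h₂ (Or.inr h.le))

theorem tsupport_annCut {r₁ r₂ : ℝ} (h₁ : 0 < r₁) (h₂ : 0 < r₂) :
    tsupport (annCut n r₁ r₂) ⊆ {ξ | ξ ≠ 0} := by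
  have h : tsupport (annCut n r₁ r₂) ⊆ {ξ | r₁ / 2 ≤ ‖ξ‖} := by
    refine closure_minimal (fun ξ hξ => ?_) (isClosed_le continuous_const continuous_norm)
    by_contra h
    exact hξ (annCut_eq_zero h₁ h₂ (Or.inl (not_le.1 h).le))
  intro ξ hξ h0
  have := h hξ
  rw [h0, Set.mem_ofPred_eq, norm_zero] at this
  linarith

/-- A smooth window supported in `[-1, 1]` whose integer translates sum to `1`. -/
def latticeWindow (t : ℝ) : ℝ := Real.smoothTransition (t + 1) - Real.smoothTransition t

theorem contDiff_latticeWindow : ContDiff ℝ (⊤ : ℕ∞) latticeWindow :=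
  (Real.smoothTransition.contDiff.comp (contDiff_id.add contDiff_const)).sub
    Real.smoothTransition.contDiff

theorem latticeWindow_eq_zero {t : ℝ} (h : 1 ≤ |t|) : latticeWindow t = 0 := by
  rw [latticeWindow]
  rcases le_abs.1 h with h | h
  · rw [Real.smoothTransition.one_of_one_le h, Real.smoothTransition.one_of_one_le (by linarith),
      sub_self]
  · rw [Real.smoothTransition.zero_of_nonpos (by linarith),
      Real.smoothTransition.zero_of_nonpos (by linarith), sub_self]

theorem sum_latticeWindow {L : ℕ} {t : ℝ} (h : |t| ≤ L) :
    ∑ l ∈ Finset.Icc (-(L : ℤ)) L, latticeWindow (t - l) = 1 := by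
  have key : ∀ m : ℕ, ∑ l ∈ Finset.Icc (-(m : ℤ)) m, latticeWindow (t - l) =
      Real.smoothTransition (t + m + 1) - Real.smoothTransition (t - m) := by
    intro m
    induction m with
    | zero => simp [latticeWindow]
    | succ m ih =>
      have e : Finset.Icc (-((m + 1 : ℕ) : ℤ)) ((m + 1 : ℕ) : ℤ) =
          insert (-((m + 1 : ℕ) : ℤ)) (insert ((m + 1 : ℕ) : ℤ) (Finset.Icc (-(m : ℤ)) m)) := by
        ext l
        simp only [Finset.mem_Icc, Finset.mem_insert]
        omega
      rw [e, Finset.sum_insert, Finset.sum_insert, ih, latticeWindow, latticeWindow]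
      · push_cast
        rw [show t - (-((m : ℝ) + 1)) + 1 = t + (m + 1) + 1 by ring,
          show t - (-((m : ℝ) + 1)) = t + m + 1 by ring,
          show t - ((m : ℝ) + 1) + 1 = t - m by ring]
        ring
      · simp
      · simp only [Finset.mem_Icc, Finset.mem_insert]
        omega
  rw [key, Real.smoothTransition.one_of_one_le, Real.smoothTransition.zero_of_nonpos, sub_zero]
  · linarith [(abs_le.1 h).2]
  · linarith [(abs_le.1 h).1]

end Cutoffs

section UnitInterval

variable {ι X G : Type*} [NormedAddCommGroup X] [NormedSpace ℝ X] [ProperSpace X]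
  [NormedAddCommGroup G] [NormedSpace ℝ G] [CompleteSpace G]

theorem UBd.integral_unit {f : ι → ℝ × X → G} {w ρ : ι → X → ℝ}
    (hf : ∀ i, ContDiff ℝ (⊤ : ℕ∞) (f i))
    (hb : UBd (fun (j : ι × unitInterval) x => f j.1 ((j.2 : ℝ), x)) (fun j => w j.1)
      (fun j => ρ j.1))
    (hw : ∀ i, Continuous (w i)) (hρ : ∀ i, Continuous (ρ i)) :
    UBd (fun i x => ∫ s : unitInterval, f i ((s : ℝ), x)) w ρ := by
  have h := fun i => contDiff_integral_and_bound (ν := (volume : Measure unitInterval))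
    (F := fun s x => f i ((s : ℝ), x)) (fun s => hb.smooth (i, s))
    (fun k x => by
      have h1 := continuous_iteratedFDeriv_slice (k := k) ((hf i).of_le (by exact_mod_cast le_top))
      have h2 : Continuous fun s : unitInterval => ((s : ℝ), x) :=
        continuous_subtype_val.prodMk continuous_const
      exact (h1.comp h2).aestronglyMeasurable)
    (g := fun k _ => (hb.2 k).choose) (ω := fun k x => w i x * ρ i x ^ k)
    (fun k => integrable_const _) (fun k => (hw i).mul ((hρ i).pow k))
    (fun k _ => (hb.2 k).choose_spec.1) (fun k s x => (hb.2 k).choose_spec.2 (i, s) x)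
  refine ⟨fun i => (h i).1, fun k => ⟨(hb.2 k).choose, (hb.2 k).choose_spec.1, fun i x => ?_⟩⟩
  have := (h i).2 k x
  simpa using this

theorem integral_unitInterval {G : Type*} [NormedAddCommGroup G] [NormedSpace ℝ G]
    (f : ℝ → G) : ∫ s : unitInterval, f s = ∫ s in (0 : ℝ)..1, f s := by
  rw [intervalIntegral.integral_of_le zero_le_one, ← integral_Icc_eq_integral_Ioc]
  exact integral_subtype_comap measurableSet_Icc f

theorem taylor_two_unitInterval {g g' g'' : ℝ → ℝ} (h : ∀ s ∈ Set.Icc (0 : ℝ) 1, HasDerivAt g (g' s) s)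
    (h' : ∀ s ∈ Set.Icc (0 : ℝ) 1, HasDerivAt g' (g'' s) s)
    (hc : ContinuousOn g'' (Set.Icc 0 1)) :
    g 1 = g 0 + g' 0 + ∫ s : unitInterval, (1 - (s : ℝ)) * g'' s := by
  have h1 : ∀ s ∈ Set.uIcc (0 : ℝ) 1,
      HasDerivAt (fun s => g s + (1 - s) * g' s) ((1 - s) * g'' s) s := by
    intro s hs
    rw [Set.uIcc_of_le zero_le_one] at hs
    have h2 := (h s hs).add (((hasDerivAt_id s).const_sub 1).mul (h' s hs))
    refine h2.congr_deriv ?_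
    simp
  have h3 := intervalIntegral.integral_eq_sub_of_hasDerivAt h1 (by
    refine ContinuousOn.intervalIntegrable ?_
    rw [Set.uIcc_of_le zero_le_one]
    exact (continuous_const.sub continuous_id).continuousOn.mul hc)
  rw [integral_unitInterval (fun s => (1 - s) * g'' s), h3]
  simp

theorem ftc_unitInterval {G : Type*} [NormedAddCommGroup G] [NormedSpace ℝ G] [CompleteSpace G]
    {g g' : ℝ → G} (h : ∀ s ∈ Set.Icc (0 : ℝ) 1, HasDerivAt g (g' s) s)
    (hc : ContinuousOn g' (Set.Icc 0 1)) : g 1 - g 0 = ∫ s : unitInterval, g' s := by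
  rw [integral_unitInterval]
  refine (intervalIntegral.integral_eq_sub_of_hasDerivAt (by rwa [Set.uIcc_of_le zero_le_one]) ?_).symm
  refine ContinuousOn.intervalIntegrable ?_
  rwa [Set.uIcc_of_le zero_le_one]

end UnitInterval

section Shear

variable {n : ℕ}

/-- The projection killing the `i`-th coordinate. -/
def coordKill (i : Fin n) : Rn n →L[ℝ] Rn n :=
  ContinuousLinearMap.id ℝ (Rn n) -
    (EuclideanSpace.proj i : Rn n →L[ℝ] ℝ).smulRight (EuclideanSpace.single i (1 : ℝ))

/-- The linear map sending `e_i` to `ω` and `e_j` to `ε e_j` for `j ≠ i`. -/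
def shear (i : Fin n) (ω : Rn n) (ε : ℝ) : Rn n →L[ℝ] Rn n :=
  (EuclideanSpace.proj i : Rn n →L[ℝ] ℝ).smulRight ω + ε • coordKill i

theorem coordKill_apply (i : Fin n) (ζ : Rn n) :
    coordKill i ζ = ζ - ζ i • EuclideanSpace.single i (1 : ℝ) := rfl

theorem shear_apply (i : Fin n) (ω : Rn n) (ε : ℝ) (ζ : Rn n) :
    shear i ω ε ζ = ζ i • ω + ε • coordKill i ζ := rfl

theorem coordKill_same (i : Fin n) (ζ : Rn n) : coordKill i ζ i = 0 := by
  simp [coordKill_apply]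

theorem coordKill_ne {i j : Fin n} (h : j ≠ i) (ζ : Rn n) : coordKill i ζ j = ζ j := by
  simp [coordKill_apply, h]

theorem shear_same (i : Fin n) (ω : Rn n) (ε : ℝ) (ζ : Rn n) :
    shear i ω ε ζ i = ζ i * ω i := by
  rw [shear_apply, PiLp.add_apply, PiLp.smul_apply, PiLp.smul_apply, coordKill_same]
  simp

theorem shear_ne {i j : Fin n} (h : j ≠ i) (ω : Rn n) (ε : ℝ) (ζ : Rn n) :
    shear i ω ε ζ j = ζ i * ω j + ε * ζ j := by
  rw [shear_apply, PiLp.add_apply, PiLp.smul_apply, PiLp.smul_apply, coordKill_ne h]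
  simp

theorem norm_proj_le (i : Fin n) : ‖(EuclideanSpace.proj i : Rn n →L[ℝ] ℝ)‖ ≤ 1 :=
  ContinuousLinearMap.opNorm_le_bound _ zero_le_one fun x => by
    simpa using PiLp.norm_apply_le x i

theorem norm_coordKill_le (i : Fin n) : ‖coordKill i‖ ≤ 2 := by
  refine (norm_sub_le _ _).trans ?_
  have h1 := ContinuousLinearMap.norm_id_le (𝕜 := ℝ) (E := Rn n)
  have h2 := norm_proj_le i
  rw [ContinuousLinearMap.norm_smulRight_apply, PiLp.norm_single, norm_one, mul_one]
  linarith

theorem norm_shear_le (i : Fin n) (ω : Rn n) {ε R : ℝ} (hε : |ε| ≤ 1) (hω : ‖ω‖ ≤ R) :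
    ‖shear i ω ε‖ ≤ R + 2 := by
  refine (norm_add_le _ _).trans (add_le_add ?_ ?_)
  · rw [ContinuousLinearMap.norm_smulRight_apply]
    have := norm_proj_le i
    exact (mul_le_of_le_one_left (norm_nonneg _) this).trans hω
  · rw [norm_smul, Real.norm_eq_abs]
    exact (mul_le_of_le_one_left (norm_nonneg _) hε).trans (norm_coordKill_le i)

theorem det_shear (i : Fin n) (ω : Rn n) (ε : ℝ) :
    LinearMap.det (shear i ω ε : Rn n →ₗ[ℝ] Rn n) = ε ^ (n - 1) * ω i := by
  rw [← LinearMap.det_toMatrix (EuclideanSpace.basisFun (Fin n) ℝ).toBasis]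
  have h : LinearMap.toMatrix (EuclideanSpace.basisFun (Fin n) ℝ).toBasis
      (EuclideanSpace.basisFun (Fin n) ℝ).toBasis (shear i ω ε : Rn n →ₗ[ℝ] Rn n) =
      (ε • (1 : Matrix (Fin n) (Fin n) ℝ)).updateCol i ω := by
    ext a b
    rw [LinearMap.toMatrix_apply]
    simp only [OrthonormalBasis.coe_toBasis, OrthonormalBasis.coe_toBasis_repr_apply,
      EuclideanSpace.basisFun_apply, EuclideanSpace.basisFun_repr, ContinuousLinearMap.coe_coe]
    by_cases hb : b = i
    · subst hb
      rw [Matrix.updateCol_self]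
      by_cases ha : a = b
      · subst ha; rw [shear_same]; simp
      · rw [shear_ne ha]; simp [ha]
    · rw [Matrix.updateCol_ne hb]
      by_cases ha : a = i
      · subst ha; rw [shear_same]; simp [Ne.symm hb]
      · rw [shear_ne ha]; simp [Matrix.one_apply, Ne.symm hb]
  rw [h, ← Matrix.cramer_apply, Matrix.cramer_smul, Matrix.cramer_one]
  simp

theorem det_adjoint (A : Rn n →L[ℝ] Rn n) :
    LinearMap.det (ContinuousLinearMap.adjoint A : Rn n →ₗ[ℝ] Rn n) =
      LinearMap.det (A : Rn n →ₗ[ℝ] Rn n) := by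
  set b := EuclideanSpace.basisFun (Fin n) ℝ
  rw [← LinearMap.det_toMatrix b.toBasis, ← LinearMap.det_toMatrix b.toBasis (A : Rn n →ₗ[ℝ] Rn n)]
  have h := LinearMap.toMatrix_adjoint b b (A : Rn n →ₗ[ℝ] Rn n)
  have h2 : (ContinuousLinearMap.adjoint A : Rn n →ₗ[ℝ] Rn n) =
      LinearMap.adjoint (A : Rn n →ₗ[ℝ] Rn n) := rfl
  rw [h2, h, Matrix.det_conjTranspose]
  simp

end Shear

section Windows

variable {n : ℕ}

/-- A smooth cutoff equal to `1` on the ball of radius `R` and supported in that of radius `2 * R`. -/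
def ballCut (n : ℕ) (R : ℝ) (ξ : Rn n) : ℝ :=
  Real.smoothTransition ((4 * R ^ 2 - ‖ξ‖ ^ 2) / (3 * R ^ 2))

theorem contDiff_ballCut (R : ℝ) : ContDiff ℝ (⊤ : ℕ∞) (ballCut n R) :=
  Real.smoothTransition.contDiff.comp
    ((contDiff_const.sub (contDiff_norm_sq (E := Rn n) ℝ)).div_const _)

theorem ballCut_eq_one {R : ℝ} (hR : 0 < R) {ξ : Rn n} (h : ‖ξ‖ ≤ R) : ballCut n R ξ = 1 := by
  have e2 : ‖ξ‖ ^ 2 ≤ R ^ 2 := by gcongr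
  rw [ballCut, Real.smoothTransition.one_of_one_le]
  rw [le_div_iff₀ (by positivity)]; linarith

theorem ballCut_eq_zero {R : ℝ} (hR : 0 < R) {ξ : Rn n} (h : 2 * R ≤ ‖ξ‖) : ballCut n R ξ = 0 := by
  refine Real.smoothTransition.zero_of_nonpos (div_nonpos_of_nonpos_of_nonneg ?_ (by positivity))
  have : (2 * R) ^ 2 ≤ ‖ξ‖ ^ 2 := by gcongr
  linarith

/-- The product of lattice windows in the variables `ζ_j / ζ_i`, `j ≠ i`. -/
def prodWindow (i : Fin n) (c : ℝ) (ζ : Rn n) : ℝ :=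
  ∏ j, if j = i then 1 else latticeWindow (ζ j * smoothRecip c (ζ i))

/-- The compactly supported window attached to a cell of the angular decomposition. -/
def cellWindow (i : Fin n) (c : ℝ) (ζ : Rn n) : ℝ := ballCut n (4 * n) ζ * prodWindow i c ζ

theorem contDiff_cellWindow (i : Fin n) {c : ℝ} (hc : 0 < c) :
    ContDiff ℝ (⊤ : ℕ∞) (cellWindow i c) := by
  refine (contDiff_ballCut _).mul (contDiff_prod fun j _ => ?_)
  by_cases h : j = i
  · simp only [h, if_true]; exact contDiff_const
  · simp only [h, if_false]
    have hp : ∀ k : Fin n, ContDiff ℝ (⊤ : ℕ∞) fun ζ : Rn n => ζ k := fun k =>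
      (EuclideanSpace.proj k : Rn n →L[ℝ] ℝ).contDiff
    exact contDiff_latticeWindow.comp ((hp j).mul ((contDiff_smoothRecip hc).comp (hp i)))

theorem cellWindow_eq_zero (i : Fin n) (c : ℝ) {ζ : Rn n} (h : 8 * (n : ℝ) < ‖ζ‖) :
    cellWindow i c ζ = 0 := by
  have hn : 0 < (n : ℝ) := Nat.cast_pos.2 (Nat.pos_of_ne_zero fun h0 => by subst h0; exact i.elim0)
  rw [cellWindow, ballCut_eq_zero (by positivity) (by linarith), zero_mul]

theorem norm_le_of_forall_abs_le {R : ℝ} (ζ : Rn n) (h : ∀ j, |ζ j| ≤ R) : ‖ζ‖ ≤ n * R := by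
  rw [← Rn.sum_single ζ]
  refine (norm_sum_le _ _).trans ?_
  calc ∑ l, ‖ζ l • EuclideanSpace.single l (1 : ℝ)‖ ≤ ∑ _l : Fin n, R := by
        refine Finset.sum_le_sum fun l _ => ?_
        rw [norm_smul, PiLp.norm_single, norm_one, mul_one]
        exact h l
    _ = n * R := by simp

theorem cellWindow_eq_prodWindow (i : Fin n) {c : ℝ} (hc : 0 < c) {ζ : Rn n} (h : c ≤ ζ i)
    (h' : ζ i ≤ 4) : cellWindow i c ζ = prodWindow i c ζ := by
  have hn : 0 < (n : ℝ) := Nat.cast_pos.2 (Nat.pos_of_ne_zero fun h0 => by subst h0; exact i.elim0)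
  by_cases h0 : prodWindow i c ζ = 0
  · rw [cellWindow, h0, mul_zero]
  · rw [cellWindow, ballCut_eq_one (by positivity), one_mul]
    rw [mul_comm]
    refine norm_le_of_forall_abs_le ζ fun j => ?_
    by_cases hj : j = i
    · rw [hj, abs_of_pos (by linarith)]; exact h'
    · have h1 := Finset.prod_ne_zero_iff.1 h0 j (Finset.mem_univ j)
      rw [if_neg hj, smoothRecip_of_le hc h] at h1
      by_contra! h2
      refine h1 (latticeWindow_eq_zero ?_)
      rw [mul_one_div, abs_div, abs_of_pos (show 0 < ζ i by linarith), le_div_iff₀ (by linarith)]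
      linarith

end Windows

section PhaseTaylor

variable {n : ℕ} {φ : Rn n → Rn n → ℝ}

theorem PhaseClass.taylor (hφ : PhaseClass n 2 φ) (x : Rn n) {ω w : Rn n} {t : ℝ} (ht : 0 < t)
    (hω : ω ≠ 0) (h : ∀ s ∈ Set.Icc (0 : ℝ) 1, t • ω + s • w ≠ 0) :
    φ x (t • ω + w) = partialSnd φ x ω (t • ω + w) +
      ∫ s : unitInterval, (1 - (s : ℝ)) * partialSnd (partialSnd φ) x (t • ω + (s : ℝ) • w) w w := by
  have hs := hφ.smoothOver
  have hs1 := hs.partialSnd isOpen_ne_zero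
  have hs2 := hs1.partialSnd isOpen_ne_zero
  have hl : ∀ s : ℝ, HasDerivAt (fun s : ℝ => t • ω + s • w) w s := fun s => by
    simpa using ((hasDerivAt_id s).smul_const w).const_add (t • ω)
  have h0 : ∀ s ∈ Set.Icc (0 : ℝ) 1, HasDerivAt (fun s : ℝ => φ x (t • ω + s • w))
      (partialSnd φ x (t • ω + s • w) w) s := by
    intro s hs'
    have h1 := HasFDerivAt.comp (f := fun ξ' => (x, ξ')) _ (hs.hasFDerivAt isOpen_ne_zero x (h s hs'))
      (hasFDerivAt_prodMk_right x (t • ω + s • w))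
    exact (h1.differentiableAt.hasFDerivAt (f := fun ξ => φ x ξ)).comp_hasDerivAt s (hl s)
  have h1 : ∀ s ∈ Set.Icc (0 : ℝ) 1, HasDerivAt (fun s : ℝ => partialSnd φ x (t • ω + s • w) w)
      (partialSnd (partialSnd φ) x (t • ω + s • w) w w) s := by
    intro s hs'
    have h1 := HasFDerivAt.comp (f := fun ξ' => (x, ξ')) _ (hs1.hasFDerivAt isOpen_ne_zero x (h s hs'))
      (hasFDerivAt_prodMk_right x (t • ω + s • w))
    have h2 := (h1.differentiableAt.hasFDerivAt (f := fun ξ => partialSnd φ x ξ)).comp_hasDerivAt s (hl s)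
    exact ((ContinuousLinearMap.apply ℝ ℝ w).hasFDerivAt.comp_hasDerivAt s h2)
  have h2 : ContinuousOn (fun s : ℝ => partialSnd (partialSnd φ) x (t • ω + s • w) w w)
      (Set.Icc 0 1) := by
    intro s hs'
    have h3 := (hs2.contDiffAt isOpen_ne_zero (x := x) (h s hs')).continuousAt
    have h4 : ContinuousAt (fun s : ℝ => (x, t • ω + s • w)) s := by fun_prop
    have h5 := ContinuousAt.comp (f := fun s : ℝ => (x, t • ω + s • w)) h3 h4
    exact ((h5.clm_apply continuousAt_const).clm_apply continuousAt_const).continuousWithinAt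
  have key := taylor_two_unitInterval h0 h1 h2
  simp only [one_smul, zero_smul, add_zero] at key
  rw [key, hφ.1.2 x ω t ht, hφ.1.partialSnd_smul x ht, ← hφ.1.euler x hω, map_add, map_smul]
  rfl

end PhaseTaylor

section CellBound

variable {n : ℕ} {φ : Rn n → Rn n → ℝ}

theorem UBd.clm_id {ι X G : Type*} [NormedAddCommGroup X] [NormedSpace ℝ X]
    [NormedAddCommGroup G] [NormedSpace ℝ G] (L : X →L[ℝ] G) :
    UBd (fun (_ : ι) v => L v) (fun _ v => 1 + ‖v‖) (fun _ _ => 1) := by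
  refine UBd.const_fun L.contDiff fun k => ⟨‖L‖, norm_nonneg _, fun v _ => ?_⟩
  rw [one_pow, mul_one]
  match k with
  | 0 =>
    rw [norm_iteratedFDeriv_zero]
    exact (L.le_opNorm v).trans (by gcongr; linarith)
  | 1 =>
    rw [norm_iteratedFDeriv_one, L.fderiv]
    exact le_mul_of_one_le_right (norm_nonneg _) (by linarith [norm_nonneg v])
  | k + 2 =>
    have : iteratedFDeriv ℝ (k + 2) L v = 0 := by
      have h : ‖iteratedFDeriv ℝ (k + 2) L v‖ = 0 := by
        rw [← norm_iteratedFDeriv_fderiv]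
        have h2 : fderiv ℝ L = fun _ => L := funext fun v => L.fderiv
        rw [h2, iteratedFDeriv_const_of_ne (by omega)]
        simp
      exact norm_eq_zero.1 h
    rw [this, norm_zero]
    positivity

theorem UBd.smul_unit {ι X G : Type*} [NormedAddCommGroup X] [NormedSpace ℝ X]
    [NormedAddCommGroup G] [NormedSpace ℝ G] {f : ι → X → G} {w ρ : ι → X → ℝ}
    (hf : UBd f w ρ) (a : ι → ℝ) (K : ℝ) (hK : 0 ≤ K) (ha : ∀ i, |a i| ≤ K) :
    UBd (fun i v => a i • f i v) w ρ := by
  refine ⟨fun i => contDiff_const.smul (hf.smooth i), fun k => ?_⟩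
  obtain ⟨C, hC, h⟩ := hf.2 k
  refine ⟨K * C, by positivity, fun i v => ?_⟩
  rw [iteratedFDeriv_const_smul_apply' ((hf.smooth' i k).contDiffAt), norm_smul, mul_assoc]
  gcongr
  · exact ha i
  · exact h i v

/-- The second order Taylor remainder of the phase in the anisotropic coordinates of a cell. -/
def cellRem (n : ℕ) (φ : Rn n → Rn n → ℝ) (c : Rn n → ℝ) (i : Fin n) (x ω : Rn n) (ε : ℝ)
    (p : ℝ × Rn n) : ℝ :=
  (1 - p.1) * (c (p.2 i • ω + (p.1 * ε) • coordKill i p.2) •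
    partialSnd (partialSnd φ) x (p.2 i • ω + (p.1 * ε) • coordKill i p.2))
      (coordKill i p.2) (coordKill i p.2)

theorem contDiff_cellRem (hφ : PhaseClass n 2 φ) {c : Rn n → ℝ}
    (hc : ContDiff ℝ (⊤ : ℕ∞) c) (hcs : HasCompactSupport c) (hcU : tsupport c ⊆ {ξ | ξ ≠ 0})
    (i : Fin n) (x ω : Rn n) (ε : ℝ) : ContDiff ℝ (⊤ : ℕ∞) (cellRem n φ c i x ω ε) := by
  have h := (hφ.UBd_partialSnd_partialSnd hc hcs hcU).smooth ()
  have h1 : ContDiff ℝ (⊤ : ℕ∞) fun p : ℝ × Rn n => p.2 i :=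
    (EuclideanSpace.proj i : Rn n →L[ℝ] ℝ).contDiff.comp contDiff_snd
  have h2 : ContDiff ℝ (⊤ : ℕ∞) fun p : ℝ × Rn n => coordKill i p.2 :=
    (coordKill i).contDiff.comp contDiff_snd
  have h3 : ContDiff ℝ (⊤ : ℕ∞) fun p : ℝ × Rn n =>
      (x, p.2 i • ω + (p.1 * ε) • coordKill i p.2) :=
    contDiff_const.prodMk ((h1.smul contDiff_const).add
      ((contDiff_fst.mul contDiff_const).smul h2))
  exact (contDiff_const.sub contDiff_fst).mul (((h.comp h3).clm_apply h2).clm_apply h2)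

theorem UBd_cellRem (hφ : PhaseClass n 2 φ) {c : Rn n → ℝ}
    (hc : ContDiff ℝ (⊤ : ℕ∞) c) (hcs : HasCompactSupport c) (hcU : tsupport c ⊆ {ξ | ξ ≠ 0})
    (i : Fin n) {κ : Type*} (x ω : κ → Rn n) (ε : κ → ℝ) {R : ℝ} (hR : 0 ≤ R)
    (hω : ∀ j, ‖ω j‖ ≤ R) (hε : ∀ j, |ε j| ≤ 1) :
    UBd (fun j ζ => ∫ s : unitInterval, cellRem n φ c i (x j) (ω j) (ε j) ((s : ℝ), ζ))
      (fun _ ζ => (1 + ‖ζ‖) ^ 2) (fun _ _ => R + 2) := by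
  have hG := hφ.UBd_partialSnd_partialSnd hc hcs hcU
  refine UBd.integral_unit (fun j => contDiff_cellRem hφ hc hcs hcU i (x j) (ω j) (ε j)) ?_
    (fun _ => by fun_prop) (fun _ => by fun_prop)
  have hA : ∀ j : κ × unitInterval,
      ‖(ContinuousLinearMap.inr ℝ (Rn n) (Rn n)).comp (shear i (ω j.1) ((j.2 : ℝ) * ε j.1))‖ ≤
        R + 2 := by
    intro j
    refine (ContinuousLinearMap.opNorm_comp_le _ _).trans ?_
    refine (mul_le_of_le_one_left (norm_nonneg _)
      (ContinuousLinearMap.norm_inr_le_one ℝ (Rn n) (Rn n))).trans ?_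
    refine norm_shear_le i _ ?_ (hω j.1)
    rw [abs_mul, abs_of_nonneg j.2.2.1]
    exact mul_le_one₀ j.2.2.2 (abs_nonneg _) (hε j.1)
  have h1 := hG.comp_affine (fun _ _ => zero_le_one) (fun _ _ => zero_le_one) (fun _ => ())
    (fun j : κ × unitInterval => (ContinuousLinearMap.inr ℝ (Rn n) (Rn n)).comp
      (shear i (ω j.1) ((j.2 : ℝ) * ε j.1))) (fun j => (x j.1, 0)) (fun _ => R + 2) hA
  simp only [one_mul] at h1
  have hP : UBd (fun (_ : κ × unitInterval) v => coordKill i v) (fun _ v => 1 + ‖v‖)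
      (fun _ _ => R + 2) :=
    (UBd.clm_id (coordKill i)).mono 1 zero_le_one (fun _ _ => by positivity)
      (fun _ _ => by rw [one_mul]) (fun _ _ => zero_le_one) (fun _ _ => by linarith)
  have h2 := UBd.bilin (ContinuousLinearMap.id ℝ (Rn n →L[ℝ] Rn n →L[ℝ] ℝ)) h1 hP
    (fun _ _ => zero_le_one) (fun _ _ => by positivity)
  have h3 := UBd.bilin (ContinuousLinearMap.id ℝ (Rn n →L[ℝ] ℝ)) h2 hP
    (fun _ _ => by positivity) (fun _ _ => by positivity)
  have h4 := h3.smul_unit (fun j => 1 - (j.2 : ℝ)) 1 zero_le_one (fun j => by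
    rw [abs_of_nonneg (by linarith [j.2.2.2])]; linarith [j.2.2.1])
  have h5 : UBd (fun (j : κ × unitInterval) ζ => cellRem n φ c i (x j.1) (ω j.1) (ε j.1)
      ((j.2 : ℝ), ζ)) (fun _ ζ => 1 * (1 + ‖ζ‖) * (1 + ‖ζ‖)) (fun _ _ => R + 2) := by
    refine (iff_of_eq (congrArg (fun f => UBd f _ _) ?_)).1 h4
    funext j ζ
    simp [cellRem, shear_apply]
  refine h5.mono 1 zero_le_one (fun _ _ => by positivity) (fun _ _ => by nlinarith)
    (fun _ _ => by positivity) (fun _ _ => le_rfl)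

theorem cell_bound (hφ : PhaseClass n 2 φ) {ι : Type*} {lam : ι → ℝ} (hlam : ∀ j, 1 ≤ lam j)
    {β : ι → Rn n → Rn n → ℂ}
    (hβ : UBd (fun (j : ι × Rn n) η => β j.1 j.2 η) (fun _ _ => 1) (fun _ _ => 1))
    (i : Fin n) {c₁ : ℝ} (hc₁ : 0 < c₁) {σ : ℝ} (hσ : σ * σ = 1)
    (hsupp : ∀ j x η, β j x η ≠ 0 → c₁ ≤ σ * η i ∧ ‖η‖ ≤ 4) (R : ℝ) (N : ℕ) :
    ∃ C : ℝ, 0 ≤ C ∧ ∀ (j : ι) (x y ω : Rn n), ω i = σ → ‖ω‖ ≤ R →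
      ‖∫ ζ, (cellWindow i c₁ ζ : ℂ) * (β j x (shear i ω (√(lam j))⁻¹ ζ) *
        cexp (I * ((lam j * (φ x (shear i ω (√(lam j))⁻¹ ζ) -
          ⟪y, shear i ω (√(lam j))⁻¹ ζ⟫_ℝ) : ℝ) : ℂ)))‖ ≤
        C * ((1 + ‖lam j • ContinuousLinearMap.adjoint (shear i ω (√(lam j))⁻¹)
          (phaseGrad φ ω x - y)‖) ^ N)⁻¹ := by
  have hn : 0 < (n : ℝ) := Nat.cast_pos.2 (Nat.pos_of_ne_zero fun h0 => by subst h0; exact i.elim0)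
  by_cases hR : 0 ≤ R
  swap
  · exact ⟨0, le_rfl, fun j x y ω _ h => absurd ((norm_nonneg ω).trans h) hR⟩
  set r₂ : ℝ := 4 * R + 16 * n with hr₂
  have hr₂0 : 0 < r₂ := by positivity
  have hε : ∀ j, |(√(lam j))⁻¹| ≤ 1 := fun j => by
    rw [abs_of_nonneg (by positivity)]
    exact inv_le_one_of_one_le₀ (Real.one_le_sqrt.2 (hlam j))
  -- the family of cells
  let κ := ι × Rn n × {ω : Rn n // ω i = σ ∧ ‖ω‖ ≤ R}
  have hH := UBd_cellRem hφ (contDiff_annCut c₁ r₂) (hasCompactSupport_annCut hc₁ hr₂0)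
    (tsupport_annCut hc₁ hr₂0) i (κ := κ) (fun j => j.2.1) (fun j => (j.2.2 : Rn n))
    (fun j => (√(lam j.1))⁻¹) hR (fun j => j.2.2.2.2) (fun j => hε j.1)
  set H : κ → Rn n → ℝ := fun j ζ => ∫ s : unitInterval, cellRem n φ (annCut n c₁ r₂) i j.2.1
    (j.2.2 : Rn n) (√(lam j.1))⁻¹ ((s : ℝ), ζ) with hHdef
  set ρ : κ → Rn n → ℝ := fun _ ζ => (R + 2) * (1 + ‖ζ‖) ^ 2 with hρ
  have hone : ∀ ζ : Rn n, 1 ≤ (1 + ‖ζ‖) ^ 2 := fun ζ => one_le_pow₀ (by linarith [norm_nonneg ζ])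
  have hρ0 : ∀ j ζ, 0 ≤ ρ j ζ := fun j ζ => by positivity
  have hE : UBd (fun j ζ => cexp (I * (H j ζ : ℂ))) (fun _ _ => 1) ρ := by
    refine UBd.cexp hρ0 hH.smooth fun k hk => ?_
    obtain ⟨C, hC, h⟩ := hH.2 k
    refine ⟨C, hC, fun j ζ => (h j ζ).trans ?_⟩
    rw [hρ, mul_pow, mul_comm ((1 + ‖ζ‖) ^ 2)]
    gcongr
    exact le_self_pow₀ (hone ζ) (by omega)
  have hb : UBd (fun (j : κ) ζ => β j.1 j.2.1 (shear i (j.2.2 : Rn n) (√(lam j.1))⁻¹ ζ))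
      (fun _ _ => 1) ρ := by
    have := hβ.comp_affine (fun _ _ => zero_le_one) (fun _ _ => zero_le_one)
      (fun j : κ => (j.1, j.2.1)) (fun j => shear i (j.2.2 : Rn n) (√(lam j.1))⁻¹)
      (fun _ => 0) (fun _ => R + 2) (fun j => norm_shear_le i _ (hε j.1) j.2.2.2.2)
    simp only [add_zero, one_mul] at this
    refine this.mono 1 zero_le_one (fun _ _ => zero_le_one) (fun _ _ => by rw [one_mul])
      (fun _ _ => by positivity) fun j ζ => ?_
    exact le_mul_of_one_le_right (by positivity) (hone ζ)
  have hW : UBd (fun (_ : κ) ζ => (cellWindow i c₁ ζ : ℂ)) (fun _ _ => 1) ρ := by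
    have h1 : ContDiff ℝ (⊤ : ℕ∞) fun ζ : Rn n => (cellWindow i c₁ ζ : ℂ) :=
      Complex.ofRealCLM.contDiff.comp (contDiff_cellWindow i hc₁)
    have h2 : HasCompactSupport fun ζ : Rn n => (cellWindow i c₁ ζ : ℂ) :=
      HasCompactSupport.of_support_subset_isCompact (isCompact_closedBall 0 (8 * (n : ℝ)))
        fun ζ hζ => by
          rw [mem_closedBall_zero_iff]
          by_contra! h
          exact hζ (by simp [cellWindow_eq_zero i c₁ h])
    refine (UBd.of_hasCompactSupport h1 h2).mono 1 zero_le_one (fun _ _ => zero_le_one)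
      (fun _ _ => by rw [one_mul]) (fun _ _ => zero_le_one) fun j ζ => ?_
    have := hone ζ
    rw [hρ]
    nlinarith
  have hB := UBd.bilin (ContinuousLinearMap.mul ℝ ℂ) (UBd.bilin (ContinuousLinearMap.mul ℝ ℂ) hW hb
    (fun _ _ => zero_le_one) hρ0) hE (fun _ _ => by norm_num) hρ0
  simp only [ContinuousLinearMap.mul_apply', mul_one] at hB
  have hzero : ∀ (j : κ) (ζ : Rn n), 8 * (n : ℝ) < ‖ζ‖ → (cellWindow i c₁ ζ : ℂ) *
      β j.1 j.2.1 (shear i (j.2.2 : Rn n) (√(lam j.1))⁻¹ ζ) * cexp (I * (H j ζ : ℂ)) = 0 :=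
    fun j ζ h => by simp [cellWindow_eq_zero i c₁ h]
  have hB' := hB.of_support (w' := fun _ _ => 1) (ρ' := fun _ _ => 1)
    (fun _ => Metric.closedBall 0 (8 * (n : ℝ))) (fun _ => Metric.isClosed_closedBall)
    (fun j ζ hζ => hzero j ζ (by simpa using hζ)) ((R + 2) * (1 + 8 * n) ^ 2) (by positivity)
    (fun _ _ => zero_le_one) hρ0 (fun _ _ => zero_le_one) (fun _ _ => zero_le_one)
    (fun j ζ _ => by
      have : 1 ≤ (1 + 8 * (n : ℝ)) ^ 2 := one_le_pow₀ (by linarith)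
      nlinarith)
    (fun j ζ hζ => by
      rw [mem_closedBall_zero_iff] at hζ
      rw [mul_one]
      show (R + 2) * (1 + ‖ζ‖) ^ 2 ≤ _
      gcongr)
  obtain ⟨C, hC, hbd⟩ := fourier_decay hB' (8 * n) hzero N
  refine ⟨C, hC, fun j x y ω hω hωR => ?_⟩
  refine le_of_eq_of_le (congrArg norm (integral_congr_ae (Filter.Eventually.of_forall fun ζ => ?_)))
    (hbd (j, x, ⟨ω, hω, hωR⟩) _)
  show (cellWindow i c₁ ζ : ℂ) * (β j x (shear i ω (√(lam j))⁻¹ ζ) *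
        cexp (I * ((lam j * (φ x (shear i ω (√(lam j))⁻¹ ζ) -
          ⟪y, shear i ω (√(lam j))⁻¹ ζ⟫_ℝ) : ℝ) : ℂ))) =
    (cellWindow i c₁ ζ : ℂ) * β j x (shear i ω (√(lam j))⁻¹ ζ) *
    cexp (I * (H (j, x, ⟨ω, hω, hωR⟩) ζ : ℂ)) * cexp _
  by_cases hz : (cellWindow i c₁ ζ : ℂ) * β j x (shear i ω (√(lam j))⁻¹ ζ) = 0
  · rw [hz, zero_mul, zero_mul, ← mul_assoc, hz, zero_mul]
  rw [← mul_assoc, mul_assoc _ (cexp _) (cexp _), ← Complex.exp_add]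
  congr 2
  rw [← mul_add, ← Complex.ofReal_add]
  congr 2
  have hz1 : cellWindow i c₁ ζ ≠ 0 := fun h => hz (by simp [h])
  have hz2 := hsupp j x _ (right_ne_zero_of_mul hz)
  have hζn : ‖ζ‖ ≤ 8 * n := by
    by_contra! h
    exact hz1 (cellWindow_eq_zero i c₁ h)
  have hζi : c₁ ≤ ζ i := by
    have := hz2.1
    rw [shear_same, hω, mul_left_comm, hσ, mul_one] at this
    exact this
  have hσ1 : |σ| = 1 := by
    have : |σ| * |σ| = 1 := by rw [← abs_mul, hσ, abs_one]
    nlinarith [abs_nonneg σ]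
  have hζ4 : ζ i ≤ 4 := by
    have h1 := (PiLp.norm_apply_le (shear i ω (√(lam j))⁻¹ ζ) i).trans hz2.2
    rw [shear_same, hω, Real.norm_eq_abs, abs_mul, hσ1, mul_one] at h1
    exact (le_abs_self _).trans h1
  set ε := (√(lam j))⁻¹ with hεdef
  have hε2 : lam j * (ε * ε) = 1 := by
    rw [hεdef, ← mul_inv, Real.mul_self_sqrt (by linarith [hlam j]),
      mul_inv_cancel₀ (by linarith [hlam j])]
  have hseg : ∀ s ∈ Set.Icc (0 : ℝ) 1, c₁ ≤ ‖ζ i • ω + (s * ε) • coordKill i ζ‖ ∧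
      ‖ζ i • ω + (s * ε) • coordKill i ζ‖ ≤ r₂ := by
    intro s hs
    constructor
    · refine le_trans ?_ (PiLp.norm_apply_le _ i)
      rw [PiLp.add_apply, PiLp.smul_apply, PiLp.smul_apply, coordKill_same, hω]
      simp only [smul_eq_mul, mul_zero, add_zero, Real.norm_eq_abs, abs_mul, hσ1, mul_one]
      exact hζi.trans (le_abs_self _)
    · refine (norm_add_le _ _).trans ?_
      rw [norm_smul, norm_smul, Real.norm_eq_abs, Real.norm_eq_abs,
        abs_of_pos (show 0 < ζ i by linarith), hr₂]
      have h1 : |s * ε| ≤ 1 := by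
        rw [abs_mul, abs_of_nonneg hs.1]
        exact mul_le_one₀ hs.2 (abs_nonneg _) (hε j)
      have h2 : ‖coordKill i ζ‖ ≤ 2 * (8 * n) :=
        ((coordKill i).le_opNorm ζ).trans (mul_le_mul (norm_coordKill_le i) hζn
          (norm_nonneg _) (by norm_num))
      have h3 : |s * ε| * ‖coordKill i ζ‖ ≤ 1 * (2 * (8 * n)) :=
        mul_le_mul h1 h2 (norm_nonneg _) zero_le_one
      have h4 : ζ i * ‖ω‖ ≤ 4 * R := mul_le_mul hζ4 hωR (norm_nonneg _) (by norm_num)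
      linarith
  have hω0 : ω ≠ 0 := by
    rintro rfl
    rw [← hω] at hσ1
    simp at hσ1
  have ht := hφ.taylor x (ω := ω) (w := ε • coordKill i ζ) (t := ζ i) (by linarith) hω0
    (fun s hs => by
      rw [smul_smul]
      exact norm_pos_iff.1 (hc₁.trans_le (hseg s hs).1))
  rw [← shear_apply] at ht
  have hHeq : lam j * ∫ s : unitInterval, (1 - (s : ℝ)) * partialSnd (partialSnd φ) x
      (ζ i • ω + (s : ℝ) • ε • coordKill i ζ) (ε • coordKill i ζ) (ε • coordKill i ζ) =
      H (j, x, ⟨ω, hω, hωR⟩) ζ := by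
    rw [← integral_const_mul]
    refine integral_congr_ae (Filter.Eventually.of_forall fun s => ?_)
    simp only [cellRem]
    rw [annCut_eq_one hc₁ hr₂0 (hseg s s.2).1 (hseg s s.2).2, one_smul, smul_smul]
    simp only [map_smul, smul_apply, smul_eq_mul]
    linear_combination ((1 - (s : ℝ)) * partialSnd (partialSnd φ) x
      (ζ i • ω + ((s : ℝ) * ε) • coordKill i ζ) (coordKill i ζ) (coordKill i ζ)) * hε2
  rw [ht, ← hHeq, real_inner_smul_left, ContinuousLinearMap.adjoint_inner_left, inner_sub_left,
    phaseGrad, inner_sharp]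
  ring

end CellBound

section Cells

variable {n : ℕ}

/-- The direction of the cell with lattice index `l` in the sector `(i, σ)`. -/
def cellDir (i : Fin n) (σ ε : ℝ) (l : Fin n → ℤ) : Rn n :=
  WithLp.toLp 2 fun j => if j = i then σ else ε * l j

theorem cellDir_same (i : Fin n) (σ ε : ℝ) (l : Fin n → ℤ) : cellDir i σ ε l i = σ := by
  simp [cellDir]

theorem cellDir_ne {i j : Fin n} (h : j ≠ i) (σ ε : ℝ) (l : Fin n → ℤ) :
    cellDir i σ ε l j = ε * l j := by
  simp [cellDir, h]

/-- The lattice indices of the cells of a sector. -/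
def cellIndex (n : ℕ) (i : Fin n) (L : ℕ) : Finset (Fin n → ℤ) :=
  Fintype.piFinset fun j => if j = i then {0} else Finset.Icc (-(L : ℤ)) L

theorem card_cellIndex (i : Fin n) (L : ℕ) : (cellIndex n i L).card = (2 * L + 1) ^ (n - 1) := by
  rw [cellIndex, Fintype.card_piFinset, ← Finset.mul_prod_erase _ _ (Finset.mem_univ i)]
  rw [if_pos rfl, Finset.card_singleton, one_mul, Finset.prod_congr rfl
    (g := fun _ => 2 * L + 1), Finset.prod_const, Finset.card_erase_of_mem (Finset.mem_univ i),
    Finset.card_univ, Fintype.card_fin]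
  intro j hj
  rw [if_neg (Finset.ne_of_mem_erase hj), Int.card_Icc]
  omega

theorem norm_cellDir_le {i : Fin n} {σ ε : ℝ} {L : ℕ} {l : Fin n → ℤ} (hl : l ∈ cellIndex n i L)
    {R : ℝ} (hR : 1 ≤ R) (hσ : |σ| ≤ 1) (hε : 0 ≤ ε) (hL : ε * L ≤ R) :
    ‖cellDir i σ ε l‖ ≤ n * R := by
  refine norm_le_of_forall_abs_le _ fun j => ?_
  by_cases h : j = i
  · subst h
    rw [cellDir_same]
    exact hσ.trans hR
  · rw [cellDir_ne h, abs_mul, abs_of_nonneg hε]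
    have := (Fintype.mem_piFinset.1 hl) j
    rw [if_neg h, Finset.mem_Icc, ← abs_le] at this
    refine le_trans ?_ hL
    have h2 : |(l j : ℝ)| ≤ L := by exact_mod_cast this
    gcongr

/-- The window of a cell, in the original coordinates. -/
def cellFactor (i : Fin n) (c σ ε : ℝ) (l : Fin n → ℤ) (η : Rn n) : ℝ :=
  ∏ j, if j = i then 1 else latticeWindow (η j * ε⁻¹ * smoothRecip c (σ * η i) - l j)

theorem continuous_cellFactor (i : Fin n) {c : ℝ} (hc : 0 < c) (σ ε : ℝ) (l : Fin n → ℤ) :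
    Continuous (cellFactor i c σ ε l) := by
  refine continuous_finsetProd _ fun j _ => ?_
  have h1 := contDiff_latticeWindow.continuous
  have h2 := (contDiff_smoothRecip hc).continuous
  split_ifs
  · exact continuous_const
  · fun_prop

theorem cellFactor_shear (i : Fin n) {c σ ε : ℝ} (hc : 0 < c) (hσ : σ * σ = 1) (hε : 0 < ε)
    (l : Fin n → ℤ) {ζ : Rn n} (hζ : c ≤ ζ i) :
    cellFactor i c σ ε l (shear i (cellDir i σ ε l) ε ζ) = prodWindow i c ζ := by
  refine Finset.prod_congr rfl fun j _ => ?_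
  split_ifs with h
  · rfl
  · rw [shear_ne h, shear_same, cellDir_same, cellDir_ne h, mul_left_comm σ, hσ, mul_one,
      smoothRecip_of_le hc hζ]
    have : ζ i ≠ 0 := by linarith
    congr 1
    field_simp
    ring

theorem sum_cellFactor (i : Fin n) {c σ ε : ℝ} {L : ℕ} {η : Rn n}
    (hL : ∀ j, |η j * ε⁻¹ * smoothRecip c (σ * η i)| ≤ L) :
    ∑ l ∈ cellIndex n i L, cellFactor i c σ ε l η = 1 := by
  have h := Finset.prod_univ_sum (fun j : Fin n => if j = i then {0} else Finset.Icc (-(L : ℤ)) L)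
    (fun j (m : ℤ) => if j = i then (1 : ℝ) else
      latticeWindow (η j * ε⁻¹ * smoothRecip c (σ * η i) - m))
  rw [cellIndex]
  refine h.symm.trans (Finset.prod_eq_one fun j _ => ?_)
  by_cases h : j = i
  · simp [h]
  · simp only [h, if_false]
    exact sum_latticeWindow (hL j)

theorem integral_comp_linear {A : Rn n →L[ℝ] Rn n} (hA : LinearMap.det (A : Rn n →ₗ[ℝ] Rn n) ≠ 0)
    {g : Rn n → ℂ} (hg : Continuous g) :
    ∫ η, g η = |LinearMap.det (A : Rn n →ₗ[ℝ] Rn n)| • ∫ ζ, g (A ζ) := by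
  have h := Measure.map_linearMap_addHaar_eq_smul_addHaar (volume : Measure (Rn n)) hA
  have h2 : ∫ ζ, g (A ζ) = ∫ η, g η ∂(Measure.map A volume) :=
    (integral_map A.continuous.aemeasurable hg.aestronglyMeasurable).symm
  have h3 : Measure.map A volume = Measure.map (A : Rn n →ₗ[ℝ] Rn n) (volume : Measure (Rn n)) := rfl
  rw [h2, h3, h, integral_smul_measure, ENNReal.toReal_ofReal (abs_nonneg _), smul_smul, abs_inv,
    mul_inv_cancel₀ (abs_ne_zero.2 hA), one_smul]

theorem lintegral_comp_linear {A : Rn n →L[ℝ] Rn n}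
    (hA : LinearMap.det (A : Rn n →ₗ[ℝ] Rn n) ≠ 0) {g : Rn n → ℝ≥0∞} (hg : Measurable g) :
    ∫⁻ ζ, g (A ζ) = ENNReal.ofReal |LinearMap.det (A : Rn n →ₗ[ℝ] Rn n)|⁻¹ * ∫⁻ η, g η := by
  have h := Measure.map_linearMap_addHaar_eq_smul_addHaar (volume : Measure (Rn n)) hA
  have h2 : ∫⁻ ζ, g (A ζ) = ∫⁻ η, g η ∂(Measure.map A volume) :=
    (lintegral_map hg A.continuous.measurable).symm
  have h3 : Measure.map A volume = Measure.map (A : Rn n →ₗ[ℝ] Rn n) (volume : Measure (Rn n)) := rfl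
  rw [h2, h3, h, lintegral_smul_measure, abs_inv, smul_eq_mul]

theorem integral_eq_sum_cells (i : Fin n) {c σ ε : ℝ} (hc : 0 < c) (hσ : σ * σ = 1) (hε : 0 < ε)
    {L : ℕ} (hL : 4 / (c * ε) ≤ L) {f : Rn n → ℂ} (hf : Continuous f)
    (hs : ∀ η, f η ≠ 0 → c ≤ σ * η i ∧ ‖η‖ ≤ 4) :
    ∫ η, f η = ∑ l ∈ cellIndex n i L, ε ^ (n - 1) •
      ∫ ζ, (cellWindow i c ζ : ℂ) * f (shear i (cellDir i σ ε l) ε ζ) := by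
  have hfc : HasCompactSupport f := HasCompactSupport.of_support_subset_isCompact
    (isCompact_closedBall 0 4) fun η hη => by
      rw [mem_closedBall_zero_iff]; exact (hs η hη).2
  have hσ1 : |σ| = 1 := by
    have : |σ| * |σ| = 1 := by rw [← abs_mul, hσ, abs_one]
    nlinarith [abs_nonneg σ]
  have hcf : ∀ l, Continuous fun η => (cellFactor i c σ ε l η : ℂ) * f η := fun l =>
    (Complex.continuous_ofReal.comp (continuous_cellFactor i hc σ ε l)).mul hf
  have hsum : ∀ η, f η = ∑ l ∈ cellIndex n i L, (cellFactor i c σ ε l η : ℂ) * f η := by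
    intro η
    by_cases h0 : f η = 0
    · simp [h0]
    · rw [← Finset.sum_mul, ← Complex.ofReal_sum, sum_cellFactor i, Complex.ofReal_one, one_mul]
      intro j
      obtain ⟨h1, h2⟩ := hs η h0
      rw [smoothRecip_of_le hc h1, abs_mul, abs_mul, abs_of_pos (inv_pos.2 hε),
        abs_of_pos (one_div_pos.2 (hc.trans_le h1))]
      refine le_trans ?_ hL
      calc |η j| * ε⁻¹ * (1 / (σ * η i)) ≤ 4 * ε⁻¹ * (1 / c) := by
            have : 0 ≤ 1 / (σ * η i) := (one_div_pos.2 (hc.trans_le h1)).le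
            gcongr
            exact (PiLp.norm_apply_le η j).trans h2
        _ = 4 / (c * ε) := by field_simp
  rw [integral_congr_ae (Filter.Eventually.of_forall hsum), integral_finsetSum]
  swap
  · exact fun l _ => (hcf l).integrable_of_hasCompactSupport hfc.mul_left
  refine Finset.sum_congr rfl fun l _ => ?_
  have hdet : LinearMap.det (shear i (cellDir i σ ε l) ε : Rn n →ₗ[ℝ] Rn n) = ε ^ (n - 1) * σ := by
    rw [det_shear, cellDir_same]
  have hdet' : |LinearMap.det (shear i (cellDir i σ ε l) ε : Rn n →ₗ[ℝ] Rn n)| = ε ^ (n - 1) := by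
    rw [hdet, abs_mul, hσ1, mul_one, abs_of_pos (by positivity)]
  rw [integral_comp_linear (A := shear i (cellDir i σ ε l) ε)
    (by rw [← abs_pos, hdet']; positivity) (hcf l), hdet']
  congr 1
  refine integral_congr_ae (Filter.Eventually.of_forall fun ζ => ?_)
  show (cellFactor i c σ ε l (shear i (cellDir i σ ε l) ε ζ) : ℂ) *
    f (shear i (cellDir i σ ε l) ε ζ) =
      (cellWindow i c ζ : ℂ) * f (shear i (cellDir i σ ε l) ε ζ)
  by_cases h0 : f (shear i (cellDir i σ ε l) ε ζ) = 0
  · simp [h0]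
  obtain ⟨h1, h2⟩ := hs _ h0
  have h3 : c ≤ ζ i := by
    rw [shear_same, cellDir_same, mul_left_comm σ, hσ, mul_one] at h1
    exact h1
  have h4 : ζ i ≤ 4 := by
    have h5 := (PiLp.norm_apply_le (shear i (cellDir i σ ε l) ε ζ) i).trans h2
    rw [shear_same, cellDir_same, Real.norm_eq_abs, abs_mul, hσ1, mul_one] at h5
    exact (le_abs_self _).trans h5
  rw [cellFactor_shear i hc hσ hε l h3, cellWindow_eq_prodWindow i hc h3 h4]

end Cells

section CellIntegrals

variable {n : ℕ} {φ : Rn n → Rn n → ℝ}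

theorem lintegral_comp_phaseGrad_le (hφ : PhaseClass n 2 φ) (hs : SNDCondition n φ) :
    ∃ D : ℝ≥0, ∀ ω : Rn n, ω ≠ 0 → ∀ g : Rn n → ℝ≥0∞,
      ∫⁻ x, g (phaseGrad φ ω x) ≤ D * ∫⁻ z, g z := by
  obtain ⟨δ, hδ, hd⟩ := hs
  obtain ⟨c, hc, hinj⟩ := hφ.exists_phaseGrad_antilipschitz ⟨δ, hδ, hd⟩
  refine ⟨Real.toNNReal δ⁻¹, fun ω hω g => ?_⟩
  have h := lintegral_image_eq_lintegral_abs_det_fderiv_mul volume MeasurableSet.univ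
    (f := phaseGrad φ ω) (f' := fun x => (sharp n).comp (partialFst (partialSnd φ) x ω))
    (fun x _ => (hφ.hasFDerivAt_phaseGrad hω x).hasFDerivWithinAt) (fun x _ z _ hxz => by
      have := hinj ω hω x z
      rw [sub_eq_zero.2 hxz, norm_zero] at this
      have h2 : ‖x - z‖ ≤ 0 := by nlinarith [norm_nonneg (x - z)]
      exact sub_eq_zero.1 (norm_le_zero_iff.1 h2)) g
  rw [Measure.restrict_univ] at h
  calc ∫⁻ x, g (phaseGrad φ ω x)
      ≤ ∫⁻ x, ENNReal.ofReal δ⁻¹ * (ENNReal.ofReal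
          |((sharp n).comp (partialFst (partialSnd φ) x ω)).det| * g (phaseGrad φ ω x)) := by
        refine lintegral_mono fun x => ?_
        rw [← mul_assoc, ← ENNReal.ofReal_mul (by positivity)]
        refine le_mul_of_one_le_left zero_le ?_
        rw [ENNReal.one_le_ofReal, hφ.det_phaseGrad_eq hω, ← div_eq_inv_mul, one_le_div hδ]
        exact hd x ω hω
    _ = ENNReal.ofReal δ⁻¹ * ∫⁻ z in phaseGrad φ ω '' Set.univ, g z := by
        rw [h, lintegral_const_mul' _ _ ENNReal.ofReal_ne_top]
    _ ≤ _ := by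
        refine mul_le_mul' le_rfl ?_
        exact setLIntegral_le_lintegral _ _

theorem det_smul_adjoint_shear (i : Fin n) (ω : Rn n) (ε lam : ℝ) :
    LinearMap.det ((lam • ContinuousLinearMap.adjoint (shear i ω ε) : Rn n →L[ℝ] Rn n) :
      Rn n →ₗ[ℝ] Rn n) = lam ^ n * (ε ^ (n - 1) * ω i) := by
  rw [ContinuousLinearMap.toLinearMap_smul, LinearMap.det_smul, det_adjoint, det_shear,
    finrank_euclideanSpace_fin]

/-- The decaying profile of a cell, raised to a power. -/
def bracketPow (n : ℕ) (r : ℝ) (z : Rn n) : ℝ≥0∞ := ENNReal.ofReal ((1 + ‖z‖) ^ (-r))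

theorem measurable_bracketPow (n : ℕ) (r : ℝ) : Measurable (bracketPow n r) := by
  unfold bracketPow
  fun_prop

theorem lintegral_bracketPow_lt_top (n : ℕ) {r : ℝ} (hr : n < r) :
    ∫⁻ z, bracketPow n r z < ∞ :=
  finite_integral_one_add_norm (by simpa using hr)

theorem lintegral_cell_snd (i : Fin n) {ε lam : ℝ} (hε : 0 < ε) (hlam : 0 < lam) {ω : Rn n}
    (hω : |ω i| = 1) (r : ℝ) (z : Rn n) :
    ∫⁻ y, bracketPow n r (lam • ContinuousLinearMap.adjoint (shear i ω ε) (z - y)) =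
      ENNReal.ofReal (lam ^ n * ε ^ (n - 1))⁻¹ * ∫⁻ z, bracketPow n r z := by
  set A : Rn n →L[ℝ] Rn n := lam • ContinuousLinearMap.adjoint (shear i ω ε) with hA
  have hdet : |LinearMap.det (A : Rn n →ₗ[ℝ] Rn n)| = lam ^ n * ε ^ (n - 1) := by
    rw [hA, det_smul_adjoint_shear, abs_mul, abs_mul, hω, mul_one, abs_of_pos (by positivity),
      abs_of_pos (by positivity)]
  have h1 := lintegral_comp_linear (A := A) (by rw [← abs_pos, hdet]; positivity)
    (measurable_bracketPow n r)
  rw [hdet] at h1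
  rw [← h1]
  exact lintegral_sub_left_eq_self (fun y => bracketPow n r (A y)) z

theorem lintegral_cell_fst (hφ : PhaseClass n 2 φ) (hs : SNDCondition n φ) :
    ∃ D : ℝ≥0, ∀ (i : Fin n) (ε lam : ℝ), 0 < ε → 0 < lam → ∀ ω : Rn n, |ω i| = 1 →
      ∀ (r : ℝ) (y : Rn n), ∫⁻ x, bracketPow n r
        (lam • ContinuousLinearMap.adjoint (shear i ω ε) (phaseGrad φ ω x - y)) ≤
      D * (ENNReal.ofReal (lam ^ n * ε ^ (n - 1))⁻¹ * ∫⁻ z, bracketPow n r z) := by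
  obtain ⟨D, hD⟩ := lintegral_comp_phaseGrad_le hφ hs
  refine ⟨D, fun i ε lam hε hlam ω hω r y => ?_⟩
  have hω0 : ω ≠ 0 := by
    rintro rfl
    simp at hω
  refine (hD ω hω0 fun z => bracketPow n r
    (lam • ContinuousLinearMap.adjoint (shear i ω ε) (z - y))).trans (mul_le_mul' le_rfl ?_)
  rw [← lintegral_cell_snd i hε hlam hω r y]
  refine le_of_eq ?_
  have h : ∀ z, bracketPow n r (lam • ContinuousLinearMap.adjoint (shear i ω ε) (z - y)) =
      bracketPow n r (lam • ContinuousLinearMap.adjoint (shear i ω ε) (y - z)) := fun z => by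
    rw [bracketPow, bracketPow, ← norm_neg, ← smul_neg, ← map_neg, neg_sub]
  simp_rw [h]

end CellIntegrals

section SectorBound

variable {n : ℕ} {φ : Rn n → Rn n → ℝ}

/-- The oscillatory integral with large parameter `lam` and amplitude `b`. -/
def oscInt (n : ℕ) (φ : Rn n → Rn n → ℝ) (lam : ℝ) (b : Rn n → Rn n → ℂ) (x y : Rn n) : ℂ :=
  ∫ η, b x η * cexp (I * ((lam * (φ x η - ⟪y, η⟫_ℝ) : ℝ) : ℂ))

theorem PhaseSmoothHomog.continuousAt_snd (hφ : PhaseSmoothHomog n φ) (x : Rn n) {η : Rn n}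
    (hη : η ≠ 0) : ContinuousAt (φ x) η := by
  have h := hφ.1.continuousOn.continuousAt (x := (x, η))
    ((isOpen_ne_fun continuous_snd continuous_const).mem_nhds hη)
  exact ContinuousAt.comp (f := fun η => (x, η)) (g := fun p : Rn n × Rn n => φ p.1 p.2) h
    (by fun_prop)

theorem continuous_oscInt_integrand (hφ : PhaseSmoothHomog n φ) {b : Rn n → ℂ}
    (hb : Continuous b) {r : ℝ} (hr : 0 < r) (h0 : ∀ η, ‖η‖ < r → b η = 0) (lam : ℝ)
    (x y : Rn n) :
    Continuous fun η => b η * cexp (I * ((lam * (φ x η - ⟪y, η⟫_ℝ) : ℝ) : ℂ)) := by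
  refine continuous_iff_continuousAt.2 fun η => ?_
  by_cases hη : η = 0
  · subst hη
    refine (continuousAt_const (y := (0 : ℂ))).congr ?_
    filter_upwards [Metric.ball_mem_nhds (0 : Rn n) hr] with ξ hξ
    rw [h0 ξ (by simpa using hξ), zero_mul]
  · have := hφ.continuousAt_snd x hη
    fun_prop

/-- The power of the frequency by which an oscillatory kernel is bounded in `L^p`. -/
def kernelRate (n : ℕ) (p : ℝ) : ℝ := ((n : ℝ) - 1) * (1 - p / 2) - n

theorem rate_identity (hn : 1 ≤ n) {lam : ℝ} (hlam : 1 ≤ lam) (p : ℝ) :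
    ((√lam)⁻¹)⁻¹ ^ (n - 1) * (((√lam)⁻¹) ^ (n - 1)) ^ p * (lam ^ n * ((√lam)⁻¹) ^ (n - 1))⁻¹ =
      lam ^ kernelRate n p := by
  have hl : 0 < lam := by linarith
  have h1 : √lam = lam ^ (1 / 2 : ℝ) := Real.sqrt_eq_rpow lam
  have h2 : ((√lam)⁻¹) ^ (n - 1) = lam ^ (-(((n : ℝ) - 1) / 2)) := by
    rw [h1, ← Real.rpow_neg hl.le, ← Real.rpow_natCast, ← Real.rpow_mul hl.le,
      Nat.cast_sub hn]
    congr 1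
    push_cast
    ring
  rw [inv_pow ((√lam)⁻¹), h2, ← Real.rpow_natCast lam n, ← Real.rpow_add hl,
    ← Real.rpow_neg hl.le, ← Real.rpow_neg hl.le, ← Real.rpow_mul hl.le, ← Real.rpow_add hl,
    ← Real.rpow_add hl, kernelRate]
  congr 1
  ring

theorem enorm_rpow_le_bracketPow {u : ℂ} {z : Rn n} {c p : ℝ} (hc : 0 ≤ c) (hp : 0 ≤ p) {N : ℕ}
    (h : ‖u‖ ≤ c * ((1 + ‖z‖) ^ N)⁻¹) :
    ‖u‖ₑ ^ p ≤ ENNReal.ofReal (c ^ p) * bracketPow n (N * p) z := by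
  rw [← ofReal_norm, ENNReal.ofReal_rpow_of_nonneg (norm_nonneg _) hp, bracketPow,
    ← ENNReal.ofReal_mul (by positivity)]
  refine ENNReal.ofReal_le_ofReal ((Real.rpow_le_rpow (norm_nonneg _) h hp).trans_eq ?_)
  rw [Real.mul_rpow hc (by positivity), ← Real.rpow_natCast, ← Real.rpow_neg (by positivity),
    ← Real.rpow_mul (by positivity), neg_mul]

theorem enorm_sum_rpow_le {κ : Type*} (s : Finset κ) (f : κ → ℂ) {p : ℝ} (hp : 0 < p)
    (hp1 : p ≤ 1) : ‖∑ l ∈ s, f l‖ₑ ^ p ≤ ∑ l ∈ s, ‖f l‖ₑ ^ p := by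
  classical
  induction s using Finset.induction_on with
  | empty => simp [hp]
  | insert a s ha ih =>
    rw [Finset.sum_insert ha, Finset.sum_insert ha]
    calc ‖f a + ∑ l ∈ s, f l‖ₑ ^ p ≤ (‖f a‖ₑ + ‖∑ l ∈ s, f l‖ₑ) ^ p := by
          gcongr
          exact enorm_add_le _ _
      _ ≤ ‖f a‖ₑ ^ p + ‖∑ l ∈ s, f l‖ₑ ^ p := ENNReal.rpow_add_le_add_rpow _ _ hp.le hp1
      _ ≤ _ := by gcongr

theorem sector_kernel_bound (hφ : PhaseClass n 2 φ) (hs : SNDCondition n φ) {ι : Type*}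
    {lam : ι → ℝ} (hlam : ∀ j, 1 ≤ lam j) {β : ι → Rn n → Rn n → ℂ}
    (hβ : UBd (fun (j : ι × Rn n) η => β j.1 j.2 η) (fun _ _ => 1) (fun _ _ => 1))
    (i : Fin n) {c₁ : ℝ} (hc₁ : 0 < c₁) {σ : ℝ} (hσ : σ * σ = 1)
    (hsupp : ∀ j x η, β j x η ≠ 0 → c₁ ≤ σ * η i ∧ ‖η‖ ≤ 4) {p : ℝ} (hp : 0 < p) (hp1 : p ≤ 1) :
    ∃ C : ℝ≥0, ∀ j,
      (∀ y, ∫⁻ x, ‖oscInt n φ (lam j) (β j) x y‖ₑ ^ p ≤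
        C * ENNReal.ofReal (lam j ^ kernelRate n p)) ∧
      ∀ x, ∫⁻ y, ‖oscInt n φ (lam j) (β j) x y‖ₑ ^ p ≤
        C * ENNReal.ofReal (lam j ^ kernelRate n p) := by
  have hn : 1 ≤ n := Nat.pos_of_ne_zero fun h0 => by subst h0; exact i.elim0
  have hσ1 : |σ| = 1 := by
    have : |σ| * |σ| = 1 := by rw [← abs_mul, hσ, abs_one]
    nlinarith [abs_nonneg σ]
  set R : ℝ := n * (4 / c₁ + 1) with hR
  obtain ⟨N, hN⟩ : ∃ N : ℕ, (n : ℝ) / p < N := exists_nat_gt _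
  have hNp : (n : ℝ) < N * p := (div_lt_iff₀ hp).1 hN
  obtain ⟨C, hC, hcell⟩ := cell_bound hφ hlam hβ i hc₁ hσ hsupp R N
  obtain ⟨D, hD⟩ := lintegral_cell_fst hφ hs
  set J := ∫⁻ z, bracketPow n (N * p) z with hJ
  have hJt : J ≠ ∞ := (lintegral_bracketPow_lt_top n hNp).ne
  set Q : ℝ := (8 / c₁ + 3) ^ (n - 1) * C ^ p with hQ
  have hQ0 : 0 ≤ Q := by positivity
  refine ⟨Real.toNNReal Q * (D + 1) * J.toNNReal, fun j => ?_⟩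
  set ε := (√(lam j))⁻¹ with hεdef
  have hl0 : 0 < lam j := by linarith [hlam j]
  have hε : 0 < ε := by positivity
  have hε1 : ε ≤ 1 := inv_le_one_of_one_le₀ (Real.one_le_sqrt.2 (hlam j))
  set L := ⌈4 / (c₁ * ε)⌉₊ with hL
  have hL1 : 4 / (c₁ * ε) ≤ L := Nat.le_ceil _
  have hL2 : (L : ℝ) ≤ (4 / c₁ + 1) / ε := by
    refine (Nat.ceil_lt_add_one (by positivity)).le.trans ?_
    rw [add_div, div_div]
    gcongr
    rw [le_div_iff₀ hε]; linarith
  have hεL : ε * L ≤ 4 / c₁ + 1 := by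
    rw [le_div_iff₀ hε] at hL2; linarith
  have hcard : ((cellIndex n i L).card : ℝ) ≤ (8 / c₁ + 3) ^ (n - 1) * ε⁻¹ ^ (n - 1) := by
    rw [card_cellIndex, ← mul_pow]
    push_cast
    gcongr
    have : (1 : ℝ) ≤ 1 / ε := by rw [le_div_iff₀ hε]; linarith
    calc 2 * (L : ℝ) + 1 ≤ 2 * ((4 / c₁ + 1) / ε) + 1 / ε := by gcongr
      _ = _ := by field_simp; ring
  have hbound : ∀ x y, ‖oscInt n φ (lam j) (β j) x y‖ₑ ^ p ≤ ∑ l ∈ cellIndex n i L,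
      ENNReal.ofReal ((ε ^ (n - 1) * C) ^ p) * bracketPow n (N * p) (lam j •
        ContinuousLinearMap.adjoint (shear i (cellDir i σ ε l) ε)
          (phaseGrad φ (cellDir i σ ε l) x - y)) := by
    intro x y
    have hcont := continuous_oscInt_integrand hφ.1 (hβ.smooth (j, x)).continuous hc₁
      (fun η hη => by
        by_contra h0
        have h1 := (hsupp j x η h0).1
        have h2 : |σ * η i| < c₁ := by
          rw [abs_mul, hσ1, one_mul]; exact (PiLp.norm_apply_le η i).trans_lt hη
        linarith [le_abs_self (σ * η i)]) (lam j) x y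
    rw [oscInt, integral_eq_sum_cells i hc₁ hσ hε hL1 hcont
      (fun η hη => hsupp j x η (left_ne_zero_of_mul hη))]
    refine (enorm_sum_rpow_le _ _ hp hp1).trans (Finset.sum_le_sum fun l hl => ?_)
    refine enorm_rpow_le_bracketPow (by positivity) hp.le ?_
    rw [norm_smul, Real.norm_of_nonneg (by positivity), mul_assoc]
    refine mul_le_mul_of_nonneg_left ?_ (by positivity)
    refine hcell j x y _ (cellDir_same i σ ε l) (norm_cellDir_le hl ?_ hσ1.le hε.le hεL)
    have : 0 < 4 / c₁ := by positivity
    linarith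
  have hω : ∀ l, |cellDir i σ ε l i| = 1 := fun l => by rw [cellDir_same, hσ1]
  have hfinal : ∀ I : (Fin n → ℤ) → ℝ≥0∞, (∀ l, I l ≤ (D + 1 : ℝ≥0) *
      (ENNReal.ofReal (lam j ^ n * ε ^ (n - 1))⁻¹ * J)) →
      ∑ l ∈ cellIndex n i L, ENNReal.ofReal ((ε ^ (n - 1) * C) ^ p) * I l ≤
        ((Real.toNNReal Q * (D + 1) * J.toNNReal : ℝ≥0) : ℝ≥0∞) *
          ENNReal.ofReal (lam j ^ kernelRate n p) := by
    intro I hI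
    calc ∑ l ∈ cellIndex n i L, ENNReal.ofReal ((ε ^ (n - 1) * C) ^ p) * I l
        ≤ ∑ l ∈ cellIndex n i L, ENNReal.ofReal ((ε ^ (n - 1) * C) ^ p) * ((D + 1 : ℝ≥0) *
            (ENNReal.ofReal (lam j ^ n * ε ^ (n - 1))⁻¹ * J)) :=
          Finset.sum_le_sum fun l _ => mul_le_mul' le_rfl (hI l)
      _ = ENNReal.ofReal ((cellIndex n i L).card) * (ENNReal.ofReal ((ε ^ (n - 1) * C) ^ p) *
            ((D + 1 : ℝ≥0) * (ENNReal.ofReal (lam j ^ n * ε ^ (n - 1))⁻¹ * J))) := by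
          rw [Finset.sum_const, nsmul_eq_mul, ENNReal.ofReal_natCast]
      _ = (D + 1 : ℝ≥0) * J * ENNReal.ofReal ((cellIndex n i L).card * (ε ^ (n - 1) * C) ^ p *
            (lam j ^ n * ε ^ (n - 1))⁻¹) := by
          rw [ENNReal.ofReal_mul (by positivity), ENNReal.ofReal_mul (by positivity)]
          ring
      _ ≤ (D + 1 : ℝ≥0) * J * ENNReal.ofReal (Q * lam j ^ kernelRate n p) := by
          refine mul_le_mul' le_rfl (ENNReal.ofReal_le_ofReal ?_)
          rw [← rate_identity hn (hlam j) p, ← hεdef, Real.mul_rpow (by positivity) hC, hQ]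
          calc _ ≤ ((8 / c₁ + 3) ^ (n - 1) * ε⁻¹ ^ (n - 1)) * ((ε ^ (n - 1)) ^ p * C ^ p) *
                (lam j ^ n * ε ^ (n - 1))⁻¹ := by gcongr
            _ = _ := by ring
      _ = _ := by
          rw [ENNReal.ofReal_mul hQ0, ENNReal.coe_mul, ENNReal.coe_mul, ENNReal.coe_toNNReal hJt,
            ENNReal.ofReal]
          ring
  have hmeas : ∀ l, Measurable fun p' : Rn n × Rn n => bracketPow n (N * p) (lam j •
      ContinuousLinearMap.adjoint (shear i (cellDir i σ ε l) ε)
        (phaseGrad φ (cellDir i σ ε l) p'.1 - p'.2)) := by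
    intro l
    have hne : cellDir i σ ε l ≠ 0 := fun h => by
      have := hω l
      rw [h] at this
      simp at this
    have h1 : Continuous (phaseGrad φ (cellDir i σ ε l)) :=
      continuous_iff_continuousAt.2 fun x => (hφ.hasFDerivAt_phaseGrad hne x).continuousAt
    exact (measurable_bracketPow n _).comp (by fun_prop : Continuous _).measurable
  constructor
  · intro y
    refine (lintegral_mono fun x => hbound x y).trans ?_
    rw [lintegral_finsetSum]
    swap
    · exact fun l _ => ((hmeas l).comp (by fun_prop :
        Measurable fun x : Rn n => (x, y))).const_mul _
    simp_rw [lintegral_const_mul' _ _ ENNReal.ofReal_ne_top]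
    refine hfinal _ fun l => (hD i ε (lam j) hε hl0 _ (hω l) _ y).trans ?_
    gcongr
    exact_mod_cast le_self_add
  · intro x
    refine (lintegral_mono fun y => hbound x y).trans ?_
    rw [lintegral_finsetSum]
    swap
    · exact fun l _ => ((hmeas l).comp (by fun_prop :
        Measurable fun y : Rn n => (x, y))).const_mul _
    simp_rw [lintegral_const_mul' _ _ ENNReal.ofReal_ne_top]
    refine hfinal _ fun l => ?_
    rw [lintegral_cell_snd i hε hl0 (hω l)]
    refine le_mul_of_one_le_left zero_le ?_
    exact_mod_cast le_add_self

end SectorBound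

section KernelBound

variable {n : ℕ} {φ : Rn n → Rn n → ℝ}

/-- The sign attached to a Boolean. -/
def boolSign (b : Bool) : ℝ := if b then 1 else -1

theorem boolSign_mul_self (b : Bool) : boolSign b * boolSign b = 1 := by
  cases b <;> simp [boolSign]

/-- A smooth indicator of the sector around the coordinate direction `boolSign t.2 • e_{t.1}`. -/
def sectorBump (n : ℕ) (t : Fin n × Bool) (η : Rn n) : ℝ :=
  Real.smoothTransition ((boolSign t.2 * η t.1 - (8 * (n : ℝ))⁻¹) / (8 * (n : ℝ))⁻¹)

theorem sectorBump_nonneg (t : Fin n × Bool) (η : Rn n) : 0 ≤ sectorBump n t η :=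
  Real.smoothTransition.nonneg _

theorem contDiff_sectorBump (t : Fin n × Bool) : ContDiff ℝ (⊤ : ℕ∞) (sectorBump n t) :=
  Real.smoothTransition.contDiff.comp (((contDiff_const.mul
    (EuclideanSpace.proj t.1 : Rn n →L[ℝ] ℝ).contDiff).sub contDiff_const).div_const _)

theorem le_of_sectorBump_ne_zero {t : Fin n × Bool} {η : Rn n} (h : sectorBump n t η ≠ 0) :
    (8 * (n : ℝ))⁻¹ ≤ boolSign t.2 * η t.1 := by
  by_contra! h2
  refine h (Real.smoothTransition.zero_of_nonpos (div_nonpos_of_nonpos_of_nonneg ?_ ?_))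
  · linarith
  · positivity

theorem one_le_sum_sectorBump (hn : 1 ≤ n) {η : Rn n} (h : 1 / 4 ≤ ‖η‖) :
    1 ≤ ∑ t, sectorBump n t η := by
  have hn0 : 0 < (n : ℝ) := by exact_mod_cast hn
  obtain ⟨i, hi⟩ : ∃ i, (4 * (n : ℝ))⁻¹ ≤ |η i| := by
    by_contra! h2
    have hne : (Finset.univ : Finset (Fin n)).Nonempty := ⟨⟨0, hn⟩, Finset.mem_univ _⟩
    obtain ⟨i, -, hi⟩ := Finset.exists_max_image Finset.univ (fun i => |η i|) hne
    have h3 := norm_le_of_forall_abs_le η fun j => hi j (Finset.mem_univ j)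
    have h4 : n * |η i| < n * (4 * (n : ℝ))⁻¹ := mul_lt_mul_of_pos_left (h2 i) hn0
    have h5 : n * (4 * (n : ℝ))⁻¹ = 1 / 4 := by field_simp
    linarith
  obtain ⟨b, hb⟩ : ∃ b, (4 * (n : ℝ))⁻¹ ≤ boolSign b * η i := by
    rcases abs_cases (η i) with h | h
    · exact ⟨true, by simp only [boolSign, if_true]; linarith⟩
    · exact ⟨false, by simp only [boolSign]; rw [if_neg Bool.false_ne_true]; linarith⟩
  have h1 : sectorBump n (i, b) η = 1 := by
    refine Real.smoothTransition.one_of_one_le ?_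
    rw [one_le_div (by positivity)]
    have : (4 * (n : ℝ))⁻¹ = (8 * (n : ℝ))⁻¹ + (8 * (n : ℝ))⁻¹ := by field_simp; norm_num
    simp only
    linarith
  rw [← h1]
  exact Finset.single_le_sum (f := fun t => sectorBump n t η) (fun t _ => sectorBump_nonneg t η)
    (Finset.mem_univ (i, b))

/-- The members of the partition of unity of the annulus `1/4 ≤ ‖η‖ ≤ 4` into sectors. -/
def sectorPart (n : ℕ) (t : Fin n × Bool) (η : Rn n) : ℝ :=
  annCut n (1 / 4) 4 η * (sectorBump n t η * smoothRecip 1 (∑ u, sectorBump n u η))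

theorem contDiff_sectorPart (t : Fin n × Bool) : ContDiff ℝ (⊤ : ℕ∞) (sectorPart n t) :=
  (contDiff_annCut _ _).mul ((contDiff_sectorBump t).mul
    ((contDiff_smoothRecip one_pos).comp (ContDiff.sum fun u _ => contDiff_sectorBump u)))

theorem sum_sectorPart (hn : 1 ≤ n) {η : Rn n} (h : 1 / 4 ≤ ‖η‖) (h' : ‖η‖ ≤ 4) :
    ∑ t, sectorPart n t η = 1 := by
  have h1 := one_le_sum_sectorBump hn h
  simp only [sectorPart]
  rw [← Finset.mul_sum, ← Finset.sum_mul, smoothRecip_of_le one_pos h1,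
    annCut_eq_one (by norm_num) (by norm_num) h h', one_mul, mul_one_div_cancel (by linarith)]

theorem UBd_sectorPart_mul {ι X : Type*} {β : ι → X → Rn n → ℂ}
    (hβ : UBd (fun (j : ι × X) η => β j.1 j.2 η) (fun _ _ => 1) (fun _ _ => 1))
    (t : Fin n × Bool) :
    UBd (fun (j : ι × X) η => (sectorPart n t η : ℂ) * β j.1 j.2 η)
      (fun _ _ => 1) (fun _ _ => 1) := by
  have h1 : ContDiff ℝ (⊤ : ℕ∞) fun η : Rn n => (sectorPart n t η : ℂ) :=
    Complex.ofRealCLM.contDiff.comp (contDiff_sectorPart t)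
  have h2 : HasCompactSupport fun η : Rn n => (sectorPart n t η : ℂ) := by
    have : HasCompactSupport (sectorPart n t) :=
      (hasCompactSupport_annCut (by norm_num) (by norm_num)).mul_right
    exact this.comp_left Complex.ofReal_zero
  have := UBd.bilin (ContinuousLinearMap.mul ℝ ℂ) (UBd.of_hasCompactSupport (ι := ι × X) h1 h2) hβ
    (fun _ _ => zero_le_one) (fun _ _ => zero_le_one)
  simp only [ContinuousLinearMap.mul_apply', mul_one] at this
  exact this

theorem continuous_oscInt_integrand_prod (hφ : PhaseSmoothHomog n φ) {b : Rn n → Rn n → ℂ}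
    (hb : Continuous fun q : Rn n × Rn n => b q.1 q.2) {r : ℝ} (hr : 0 < r)
    (h0 : ∀ x η, ‖η‖ < r → b x η = 0) (lam : ℝ) :
    Continuous fun q : (Rn n × Rn n) × Rn n =>
      b q.1.1 q.2 * cexp (I * ((lam * (φ q.1.1 q.2 - ⟪q.1.2, q.2⟫_ℝ) : ℝ) : ℂ)) := by
  refine continuous_iff_continuousAt.2 fun q => ?_
  by_cases hη : q.2 = 0
  · have hz : ∀ᶠ q' in nhds q, b q'.1.1 q'.2 *
        cexp (I * ((lam * (φ q'.1.1 q'.2 - ⟪q'.1.2, q'.2⟫_ℝ) : ℝ) : ℂ)) = 0 := by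
      have : Filter.Tendsto (fun q' : (Rn n × Rn n) × Rn n => q'.2) (nhds q) (nhds 0) := by
        rw [← hη]; exact continuous_snd.continuousAt
      filter_upwards [this (Metric.ball_mem_nhds (0 : Rn n) hr)] with q' hq'
      rw [h0 _ _ (by simpa using hq'), zero_mul]
    exact (continuousAt_const (y := (0 : ℂ))).congr (hz.mono fun _ h => h.symm)
  · have h : ContinuousAt (fun p : Rn n × Rn n => φ p.1 p.2) (q.1.1, q.2) :=
      hφ.1.continuousOn.continuousAt
        ((isOpen_ne_fun continuous_snd continuous_const).mem_nhds hη)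
    have h2 : ContinuousAt (fun q : (Rn n × Rn n) × Rn n => φ q.1.1 q.2) q :=
      ContinuousAt.comp (f := fun q : (Rn n × Rn n) × Rn n => (q.1.1, q.2))
        (g := fun p : Rn n × Rn n => φ p.1 p.2) h (by fun_prop)
    have h3 : Continuous fun q : (Rn n × Rn n) × Rn n => b q.1.1 q.2 :=
      hb.comp (by fun_prop : Continuous fun q : (Rn n × Rn n) × Rn n => (q.1.1, q.2))
    fun_prop

theorem measurable_oscInt (hφ : PhaseSmoothHomog n φ) {b : Rn n → Rn n → ℂ}
    (hb : Continuous fun q : Rn n × Rn n => b q.1 q.2) {r : ℝ} (hr : 0 < r)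
    (h0 : ∀ x η, ‖η‖ < r → b x η = 0) (lam : ℝ) :
    Measurable fun q : Rn n × Rn n => oscInt n φ lam b q.1 q.2 :=
  (continuous_oscInt_integrand_prod hφ hb hr h0 lam).stronglyMeasurable.integral_prod_right'
    |>.measurable

theorem measurable_slice_fst {F : Rn n → Rn n → ℂ}
    (h : Measurable fun q : Rn n × Rn n => F q.1 q.2) (y : Rn n) : Measurable fun x => F x y :=
  h.comp (by fun_prop : Measurable fun x : Rn n => (x, y))

theorem measurable_slice_snd {F : Rn n → Rn n → ℂ}
    (h : Measurable fun q : Rn n × Rn n => F q.1 q.2) (x : Rn n) : Measurable fun y => F x y :=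
  h.comp (by fun_prop : Measurable fun y : Rn n => (x, y))

theorem kernel_bound (hn : 1 ≤ n) (hφ : PhaseClass n 2 φ) (hs : SNDCondition n φ) {ι : Type*}
    {lam : ι → ℝ} (hlam : ∀ j, 1 ≤ lam j) {β : ι → Rn n → Rn n → ℂ}
    (hβ : UBd (fun (j : ι × Rn n) η => β j.1 j.2 η) (fun _ _ => 1) (fun _ _ => 1))
    (hsupp : ∀ j x η, β j x η ≠ 0 → 1 / 4 ≤ ‖η‖ ∧ ‖η‖ ≤ 4) {p : ℝ} (hp : 0 < p) (hp1 : p ≤ 1)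
    (hβc : ∀ j, Continuous fun q : Rn n × Rn n => β j q.1 q.2) :
    ∃ C : ℝ≥0, ∀ j,
      (∀ y, ∫⁻ x, ‖oscInt n φ (lam j) (β j) x y‖ₑ ^ p ≤
        C * ENNReal.ofReal (lam j ^ kernelRate n p)) ∧
      ∀ x, ∫⁻ y, ‖oscInt n φ (lam j) (β j) x y‖ₑ ^ p ≤
        C * ENNReal.ofReal (lam j ^ kernelRate n p) := by
  have hc : 0 < (8 * (n : ℝ))⁻¹ := by
    have : 0 < (n : ℝ) := by exact_mod_cast hn
    positivity
  have hsec := fun t : Fin n × Bool => sector_kernel_bound hφ hs hlam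
    (β := fun j x η => (sectorPart n t η : ℂ) * β j x η) (UBd_sectorPart_mul hβ t) t.1 hc
      (boolSign_mul_self t.2) (fun j x η h => by
      constructor
      · refine le_of_sectorBump_ne_zero fun h0 => h ?_
        simp [sectorPart, h0]
      · exact (hsupp j x η (right_ne_zero_of_mul h)).2) hp hp1
  choose C hC using hsec
  have hsum : ∀ j x y, oscInt n φ (lam j) (β j) x y = ∑ t, oscInt n φ (lam j)
      (fun x η => (sectorPart n t η : ℂ) * β j x η) x y := by
    intro j x y
    have h0 : ∀ η, ‖η‖ < 1 / 4 → β j x η = 0 := fun η hη => by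
      by_contra h
      linarith [(hsupp j x η h).1]
    simp only [oscInt]
    rw [← integral_finsetSum]
    · refine integral_congr_ae (Filter.Eventually.of_forall fun η => ?_)
      simp only
      by_cases h : β j x η = 0
      · simp [h]
      · rw [← Finset.sum_mul, ← Finset.sum_mul, ← Complex.ofReal_sum,
          sum_sectorPart hn (hsupp j x η h).1 (hsupp j x η h).2, Complex.ofReal_one, one_mul]
    · intro t _
      refine (continuous_oscInt_integrand hφ.1
        ((UBd_sectorPart_mul hβ t).smooth (j, x)).continuous (by norm_num : (0 : ℝ) < 1 / 4)
        (fun η hη => by simp [h0 η hη]) (lam j) x y).integrable_of_hasCompactSupport ?_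
      refine HasCompactSupport.of_support_subset_isCompact (isCompact_closedBall 0 4) fun η hη => ?_
      rw [mem_closedBall_zero_iff]
      exact (hsupp j x η (right_ne_zero_of_mul (left_ne_zero_of_mul hη))).2
  refine ⟨∑ t, C t, fun j => ?_⟩
  have hb : ∀ x y, ‖oscInt n φ (lam j) (β j) x y‖ₑ ^ p ≤ ∑ t, ‖oscInt n φ (lam j)
      (fun x η => (sectorPart n t η : ℂ) * β j x η) x y‖ₑ ^ p := fun x y => by
    rw [hsum]; exact enorm_sum_rpow_le _ _ hp hp1
  have hm' : ∀ t, Measurable fun q : Rn n × Rn n =>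
      oscInt n φ (lam j) (fun x η => (sectorPart n t η : ℂ) * β j x η) q.1 q.2 := fun t => by
    refine measurable_oscInt hφ.1 (r := 1 / 4) ?_ (by norm_num) (fun x η hη => ?_) (lam j)
    · have h1 := (contDiff_sectorPart t).continuous
      exact (Complex.continuous_ofReal.comp (h1.comp continuous_snd)).mul (hβc j)
    · by_contra h
      linarith [(hsupp j x η (right_ne_zero_of_mul h)).1]
  have hm2 : ∀ t y, AEMeasurable fun x => ‖oscInt n φ (lam j)
      (fun x η => (sectorPart n t η : ℂ) * β j x η) x y‖ₑ ^ p := fun t y =>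
    ((measurable_slice_fst (hm' t) y).enorm.pow_const p).aemeasurable
  have hm3 : ∀ t x, AEMeasurable fun y => ‖oscInt n φ (lam j)
      (fun x η => (sectorPart n t η : ℂ) * β j x η) x y‖ₑ ^ p := fun t x =>
    ((measurable_slice_snd (hm' t) x).enorm.pow_const p).aemeasurable
  constructor
  · intro y
    refine (lintegral_mono fun x => hb x y).trans ?_
    rw [lintegral_finsetSum' _ fun t _ => hm2 t y]
    rw [ENNReal.ofNNReal_finsetSum, Finset.sum_mul]
    exact Finset.sum_le_sum fun t _ => (hC t j).1 y
  · intro x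
    refine (lintegral_mono fun y => hb x y).trans ?_
    rw [lintegral_finsetSum' _ fun t _ => hm3 t x]
    rw [ENNReal.ofNNReal_finsetSum, Finset.sum_mul]
    exact Finset.sum_le_sum fun t _ => (hC t j).2 x

end KernelBound

/-! ### Integral operators: Schur's test and the `T T^*` method -/

section KernelOperators

variable {α : Type*} [MeasurableSpace α] {μ : Measure α}

/-- The integral operator with kernel `K`. -/
def kerOp (μ : Measure α) (K : α → α → ℂ) (f : α → ℂ) (x : α) : ℂ := ∫ y, K x y * f y ∂μ

theorem measurable_kerOp [SFinite μ] {K : α → α → ℂ} (hK : Measurable fun q : α × α => K q.1 q.2)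
    {f : α → ℂ} (hf : Measurable f) : Measurable (kerOp μ K f) := by
  have : StronglyMeasurable fun q : α × α => K q.1 q.2 * f q.2 :=
    (hK.mul (hf.comp measurable_snd)).stronglyMeasurable
  exact this.integral_prod_right'.measurable

theorem enorm_kerOp_le {K : α → α → ℂ} (f : α → ℂ) (x : α) :
    ‖kerOp μ K f x‖ₑ ≤ ∫⁻ y, ‖K x y‖ₑ * ‖f y‖ₑ ∂μ := by
  refine (enorm_integral_le_lintegral_enorm _).trans_eq ?_
  simp only [enorm_mul]

theorem enorm_kerOp_le_of_bdd {K : α → α → ℂ} {A M : ℝ≥0∞}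
    (hx : ∀ x, ∫⁻ y, ‖K x y‖ₑ ∂μ ≤ A) (hM : M ≠ ∞) {f : α → ℂ} (hf : ∀ y, ‖f y‖ₑ ≤ M) (x : α) :
    ‖kerOp μ K f x‖ₑ ≤ A * M := by
  refine (enorm_kerOp_le f x).trans ?_
  calc ∫⁻ y, ‖K x y‖ₑ * ‖f y‖ₑ ∂μ ≤ ∫⁻ y, ‖K x y‖ₑ * M ∂μ :=
        lintegral_mono fun y => mul_le_mul_right (hf y) _
    _ = (∫⁻ y, ‖K x y‖ₑ ∂μ) * M := lintegral_mul_const' _ _ hM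
    _ ≤ A * M := mul_le_mul_left (hx x) _

theorem lintegral_kernel_mul_le [SFinite μ] {K : α → α → ℂ}
    (hK : Measurable fun q : α × α => K q.1 q.2) {A : ℝ≥0∞}
    (hy : ∀ y, ∫⁻ x, ‖K x y‖ₑ ∂μ ≤ A) {f : α → ℂ} (hf : Measurable f) :
    ∫⁻ x, ∫⁻ y, ‖K x y‖ₑ * ‖f y‖ₑ ∂μ ∂μ ≤ A * ∫⁻ y, ‖f y‖ₑ ∂μ := by
  rw [lintegral_lintegral_swap (hK.enorm.mul (hf.comp measurable_snd).enorm).aemeasurable,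
    ← lintegral_const_mul _ hf.enorm]
  refine lintegral_mono fun y => ?_
  rw [lintegral_mul_const' _ _ enorm_ne_top]
  exact mul_le_mul_left (hy y) _

theorem lintegral_enorm_kerOp_le [SFinite μ] {K : α → α → ℂ}
    (hK : Measurable fun q : α × α => K q.1 q.2) {A : ℝ≥0∞}
    (hy : ∀ y, ∫⁻ x, ‖K x y‖ₑ ∂μ ≤ A) {f : α → ℂ} (hf : Measurable f) :
    ∫⁻ x, ‖kerOp μ K f x‖ₑ ∂μ ≤ A * ∫⁻ y, ‖f y‖ₑ ∂μ :=
  (lintegral_mono fun x => enorm_kerOp_le f x).trans (lintegral_kernel_mul_le hK hy hf)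

theorem integral_kerOp_mul [SFinite μ] {K : α → α → ℂ}
    (hK : Measurable fun q : α × α => K q.1 q.2) {A M : ℝ≥0∞} (hA : A ≠ ∞) (hM : M ≠ ∞)
    (hy : ∀ y, ∫⁻ x, ‖K x y‖ₑ ∂μ ≤ A) {u v : α → ℂ} (hu : Measurable u) (hv : Measurable v)
    (hui : ∫⁻ y, ‖u y‖ₑ ∂μ ≠ ∞) (hvb : ∀ x, ‖v x‖ₑ ≤ M) :
    ∫ x, kerOp μ K u x * v x ∂μ = ∫ y, u y * ∫ x, K x y * v x ∂μ ∂μ := by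
  have hm : Measurable fun q : α × α => K q.1 q.2 * u q.2 * v q.1 :=
    (hK.mul (hu.comp measurable_snd)).mul (hv.comp measurable_fst)
  have hi : Integrable (fun q : α × α => K q.1 q.2 * u q.2 * v q.1) (μ.prod μ) := by
    refine ⟨hm.aestronglyMeasurable, ?_⟩
    rw [hasFiniteIntegral_iff_enorm, lintegral_prod _ hm.enorm.aemeasurable]
    calc ∫⁻ x, ∫⁻ y, ‖K x y * u y * v x‖ₑ ∂μ ∂μ
        ≤ ∫⁻ x, (∫⁻ y, ‖K x y‖ₑ * ‖u y‖ₑ ∂μ) * M ∂μ := by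
          refine lintegral_mono fun x => ?_
          rw [← lintegral_mul_const' _ _ hM]
          refine lintegral_mono fun y => ?_
          rw [enorm_mul, enorm_mul]
          exact mul_le_mul_right (hvb x) _
      _ = (∫⁻ x, ∫⁻ y, ‖K x y‖ₑ * ‖u y‖ₑ ∂μ ∂μ) * M := lintegral_mul_const' _ _ hM
      _ ≤ (A * ∫⁻ y, ‖u y‖ₑ ∂μ) * M := mul_le_mul_left (lintegral_kernel_mul_le hK hy hu) _
      _ < ∞ := ENNReal.mul_lt_top (ENNReal.mul_lt_top hA.lt_top hui.lt_top) hM.lt_top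
  calc ∫ x, kerOp μ K u x * v x ∂μ = ∫ x, ∫ y, K x y * u y * v x ∂μ ∂μ := by
        refine integral_congr_ae (Filter.Eventually.of_forall fun x => ?_)
        show (∫ y, K x y * u y ∂μ) * v x = _
        rw [← integral_mul_const]
    _ = ∫ y, ∫ x, K x y * u y * v x ∂μ ∂μ := integral_integral_swap hi
    _ = _ := by
        refine integral_congr_ae (Filter.Eventually.of_forall fun y => ?_)
        show _ = u y * ∫ x, K x y * v x ∂μ
        rw [← integral_const_mul]
        refine integral_congr_ae (Filter.Eventually.of_forall fun x => ?_)
        show _ = u y * (K x y * v x)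
        ring

theorem ENNReal.mul_le_sq_add_sq (a b : ℝ≥0∞) : a * b ≤ a ^ 2 + b ^ 2 := by
  rcases le_total a b with h | h
  · calc a * b ≤ b * b := mul_le_mul_left h _
      _ = b ^ 2 := (sq b).symm
      _ ≤ _ := le_add_self
  · calc a * b ≤ a * a := mul_le_mul_right h _
      _ = a ^ 2 := (sq a).symm
      _ ≤ _ := le_self_add

theorem enorm_integral_mul_conj [SFinite μ] {h : α → ℂ}
    (hi : Integrable (fun x => h x * (starRingEnd ℂ) (h x)) μ) :
    ‖∫ x, h x * (starRingEnd ℂ) (h x) ∂μ‖ₑ = ∫⁻ x, ‖h x‖ₑ ^ 2 ∂μ := by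
  have e : ∀ x, h x * (starRingEnd ℂ) (h x) = ((‖h x‖ ^ 2 : ℝ) : ℂ) := fun x => by
    rw [Complex.mul_conj, Complex.normSq_eq_norm_sq]
  simp only [e] at hi ⊢
  have hi' : Integrable (fun x => ‖h x‖ ^ 2) μ := by
    refine hi.re.congr (Filter.Eventually.of_forall fun x => ?_)
    exact Complex.ofReal_re _
  rw [integral_complex_ofReal, ← ofReal_norm, Complex.norm_real, Real.norm_eq_abs,
    abs_of_nonneg (integral_nonneg fun x => by positivity),
    ofReal_integral_eq_lintegral_ofReal hi' (Filter.Eventually.of_forall fun x => by positivity)]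
  refine lintegral_congr fun x => ?_
  rw [ENNReal.ofReal_pow (norm_nonneg _), ofReal_norm]

theorem lintegral_mul_sq_le {f g : α → ℝ≥0∞} (hf : Measurable f) (hg : Measurable g) :
    (∫⁻ x, f x * g x ∂μ) ^ 2 ≤ (∫⁻ x, f x ^ 2 ∂μ) * ∫⁻ x, g x ^ 2 ∂μ := by
  have := ENNReal.lintegral_mul_le_Lp_mul_Lq μ Real.HolderConjugate.two_two hf.aemeasurable
    hg.aemeasurable
  calc (∫⁻ x, f x * g x ∂μ) ^ 2 ≤ _ := pow_le_pow_left' this 2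
    _ = _ := by
      rw [mul_pow, ← ENNReal.rpow_natCast, ← ENNReal.rpow_mul, ← ENNReal.rpow_natCast (_ ^ _),
        ← ENNReal.rpow_mul]
      norm_num

/-- The `T T^*` method. -/
theorem lintegral_sq_kerOp_le [SFinite μ] {K : α → α → ℂ}
    (hK : Measurable fun q : α × α => K q.1 q.2) {A B : ℝ≥0∞} (hA : A ≠ ∞)
    (hx : ∀ x, ∫⁻ y, ‖K x y‖ₑ ∂μ ≤ A) (hy : ∀ y, ∫⁻ x, ‖K x y‖ₑ ∂μ ≤ A)
    (hB : ∀ x, ∫⁻ z, ‖∫ y, (starRingEnd ℂ) (K z y) * K x y ∂μ‖ₑ ∂μ ≤ B)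
    {f : α → ℂ} (hf : Measurable f) (hfi : ∫⁻ y, ‖f y‖ₑ ∂μ ≠ ∞) {M : ℝ≥0∞} (hM : M ≠ ∞)
    (hfM : ∀ y, ‖f y‖ₑ ≤ M) :
    ∫⁻ x, ‖kerOp μ K f x‖ₑ ^ 2 ∂μ ≤ 2 * B * ∫⁻ y, ‖f y‖ₑ ^ 2 ∂μ := by
  set h := kerOp μ K f with hh
  have hhm : Measurable h := measurable_kerOp hK hf
  have hhb : ∀ x, ‖h x‖ₑ ≤ A * M := enorm_kerOp_le_of_bdd hx hM hfM
  have hAM : A * M ≠ ∞ := ENNReal.mul_ne_top hA hM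
  have hhi : ∫⁻ x, ‖h x‖ₑ ∂μ ≠ ∞ :=
    ((lintegral_enorm_kerOp_le hK hy hf).trans_lt (ENNReal.mul_lt_top hA.lt_top hfi.lt_top)).ne
  set L : α → α → ℂ := fun y x => (starRingEnd ℂ) (K x y) with hL
  have hLm : Measurable fun q : α × α => L q.1 q.2 :=
    (Complex.continuous_conj.measurable.comp (hK.comp measurable_swap))
  have hLn : ∀ x y, ‖L y x‖ₑ = ‖K x y‖ₑ := fun x y => by
    simp only [hL]; rw [← ofReal_norm, RCLike.norm_conj, ofReal_norm]
  have hLx : ∀ y, ∫⁻ x, ‖L y x‖ₑ ∂μ ≤ A := fun y => by simpa only [hLn] using hy y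
  have hLy : ∀ x, ∫⁻ y, ‖L y x‖ₑ ∂μ ≤ A := fun x => by simpa only [hLn] using hx x
  set g := kerOp μ L h with hg
  have hgm : Measurable g := measurable_kerOp hLm hhm
  have hgb : ∀ y, ‖g y‖ₑ ≤ A * (A * M) := enorm_kerOp_le_of_bdd hLx hAM hhb
  have hgi : ∫⁻ x, ‖g x‖ₑ ∂μ ≠ ∞ :=
    ((lintegral_enorm_kerOp_le hLm hLy hhm).trans_lt
      (ENNReal.mul_lt_top hA.lt_top hhi.lt_top)).ne
  have hsq : ∀ {u : α → ℂ} {R : ℝ≥0∞}, Measurable u → R ≠ ∞ → (∀ x, ‖u x‖ₑ ≤ R) →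
      ∫⁻ x, ‖u x‖ₑ ∂μ ≠ ∞ → ∫⁻ x, ‖u x‖ₑ ^ 2 ∂μ < ∞ ∧
        Integrable (fun x => u x * (starRingEnd ℂ) (u x)) μ := by
    intro u R hu hR hb hi
    have h1 : ∫⁻ x, ‖u x‖ₑ ^ 2 ∂μ < ∞ := by
      calc ∫⁻ x, ‖u x‖ₑ ^ 2 ∂μ ≤ ∫⁻ x, R * ‖u x‖ₑ ∂μ :=
            lintegral_mono fun x => by rw [sq]; exact mul_le_mul_left (hb x) _
        _ = R * ∫⁻ x, ‖u x‖ₑ ∂μ := lintegral_const_mul _ hu.enorm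
        _ < ∞ := ENNReal.mul_lt_top hR.lt_top hi.lt_top
    refine ⟨h1, (hu.mul (Complex.continuous_conj.measurable.comp hu)).aestronglyMeasurable, ?_⟩
    rw [hasFiniteIntegral_iff_enorm]
    refine (lintegral_congr fun x => ?_).trans_lt h1
    show ‖u x * (starRingEnd ℂ) (u x)‖ₑ = _
    rw [enorm_mul, ← ofReal_norm ((starRingEnd ℂ) (u x)), RCLike.norm_conj, ofReal_norm, sq]
  have hconj : ∀ y, (∫ x, K x y * (starRingEnd ℂ) (h x) ∂μ) = (starRingEnd ℂ) (g y) := fun y => by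
    simp only [hg, kerOp, hL]
    rw [← integral_conj]
    simp
  have hcm : Measurable fun x => (starRingEnd ℂ) (h x) :=
    Complex.continuous_conj.measurable.comp hhm
  have hcb : ∀ x, ‖(starRingEnd ℂ) (h x)‖ₑ ≤ A * M := fun x => by
    rw [← ofReal_norm, RCLike.norm_conj, ofReal_norm]; exact hhb x
  have hce : ∀ z : ℂ, ‖(starRingEnd ℂ) z‖ₑ = ‖z‖ₑ := fun z => by
    rw [← ofReal_norm, RCLike.norm_conj, ofReal_norm]
  obtain ⟨hH, hHi⟩ := hsq hhm hAM hhb hhi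
  obtain ⟨-, hGi⟩ := hsq hgm (ENNReal.mul_ne_top hA hAM) hgb hgi
  have e1 : ∫⁻ x, ‖h x‖ₑ ^ 2 ∂μ ≤ ∫⁻ y, ‖f y‖ₑ * ‖g y‖ₑ ∂μ := by
    rw [← enorm_integral_mul_conj hHi, hh, integral_kerOp_mul hK hA hAM hy hf hcm hfi hcb]
    simp only [hconj]
    refine (enorm_integral_le_lintegral_enorm _).trans_eq ?_
    simp only [enorm_mul, hce]
  have e2 : ∀ x, kerOp μ K g x = ∫ z, (∫ y, (starRingEnd ℂ) (K z y) * K x y ∂μ) * h z ∂μ := by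
    intro x
    have hm2 : Measurable fun q : α × α => (starRingEnd ℂ) (K q.1 q.2) :=
      Complex.continuous_conj.measurable.comp hK
    have := integral_kerOp_mul (K := fun z y => (starRingEnd ℂ) (K z y)) hm2 hA hAM
      (fun y => by simpa only [hce] using hy y) (u := K x) (v := h)
      (hK.comp measurable_prodMk_left) hhm (((hx x).trans_lt hA.lt_top).ne) hhb
    exact this.symm
  have e3 : ∫⁻ x, ‖g x‖ₑ ^ 2 ∂μ ≤ 2 * B * ∫⁻ x, ‖h x‖ₑ ^ 2 ∂μ := by
    have hNm : Measurable fun q : α × α => ∫ y, (starRingEnd ℂ) (K q.2 y) * K q.1 y ∂μ := by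
      have : StronglyMeasurable fun r : (α × α) × α =>
          (starRingEnd ℂ) (K r.1.2 r.2) * K r.1.1 r.2 := by
        refine Measurable.stronglyMeasurable (Measurable.mul ?_ ?_)
        · exact Complex.continuous_conj.measurable.comp
            (hK.comp ((measurable_snd.comp measurable_fst).prodMk measurable_snd))
        · exact hK.comp ((measurable_fst.comp measurable_fst).prodMk measurable_snd)
      exact this.integral_prod_right'.measurable
    set N : α → α → ℂ := fun x z => ∫ y, (starRingEnd ℂ) (K z y) * K x y ∂μ with hN
    have hsymm : ∀ x z, ‖N x z‖ₑ = ‖N z x‖ₑ := fun x z => by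
      rw [← hce (N z x)]
      simp only [hN]
      rw [← integral_conj]
      refine congrArg _ (integral_congr_ae (Filter.Eventually.of_forall fun y => ?_))
      simp [mul_comm]
    have hB2 : ∀ z, ∫⁻ x, ‖N x z‖ₑ ∂μ ≤ B := fun z => by
      simp only [fun x => hsymm x z]; exact hB z
    have e : ‖∫ x, g x * (starRingEnd ℂ) (g x) ∂μ‖ₑ
        ≤ ∫⁻ x, ∫⁻ z, (‖h x‖ₑ ^ 2 + ‖h z‖ₑ ^ 2) * ‖N x z‖ₑ ∂μ ∂μ := by
      have := integral_kerOp_mul hK hA hAM hy hgm hcm hgi hcb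
      simp only [hconj] at this
      rw [← this]
      refine (enorm_integral_le_lintegral_enorm _).trans (lintegral_mono fun x => ?_)
      rw [enorm_mul, hce, e2 x]
      refine (mul_le_mul_left (enorm_integral_le_lintegral_enorm _) _).trans ?_
      rw [← lintegral_mul_const' _ _ enorm_ne_top]
      refine lintegral_mono fun z => ?_
      rw [enorm_mul, mul_assoc, mul_comm]
      refine mul_le_mul_left ?_ _
      rw [mul_comm]
      exact ENNReal.mul_le_sq_add_sq _ _
    rw [enorm_integral_mul_conj hGi] at e
    refine e.trans ?_
    have hhm2 : Measurable fun x => ‖h x‖ₑ ^ 2 := hhm.enorm.pow_const 2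
    have hNm' : Measurable fun q : α × α => ‖N q.1 q.2‖ₑ := hNm.enorm
    have s1 : ∫⁻ x, ∫⁻ z, ‖h x‖ₑ ^ 2 * ‖N x z‖ₑ ∂μ ∂μ ≤ B * ∫⁻ x, ‖h x‖ₑ ^ 2 ∂μ := by
      rw [← lintegral_const_mul _ hhm2]
      refine lintegral_mono fun x => ?_
      rw [lintegral_const_mul' _ _ (by finiteness), mul_comm]
      exact mul_le_mul_left (hB x) _
    have s2 : ∫⁻ x, ∫⁻ z, ‖h z‖ₑ ^ 2 * ‖N x z‖ₑ ∂μ ∂μ ≤ B * ∫⁻ x, ‖h x‖ₑ ^ 2 ∂μ := by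
      rw [lintegral_lintegral_swap ((hhm2.comp measurable_snd).mul hNm').aemeasurable,
        ← lintegral_const_mul _ hhm2]
      refine lintegral_mono fun z => ?_
      rw [lintegral_const_mul' _ _ (by finiteness), mul_comm]
      exact mul_le_mul_left (hB2 z) _
    calc _ = ∫⁻ x, (∫⁻ z, ‖h x‖ₑ ^ 2 * ‖N x z‖ₑ ∂μ) + ∫⁻ z, ‖h z‖ₑ ^ 2 * ‖N x z‖ₑ ∂μ ∂μ := by
          refine lintegral_congr fun x => ?_
          simp only [add_mul]
          exact lintegral_add_left ((hNm'.comp measurable_prodMk_left).const_mul _) _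
      _ = _ := lintegral_add_left
          (((hhm2.comp measurable_fst).mul hNm').lintegral_prod_right') _
      _ ≤ _ := add_le_add s1 s2
      _ = _ := by ring
  set H := ∫⁻ x, ‖h x‖ₑ ^ 2 ∂μ with hHdef
  rcases eq_or_ne H 0 with h0 | h0
  · rw [h0]; exact zero_le
  have e4 : H * H ≤ 2 * B * (∫⁻ y, ‖f y‖ₑ ^ 2 ∂μ) * H := by
    calc H * H = H ^ 2 := (sq H).symm
      _ ≤ _ := pow_le_pow_left' e1 2
      _ ≤ _ := lintegral_mul_sq_le hf.enorm hgm.enorm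
      _ ≤ _ := mul_le_mul_right e3 _
      _ = _ := by ring
  exact (ENNReal.mul_le_mul_iff_left h0 hH.ne).1 e4

end KernelOperators

/-! ### Interpolation by truncation -/

section Interpolation

variable {α : Type*} [MeasurableSpace α] {μ : Measure α}

theorem lintegral_Ioo_rpow {s b : ℝ} (hs : 0 < s) (hb : 0 ≤ b) :
    ∫⁻ t in Set.Ioo 0 b, ENNReal.ofReal (t ^ (s - 1)) = ENNReal.ofReal (b ^ s / s) := by
  have hi : IntervalIntegrable (fun t : ℝ => t ^ (s - 1)) volume 0 b :=
    intervalIntegral.intervalIntegrable_rpow' (by linarith)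
  rw [intervalIntegrable_iff_integrableOn_Ioo_of_le hb] at hi
  rw [← ofReal_integral_eq_lintegral_ofReal hi]
  · rw [← integral_Ioc_eq_integral_Ioo, ← intervalIntegral.integral_of_le hb,
      integral_rpow (Or.inl (by linarith))]
    simp [Real.zero_rpow hs.ne']
  · exact (ae_restrict_mem measurableSet_Ioo).mono fun t ht => Real.rpow_nonneg ht.1.le _

theorem lintegral_Ioi_rpow {s b : ℝ} (hs : 0 < s) (hb : 0 < b) :
    ∫⁻ t in Set.Ioi b, ENNReal.ofReal (t ^ (-s - 1)) = ENNReal.ofReal (b ^ (-s) / s) := by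
  have hi := integrableOn_Ioi_rpow_of_lt (a := -s - 1) (by linarith) hb
  rw [← ofReal_integral_eq_lintegral_ofReal hi]
  · rw [integral_Ioi_rpow_of_lt (by linarith) hb]
    congr 1
    rw [show -s - 1 + 1 = -s by ring, neg_div_neg_eq]
  · exact (ae_restrict_mem measurableSet_Ioi).mono fun t ht =>
      Real.rpow_nonneg (hb.trans ht).le _

theorem lintegral_superlevel_le [SFinite μ] {f : α → ℝ} (hf : Measurable f) (hf0 : ∀ y, 0 ≤ f y)
    {w : α → ℝ≥0∞} (hw : Measurable w) {c s : ℝ} (hc : 0 < c) (hs : 0 < s) :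
    ∫⁻ t in Set.Ioi (0 : ℝ), ENNReal.ofReal (t ^ (s - 1)) *
        ∫⁻ y, {y | c * t < f y}.indicator w y ∂μ
      ≤ ∫⁻ y, w y * ENNReal.ofReal ((f y / c) ^ s / s) ∂μ := by
  have hS : MeasurableSet {q : ℝ × α | c * q.1 < f q.2} :=
    measurableSet_lt (measurable_fst.const_mul c) (hf.comp measurable_snd)
  have hm : Measurable fun q : ℝ × α => {y | c * q.1 < f y}.indicator w q.2 :=
    (hw.comp measurable_snd).indicator hS
  have hp : Measurable fun t : ℝ => ENNReal.ofReal (t ^ (s - 1)) := by fun_prop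
  calc _ = ∫⁻ t in Set.Ioi (0 : ℝ), ∫⁻ y, ENNReal.ofReal (t ^ (s - 1)) *
          {y | c * t < f y}.indicator w y ∂μ := by
        refine lintegral_congr fun t => ?_
        rw [lintegral_const_mul' _ _ ENNReal.ofReal_ne_top]
    _ = ∫⁻ y, (∫⁻ t in Set.Ioi (0 : ℝ), ENNReal.ofReal (t ^ (s - 1)) *
          {y | c * t < f y}.indicator w y) ∂μ :=
        lintegral_lintegral_swap ((hp.comp measurable_fst).mul hm).aemeasurable
    _ ≤ _ := by
        refine lintegral_mono fun y => ?_
        rw [← lintegral_Ioo_rpow hs (div_nonneg (hf0 y) hc.le), ← lintegral_const_mul _ hp,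
          ← lintegral_indicator measurableSet_Ioi, ← lintegral_indicator measurableSet_Ioo]
        refine lintegral_mono fun t => ?_
        by_cases h0 : 0 < t
        · by_cases h : c * t < f y
          · have h2 : t ∈ Set.Ioo 0 (f y / c) := ⟨h0, by rw [lt_div_iff₀ hc]; linarith⟩
            have h3 : y ∈ {y | c * t < f y} := h
            rw [Set.indicator_of_mem (Set.mem_Ioi.2 h0), Set.indicator_of_mem h2,
              Set.indicator_of_mem h3, mul_comm]
          · have h3 : y ∉ {y | c * t < f y} := h
            rw [Set.indicator_of_mem (Set.mem_Ioi.2 h0), Set.indicator_of_notMem h3, mul_zero]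
            exact zero_le
        · rw [Set.indicator_of_notMem (by simpa using h0)]
          exact zero_le

theorem lintegral_sublevel_le [SFinite μ] {f : α → ℝ} (hf : Measurable f) (hf0 : ∀ y, 0 ≤ f y)
    {w : α → ℝ≥0∞} (hw : Measurable w) (hwf : ∀ y, f y = 0 → w y = 0) {c s : ℝ} (hc : 0 < c)
    (hs : 0 < s) :
    ∫⁻ t in Set.Ioi (0 : ℝ), ENNReal.ofReal (t ^ (-s - 1)) *
        ∫⁻ y, {y | f y < c * t}.indicator w y ∂μ
      ≤ ∫⁻ y, w y * ENNReal.ofReal ((f y / c) ^ (-s) / s) ∂μ := by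
  have hS : MeasurableSet {q : ℝ × α | f q.2 < c * q.1} :=
    measurableSet_lt (hf.comp measurable_snd) (measurable_fst.const_mul c)
  have hm : Measurable fun q : ℝ × α => {y | f y < c * q.1}.indicator w q.2 :=
    (hw.comp measurable_snd).indicator hS
  have hp : Measurable fun t : ℝ => ENNReal.ofReal (t ^ (-s - 1)) := by fun_prop
  calc _ = ∫⁻ t in Set.Ioi (0 : ℝ), ∫⁻ y, ENNReal.ofReal (t ^ (-s - 1)) *
          {y | f y < c * t}.indicator w y ∂μ := by
        refine lintegral_congr fun t => ?_
        rw [lintegral_const_mul' _ _ ENNReal.ofReal_ne_top]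
    _ = ∫⁻ y, (∫⁻ t in Set.Ioi (0 : ℝ), ENNReal.ofReal (t ^ (-s - 1)) *
          {y | f y < c * t}.indicator w y) ∂μ :=
        lintegral_lintegral_swap ((hp.comp measurable_fst).mul hm).aemeasurable
    _ ≤ _ := by
        refine lintegral_mono fun y => ?_
        rcases (hf0 y).eq_or_lt with h0 | h0
        · have : w y = 0 := hwf y h0.symm
          simp [Set.indicator_apply, this]
        rw [← lintegral_Ioi_rpow hs (div_pos h0 hc), ← lintegral_const_mul _ hp,
          ← lintegral_indicator measurableSet_Ioi, ← lintegral_indicator measurableSet_Ioi]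
        refine lintegral_mono fun t => ?_
        by_cases h1 : 0 < t
        · by_cases h : f y < c * t
          · have h2 : t ∈ Set.Ioi (f y / c) := by
              rw [Set.mem_Ioi, div_lt_iff₀ hc]; linarith
            have h3 : y ∈ {y | f y < c * t} := h
            rw [Set.indicator_of_mem (Set.mem_Ioi.2 h1), Set.indicator_of_mem h2,
              Set.indicator_of_mem h3, mul_comm]
          · have h3 : y ∉ {y | f y < c * t} := h
            rw [Set.indicator_of_mem (Set.mem_Ioi.2 h1), Set.indicator_of_notMem h3, mul_zero]
            exact zero_le
        · rw [Set.indicator_of_notMem (by simpa using h1)]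
          exact zero_le

theorem measure_lt_norm_le {u : α → ℂ} (hu : Measurable u) (r : ℕ) {t : ℝ} (ht : 0 < t) :
    μ {x | t / 2 < ‖u x‖} ≤ ENNReal.ofReal ((2 / t) ^ r) * ∫⁻ x, ‖u x‖ₑ ^ r ∂μ := by
  have h := mul_meas_ge_le_lintegral (μ := μ) (hu.enorm.pow_const r)
    (ENNReal.ofReal ((t / 2) ^ r))
  have hsub : {x | t / 2 < ‖u x‖} ⊆ {x | ENNReal.ofReal ((t / 2) ^ r) ≤ ‖u x‖ₑ ^ r} := by
    intro x hx
    have hx' : t / 2 < ‖u x‖ := hx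
    show ENNReal.ofReal ((t / 2) ^ r) ≤ ‖u x‖ₑ ^ r
    rw [← ofReal_norm, ← ENNReal.ofReal_pow (norm_nonneg _)]
    exact ENNReal.ofReal_le_ofReal (pow_le_pow_left₀ (by positivity) hx'.le r)
  calc _ ≤ μ {x | ENNReal.ofReal ((t / 2) ^ r) ≤ ‖u x‖ₑ ^ r} := measure_mono hsub
    _ = ENNReal.ofReal ((2 / t) ^ r) * (ENNReal.ofReal ((t / 2) ^ r) *
          μ {x | ENNReal.ofReal ((t / 2) ^ r) ≤ ‖u x‖ₑ ^ r}) := by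
        rw [← mul_assoc, ← ENNReal.ofReal_mul (by positivity), ← mul_pow]
        rw [show 2 / t * (t / 2) = 1 by field_simp]
        simp
    _ ≤ _ := mul_le_mul_right h _

theorem lintegral_enorm_rpow_eq {u : α → ℂ} (hu : Measurable u) {p : ℝ} (hp : 0 < p) :
    ∫⁻ x, ‖u x‖ₑ ^ p ∂μ = ENNReal.ofReal p *
      ∫⁻ t in Set.Ioi (0 : ℝ), μ {x | t < ‖u x‖} * ENNReal.ofReal (t ^ (p - 1)) := by
  rw [← lintegral_rpow_eq_lintegral_meas_lt_mul μ (Filter.Eventually.of_forall fun x =>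
    norm_nonneg (u x)) hu.norm.aemeasurable hp]
  refine lintegral_congr fun x => ?_
  rw [← ofReal_norm, ENNReal.ofReal_rpow_of_nonneg (norm_nonneg _) hp.le]

theorem kerOp_add {K : α → α → ℂ} {x : α} (hKi : Integrable (K x) μ) {f g : α → ℂ} {M : ℝ}
    (hf : Measurable f) (hg : Measurable g) (hfM : ∀ y, ‖f y‖ ≤ M) (hgM : ∀ y, ‖g y‖ ≤ M) :
    kerOp μ K (fun y => f y + g y) x = kerOp μ K f x + kerOp μ K g x := by
  unfold kerOp
  rw [← integral_add]
  · simp only [mul_add]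
  · exact hKi.mul_bdd hf.aestronglyMeasurable (Filter.Eventually.of_forall hfM)
  · exact hKi.mul_bdd hg.aestronglyMeasurable (Filter.Eventually.of_forall hgM)

theorem enorm_indicator_pow {α : Type*} (S : Set α) (f : α → ℂ) {r : ℕ} (hr : r ≠ 0) (y : α) :
    ‖S.indicator f y‖ₑ ^ r = S.indicator (fun y => ‖f y‖ₑ ^ r) y := by
  by_cases h : y ∈ S
  · simp [h]
  · simp [h, hr]

theorem norm_kerOp_split {K : α → α → ℂ} {x : α} (hKi : Integrable (K x) μ) {f : α → ℂ} {M : ℝ}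
    (hf : Measurable f) (hfM : ∀ y, ‖f y‖ ≤ M) {S : Set α} (hS : MeasurableSet S) :
    ‖kerOp μ K f x‖ ≤ ‖kerOp μ K (S.indicator f) x‖ + ‖kerOp μ K (Sᶜ.indicator f) x‖ := by
  have hb : ∀ T : Set α, ∀ y, ‖T.indicator f y‖ ≤ M := fun T y =>
    (norm_indicator_le_norm_self f y).trans (hfM y)
  have e : kerOp μ K f x = kerOp μ K (S.indicator f) x + kerOp μ K (Sᶜ.indicator f) x := by
    rw [← kerOp_add hKi (hf.indicator hS) (hf.indicator hS.compl) (hb _) (hb _)]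
    congr 1
    funext y
    exact (Set.indicator_self_add_compl_apply S f y).symm
  rw [e]
  exact norm_add_le _ _

theorem lintegral_rpow_kerOp_le_of_two_lt [SFinite μ] {p : ℝ} (hp : 2 < p) {K : α → α → ℂ}
    (hK : Measurable fun q : α × α => K q.1 q.2) {A : ℝ} (hA : 0 < A)
    (hx : ∀ x, ∫⁻ y, ‖K x y‖ₑ ∂μ ≤ ENNReal.ofReal A) {B : ℝ≥0∞} (hBt : B ≠ ∞)
    {f : α → ℂ} (hf : Measurable f) {M : ℝ} (hfM : ∀ y, ‖f y‖ ≤ M)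
    (hL2 : ∀ S : Set α, MeasurableSet S → ∫⁻ x, ‖kerOp μ K (S.indicator f) x‖ₑ ^ 2 ∂μ
      ≤ B * ∫⁻ y, ‖S.indicator f y‖ₑ ^ 2 ∂μ) :
    ∫⁻ x, ‖kerOp μ K f x‖ₑ ^ p ∂μ ≤
      ENNReal.ofReal (p * 4 * 2 ^ (p - 2) / (p - 2)) * B * ENNReal.ofReal (A ^ (p - 2)) *
        ∫⁻ y, ‖f y‖ₑ ^ p ∂μ := by
  have hKi : ∀ x, Integrable (K x) μ := fun x =>
    ⟨(hK.comp measurable_prodMk_left).aestronglyMeasurable, by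
      rw [hasFiniteIntegral_iff_enorm]; exact (hx x).trans_lt ENNReal.ofReal_lt_top⟩
  rw [lintegral_enorm_rpow_eq (measurable_kerOp hK hf) (by linarith)]
  set c : ℝ := (2 * A)⁻¹ with hc
  have hc0 : 0 < c := by positivity
  have key : ∀ t : ℝ, 0 < t → μ {x | t < ‖kerOp μ K f x‖} * ENNReal.ofReal (t ^ (p - 1)) ≤
      4 * B * (ENNReal.ofReal (t ^ (p - 2 - 1)) *
        ∫⁻ y, {y | c * t < ‖f y‖}.indicator (fun y => ‖f y‖ₑ ^ 2) y ∂μ) := by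
    intro t ht
    set S : Set α := {y | c * t < ‖f y‖} with hSdef
    have hS : MeasurableSet S := measurableSet_lt measurable_const hf.norm
    have hsub : {x | t < ‖kerOp μ K f x‖} ⊆ {x | t / 2 < ‖kerOp μ K (S.indicator f) x‖} := by
      intro x hx1
      have hx1' : t < ‖kerOp μ K f x‖ := hx1
      have h1 := norm_kerOp_split (hKi x) hf hfM hS
      have h2 : ‖kerOp μ K (Sᶜ.indicator f) x‖ₑ ≤ ENNReal.ofReal A * ENNReal.ofReal (c * t) := by
        refine enorm_kerOp_le_of_bdd hx ENNReal.ofReal_ne_top (fun y => ?_) x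
        rw [← ofReal_norm]
        refine ENNReal.ofReal_le_ofReal ?_
        by_cases hy : y ∈ S
        · simp only [Set.indicator, Set.mem_compl_iff, hy, not_true, if_false, norm_zero]
          positivity
        · have hy2 : ‖f y‖ ≤ c * t := not_lt.1 hy
          simpa [Set.indicator, hy] using hy2
      rw [← ENNReal.ofReal_mul hA.le, ← ofReal_norm,
        ENNReal.ofReal_le_ofReal_iff (by positivity)] at h2
      have h3 : A * (c * t) = t / 2 := by rw [hc]; field_simp
      show t / 2 < _
      linarith
    have h4 := measure_lt_norm_le (μ := μ) (measurable_kerOp (μ := μ) hK (hf.indicator hS)) 2 ht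
    have h5 := hL2 S hS
    simp only [enorm_indicator_pow S f two_ne_zero] at h5
    calc _ ≤ (ENNReal.ofReal ((2 / t) ^ 2) * (B * ∫⁻ y, S.indicator (fun y => ‖f y‖ₑ ^ 2) y ∂μ)) *
          ENNReal.ofReal (t ^ (p - 1)) :=
          mul_le_mul_left (((measure_mono hsub).trans h4).trans (mul_le_mul_right h5 _)) _
      _ = (ENNReal.ofReal ((2 / t) ^ 2) * ENNReal.ofReal (t ^ (p - 1))) *
          (B * ∫⁻ y, S.indicator (fun y => ‖f y‖ₑ ^ 2) y ∂μ) := by ring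
      _ = (4 * ENNReal.ofReal (t ^ (p - 2 - 1))) *
          (B * ∫⁻ y, S.indicator (fun y => ‖f y‖ₑ ^ 2) y ∂μ) := by
          congr 1
          rw [← ENNReal.ofReal_mul (by positivity),
            show (4 : ℝ≥0∞) = ENNReal.ofReal 4 by norm_num, ← ENNReal.ofReal_mul (by norm_num)]
          congr 1
          rw [show p - 1 = (p - 2 - 1) + (2 : ℕ) by push_cast; ring, Real.rpow_add_natCast ht.ne']
          field_simp
          ring
      _ = _ := by ring
  have hfm : Measurable fun y => ‖f y‖ₑ ^ 2 := hf.enorm.pow_const 2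
  calc _ ≤ ENNReal.ofReal p * ∫⁻ t in Set.Ioi (0 : ℝ), 4 * B * (ENNReal.ofReal (t ^ (p - 2 - 1)) *
        ∫⁻ y, {y | c * t < ‖f y‖}.indicator (fun y => ‖f y‖ₑ ^ 2) y ∂μ) :=
        mul_le_mul_right (setLIntegral_mono' measurableSet_Ioi fun t ht => key t ht) _
    _ = ENNReal.ofReal p * (4 * B * ∫⁻ t in Set.Ioi (0 : ℝ), (ENNReal.ofReal (t ^ (p - 2 - 1)) *
        ∫⁻ y, {y | c * t < ‖f y‖}.indicator (fun y => ‖f y‖ₑ ^ 2) y ∂μ)) := by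
        rw [lintegral_const_mul' _ _ (ENNReal.mul_ne_top (by norm_num) hBt)]
    _ ≤ ENNReal.ofReal p * (4 * B * ∫⁻ y, ‖f y‖ₑ ^ 2 *
          ENNReal.ofReal ((‖f y‖ / c) ^ (p - 2) / (p - 2)) ∂μ) := by
        gcongr
        exact lintegral_superlevel_le hf.norm (fun y => norm_nonneg _) hfm hc0 (by linarith)
    _ = ENNReal.ofReal p * (4 * B * ∫⁻ y, ENNReal.ofReal ((2 * A) ^ (p - 2) / (p - 2)) *
          ‖f y‖ₑ ^ p ∂μ) := by
        congr 3
        funext y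
        rw [← ofReal_norm, ← ENNReal.ofReal_pow (norm_nonneg _),
          ENNReal.ofReal_rpow_of_nonneg (norm_nonneg _) (by linarith),
          ← ENNReal.ofReal_mul (by positivity), ← ENNReal.ofReal_mul
            (div_nonneg (by positivity) (by linarith))]
        congr 1
        rw [hc, div_inv_eq_mul, Real.mul_rpow (norm_nonneg _) (by positivity)]
        rcases (norm_nonneg (f y)).eq_or_lt with h0 | h0
        · rw [← h0, Real.zero_rpow (by linarith : p ≠ 0)]; simp
        · rw [show ‖f y‖ ^ p = ‖f y‖ ^ (p - 2) * ‖f y‖ ^ 2 by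
            rw [← Real.rpow_add_natCast h0.ne']; congr 1; push_cast; ring]
          ring
    _ = _ := by
        have hc1 : 0 ≤ (2 : ℝ) ^ (p - 2) / (p - 2) := div_nonneg (by positivity) (by linarith)
        have e1 : ENNReal.ofReal (p * 4 * 2 ^ (p - 2) / (p - 2)) =
            ENNReal.ofReal p * (4 * ENNReal.ofReal (2 ^ (p - 2) / (p - 2))) := by
          rw [show (4 : ℝ≥0∞) = ENNReal.ofReal 4 by norm_num, ← ENNReal.ofReal_mul (by norm_num),
            ← ENNReal.ofReal_mul (by linarith)]
          congr 1
          ring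
        have e2 : ENNReal.ofReal ((2 * A) ^ (p - 2) / (p - 2)) =
            ENNReal.ofReal (2 ^ (p - 2) / (p - 2)) * ENNReal.ofReal (A ^ (p - 2)) := by
          rw [← ENNReal.ofReal_mul hc1, Real.mul_rpow (by norm_num) hA.le]
          congr 1
          ring
        rw [lintegral_const_mul' _ _ ENNReal.ofReal_ne_top, e1, e2]
        ring

theorem lintegral_rpow_kerOp_le_of_lt_two [SFinite μ] {p : ℝ} (hp : 1 < p) (hp2 : p < 2)
    {K : α → α → ℂ} (hK : Measurable fun q : α × α => K q.1 q.2) {A : ℝ} (hA : 0 < A)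
    (hx : ∀ x, ∫⁻ y, ‖K x y‖ₑ ∂μ ≤ ENNReal.ofReal A)
    (hy : ∀ y, ∫⁻ x, ‖K x y‖ₑ ∂μ ≤ ENNReal.ofReal A) {B : ℝ≥0∞} (hBt : B ≠ ∞)
    {f : α → ℂ} (hf : Measurable f) {M : ℝ} (hfM : ∀ y, ‖f y‖ ≤ M)
    (hL2 : ∀ S : Set α, MeasurableSet S → ∫⁻ x, ‖kerOp μ K (S.indicator f) x‖ₑ ^ 2 ∂μ
      ≤ B * ∫⁻ y, ‖S.indicator f y‖ₑ ^ 2 ∂μ) :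
    ∫⁻ x, ‖kerOp μ K f x‖ₑ ^ p ∂μ ≤
      (ENNReal.ofReal (p * 2 / (p - 1)) + ENNReal.ofReal (p * 8 / (2 - p)) * B) *
        ENNReal.ofReal (A ^ (2 - p)) * ∫⁻ y, ‖f y‖ₑ ^ p ∂μ := by
  have hKi : ∀ x, Integrable (K x) μ := fun x =>
    ⟨(hK.comp measurable_prodMk_left).aestronglyMeasurable, by
      rw [hasFiniteIntegral_iff_enorm]; exact (hx x).trans_lt ENNReal.ofReal_lt_top⟩
  rw [lintegral_enorm_rpow_eq (measurable_kerOp hK hf) (by linarith)]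
  set I1 : ℝ → ℝ≥0∞ := fun t => ENNReal.ofReal (t ^ (p - 1 - 1)) *
    ∫⁻ y, {y | A * t < ‖f y‖}.indicator (fun y => ‖f y‖ₑ) y ∂μ with hI1
  set I2 : ℝ → ℝ≥0∞ := fun t => ENNReal.ofReal (t ^ (-(2 - p) - 1)) *
    ∫⁻ y, {y | ‖f y‖ < (2 * A) * t}.indicator (fun y => ‖f y‖ₑ ^ 2) y ∂μ with hI2
  have key : ∀ t : ℝ, 0 < t → μ {x | t < ‖kerOp μ K f x‖} * ENNReal.ofReal (t ^ (p - 1)) ≤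
      ENNReal.ofReal (2 * A) * I1 t + 4 * B * I2 t := by
    intro t ht
    set S : Set α := {y | A * t < ‖f y‖} with hSdef
    have hS : MeasurableSet S := measurableSet_lt measurable_const hf.norm
    have hsub : {x | t < ‖kerOp μ K f x‖} ⊆ {x | t / 2 < ‖kerOp μ K (S.indicator f) x‖} ∪
        {x | t / 2 < ‖kerOp μ K (Sᶜ.indicator f) x‖} := by
      intro x hx1
      have hx1' : t < ‖kerOp μ K f x‖ := hx1
      have h1 := norm_kerOp_split (hKi x) hf hfM hS
      by_cases h : t / 2 < ‖kerOp μ K (S.indicator f) x‖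
      · exact Or.inl h
      · refine Or.inr ?_
        show t / 2 < _
        push Not at h
        linarith
    have h4 := measure_lt_norm_le (μ := μ) (measurable_kerOp (μ := μ) hK (hf.indicator hS)) 1 ht
    have h4' := measure_lt_norm_le (μ := μ) (measurable_kerOp (μ := μ) hK (hf.indicator hS.compl)) 2 ht
    have h5 := lintegral_enorm_kerOp_le hK hy (hf.indicator hS)
    have h5' := hL2 Sᶜ hS.compl
    simp only [pow_one] at h4
    have e1 : ∀ y, ‖S.indicator f y‖ₑ = S.indicator (fun y => ‖f y‖ₑ) y := fun y => by
      simpa using enorm_indicator_pow S f one_ne_zero y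
    simp only [e1] at h5
    have h6 : ∫⁻ y, ‖Sᶜ.indicator f y‖ₑ ^ 2 ∂μ ≤
        ∫⁻ y, {y | ‖f y‖ < (2 * A) * t}.indicator (fun y => ‖f y‖ₑ ^ 2) y ∂μ := by
      refine lintegral_mono fun y => ?_
      rw [enorm_indicator_pow _ _ two_ne_zero]
      refine Set.indicator_le_indicator_of_subset (fun z hz => ?_) (fun _ => zero_le) y
      have hz2 : ‖f z‖ ≤ A * t := not_lt.1 hz
      show ‖f z‖ < 2 * A * t
      nlinarith [mul_pos hA ht]
    have hm : μ {x | t < ‖kerOp μ K f x‖} ≤ ENNReal.ofReal (2 / t) * (ENNReal.ofReal A *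
          ∫⁻ y, S.indicator (fun y => ‖f y‖ₑ) y ∂μ) + ENNReal.ofReal ((2 / t) ^ 2) * (B *
          ∫⁻ y, {y | ‖f y‖ < (2 * A) * t}.indicator (fun y => ‖f y‖ₑ ^ 2) y ∂μ) :=
      (measure_mono hsub).trans ((measure_union_le _ _).trans (add_le_add
        (h4.trans (mul_le_mul_right h5 _))
        (h4'.trans (mul_le_mul_right (h5'.trans (mul_le_mul_right h6 _)) _))))
    refine (mul_le_mul_left hm _).trans_eq ?_
    rw [hI1, hI2]
    dsimp only
    generalize ∫⁻ y, {y | ‖f y‖ < (2 * A) * t}.indicator (fun y => ‖f y‖ₑ ^ 2) y ∂μ = Y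
    generalize ∫⁻ y, S.indicator (fun y => ‖f y‖ₑ) y ∂μ = X
    have a1 : ENNReal.ofReal (2 / t) * ENNReal.ofReal (t ^ (p - 1)) =
        2 * ENNReal.ofReal (t ^ (p - 1 - 1)) := by
      rw [← ENNReal.ofReal_mul (by positivity), show (2 : ℝ≥0∞) = ENNReal.ofReal 2 by norm_num,
        ← ENNReal.ofReal_mul (by norm_num)]
      congr 1
      rw [show t ^ (p - 1) = t ^ (p - 1 - 1) * t ^ 1 by
        rw [← Real.rpow_add_natCast ht.ne']; congr 1; push_cast; ring]
      field_simp
    have a2 : ENNReal.ofReal ((2 / t) ^ 2) * ENNReal.ofReal (t ^ (p - 1)) =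
        4 * ENNReal.ofReal (t ^ (-(2 - p) - 1)) := by
      rw [← ENNReal.ofReal_mul (by positivity), show (4 : ℝ≥0∞) = ENNReal.ofReal 4 by norm_num,
        ← ENNReal.ofReal_mul (by norm_num)]
      congr 1
      rw [show t ^ (p - 1) = t ^ (-(2 - p) - 1) * t ^ 2 by
        rw [← Real.rpow_add_natCast ht.ne']; congr 1; push_cast; ring]
      field_simp
      ring
    rw [ENNReal.ofReal_mul (by norm_num : (0 : ℝ) ≤ 2), show ENNReal.ofReal 2 = 2 by norm_num]
    calc _ = (ENNReal.ofReal (2 / t) * ENNReal.ofReal (t ^ (p - 1))) * (ENNReal.ofReal A * X) +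
          (ENNReal.ofReal ((2 / t) ^ 2) * ENNReal.ofReal (t ^ (p - 1))) * (B * Y) := by ring
      _ = _ := by rw [a1, a2]; ring
  have hfm : Measurable fun y => ‖f y‖ₑ ^ 2 := hf.enorm.pow_const 2
  have hI1m : Measurable I1 := by
    refine Measurable.mul (by fun_prop) ?_
    have hS : MeasurableSet {q : ℝ × α | A * q.1 < ‖f q.2‖} :=
      measurableSet_lt (measurable_fst.const_mul A) (hf.norm.comp measurable_snd)
    have hm : Measurable fun q : ℝ × α => {y | A * q.1 < ‖f y‖}.indicator (fun y => ‖f y‖ₑ) q.2 :=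
      (hf.enorm.comp measurable_snd).indicator hS
    exact hm.lintegral_prod_right'
  have j1 : ∫⁻ t in Set.Ioi (0 : ℝ), I1 t ≤
      ENNReal.ofReal ((A ^ (p - 1))⁻¹ / (p - 1)) * ∫⁻ y, ‖f y‖ₑ ^ p ∂μ := by
    refine (lintegral_superlevel_le hf.norm (fun y => norm_nonneg _) hf.enorm hA
      (by linarith)).trans_eq ?_
    rw [← lintegral_const_mul' _ _ ENNReal.ofReal_ne_top]
    refine lintegral_congr fun y => ?_
    rw [← ofReal_norm, ENNReal.ofReal_rpow_of_nonneg (norm_nonneg _) (by linarith),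
      ← ENNReal.ofReal_mul (by positivity), ← ENNReal.ofReal_mul
        (div_nonneg (by positivity) (by linarith))]
    congr 1
    rw [Real.div_rpow (norm_nonneg _) hA.le]
    rcases (norm_nonneg (f y)).eq_or_lt with h0 | h0
    · rw [← h0, Real.zero_rpow (by linarith : p ≠ 0)]; simp
    · rw [show ‖f y‖ ^ p = ‖f y‖ ^ (p - 1) * ‖f y‖ ^ 1 by
        rw [← Real.rpow_add_natCast h0.ne']; congr 1; push_cast; ring]
      ring
  have j2 : ∫⁻ t in Set.Ioi (0 : ℝ), I2 t ≤
      ENNReal.ofReal ((2 * A) ^ (2 - p) / (2 - p)) * ∫⁻ y, ‖f y‖ₑ ^ p ∂μ := by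
    refine (lintegral_sublevel_le hf.norm (fun y => norm_nonneg _) hfm (fun y h => ?_)
      (by positivity : 0 < 2 * A) (by linarith)).trans_eq ?_
    · rw [← ofReal_norm, h]; simp
    rw [← lintegral_const_mul' _ _ ENNReal.ofReal_ne_top]
    refine lintegral_congr fun y => ?_
    rw [← ofReal_norm, ENNReal.ofReal_rpow_of_nonneg (norm_nonneg _) (by linarith),
      ← ENNReal.ofReal_pow (norm_nonneg _),
      ← ENNReal.ofReal_mul (by positivity), ← ENNReal.ofReal_mul
        (div_nonneg (by positivity) (by linarith))]
    congr 1
    rcases (norm_nonneg (f y)).eq_or_lt with h0 | h0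
    · rw [← h0, Real.zero_rpow (by linarith : p ≠ 0)]; simp
    · rw [show ‖f y‖ ^ p = ‖f y‖ ^ (-(2 - p)) * ‖f y‖ ^ 2 by
        rw [← Real.rpow_add_natCast h0.ne']; congr 1; push_cast; ring,
        Real.div_rpow (norm_nonneg _) (by positivity), Real.rpow_neg (by positivity : 0 ≤ 2 * A),
        div_inv_eq_mul]
      ring
  have hY : (2 : ℝ) ^ (2 - p) ≤ 2 := by
    calc (2 : ℝ) ^ (2 - p) ≤ 2 ^ (1 : ℝ) :=
          Real.rpow_le_rpow_of_exponent_le (by norm_num) (by linarith)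
      _ = 2 := by norm_num
  have b1 : ENNReal.ofReal p * (ENNReal.ofReal (2 * A) *
      ENNReal.ofReal ((A ^ (p - 1))⁻¹ / (p - 1))) =
        ENNReal.ofReal (p * 2 / (p - 1)) * ENNReal.ofReal (A ^ (2 - p)) := by
    rw [← ENNReal.ofReal_mul (by positivity), ← ENNReal.ofReal_mul (by linarith),
      ← ENNReal.ofReal_mul (div_nonneg (by linarith) (by linarith))]
    congr 1
    rw [show 2 - p = -(p - 1) + (1 : ℕ) by push_cast; ring, Real.rpow_add_natCast hA.ne',
      Real.rpow_neg hA.le]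
    ring
  have b2 : ENNReal.ofReal p * (4 * ENNReal.ofReal ((2 * A) ^ (2 - p) / (2 - p))) ≤
      ENNReal.ofReal (p * 8 / (2 - p)) * ENNReal.ofReal (A ^ (2 - p)) := by
    have h2p : 0 < 2 - p := by linarith
    rw [show (4 : ℝ≥0∞) = ENNReal.ofReal 4 by norm_num, ← ENNReal.ofReal_mul (by norm_num),
      ← ENNReal.ofReal_mul (by linarith), ← ENNReal.ofReal_mul (by positivity)]
    refine ENNReal.ofReal_le_ofReal ?_
    rw [Real.mul_rpow (by norm_num) hA.le]
    calc p * (4 * (2 ^ (2 - p) * A ^ (2 - p) / (2 - p)))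
        = p * 4 / (2 - p) * 2 ^ (2 - p) * A ^ (2 - p) := by ring
      _ ≤ p * 4 / (2 - p) * 2 * A ^ (2 - p) := by gcongr
      _ = _ := by ring
  calc _ ≤ ENNReal.ofReal p * ∫⁻ t in Set.Ioi (0 : ℝ),
        (ENNReal.ofReal (2 * A) * I1 t + 4 * B * I2 t) :=
        mul_le_mul_right (setLIntegral_mono' measurableSet_Ioi fun t ht => key t ht) _
    _ = ENNReal.ofReal p * (ENNReal.ofReal (2 * A) * (∫⁻ t in Set.Ioi (0 : ℝ), I1 t) +
        4 * B * ∫⁻ t in Set.Ioi (0 : ℝ), I2 t) := by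
        rw [lintegral_add_left (hI1m.const_mul _), lintegral_const_mul' _ _ ENNReal.ofReal_ne_top,
          lintegral_const_mul' _ _ (ENNReal.mul_ne_top (by norm_num) hBt)]
    _ ≤ ENNReal.ofReal p * (ENNReal.ofReal (2 * A) * (ENNReal.ofReal ((A ^ (p - 1))⁻¹ / (p - 1)) *
          ∫⁻ y, ‖f y‖ₑ ^ p ∂μ) + 4 * B * (ENNReal.ofReal ((2 * A) ^ (2 - p) / (2 - p)) *
          ∫⁻ y, ‖f y‖ₑ ^ p ∂μ)) := by gcongr
    _ = ((ENNReal.ofReal p * (ENNReal.ofReal (2 * A) *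
          ENNReal.ofReal ((A ^ (p - 1))⁻¹ / (p - 1)))) + (ENNReal.ofReal p *
          (4 * ENNReal.ofReal ((2 * A) ^ (2 - p) / (2 - p)))) * B) * ∫⁻ y, ‖f y‖ₑ ^ p ∂μ := by ring
    _ ≤ (ENNReal.ofReal (p * 2 / (p - 1)) * ENNReal.ofReal (A ^ (2 - p)) +
          (ENNReal.ofReal (p * 8 / (2 - p)) * ENNReal.ofReal (A ^ (2 - p))) * B) *
          ∫⁻ y, ‖f y‖ₑ ^ p ∂μ := by rw [b1]; gcongr
    _ = _ := by ring

end Interpolation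

section QuotPhase

variable {n : ℕ} {φ : Rn n → Rn n → ℝ} {c : Rn n → ℝ}

/-- The difference quotient `μ⁻¹ c(η) (φ(x + μ v, η) - φ(x, η))`, smoothly extended to `μ = 0`. -/
def quotPhase (φ : Rn n → Rn n → ℝ) (c : Rn n → ℝ) (x : Rn n) (μ : ℝ) (v η : Rn n) : ℝ :=
  ∫ s : unitInterval, (c η • partialFst φ (x + ((s : ℝ) * μ) • v) η) v

theorem PhaseClass.contDiff_partialFst (hφ : PhaseClass n 2 φ)
    (hc : ContDiff ℝ (⊤ : ℕ∞) c) (hcs : HasCompactSupport c) (hcU : tsupport c ⊆ {ξ | ξ ≠ 0}) :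
    ContDiff ℝ (⊤ : ℕ∞) (fun p : Rn n × Rn n => c p.2 • partialFst φ p.1 p.2) :=
  (hφ.UBd_partialFst hc hcs hcU).smooth ()

theorem PhaseClass.hasDerivAt_fst (hφ : PhaseClass n 2 φ) (x : Rn n) {η : Rn n} (hη : η ≠ 0)
    (w : Rn n) (s : ℝ) :
    HasDerivAt (fun s : ℝ => φ (x + s • w) η) (partialFst φ (x + s • w) η w) s := by
  have hl : HasDerivAt (fun s : ℝ => x + s • w) w s := by
    simpa using ((hasDerivAt_id s).smul_const w).const_add x
  have h1 := HasFDerivAt.comp (f := fun x' => (x', η)) (x + s • w)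
    (hφ.smoothOver.hasFDerivAt isOpen_ne_zero (x + s • w) hη) (hasFDerivAt_prodMk_left _ η)
  have h2 : HasFDerivAt (fun x' => φ x' η) (partialFst φ (x + s • w) η) (x + s • w) :=
    h1.differentiableAt.hasFDerivAt
  exact h2.comp_hasDerivAt s hl

theorem PhaseClass.mul_quotPhase (hφ : PhaseClass n 2 φ)
    (hc : ContDiff ℝ (⊤ : ℕ∞) c) (hcs : HasCompactSupport c) (hcU : tsupport c ⊆ {ξ | ξ ≠ 0})
    (x : Rn n) (μ : ℝ) (v η : Rn n) :
    μ * quotPhase φ c x μ v η = c η * (φ (x + μ • v) η - φ x η) := by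
  by_cases h0 : c η = 0
  · simp [quotPhase, h0]
  have hη : η ≠ 0 := hcU (subset_tsupport _ h0)
  have h1 := fun s (_ : s ∈ Set.Icc (0 : ℝ) 1) =>
    (hφ.hasDerivAt_fst x hη (μ • v) s).const_mul (c η)
  have h2 := ftc_unitInterval h1 (by
    have h3 := (hφ.contDiff_partialFst hc hcs hcU).continuous
    have h4 : Continuous fun s : ℝ => c η • partialFst φ (x + s • μ • v) η :=
      h3.comp (f := fun s : ℝ => (x + s • μ • v, η)) (by fun_prop)
    have h5 : Continuous fun s : ℝ => (c η • partialFst φ (x + s • μ • v) η) (μ • v) :=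
      h4.clm_apply continuous_const
    exact h5.continuousOn)
  simp only [one_smul, zero_smul, add_zero] at h2
  rw [mul_sub, h2, quotPhase, ← integral_const_mul]
  refine integral_congr_ae (Filter.Eventually.of_forall fun s => ?_)
  show μ * _ = _
  simp only [smul_apply, smul_eq_mul, map_smul, smul_smul]
  ring

theorem PhaseClass.UBd_quotPhase_snd (hφ : PhaseClass n 2 φ)
    (hc : ContDiff ℝ (⊤ : ℕ∞) c) (hcs : HasCompactSupport c) (hcU : tsupport c ⊆ {ξ | ξ ≠ 0}) :
    UBd (fun (j : Rn n × {u : Rn n // ‖u‖ ≤ 1} × ℝ) η => quotPhase φ c j.1 j.2.2 j.2.1 η)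
      (fun _ _ => 1) (fun _ _ => 1) := by
  have hG := hφ.UBd_partialFst hc hcs hcU
  refine UBd.integral_unit (f := fun (j : Rn n × {u : Rn n // ‖u‖ ≤ 1} × ℝ) (q : ℝ × Rn n) =>
    (c q.2 • partialFst φ (j.1 + (q.1 * j.2.2) • (j.2.1 : Rn n)) q.2) (j.2.1 : Rn n))
    (fun j => ?_) ?_ (fun _ => continuous_const) (fun _ => continuous_const)
  · have h := (hG.smooth ()).comp (f := fun q : ℝ × Rn n =>
      (j.1 + (q.1 * j.2.2) • (j.2.1 : Rn n), q.2)) (by fun_prop)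
    exact h.clm_apply contDiff_const
  · have h1 := hG.comp_affine (fun _ _ => zero_le_one) (fun _ _ => zero_le_one)
      (fun _ : (Rn n × {u : Rn n // ‖u‖ ≤ 1} × ℝ) × unitInterval => ())
      (fun _ => ContinuousLinearMap.inr ℝ (Rn n) (Rn n))
      (fun j => (j.1.1 + ((j.2 : ℝ) * j.1.2.2) • (j.1.2.1 : Rn n), 0)) (fun _ => 1)
      (fun _ => ContinuousLinearMap.norm_inr_le_one ℝ (Rn n) (Rn n))
    have h2 : UBd (fun (j : (Rn n × {u : Rn n // ‖u‖ ≤ 1} × ℝ) × unitInterval) (_ : Rn n) =>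
      (j.1.2.1 : Rn n)) (fun _ _ => 1) (fun _ _ => 1) :=
      UBd.const (fun j : (Rn n × {u : Rn n // ‖u‖ ≤ 1} × ℝ) × unitInterval => (j.1.2.1 : Rn n)) 1
        fun j => j.1.2.1.2
    simp only [one_mul] at h1
    have h3 := h1.bilin (ContinuousLinearMap.id ℝ (Rn n →L[ℝ] ℝ)) h2 (fun _ _ => zero_le_one)
      (fun _ _ => zero_le_one)
    simpa using h3

theorem annCut_eventually_eq_one {r₁ r₂ : ℝ} (h₁ : 0 < r₁) (h₂ : 0 < r₂) {ξ : Rn n}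
    (h : r₁ < ‖ξ‖) (h' : ‖ξ‖ < r₂) : ∀ᶠ η in nhds ξ, annCut n r₁ r₂ η = 1 := by
  have h3 := (continuous_norm (E := Rn n)).continuousAt (x := ξ)
  filter_upwards [h3.eventually (lt_mem_nhds h), h3.eventually (gt_mem_nhds h')] with η h4 h5
  exact annCut_eq_one h₁ h₂ h4.le h5.le

theorem PhaseClass.exists_fderiv_quotPhase_lower (hφ : PhaseClass n 2 φ) (hs : SNDCondition n φ) :
    ∃ k : ℝ, 0 < k ∧ ∀ x u η : Rn n, ∀ r : ℝ, 0 < r → ‖u‖ = 1 → 1 / 4 ≤ ‖η‖ → ‖η‖ ≤ 4 →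
      k ≤ ‖sharp n (fderiv ℝ (quotPhase φ (annCut n (1 / 8) 8) x r u) η)‖ := by
  obtain ⟨k, hk, h⟩ := hφ.exists_phaseGrad_antilipschitz hs
  refine ⟨k, hk, fun x u η r hr hu h1 h2 => ?_⟩
  have hη : η ≠ 0 := norm_ne_zero_iff.1 (by linarith)
  have hd : ∀ y, HasFDerivAt (φ y) (partialSnd φ y η) η := fun y => by
    have h3 := HasFDerivAt.comp (f := fun ξ' => (y, ξ')) η
      (hφ.smoothOver.hasFDerivAt isOpen_ne_zero y hη) (hasFDerivAt_prodMk_right y η)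
    exact h3.differentiableAt.hasFDerivAt
  have h4 : fderiv ℝ (quotPhase φ (annCut n (1 / 8) 8) x r u) η =
      r⁻¹ • (partialSnd φ (x + r • u) η - partialSnd φ x η) := by
    refine HasFDerivAt.fderiv ?_
    refine (((hd (x + r • u)).sub (hd x)).const_smul r⁻¹).congr_of_eventuallyEq ?_
    filter_upwards [annCut_eventually_eq_one (r₁ := 1 / 8) (r₂ := 8) (by norm_num) (by norm_num)
      (by linarith : 1 / 8 < ‖η‖) (by linarith)] with ξ hξ
    have h5 := hφ.mul_quotPhase (contDiff_annCut (1 / 8) 8)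
      (hasCompactSupport_annCut (by norm_num) (by norm_num))
      (tsupport_annCut (by norm_num) (by norm_num)) x r u ξ
    rw [hξ, one_mul] at h5
    simp only [Pi.smul_apply, Pi.sub_apply, smul_eq_mul]
    rw [← h5, inv_mul_cancel_left₀ hr.ne']
  have h6 := h η hη (x + r • u) x
  rw [add_sub_cancel_left, norm_smul, hu, mul_one, Real.norm_of_nonneg hr.le, phaseGrad, phaseGrad,
    ← map_sub] at h6
  rw [h4, map_smul, norm_smul, norm_inv, Real.norm_of_nonneg hr.le, ← div_eq_inv_mul,
    le_div_iff₀ hr]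
  exact h6

end QuotPhase

section PhaseDifference

variable {n : ℕ} {φ : Rn n → Rn n → ℝ} {ι : Type*}

theorem norm_cexp_I_mul (t : ℝ) : ‖cexp (I * (t : ℂ))‖ = 1 := by
  rw [mul_comm]; exact Complex.norm_exp_ofReal_mul_I _

theorem norm_integral_mul_cexp_le {X : Type*} [MeasurableSpace X] {μ : Measure X} {w : X → ℝ}
    (hw : Integrable w μ) {C : ℝ} {B : X → ℂ} (hB : ∀ v, ‖B v‖ ≤ C * w v) (θ : X → ℝ) :
    ‖∫ v, B v * cexp (I * (θ v : ℂ)) ∂μ‖ ≤ C * ∫ v, w v ∂μ := by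
  rw [← integral_const_mul]
  refine norm_integral_le_of_norm_le (hw.const_mul _) (Filter.Eventually.of_forall fun v => ?_)
  rw [norm_mul, norm_cexp_I_mul, mul_one]; exact hB v

theorem UBd.conj {f : ι → Rn n → ℂ} {w ρ : ι → Rn n → ℝ} (hf : UBd f w ρ) :
    UBd (fun i v => (starRingEnd ℂ) (f i v)) w ρ :=
  hf.clm_comp (Complex.conjCLE : ℂ →L[ℝ] ℂ)

theorem phase_difference_decay (hφ : PhaseClass n 2 φ) (hs : SNDCondition n φ)
    {β : ι → Rn n → Rn n → ℂ}
    (hβ : UBd (fun (j : ι × Rn n) η => β j.1 j.2 η) (fun _ _ => 1) (fun _ _ => 1))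
    (hsupp : ∀ j x η, β j x η ≠ 0 → 1 / 4 ≤ ‖η‖ ∧ ‖η‖ ≤ 4) (N : ℕ) :
    ∃ C : ℝ, 0 ≤ C ∧ ∀ j (x z : Rn n) (lam : ℝ), 0 < lam →
      ‖∫ η, ((starRingEnd ℂ) (β j z η) * β j x η) *
        cexp (I * ((lam * (φ x η - φ z η) : ℝ) : ℂ))‖ ≤ C * ((1 + lam * ‖x - z‖) ^ N)⁻¹ := by
  set w : Rn n → ℝ := fun v => ((1 + ‖v‖) ^ (n + 1))⁻¹ with hw
  have hwi : Integrable w := integrable_weight n (Nat.lt_succ_self n)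
  have hw0 : ∀ v, 0 ≤ w v := fun v => by positivity
  have hB0 : UBd (fun (j : ι × Rn n × Rn n) η => (starRingEnd ℂ) (β j.1 j.2.2 η) * β j.1 j.2.1 η)
      (fun _ v => w v) (fun _ _ => 1) := by
    have h1 := hβ.reindex (fun j : ι × Rn n × Rn n => (j.1, j.2.1))
    have h2 := (hβ.reindex (fun j : ι × Rn n × Rn n => (j.1, j.2.2))).conj
    have h3 := h2.bilin (ContinuousLinearMap.mul ℝ ℂ) h1 (fun _ _ => zero_le_one)
      (fun _ _ => zero_le_one)
    refine h3.of_support (fun _ => Metric.closedBall 0 4) (fun _ => Metric.isClosed_closedBall)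
      (fun i v hv => ?_) (5 ^ (n + 1)) (by positivity) (fun _ _ => by norm_num)
      (fun _ _ => zero_le_one) (fun _ v => hw0 v) (fun _ _ => zero_le_one) (fun i v hv => ?_)
      (fun i v hv => by rw [mul_one]; exact one_le_pow₀ (by norm_num))
    · have : β i.1 i.2.1 v = 0 := by
        by_contra h
        exact hv (mem_closedBall_zero_iff.2 (hsupp _ _ _ h).2)
      simp [this]
    · rw [mem_closedBall_zero_iff] at hv
      simp only [hw, mul_one]
      rw [← div_eq_mul_inv, le_div_iff₀ (by positivity), one_mul]
      gcongr
      linarith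
  let J := ι × Rn n × {u : Rn n // ‖u‖ = 1} × {r : ℝ // 0 < r}
  let σ : J → ι × Rn n × Rn n := fun j => (j.1, j.2.1 + (j.2.2.2 : ℝ) • (j.2.2.1 : Rn n), j.2.1)
  let τ : J → Rn n × {u : Rn n // ‖u‖ ≤ 1} × ℝ := fun j =>
    (j.2.1, ⟨j.2.2.1, j.2.2.1.2.le⟩, (j.2.2.2 : ℝ))
  obtain ⟨k, hk, hlow⟩ := hφ.exists_fderiv_quotPhase_lower hs
  have hc1 : ∀ η : Rn n, 1 / 4 ≤ ‖η‖ → ‖η‖ ≤ 4 → annCut n (1 / 8) 8 η = 1 := fun η h1 h2 =>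
    annCut_eq_one (by norm_num) (by norm_num) (by linarith) (by linarith)
  have hcC := contDiff_annCut (n := n) (1 / 8) 8
  have hcs : HasCompactSupport (annCut n (1 / 8) 8) := hasCompactSupport_annCut (by norm_num) (by norm_num)
  have hcU : tsupport (annCut n (1 / 8) 8) ⊆ {ξ | ξ ≠ 0} :=
    tsupport_annCut (by norm_num) (by norm_num)
  generalize annCut n (1 / 8) 8 = c at *
  have hT0 := hφ.UBd_quotPhase_snd hcC hcs hcU
  have hT : UBd (fun (j : J) (p : Rn n × ℝ) =>
      quotPhase φ c j.2.1 j.2.2.2 j.2.2.1 p.1) (fun _ _ => 1) (fun _ _ => 1) := by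
    have := hT0.comp_affine (fun _ v => zero_le_one) (fun _ _ => zero_le_one) τ
      (fun _ => ContinuousLinearMap.fst ℝ (Rn n) ℝ) (fun _ => 0) (fun _ => 1)
      (fun _ => ContinuousLinearMap.norm_fst_le ℝ (Rn n) ℝ)
    simpa [τ] using this
  have hBp : UBd (fun (j : J) (p : Rn n × ℝ) =>
      (starRingEnd ℂ) (β j.1 j.2.1 p.1) * β j.1 (j.2.1 + (j.2.2.2 : ℝ) • (j.2.2.1 : Rn n)) p.1)
      (fun _ p => w p.1) (fun _ _ => 1) := by
    have := hB0.comp_affine (fun _ v => hw0 v) (fun _ _ => zero_le_one) σ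
      (fun _ => ContinuousLinearMap.fst ℝ (Rn n) ℝ) (fun _ => 0) (fun _ => 1)
      (fun _ => ContinuousLinearMap.norm_fst_le ℝ (Rn n) ℝ)
    simpa [σ] using this
  have hW : UBd (fun (j : J) (p : Rn n × ℝ) =>
      sharp n (fderiv ℝ (quotPhase φ c j.2.1 j.2.2.2 j.2.2.1) p.1))
      (fun _ _ => 1) (fun _ _ => 1) := by
    have h1 := (hT0.fderiv_bound.clm_comp (sharp n)).comp_affine (fun _ v => by norm_num)
      (fun _ _ => zero_le_one) τ
      (fun _ => ContinuousLinearMap.fst ℝ (Rn n) ℝ) (fun _ => 0) (fun _ => 1)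
      (fun _ => ContinuousLinearMap.norm_fst_le ℝ (Rn n) ℝ)
    simpa [τ] using h1
  obtain ⟨V, hV, hVW⟩ := hW.exists_normalize hk
    (fun _ => {p : Rn n × ℝ | 1 / 4 ≤ ‖p.1‖ ∧ ‖p.1‖ ≤ 4})
    (fun j p hp => hlow _ _ _ _ j.2.2.2.2 j.2.2.1.2 hp.1 hp.2)
  obtain ⟨C2, hC2, hb2⟩ := hT0.fderiv_bound.norm_le
  obtain ⟨B', hB', -, hintg⟩ := exists_nsp hBp hV
    (Θ := fun (j : J) (p : Rn n × ℝ) => quotPhase φ c j.2.1 j.2.2.2 j.2.2.1 p.1)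
    (fun _ p => hw0 p.1) (fun _ _ => hwi) (fun j => hT.smooth j)
    (fun j _ => ⟨C2, fun v => by simpa using hb2 (τ j) v⟩)
    (fun _ => {p : Rn n × ℝ | 1 / 4 ≤ ‖p.1‖ ∧ ‖p.1‖ ≤ 4})
    (fun _ => (isClosed_le continuous_const continuous_fst.norm).inter
      (isClosed_le continuous_fst.norm continuous_const))
    (fun j p hp => by
      have : β j.1 j.2.1 p.1 = 0 := by
        by_contra h
        exact hp (hsupp _ _ _ h)
      simp [this])
    (fun j p hp => by
      have := hVW j p hp
      rwa [inner_sharp] at this) N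
  obtain ⟨C0, hC0, hb0⟩ := hB0.norm_le
  obtain ⟨C1, hC1, hb1⟩ := hB'.norm_le
  set A := ∫ v, w v with hA
  have hA0 : 0 ≤ A := integral_nonneg hw0
  refine ⟨2 ^ N * ((C0 + C1) * A), by positivity, fun i x z lam hlam => ?_⟩
  by_cases hξ : lam * ‖x - z‖ ≤ 1
  · have h1 := norm_integral_mul_cexp_le hwi (hb0 (i, x, z)) fun η => lam * (φ x η - φ z η)
    refine h1.trans ?_
    have : 0 ≤ lam * ‖x - z‖ := by positivity
    rw [← hA, ← div_eq_mul_inv, le_div_iff₀ (by positivity)]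
    calc C0 * A * (1 + lam * ‖x - z‖) ^ N ≤ ((C0 + C1) * A) * 2 ^ N := by
          gcongr
          · linarith
          · linarith
      _ = _ := by ring
  · push Not at hξ
    have hr : 0 < ‖x - z‖ := by
      by_contra! h
      nlinarith [norm_nonneg (x - z)]
    obtain ⟨j, hj1, hj2, hj3, hj4⟩ : ∃ j : J, j.1 = i ∧ j.2.1 = z ∧
        (j.2.2.1 : Rn n) = ‖x - z‖⁻¹ • (x - z) ∧ (j.2.2.2 : ℝ) = ‖x - z‖ :=
      ⟨(i, z, ⟨‖x - z‖⁻¹ • (x - z), by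
        rw [norm_smul, norm_inv, norm_norm, inv_mul_cancel₀ hr.ne']⟩, ⟨‖x - z‖, hr⟩), rfl, rfl,
        rfl, rfl⟩
    have hx : z + ‖x - z‖ • (‖x - z‖⁻¹ • (x - z)) = x := by
      rw [smul_smul, mul_inv_cancel₀ hr.ne', one_smul, add_sub_cancel]
    have h1 := hintg j 0 (lam * ‖x - z‖) (by positivity)
    simp only [hj1, hj2, hj3, hj4, hx] at h1
    have h2 : ∫ η, ((starRingEnd ℂ) (β i z η) * β i x η) *
        cexp (I * ((lam * (φ x η - φ z η) : ℝ) : ℂ)) =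
        ∫ v, (starRingEnd ℂ) (β i z v) * β i x v * cexp (I * ((lam * ‖x - z‖ *
          quotPhase φ c z ‖x - z‖ (‖x - z‖⁻¹ • (x - z)) v : ℝ) : ℂ)) := by
      refine integral_congr_ae (Filter.Eventually.of_forall fun η => ?_)
      show _ * _ = _ * _
      by_cases hb : β i x η = 0
      · simp [hb]
      · have h3 := hφ.mul_quotPhase hcC hcs hcU z ‖x - z‖ (‖x - z‖⁻¹ • (x - z)) η
        have h4 := hsupp _ _ _ hb
        rw [hc1 η h4.1 h4.2, one_mul, hx] at h3
        rw [mul_assoc lam, h3]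
    rw [h2, h1, norm_mul, norm_pow, norm_inv, Complex.norm_real, Real.norm_of_nonneg (by positivity)]
    have h3 := norm_integral_mul_cexp_le hwi (C := C1) (B := fun v => B' j (v, 0))
      (fun v => hb1 j (v, 0)) (fun v => lam * ‖x - z‖ *
        quotPhase φ c z ‖x - z‖ (‖x - z‖⁻¹ • (x - z)) v)
    rw [← hA] at h3
    have h5 : C1 * A ≤ (C0 + C1) * A := mul_le_mul_of_nonneg_right (by linarith) hA0
    have h6 := h3.trans h5
    clear_value A
    exact inv_pow_mul_le_of_one_le hξ.le (by positivity) h6 N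

end PhaseDifference

section KernelOperator

variable {n : ℕ} {φ : Rn n → Rn n → ℝ} {ι : Type*}

theorem contDiff_mul_cexp_phase (hφ : PhaseSmoothHomog n φ) {b : Rn n → ℂ}
    (hb : ContDiff ℝ (⊤ : ℕ∞) b) {r : ℝ} (hr : 0 < r) (h0 : ∀ η, ‖η‖ < r → b η = 0) (lam : ℝ)
    (x : Rn n) : ContDiff ℝ (⊤ : ℕ∞) fun η => b η * cexp (I * ((lam * φ x η : ℝ) : ℂ)) := by
  refine contDiff_iff_contDiffAt.2 fun η => ?_
  by_cases hη : η = 0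
  · subst hη
    refine (contDiffAt_const (c := (0 : ℂ))).congr_of_eventuallyEq ?_
    filter_upwards [Metric.ball_mem_nhds (0 : Rn n) hr] with ξ hξ
    rw [h0 ξ (by simpa using hξ), zero_mul]
  · have h1 : ContDiffAt ℝ (⊤ : ℕ∞) (φ x) η :=
      (hφ.1.contDiffAt (x := (x, η))
        ((isOpen_ne_fun continuous_snd continuous_const).mem_nhds hη)).comp (f := fun ξ => (x, ξ)) η
        (by fun_prop)
    have h2 : ContDiffAt ℝ (⊤ : ℕ∞) (fun ξ => ((lam * φ x ξ : ℝ) : ℂ)) η :=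
      Complex.ofRealCLM.contDiff.contDiffAt.comp η (contDiffAt_const.mul h1)
    exact hb.contDiffAt.mul (contDiffAt_const.mul h2).cexp

theorem integral_conj_oscInt_mul_oscInt (hφ : PhaseSmoothHomog n φ) {b : Rn n → Rn n → ℂ}
    (hb : ∀ x, ContDiff ℝ (⊤ : ℕ∞) (b x))
    (hsupp : ∀ x η, b x η ≠ 0 → 1 / 4 ≤ ‖η‖ ∧ ‖η‖ ≤ 4) {lam : ℝ} (hlam : 0 < lam) (x z : Rn n) :
    ∫ y, (starRingEnd ℂ) (oscInt n φ lam b z y) * oscInt n φ lam b x y =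
      (((2 * Real.pi / lam) ^ n : ℝ) : ℂ) * ∫ η, ((starRingEnd ℂ) (b z η) * b x η) *
        cexp (I * ((lam * (φ x η - φ z η) : ℝ) : ℂ)) := by
  have h0 : ∀ x η, ‖η‖ < 1 / 4 → b x η = 0 := fun x η h => by
    by_contra h2
    linarith [(hsupp x η h2).1]
  have hG := fun x => contDiff_mul_cexp_phase hφ (hb x) (by norm_num) (h0 x) lam x
  have hGs : ∀ x, HasCompactSupport fun η => b x η * cexp (I * ((lam * φ x η : ℝ) : ℂ)) := fun x =>
    HasCompactSupport.of_support_subset_isCompact (isCompact_closedBall 0 4) fun η hη => by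
      rw [mem_closedBall_zero_iff]
      exact (hsupp x η (left_ne_zero_of_mul hη)).2
  set G : Rn n → SchwartzMap (Rn n) ℂ := fun x => (hGs x).toSchwartzMap (hG x) with hGdef
  have hosc : ∀ x y, oscInt n φ lam b x y =
      FourierTransform.fourier (G x) ((lam / (2 * Real.pi)) • y) := by
    intro x y
    rw [SchwartzMap.fourier_coe, Real.fourier_eq', oscInt]
    refine integral_congr_ae (Filter.Eventually.of_forall fun η => ?_)
    show _ = _ • (b x η * cexp (I * ((lam * φ x η : ℝ) : ℂ)))
    rw [smul_eq_mul, mul_left_comm, ← Complex.exp_add]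
    have e : -2 * Real.pi * ⟪η, (lam / (2 * Real.pi)) • y⟫_ℝ + lam * φ x η =
        lam * (φ x η - ⟪y, η⟫_ℝ) := by
      rw [inner_smul_right, real_inner_comm]
      field_simp
      ring
    rw [mul_comm _ I, ← mul_add, ← Complex.ofReal_add, e]
  have hpl := SchwartzMap.integral_inner_fourier_fourier (G z) (G x)
  have hc : |((lam / (2 * Real.pi)) ^ Module.finrank ℝ (Rn n))⁻¹| = (2 * Real.pi / lam) ^ n := by
    rw [finrank_euclideanSpace_fin, abs_of_pos (by positivity), ← inv_pow, inv_div]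
  calc ∫ y, (starRingEnd ℂ) (oscInt n φ lam b z y) * oscInt n φ lam b x y
      = ∫ y, (fun ξ => ⟪FourierTransform.fourier (G z) ξ, FourierTransform.fourier (G x) ξ⟫_ℂ)
          ((lam / (2 * Real.pi)) • y) := by
        refine integral_congr_ae (Filter.Eventually.of_forall fun y => ?_)
        show (starRingEnd ℂ) (oscInt n φ lam b z y) * oscInt n φ lam b x y = ⟪_, _⟫_ℂ
        rw [hosc, hosc, RCLike.inner_apply, mul_comm]
    _ = (((2 * Real.pi / lam) ^ n : ℝ) : ℂ) * ∫ ξ, ⟪G z ξ, G x ξ⟫_ℂ := by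
        rw [Measure.integral_comp_smul volume (fun ξ => ⟪FourierTransform.fourier (G z) ξ,
          FourierTransform.fourier (G x) ξ⟫_ℂ), hc, hpl, Complex.real_smul]
    _ = _ := by
        congr 1
        refine integral_congr_ae (Filter.Eventually.of_forall fun η => ?_)
        show ⟪b z η * cexp (I * ((lam * φ z η : ℝ) : ℂ)),
          b x η * cexp (I * ((lam * φ x η : ℝ) : ℂ))⟫_ℂ = _
        rw [RCLike.inner_apply, map_mul, ← Complex.exp_conj, map_mul, Complex.conj_I,
          Complex.conj_ofReal, mul_mul_mul_comm, ← Complex.exp_add, mul_comm (b x η)]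
        congr 2
        push_cast
        ring

theorem lintegral_decay_le {C lam : ℝ} (hC : 0 ≤ C) (hlam : 0 < lam) (x : Rn n) :
    ∫⁻ z : Rn n, ENNReal.ofReal (C * lam ^ n * ((1 + lam * ‖x - z‖) ^ (n + 1))⁻¹) ≤
      ENNReal.ofReal (C * ∫ v : Rn n, ((1 + ‖v‖) ^ (n + 1))⁻¹) := by
  have hi := integrable_weight n (Nat.lt_succ_self n)
  have h1 : ∀ z : Rn n, C * lam ^ n * ((1 + lam * ‖x - z‖) ^ (n + 1))⁻¹ =
      (fun v : Rn n => C * lam ^ n * (fun u : Rn n => ((1 + ‖u‖) ^ (n + 1))⁻¹) (lam • v)) (x - z) := by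
    intro z
    simp only [norm_smul, Real.norm_of_nonneg hlam.le]
  simp only [h1]
  rw [lintegral_sub_left_eq_self (μ := volume) (fun v : Rn n => ENNReal.ofReal (C * lam ^ n *
    (fun u : Rn n => ((1 + ‖u‖) ^ (n + 1))⁻¹) (lam • v))) x]
  rw [← ofReal_integral_eq_lintegral_ofReal ((hi.comp_smul hlam.ne').const_mul _)
    (Filter.Eventually.of_forall fun v => by positivity), integral_const_mul,
    Measure.integral_comp_smul volume (fun u : Rn n => ((1 + ‖u‖) ^ (n + 1))⁻¹),
    finrank_euclideanSpace_fin, abs_of_pos (by positivity), smul_eq_mul]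
  refine ENNReal.ofReal_le_ofReal (le_of_eq ?_)
  field_simp

/-- The kernel of the frequency-localised operator, up to the constant `(2π)⁻ⁿ`. -/
def oscKernel (n : ℕ) (φ : Rn n → Rn n → ℝ) (lam : ℝ) (b : Rn n → Rn n → ℂ) (x y : Rn n) : ℂ :=
  ((lam ^ n : ℝ) : ℂ) * oscInt n φ lam b x y

theorem oscKernel_almost_orthogonal (hφ : PhaseClass n 2 φ) (hs : SNDCondition n φ)
    {lam : ι → ℝ} (hlam : ∀ j, 0 < lam j) {β : ι → Rn n → Rn n → ℂ}
    (hβ : UBd (fun (j : ι × Rn n) η => β j.1 j.2 η) (fun _ _ => 1) (fun _ _ => 1))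
    (hsupp : ∀ j x η, β j x η ≠ 0 → 1 / 4 ≤ ‖η‖ ∧ ‖η‖ ≤ 4) :
    ∃ B : ℝ≥0, ∀ j x, ∫⁻ z, ‖∫ y, (starRingEnd ℂ) (oscKernel n φ (lam j) (β j) z y) *
      oscKernel n φ (lam j) (β j) x y‖ₑ ≤ B := by
  obtain ⟨C, hC, h⟩ := phase_difference_decay hφ hs hβ hsupp (n + 1)
  refine ⟨Real.toNNReal ((2 * Real.pi) ^ n * C * ∫ v : Rn n, ((1 + ‖v‖) ^ (n + 1))⁻¹),
    fun j x => ?_⟩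
  have hl := hlam j
  have hp := Real.pi_pos
  refine (lintegral_mono fun z => ?_).trans
    (lintegral_decay_le (C := (2 * Real.pi) ^ n * C) (by positivity) hl x)
  have h1 : ∫ y, (starRingEnd ℂ) (oscKernel n φ (lam j) (β j) z y) *
      oscKernel n φ (lam j) (β j) x y = ((lam j ^ n * lam j ^ n : ℝ) : ℂ) *
      ∫ y, (starRingEnd ℂ) (oscInt n φ (lam j) (β j) z y) * oscInt n φ (lam j) (β j) x y := by
    rw [← integral_const_mul]
    refine integral_congr_ae (Filter.Eventually.of_forall fun y => ?_)
    show (starRingEnd ℂ) (_ * _) * (_ * _) = _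
    rw [map_mul, Complex.conj_ofReal]
    push_cast
    ring
  have hsm : ∀ x, ContDiff ℝ (⊤ : ℕ∞) (β j x) := fun x => hβ.smooth (j, x)
  rw [h1, integral_conj_oscInt_mul_oscInt hφ.1 hsm (hsupp j) hl, ← ofReal_norm, norm_mul,
    norm_mul, Complex.norm_real, Complex.norm_real, Real.norm_of_nonneg (by positivity),
    Real.norm_of_nonneg (by positivity)]
  refine ENNReal.ofReal_le_ofReal ?_
  have h2 := h j x z (lam j) hl
  calc _ ≤ lam j ^ n * lam j ^ n * ((2 * Real.pi / lam j) ^ n *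
        (C * ((1 + lam j * ‖x - z‖) ^ (n + 1))⁻¹)) := by gcongr
    _ = _ := by
      rw [div_pow]
      field_simp

end KernelOperator

section FourierSupport

variable {n : ℕ}

theorem ftransform_eq_vectorFourier (f : Rn n → ℂ) (ξ : Rn n) :
    ftransform n f ξ = VectorFourier.fourierIntegral Real.fourierChar volume
      ((2 * Real.pi)⁻¹ • innerₗ (Rn n)) f ξ := by
  rw [ftransform, VectorFourier.fourierIntegral]
  refine integral_congr_ae (Filter.Eventually.of_forall fun x => ?_)
  show _ = Real.fourierChar (-((2 * Real.pi)⁻¹ * ⟪x, ξ⟫_ℝ)) • f x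
  rw [Circle.smul_def, Real.fourierChar_apply, smul_eq_mul]
  have e : 2 * Real.pi * -((2 * Real.pi)⁻¹ * ⟪x, ξ⟫_ℝ) = -⟪x, ξ⟫_ℝ := by
    have := Real.pi_ne_zero
    field_simp
  show cexp _ * f x = _
  rw [e, Complex.ofReal_neg, neg_mul, mul_comm Complex.I]

theorem ftransform_eq_fourier (f : Rn n → ℂ) (ξ : Rn n) :
    ftransform n f ((2 * Real.pi) • ξ) = FourierTransform.fourier f ξ := by
  rw [Real.fourier_eq', ftransform]
  refine integral_congr_ae (Filter.Eventually.of_forall fun x => ?_)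
  show _ * _ = _ • _
  rw [smul_eq_mul, inner_smul_right]
  congr 2
  push_cast
  ring

theorem integral_ftransform_mul {f g : Rn n → ℂ} (hf : Integrable f) (hg : Integrable g) :
    ∫ ξ, ftransform n f ξ * g ξ = ∫ x, f x * ftransform n g x := by
  simp only [ftransform_eq_vectorFourier]
  have h := VectorFourier.integral_fourierIntegral_smul_eq_flip (μ := volume) (ν := volume)
    (L := (2 * Real.pi)⁻¹ • innerₗ (Rn n)) Real.continuous_fourierChar
    (by
      have : Continuous fun p : Rn n × Rn n => (2 * Real.pi)⁻¹ * ⟪p.1, p.2⟫_ℝ := by fun_prop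
      exact this) hf hg
  have e : ((2 * Real.pi)⁻¹ • innerₗ (Rn n)).flip = (2 * Real.pi)⁻¹ • innerₗ (Rn n) := by
    ext x y
    show (2 * Real.pi)⁻¹ * ⟪y, x⟫_ℝ = (2 * Real.pi)⁻¹ * ⟪x, y⟫_ℝ
    rw [real_inner_comm]
  rw [e] at h
  simpa only [smul_eq_mul] using h

theorem continuous_ftransform {f : Rn n → ℂ} (hf : Integrable f) : Continuous (ftransform n f) := by
  have : ftransform n f = VectorFourier.fourierIntegral Real.fourierChar volume
      ((2 * Real.pi)⁻¹ • innerₗ (Rn n)) f := funext fun ξ => ftransform_eq_vectorFourier f ξ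
  rw [this]
  refine VectorFourier.fourierIntegral_continuous Real.continuous_fourierChar ?_ hf
  have : Continuous fun p : Rn n × Rn n => (2 * Real.pi)⁻¹ * ⟪p.1, p.2⟫_ℝ := by fun_prop
  exact this

theorem norm_le_of_ftransform_support {h : Rn n → ℂ} (hc : Continuous h) (hi : Integrable h)
    {R : ℝ} (hR : ∀ ξ, 2 * Real.pi * R < ‖ξ‖ → ftransform n h ξ = 0) (y : Rn n) :
    ‖h y‖ₑ ≤ volume (Metric.closedBall (0 : Rn n) R) * ∫⁻ x, ‖h x‖ₑ := by
  have hpi := Real.pi_pos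
  have h0 : ∀ ξ, ξ ∉ Metric.closedBall (0 : Rn n) R → FourierTransform.fourier h ξ = 0 := by
    intro ξ hξ
    rw [mem_closedBall_zero_iff, not_le] at hξ
    rw [← ftransform_eq_fourier]
    refine hR _ ?_
    rw [norm_smul, Real.norm_of_nonneg (by positivity)]
    gcongr
  have hF : ∀ ξ, ‖FourierTransform.fourier h ξ‖ₑ ≤ ∫⁻ x, ‖h x‖ₑ := by
    intro ξ
    rw [Real.fourier_eq']
    refine (enorm_integral_le_lintegral_enorm _).trans (lintegral_mono fun v => ?_)
    rw [enorm_smul, mul_comm, ← ofReal_norm (cexp _), Complex.norm_exp_ofReal_mul_I]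
    simp
  have hcF : Continuous (FourierTransform.fourier h) := by
    have := (continuous_ftransform hi).comp (continuous_const_smul (2 * Real.pi) : Continuous fun ξ : Rn n => _)
    refine this.congr fun ξ => ftransform_eq_fourier h ξ
  have hiF : Integrable (FourierTransform.fourier h) :=
    hcF.integrable_of_hasCompactSupport
      (HasCompactSupport.of_support_subset_isCompact (isCompact_closedBall 0 R) fun ξ hξ => by
        by_contra h2
        exact hξ (h0 ξ h2))
  have hinv := congrFun (hc.fourierInv_fourier_eq hi hiF) y
  rw [← hinv, Real.fourierInv_eq']
  refine (enorm_integral_le_lintegral_enorm _).trans ?_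
  calc _ ≤ ∫⁻ v, (Metric.closedBall (0 : Rn n) R).indicator (fun _ => ∫⁻ x, ‖h x‖ₑ) v := by
        refine lintegral_mono fun v => ?_
        simp only
        rw [enorm_smul, ← ofReal_norm (cexp _), Complex.norm_exp_ofReal_mul_I, ENNReal.ofReal_one,
          one_mul]
        by_cases hv : v ∈ Metric.closedBall (0 : Rn n) R
        · rw [Set.indicator_of_mem hv]; exact hF v
        · rw [Set.indicator_of_notMem hv, h0 v hv]; simp
    _ = _ := by
        rw [lintegral_indicator Metric.isClosed_closedBall.measurableSet, setLIntegral_const, mul_comm]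

theorem lintegral_rpow_le_of_enorm_le {α : Type*} [MeasurableSpace α] {μ : Measure α} {h : α → ℂ}
    (hm : AEMeasurable h μ) (hi : ∫⁻ x, ‖h x‖ₑ ∂μ ≠ ∞) {V : ℝ≥0∞}
    (hb : ∀ y, ‖h y‖ₑ ≤ V * ∫⁻ x, ‖h x‖ₑ ∂μ) {p : ℝ} (hp : 0 < p) (hp1 : p ≤ 1) :
    (∫⁻ x, ‖h x‖ₑ ∂μ) ^ p ≤ V ^ (1 - p) * ∫⁻ x, ‖h x‖ₑ ^ p ∂μ := by
  set Q := ∫⁻ x, ‖h x‖ₑ ∂μ with hQ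
  by_cases hQ0 : Q = 0
  · rw [hQ0, ENNReal.zero_rpow_of_pos hp]; exact zero_le
  have h1 : Q ≤ (V * Q) ^ (1 - p) * ∫⁻ x, ‖h x‖ₑ ^ p ∂μ := by
    rw [← lintegral_const_mul'' _ (hm.enorm.pow_const p)]
    conv_lhs => rw [hQ]
    refine lintegral_mono fun x => ?_
    calc ‖h x‖ₑ = ‖h x‖ₑ ^ (1 - p) * ‖h x‖ₑ ^ p := by
          rw [← ENNReal.rpow_add_of_nonneg _ _ (by linarith) hp.le, sub_add_cancel,
            ENNReal.rpow_one]
      _ ≤ _ := by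
          gcongr
          exact hb x
  rw [ENNReal.mul_rpow_of_nonneg _ _ (by linarith : 0 ≤ 1 - p)] at h1
  have h2 : Q ^ (1 - p) * Q ^ p = Q := by
    rw [← ENNReal.rpow_add_of_nonneg _ _ (by linarith) hp.le, sub_add_cancel, ENNReal.rpow_one]
  have hq0 : Q ^ (1 - p) ≠ 0 := by
    simp [ENNReal.rpow_eq_zero_iff, hQ0, hi]
  have hqt : Q ^ (1 - p) ≠ ∞ := ENNReal.rpow_ne_top_of_nonneg (by linarith) hi
  rw [← ENNReal.mul_le_mul_iff_right hq0 hqt, h2]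
  refine h1.trans_eq ?_
  ring

end FourierSupport

section LpBounds

variable {n : ℕ} {φ : Rn n → Rn n → ℝ} {ι : Type*}

theorem oscKernel_eq_ftransform (hφ : PhaseSmoothHomog n φ) {b : Rn n → Rn n → ℂ}
    (h0 : ∀ x, b x 0 = 0) {lam : ℝ} (hlam : 0 < lam) (x y : Rn n) :
    oscKernel n φ lam b x y =
      ftransform n (fun θ => b x (lam⁻¹ • θ) * cexp (I * ((φ x θ : ℝ) : ℂ))) y := by
  have hcv := Measure.integral_comp_smul (volume : Measure (Rn n))
    (fun η => b x η * cexp (I * ((lam * (φ x η - ⟪y, η⟫_ℝ) : ℝ) : ℂ))) lam⁻¹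
  rw [finrank_euclideanSpace_fin, inv_pow, inv_inv, abs_of_pos (by positivity)] at hcv
  rw [oscKernel, oscInt, ← Complex.real_smul, ← hcv, ftransform]
  refine integral_congr_ae (Filter.Eventually.of_forall fun θ => ?_)
  show b x (lam⁻¹ • θ) * cexp _ = cexp _ * (b x (lam⁻¹ • θ) * cexp _)
  rcases eq_or_ne θ 0 with rfl | hθ
  · simp [h0]
  have e : lam * (φ x (lam⁻¹ • θ) - ⟪y, lam⁻¹ • θ⟫_ℝ) = -⟪θ, y⟫_ℝ + φ x θ := by
    rw [hφ.2 x θ lam⁻¹ (by positivity), inner_smul_right, real_inner_comm]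
    field_simp
    ring
  rw [e, mul_left_comm, ← Complex.exp_add]
  congr 2
  push_cast
  ring

theorem contDiff_rescaled_amplitude (hφ : PhaseSmoothHomog n φ) {b : Rn n → ℂ}
    (hb : ContDiff ℝ (⊤ : ℕ∞) b) {r R lam : ℝ} (hr : 0 < r) (hlam : 0 < lam)
    (hsupp : ∀ η, b η ≠ 0 → r ≤ ‖η‖ ∧ ‖η‖ ≤ R) (x : Rn n) :
    ContDiff ℝ (⊤ : ℕ∞) (fun θ => b (lam⁻¹ • θ) * cexp (I * ((φ x θ : ℝ) : ℂ))) ∧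
      HasCompactSupport (fun θ => b (lam⁻¹ • θ) * cexp (I * ((φ x θ : ℝ) : ℂ))) := by
  have hn : ∀ θ : Rn n, ‖lam⁻¹ • θ‖ = lam⁻¹ * ‖θ‖ := fun θ => by
    rw [norm_smul, Real.norm_of_nonneg (by positivity)]
  constructor
  · have := contDiff_mul_cexp_phase hφ (b := fun θ => b (lam⁻¹ • θ))
      (hb.comp (contDiff_const_smul _)) (r := lam * r) (by positivity) (fun θ hθ => by
        by_contra h
        have h1 := (hsupp _ h).1
        rw [hn] at h1
        have : lam * r ≤ ‖θ‖ := by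
          calc lam * r ≤ lam * (lam⁻¹ * ‖θ‖) := by gcongr
            _ = ‖θ‖ := by field_simp
        linarith) 1 x
    simpa only [one_mul] using this
  · refine HasCompactSupport.of_support_subset_isCompact
      (isCompact_closedBall (0 : Rn n) (lam * R)) fun θ hθ => ?_
    rw [mem_closedBall_zero_iff]
    have h1 := (hsupp (lam⁻¹ • θ) (left_ne_zero_of_mul hθ)).2
    rw [hn] at h1
    calc ‖θ‖ = lam * (lam⁻¹ * ‖θ‖) := by field_simp
      _ ≤ _ := by gcongr

theorem ftransform_cexp_mul (g : Rn n → ℂ) (ζ θ : Rn n) :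
    ftransform n (fun y => cexp (-(I * ((⟪y, ζ⟫_ℝ : ℝ) : ℂ))) * g y) θ =
      ftransform n g (θ + ζ) := by
  rw [ftransform, ftransform]
  refine integral_congr_ae (Filter.Eventually.of_forall fun y => ?_)
  show cexp _ * (cexp _ * g y) = cexp _ * g y
  rw [← mul_assoc, ← Complex.exp_add, inner_add_right]
  congr 2
  push_cast
  ring

theorem ftransform_oscKernel_mul (hφ : PhaseSmoothHomog n φ) {b : Rn n → Rn n → ℂ}
    (hb : ∀ x, ContDiff ℝ (⊤ : ℕ∞) (b x))
    (hsupp : ∀ x η, b x η ≠ 0 → 1 / 4 ≤ ‖η‖ ∧ ‖η‖ ≤ 4) {lam : ℝ} (hlam : 0 < lam)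
    {g : Rn n → ℂ} (hg : Integrable g) (x ζ : Rn n) :
    ftransform n (fun y => oscKernel n φ lam b x y * g y) ζ =
      ∫ θ, b x (lam⁻¹ • θ) * cexp (I * ((φ x θ : ℝ) : ℂ)) * ftransform n g (θ + ζ) := by
  have h0 : ∀ x, b x 0 = 0 := fun x => by
    by_contra h
    have := (hsupp x 0 h).1
    rw [norm_zero] at this
    linarith
  obtain ⟨h1, h2⟩ := contDiff_rescaled_amplitude hφ (hb x) (by norm_num) hlam (hsupp x) x
  have hi := h1.continuous.integrable_of_hasCompactSupport (μ := volume) h2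
  have hc : Continuous fun y : Rn n => cexp (-(I * ((⟪y, ζ⟫_ℝ : ℝ) : ℂ))) := by fun_prop
  have hg' : Integrable fun y => cexp (-(I * ((⟪y, ζ⟫_ℝ : ℝ) : ℂ))) * g y := by
    refine hg.bdd_mul (c := 1) hc.aestronglyMeasurable (Filter.Eventually.of_forall fun y => ?_)
    rw [Complex.norm_exp]
    simp
  have := integral_ftransform_mul hi hg'
  simp only [ftransform_cexp_mul] at this
  rw [← this, ftransform]
  refine integral_congr_ae (Filter.Eventually.of_forall fun y => ?_)
  show cexp _ * (oscKernel n φ lam b x y * g y) = _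
  rw [oscKernel_eq_ftransform hφ h0 hlam]
  ring

theorem enorm_oscKernel {lam : ℝ} (hlam : 0 < lam) (b : Rn n → Rn n → ℂ) (x y : Rn n) :
    ‖oscKernel n φ lam b x y‖ₑ = ENNReal.ofReal (lam ^ n) * ‖oscInt n φ lam b x y‖ₑ := by
  rw [oscKernel, enorm_mul, ← ofReal_norm, Complex.norm_real, Real.norm_of_nonneg (by positivity)]

theorem oscKernel_rpow_bound (hn : 1 ≤ n) (hφ : PhaseClass n 2 φ) (hs : SNDCondition n φ)
    {lam : ι → ℝ} (hlam : ∀ j, 1 ≤ lam j) {β : ι → Rn n → Rn n → ℂ}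
    (hβ : UBd (fun (j : ι × Rn n) η => β j.1 j.2 η) (fun _ _ => 1) (fun _ _ => 1))
    (hsupp : ∀ j x η, β j x η ≠ 0 → 1 / 4 ≤ ‖η‖ ∧ ‖η‖ ≤ 4) {p : ℝ} (hp : 0 < p) (hp1 : p ≤ 1)
    (hβc : ∀ j, Continuous fun q : Rn n × Rn n => β j q.1 q.2) :
    ∃ C : ℝ≥0, ∀ j,
      (∀ y, ∫⁻ x, ‖oscKernel n φ (lam j) (β j) x y‖ₑ ^ p ≤
        C * ENNReal.ofReal (lam j ^ (n * p + kernelRate n p))) ∧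
      ∀ x, ∫⁻ y, ‖oscKernel n φ (lam j) (β j) x y‖ₑ ^ p ≤
        C * ENNReal.ofReal (lam j ^ (n * p + kernelRate n p)) := by
  obtain ⟨C, hC⟩ := kernel_bound hn hφ hs hlam hβ hsupp hp hp1 hβc
  refine ⟨C, fun j => ?_⟩
  have hl : 0 < lam j := one_pos.trans_le (hlam j)
  have h1 : ∀ x y, ‖oscKernel n φ (lam j) (β j) x y‖ₑ ^ p =
      ENNReal.ofReal (lam j ^ (n * p)) * ‖oscInt n φ (lam j) (β j) x y‖ₑ ^ p := fun x y => by
    rw [enorm_oscKernel hl, ENNReal.mul_rpow_of_nonneg _ _ hp.le,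
      ENNReal.ofReal_rpow_of_pos (by positivity), Real.rpow_mul hl.le, Real.rpow_natCast]
  have h2 : (C : ℝ≥0∞) * ENNReal.ofReal (lam j ^ (n * p + kernelRate n p)) =
      ENNReal.ofReal (lam j ^ (n * p)) * (C * ENNReal.ofReal (lam j ^ kernelRate n p)) := by
    rw [Real.rpow_add hl, ENNReal.ofReal_mul (by positivity)]
    ring
  simp only [h1, h2]
  constructor
  · intro y
    rw [lintegral_const_mul' _ _ ENNReal.ofReal_ne_top]
    gcongr
    exact (hC j).1 y
  · intro x
    rw [lintegral_const_mul' _ _ ENNReal.ofReal_ne_top]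
    gcongr
    exact (hC j).2 x

theorem measurable_oscKernel (hφ : PhaseSmoothHomog n φ) {b : Rn n → Rn n → ℂ}
    (hb : Continuous fun q : Rn n × Rn n => b q.1 q.2)
    (hsupp : ∀ x η, b x η ≠ 0 → 1 / 4 ≤ ‖η‖ ∧ ‖η‖ ≤ 4) (lam : ℝ) :
    Measurable fun q : Rn n × Rn n => oscKernel n φ lam b q.1 q.2 :=
  (measurable_oscInt hφ hb (r := 1 / 4) (by norm_num) (fun x η hη => by
    by_contra h
    exact absurd (hsupp x η h).1 (not_le.2 hη)) lam).const_mul _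

theorem continuous_oscKernel (hφ : PhaseSmoothHomog n φ) {b : Rn n → Rn n → ℂ}
    (hb : ∀ x, ContDiff ℝ (⊤ : ℕ∞) (b x))
    (hsupp : ∀ x η, b x η ≠ 0 → 1 / 4 ≤ ‖η‖ ∧ ‖η‖ ≤ 4) {lam : ℝ} (hlam : 0 < lam) (x : Rn n) :
    Continuous (oscKernel n φ lam b x) := by
  have h0 : ∀ x, b x 0 = 0 := fun x => by
    by_contra h
    have := (hsupp x 0 h).1
    rw [norm_zero] at this
    linarith
  obtain ⟨h1, h2⟩ := contDiff_rescaled_amplitude hφ (hb x) (by norm_num) hlam (hsupp x) x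
  exact (continuous_ftransform (h1.continuous.integrable_of_hasCompactSupport h2)).congr
    fun y => (oscKernel_eq_ftransform hφ h0 hlam x y).symm

theorem lintegral_rpow_oscKernel_le_of_le_one (hn : 1 ≤ n) (hφ : PhaseClass n 2 φ)
    (hs : SNDCondition n φ) {lam : ι → ℝ} (hlam : ∀ j, 1 ≤ lam j) {β : ι → Rn n → Rn n → ℂ}
    (hβ : UBd (fun (j : ι × Rn n) η => β j.1 j.2 η) (fun _ _ => 1) (fun _ _ => 1))
    (hsupp : ∀ j x η, β j x η ≠ 0 → 1 / 4 ≤ ‖η‖ ∧ ‖η‖ ≤ 4) {p : ℝ} (hp : 0 < p) (hp1 : p ≤ 1)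
    (hβc : ∀ j, Continuous fun q : Rn n × Rn n => β j q.1 q.2) :
    ∃ C : ℝ≥0, ∀ j (g : Rn n → ℂ), Continuous g → Integrable g → (∃ M, ∀ y, ‖g y‖ ≤ M) →
      (∀ ξ, 2 * lam j < ‖ξ‖ → ftransform n g ξ = 0) →
      ∫⁻ x, ‖kerOp volume (oscKernel n φ (lam j) (β j)) g x‖ₑ ^ p ≤
        C * ENNReal.ofReal (lam j ^ (((n : ℝ) - 1) * |1 - p / 2|)) * ∫⁻ y, ‖g y‖ₑ ^ p := by
  obtain ⟨C, hC⟩ := oscKernel_rpow_bound hn hφ hs hlam hβ hsupp hp hp1 hβc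
  obtain ⟨C1, hC1⟩ := oscKernel_rpow_bound hn hφ hs hlam hβ hsupp one_pos le_rfl hβc
  have hv : volume (Metric.closedBall (0 : Rn n) 1) ≠ ∞ :=
    (isCompact_closedBall _ _).measure_lt_top.ne
  refine ⟨(volume (Metric.closedBall (0 : Rn n) 1)).toNNReal ^ (1 - p) * C,
    fun j g hgc hgi hgM hgs => ?_⟩
  have hl : 0 < lam j := one_pos.trans_le (hlam j)
  have hsm : ∀ x, ContDiff ℝ (⊤ : ℕ∞) (β j x) := fun x => hβ.smooth (j, x)
  have hKm := measurable_oscKernel hφ.1 (hβc j) (hsupp j) (lam j)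
  generalize hK : oscKernel n φ (lam j) (β j) = K at *
  have hKc : ∀ x, Continuous (K x) := fun x => by
    rw [← hK]; exact continuous_oscKernel hφ.1 hsm (hsupp j) hl x
  have hKi : ∀ x, Integrable (K x) := fun x => by
    refine ⟨(hKc x).aestronglyMeasurable, ?_⟩
    rw [hasFiniteIntegral_iff_enorm]
    have := (hC1 j).2 x
    rw [hK] at this
    simp only [ENNReal.rpow_one] at this
    exact this.trans_lt (by finiteness)
  obtain ⟨M, hM⟩ := hgM
  set V := volume (Metric.closedBall (0 : Rn n) (lam j)) with hV
  have hVe : V = ENNReal.ofReal (lam j ^ n) * volume (Metric.closedBall (0 : Rn n) 1) := by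
    rw [hV, Measure.addHaar_closedBall' _ _ hl.le, finrank_euclideanSpace_fin]
  have key : ∀ x, ‖kerOp volume K g x‖ₑ ^ p ≤ V ^ (1 - p) * ∫⁻ y, ‖K x y‖ₑ ^ p * ‖g y‖ₑ ^ p := by
    intro x
    have hc : Continuous fun y => K x y * g y := (hKc x).mul hgc
    have hi : Integrable fun y => K x y * g y :=
      (hKi x).mul_bdd (c := M) hgc.aestronglyMeasurable (Filter.Eventually.of_forall hM)
    have h1 := norm_le_of_ftransform_support hc hi (R := lam j) fun ξ hξ => by
      rw [← hK, ftransform_oscKernel_mul hφ.1 hsm (hsupp j) hl hgi]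
      refine integral_eq_zero_of_ae (Filter.Eventually.of_forall fun θ => ?_)
      show _ * _ * _ = (0 : ℂ)
      by_cases hb : β j x ((lam j)⁻¹ • θ) = 0
      · rw [hb]; simp
      have h2 := (hsupp j x _ hb).2
      rw [norm_smul, Real.norm_of_nonneg (by positivity), inv_mul_le_iff₀ hl] at h2
      rw [hgs, mul_zero]
      have h3 : 6 * lam j ≤ 2 * Real.pi * lam j := by
        have := Real.pi_gt_three
        gcongr
        linarith
      have h4 : ‖ξ‖ ≤ ‖θ + ξ‖ + ‖θ‖ := by
        have := norm_sub_le (θ + ξ) θ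
        rwa [add_sub_cancel_left] at this
      linarith
    have h2 := lintegral_rpow_le_of_enorm_le hc.measurable.aemeasurable
      (hasFiniteIntegral_iff_enorm.1 hi.2).ne h1 hp hp1
    calc _ ≤ (∫⁻ y, ‖K x y * g y‖ₑ) ^ p := by
          gcongr
          exact enorm_integral_le_lintegral_enorm _
      _ ≤ _ := h2
      _ = _ := by simp_rw [enorm_mul, ENNReal.mul_rpow_of_nonneg _ _ hp.le]; rfl
  refine (lintegral_mono key).trans ?_
  have hVt : V ^ (1 - p) ≠ ∞ :=
    ENNReal.rpow_ne_top_of_nonneg (by linarith) (by rw [hVe]; finiteness)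
  rw [lintegral_const_mul' _ _ hVt]
  have h3 : ∫⁻ x, ∫⁻ y, ‖K x y‖ₑ ^ p * ‖g y‖ₑ ^ p ≤
      C * ENNReal.ofReal (lam j ^ (n * p + kernelRate n p)) * ∫⁻ y, ‖g y‖ₑ ^ p := by
    rw [lintegral_lintegral_swap]
    · rw [← lintegral_const_mul' _ _ (by finiteness)]
      refine lintegral_mono fun y => ?_
      show ∫⁻ x, ‖K x y‖ₑ ^ p * ‖g y‖ₑ ^ p ≤ _
      have hmy : Measurable fun x => K x y := hKm.comp measurable_prodMk_right
      rw [lintegral_mul_const _ (hmy.enorm.pow_const p)]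
      gcongr
      have := (hC j).1 y
      rwa [hK] at this
    · exact ((hKm.enorm.pow_const p).mul
        ((hgc.measurable.enorm.pow_const p).comp measurable_snd)).aemeasurable
  refine (mul_le_mul_right h3 _).trans_eq ?_
  have hVp : V ^ (1 - p) = ENNReal.ofReal (lam j ^ (n * (1 - p))) *
      volume (Metric.closedBall (0 : Rn n) 1) ^ (1 - p) := by
    rw [hVe, ENNReal.mul_rpow_of_nonneg _ _ (by linarith),
      ENNReal.ofReal_rpow_of_pos (by positivity), Real.rpow_mul hl.le, Real.rpow_natCast]
  have hexp : ((n : ℝ) - 1) * |1 - p / 2| = n * (1 - p) + (n * p + kernelRate n p) := by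
    rw [abs_of_pos (by linarith), kernelRate]
    ring
  rw [hVp, hexp, Real.rpow_add hl (n * (1 - p)), ENNReal.ofReal_mul (by positivity), ENNReal.coe_mul,
    ENNReal.coe_rpow_of_nonneg _ (by linarith), ENNReal.coe_toNNReal hv]
  ring

theorem lintegral_rpow_oscKernel_le (hn : 1 ≤ n) (hφ : PhaseClass n 2 φ)
    (hs : SNDCondition n φ) {lam : ι → ℝ} (hlam : ∀ j, 1 ≤ lam j) {β : ι → Rn n → Rn n → ℂ}
    (hβ : UBd (fun (j : ι × Rn n) η => β j.1 j.2 η) (fun _ _ => 1) (fun _ _ => 1))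
    (hsupp : ∀ j x η, β j x η ≠ 0 → 1 / 4 ≤ ‖η‖ ∧ ‖η‖ ≤ 4) {p : ℝ} (hp : 0 < p)
    (hβc : ∀ j, Continuous fun q : Rn n × Rn n => β j q.1 q.2) :
    ∃ C : ℝ≥0, ∀ j (g : Rn n → ℂ), Continuous g → Integrable g → (∃ M, ∀ y, ‖g y‖ ≤ M) →
      (∀ ξ, 2 * lam j < ‖ξ‖ → ftransform n g ξ = 0) →
      ∫⁻ x, ‖kerOp volume (oscKernel n φ (lam j) (β j)) g x‖ₑ ^ p ≤
        C * ENNReal.ofReal (lam j ^ (((n : ℝ) - 1) * |1 - p / 2|)) * ∫⁻ y, ‖g y‖ₑ ^ p := by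
  rcases le_or_gt p 1 with hp1 | hp1
  · exact lintegral_rpow_oscKernel_le_of_le_one hn hφ hs hlam hβ hsupp hp hp1 hβc
  obtain ⟨C1, hC1⟩ := oscKernel_rpow_bound hn hφ hs hlam hβ hsupp one_pos le_rfl hβc
  obtain ⟨B, hB⟩ := oscKernel_almost_orthogonal hφ hs (fun j => one_pos.trans_le (hlam j)) hβ hsupp
  have hpos : ∀ j, 0 < lam j := fun j => one_pos.trans_le (hlam j)
  have hexp : (n : ℝ) * 1 + kernelRate n 1 = ((n : ℝ) - 1) / 2 := by
    rw [kernelRate]; ring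
  set A : ι → ℝ := fun j => (C1 + 1) * lam j ^ (((n : ℝ) - 1) / 2) with hA
  have hA0 : ∀ j, 0 < A j := fun j => by have := hpos j; positivity
  have hle : ∀ j, (C1 : ℝ≥0∞) * ENNReal.ofReal (lam j ^ (n * 1 + kernelRate n 1)) ≤
      ENNReal.ofReal (A j) := fun j => by
    have := hpos j
    rw [hexp, hA, ENNReal.ofReal_mul (by positivity)]
    gcongr
    rw [ENNReal.ofReal_add (by positivity) zero_le_one, ENNReal.ofReal_coe_nnreal]
    exact le_self_add
  have hKx : ∀ j x, ∫⁻ y, ‖oscKernel n φ (lam j) (β j) x y‖ₑ ≤ ENNReal.ofReal (A j) := fun j x => by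
    have := ((hC1 j).2 x).trans (hle j)
    simpa only [ENNReal.rpow_one] using this
  have hKy : ∀ j y, ∫⁻ x, ‖oscKernel n φ (lam j) (β j) x y‖ₑ ≤ ENNReal.ofReal (A j) := fun j y => by
    have := ((hC1 j).1 y).trans (hle j)
    simpa only [ENNReal.rpow_one] using this
  have hL2 : ∀ j (g : Rn n → ℂ), Continuous g → Integrable g → (∃ M, ∀ y, ‖g y‖ ≤ M) →
      ∀ S : Set (Rn n), MeasurableSet S →
      ∫⁻ x, ‖kerOp volume (oscKernel n φ (lam j) (β j)) (S.indicator g) x‖ₑ ^ 2 ≤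
        2 * (B : ℝ≥0∞) * ∫⁻ y, ‖S.indicator g y‖ₑ ^ 2 := by
    rintro j g hgc hgi ⟨M, hM⟩ S hS
    refine lintegral_sq_kerOp_le (measurable_oscKernel hφ.1 (hβc j) (hsupp j) (lam j))
      ENNReal.ofReal_ne_top (hKx j) (hKy j) (hB j) (hgc.measurable.indicator hS)
      (hasFiniteIntegral_iff_enorm.1 (hgi.indicator hS).2).ne (M := ENNReal.ofReal M)
      ENNReal.ofReal_ne_top fun y => ?_
    rw [← ofReal_norm]
    exact ENNReal.ofReal_le_ofReal ((norm_indicator_le_norm_self _ _).trans (hM y))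
  have hApow : ∀ j t, ENNReal.ofReal (A j ^ t) = ENNReal.ofReal (((C1 : ℝ) + 1) ^ t) *
      ENNReal.ofReal (lam j ^ (((n : ℝ) - 1) / 2 * t)) := fun j t => by
    have := hpos j
    rw [← ENNReal.ofReal_mul (by positivity), hA]
    simp only
    rw [Real.mul_rpow (by positivity) (by positivity), Real.rpow_mul this.le]
  rcases lt_trichotomy p 2 with hp2 | rfl | hp2
  · refine ⟨(Real.toNNReal (p * 2 / (p - 1)) + Real.toNNReal (p * 8 / (2 - p)) * (2 * B)) *
      Real.toNNReal (((C1 : ℝ) + 1) ^ (2 - p)), fun j g hgc hgi hgM _ => ?_⟩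
    have h := hL2 j g hgc hgi hgM
    obtain ⟨M, hM⟩ := hgM
    refine (lintegral_rpow_kerOp_le_of_lt_two hp1 hp2
      (measurable_oscKernel hφ.1 (hβc j) (hsupp j) (lam j)) (hA0 j) (hKx j) (hKy j)
      (by finiteness) hgc.measurable hM h).trans_eq ?_
    have e : ((n : ℝ) - 1) / 2 * (2 - p) = ((n : ℝ) - 1) * |1 - p / 2| := by
      rw [abs_of_pos (by linarith)]; ring
    rw [hApow, e]
    push_cast
    simp only [ENNReal.ofReal]
    ring
  · refine ⟨2 * B, fun j g hgc hgi hgM _ => ?_⟩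
    have h := hL2 j g hgc hgi hgM Set.univ MeasurableSet.univ
    simp only [Set.indicator_univ] at h
    simpa using h
  · refine ⟨Real.toNNReal (p * 4 * 2 ^ (p - 2) / (p - 2)) * (2 * B) *
      Real.toNNReal (((C1 : ℝ) + 1) ^ (p - 2)), fun j g hgc hgi hgM _ => ?_⟩
    have h := hL2 j g hgc hgi hgM
    obtain ⟨M, hM⟩ := hgM
    refine (lintegral_rpow_kerOp_le_of_two_lt hp2
      (measurable_oscKernel hφ.1 (hβc j) (hsupp j) (lam j)) (hA0 j) (hKx j)
      (by finiteness) hgc.measurable hM h).trans_eq ?_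
    have e : ((n : ℝ) - 1) / 2 * (p - 2) = ((n : ℝ) - 1) * |1 - p / 2| := by
      rw [abs_of_neg (by linarith)]; ring
    rw [hApow, e]
    push_cast
    simp only [ENNReal.ofReal]
    ring

/-- `L^p` bounds with the critical loss for a uniform family of frequency-localized operators. -/
theorem eLpNorm_oscKernel_le (hn : 1 ≤ n) (hφ : PhaseClass n 2 φ)
    (hs : SNDCondition n φ) {lam : ι → ℝ} (hlam : ∀ j, 1 ≤ lam j) {β : ι → Rn n → Rn n → ℂ}
    (hβ : UBd (fun (j : ι × Rn n) η => β j.1 j.2 η) (fun _ _ => 1) (fun _ _ => 1))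
    (hsupp : ∀ j x η, β j x η ≠ 0 → 1 / 4 ≤ ‖η‖ ∧ ‖η‖ ≤ 4) {p : ℝ≥0∞} (hp : 0 < p)
    (hβc : ∀ j, Continuous fun q : Rn n × Rn n => β j q.1 q.2) :
    ∃ C : ℝ≥0, ∀ j (g : Rn n → ℂ), Continuous g → Integrable g → (∃ M, ∀ y, ‖g y‖ ≤ M) →
      (∀ ξ, 2 * lam j < ‖ξ‖ → ftransform n g ξ = 0) →
      eLpNorm (kerOp volume (oscKernel n φ (lam j) (β j)) g) p volume ≤
        C * ENNReal.ofReal (lam j ^ (-criticalOrder n p)) * eLpNorm g p volume := by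
  by_cases hpt : p = ∞
  · subst hpt
    obtain ⟨C1, hC1⟩ := oscKernel_rpow_bound hn hφ hs hlam hβ hsupp one_pos le_rfl hβc
    refine ⟨C1, fun j g hgc hgi ⟨M, hM⟩ _ => ?_⟩
    rw [eLpNorm_exponent_top, eLpNorm_exponent_top]
    have hbd : ∀ y, ‖g y‖ₑ ≤ eLpNormEssSup g volume := by
      have h1 : ∀ᵐ y, ‖g y‖ₑ ≤ eLpNormEssSup g volume := ae_le_eLpNormEssSup
      intro y
      have hcl : IsClosed {y | ‖g y‖ₑ ≤ eLpNormEssSup g volume} :=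
        isClosed_le hgc.enorm continuous_const
      have hd : Dense {y | ‖g y‖ₑ ≤ eLpNormEssSup g volume} := Measure.dense_of_ae h1
      have := hcl.closure_eq ▸ hd y
      exact this
    have h2 : ∀ x, ∫⁻ y, ‖oscKernel n φ (lam j) (β j) x y‖ₑ ≤
        C1 * ENNReal.ofReal (lam j ^ (-criticalOrder n ∞)) := fun x => by
      have h3 := (hC1 j).2 x
      have e : (n : ℝ) * 1 + kernelRate n 1 = -criticalOrder n ∞ := by
        rw [kernelRate, criticalOrder]
        norm_num
        ring
      rw [e] at h3
      simpa only [ENNReal.rpow_one] using h3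
    refine essSup_le_of_ae_le _ (Filter.Eventually.of_forall fun x => ?_)
    refine enorm_kerOp_le_of_bdd h2 (ne_top_of_le_ne_top (b := ENNReal.ofReal M)
      ENNReal.ofReal_ne_top (essSup_le_of_ae_le _ (Filter.Eventually.of_forall fun y => ?_))) hbd x
    rw [← ofReal_norm]
    exact ENNReal.ofReal_le_ofReal (hM y)
  have hp0 : 0 < p.toReal := ENNReal.toReal_pos hp.ne' hpt
  obtain ⟨C, hC⟩ := lintegral_rpow_oscKernel_le hn hφ hs hlam hβ hsupp hp0 hβc
  refine ⟨C ^ (1 / p.toReal), fun j g hgc hgi hgM hgs => ?_⟩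
  have hl : 0 < lam j := one_pos.trans_le (hlam j)
  rw [eLpNorm_eq_lintegral_rpow_enorm_toReal hp.ne' hpt,
    eLpNorm_eq_lintegral_rpow_enorm_toReal hp.ne' hpt]
  refine (ENNReal.rpow_le_rpow (hC j g hgc hgi hgM hgs) (by positivity)).trans_eq ?_
  rw [ENNReal.mul_rpow_of_nonneg _ _ (by positivity), ENNReal.mul_rpow_of_nonneg _ _ (by positivity),
    ENNReal.coe_rpow_of_nonneg _ (by positivity), ENNReal.ofReal_rpow_of_pos (by positivity),
    ← Real.rpow_mul hl.le]
  congr 4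
  rw [criticalOrder, ENNReal.toReal_inv]
  have e : |1 - p.toReal / 2| = p.toReal * |p.toReal⁻¹ - 1 / 2| := by
    rw [← abs_of_pos hp0, ← abs_mul, abs_of_pos hp0]
    congr 1
    field_simp
  rw [e]
  field_simp

end LpBounds

section ParametricTools

variable {n : ℕ} {ι : Type*}

theorem UBd.of_schwartz {X : Type*} [NormedAddCommGroup X] [NormedSpace ℝ X]
    (Ψ : SchwartzMap X ℂ) (M : ℕ) :
    UBd (fun (_ : ι) v => Ψ v) (fun _ v => ((1 + ‖v‖) ^ M)⁻¹) (fun _ _ => 1) := by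
  refine ⟨fun _ => Ψ.smooth _, fun k => ⟨2 ^ M *
    (Finset.Iic (M, k)).sup (fun m => SchwartzMap.seminorm ℝ m.1 m.2) Ψ, by positivity,
    fun _ v => ?_⟩⟩
  have := SchwartzMap.one_add_le_sup_seminorm_apply (𝕜 := ℝ) (m := (M, k)) le_rfl le_rfl Ψ v
  rw [one_pow, mul_one, ← div_eq_mul_inv, le_div_iff₀ (by positivity), mul_comm]
  exact this

theorem UBd.const_mul {X : Type*} [NormedAddCommGroup X] [NormedSpace ℝ X]
    {f : ι → X → ℂ} {w ρ : ι → X → ℝ} (hf : UBd f w ρ) (c : ι → ℂ) :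
    UBd (fun i v => c i * f i v) (fun i v => ‖c i‖ * w i v) ρ := by
  refine ⟨fun i => contDiff_const.mul (hf.smooth i), fun k => ?_⟩
  obtain ⟨C, hC, h⟩ := hf.2 k
  refine ⟨C, hC, fun i v => ?_⟩
  have h1 := iteratedFDeriv_const_smul_apply' (a := c i) ((hf.smooth' i k).contDiffAt (x := v))
  simp only [smul_eq_mul] at h1
  rw [h1, norm_smul]
  calc ‖c i‖ * _ ≤ ‖c i‖ * (C * (w i v * ρ i v ^ k)) := by gcongr; exact h i v
    _ = _ := by ring

/-- Integration in the first variable of a family that is rapidly decreasing there. -/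
theorem UBd.integral_fst {F : ι → Rn n × Rn n → ℂ} {r : ι → ℝ}
    (hF : ∀ M : ℕ, UBd F (fun _ p => ((1 + ‖p.1‖) ^ M)⁻¹) (fun i p => r i * (1 + ‖p.1‖))) :
    UBd (fun i η => ∫ v, F i (v, η)) (fun _ _ => 1) (fun i _ => r i) := by
  choose C hC hb using fun k => ((hF (n + 1 + k)).slice).2 k
  have hs := fun i => contDiff_integral_and_bound (ν := (volume : Measure (Rn n)))
    (F := fun v η => F i (v, η)) (g := fun k v => C k * ((1 + ‖v‖) ^ (n + 1))⁻¹)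
    (ω := fun k _ => r i ^ k) (fun v => (hF 0).slice.smooth (i, v))
    (fun k x => by
      have h1 := (continuous_iteratedFDeriv_slice (((hF 0).smooth' i k)))
      exact (h1.comp (f := fun v => (v, x)) (by fun_prop)).aestronglyMeasurable)
    (fun k => (integrable_weight n (Nat.lt_succ_self n)).const_mul _)
    (fun _ => continuous_const) (fun k v => by have := hC k; positivity)
    (fun k v x => by
      refine (hb k (i, v) x).trans_eq ?_
      simp only
      have h0 : (0 : ℝ) < 1 + ‖v‖ := by linarith [norm_nonneg v]
      rw [pow_add _ (n + 1), mul_pow]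
      generalize 1 + ‖v‖ = t at h0
      field_simp)
  refine ⟨fun i => (hs i).1, fun k => ⟨∫ v : Rn n, C k * ((1 + ‖v‖) ^ (n + 1))⁻¹,
    integral_nonneg fun v => mul_nonneg (hC k) (by positivity), fun i η => ?_⟩⟩
  rw [one_mul]
  exact (hs i).2 k η

theorem UBd.fst {P : Type*} [NormedAddCommGroup P] [NormedSpace ℝ P] :
    UBd (fun (_ : ι) (p : Rn n × P) => p.1) (fun _ p => 1 + ‖p.1‖) (fun _ _ => 1) := by
  refine ⟨fun _ => contDiff_fst, fun k => ⟨1, zero_le_one, fun _ p => ?_⟩⟩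
  rw [one_pow, mul_one, one_mul]
  rcases k with _ | k
  · simp
  · refine le_trans ?_ (by simp : (1 : ℝ) ≤ 1 + ‖p.1‖)
    rw [← norm_iteratedFDeriv_fderiv]
    have h1 : fderiv ℝ (fun p : Rn n × P => p.1) = fun _ => ContinuousLinearMap.fst ℝ (Rn n) P := by
      ext1 p; exact fderiv_fst
    rw [h1]
    rcases k with _ | k
    · simpa using ContinuousLinearMap.norm_fst_le ℝ (Rn n) P
    · rw [iteratedFDeriv_const_of_ne (by omega)]; simp

variable {φ : Rn n → Rn n → ℝ} {c : Rn n → ℝ}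

theorem norm_dilate_le {t : ℝ} (h : |t| ≤ 1) :
    ‖((t • ContinuousLinearMap.fst ℝ (Rn n) (Rn n)).prod
      (ContinuousLinearMap.snd ℝ (Rn n) (Rn n)))‖ ≤ 1 := by
  refine ContinuousLinearMap.opNorm_le_bound _ zero_le_one fun p => ?_
  rw [one_mul, ContinuousLinearMap.prod_apply, Prod.norm_def, Prod.norm_def]
  refine max_le_max ?_ le_rfl
  show ‖t • p.1‖ ≤ ‖p.1‖
  rw [norm_smul]
  exact mul_le_of_le_one_left (norm_nonneg _) h

theorem PhaseClass.UBd_quotPhase (hφ : PhaseClass n 2 φ)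
    (hc : ContDiff ℝ (⊤ : ℕ∞) c) (hcs : HasCompactSupport c) (hcU : tsupport c ⊆ {ξ | ξ ≠ 0}) :
    UBd (fun (j : Rn n × {t : ℝ // |t| ≤ 1}) (p : Rn n × Rn n) => quotPhase φ c j.1 j.2 p.1 p.2)
      (fun _ p => 1 + ‖p.1‖) (fun _ _ => 1) := by
  have hG := hφ.UBd_partialFst hc hcs hcU
  refine UBd.integral_unit (f := fun (j : Rn n × {t : ℝ // |t| ≤ 1}) (q : ℝ × Rn n × Rn n) =>
    (c q.2.2 • partialFst φ (j.1 + (q.1 * (j.2 : ℝ)) • q.2.1) q.2.2) q.2.1)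
    (fun j => ?_) ?_ (fun _ => by fun_prop) (fun _ => continuous_const)
  · have h := (hG.smooth ()).comp (f := fun q : ℝ × Rn n × Rn n =>
      (j.1 + (q.1 * (j.2 : ℝ)) • q.2.1, q.2.2)) (by fun_prop)
    exact h.clm_apply (by fun_prop)
  · have h1 := hG.comp_affine (fun _ _ => zero_le_one) (fun _ _ => zero_le_one)
      (fun _ : (Rn n × {t : ℝ // |t| ≤ 1}) × unitInterval => ())
      (fun j => (((j.2 : ℝ) * j.1.2) • ContinuousLinearMap.fst ℝ (Rn n) (Rn n)).prod
        (ContinuousLinearMap.snd ℝ (Rn n) (Rn n)))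
      (fun j => (j.1.1, 0)) (fun _ => 1)
      (fun j => norm_dilate_le (by
        rw [abs_mul]
        exact mul_le_one₀ (by rw [abs_of_nonneg j.2.2.1]; exact j.2.2.2) (abs_nonneg _) j.1.2.2))
    simp only [one_mul] at h1
    have h3 := h1.bilin (ContinuousLinearMap.id ℝ (Rn n →L[ℝ] ℝ)) UBd.fst
      (fun _ _ => zero_le_one) (fun _ _ => zero_le_one)
    simpa [add_comm] using h3

theorem PhaseClass.hasFDerivAt_quotPhase (hφ : PhaseClass n 2 φ)
    (hc : ContDiff ℝ (⊤ : ℕ∞) c) (hcs : HasCompactSupport c) (hcU : tsupport c ⊆ {ξ | ξ ≠ 0})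
    (x : Rn n) {μ : ℝ} (hμ : μ ≠ 0) (v η : Rn n) :
    HasFDerivAt (fun v => quotPhase φ c x μ v η) (c η • partialFst φ (x + μ • v) η) v := by
  have h1 : (fun v => quotPhase φ c x μ v η) =
      fun v => μ⁻¹ * (c η * (φ (x + μ • v) η - φ x η)) := by
    ext v; rw [← hφ.mul_quotPhase hc hcs hcU, inv_mul_cancel_left₀ hμ]
  by_cases h0 : c η = 0
  · rw [h1]; simpa [h0] using hasFDerivAt_const (0 : ℝ) v
  have hη : η ≠ 0 := hcU (subset_tsupport _ h0)
  have h2 := HasFDerivAt.comp (f := fun x' => (x', η)) (x + μ • v)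
    (hφ.smoothOver.hasFDerivAt isOpen_ne_zero (x + μ • v) hη) (hasFDerivAt_prodMk_left _ η)
  have h3 : HasFDerivAt (fun x' => φ x' η) (partialFst φ (x + μ • v) η) (x + μ • v) :=
    h2.differentiableAt.hasFDerivAt
  have h4 : HasFDerivAt (fun v : Rn n => x + μ • v) (μ • ContinuousLinearMap.id ℝ (Rn n)) v :=
    ((hasFDerivAt_id v).const_smul μ).const_add x
  have h5 := (((h3.comp v h4).sub_const (φ x η)).const_mul (c η)).const_mul μ⁻¹
  have e : c η • partialFst φ (x + μ • v) η = μ⁻¹ • c η • partialFst φ (x + μ • v) η ∘SL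
      (μ • ContinuousLinearMap.id ℝ (Rn n)) := by
    ext w
    simp only [smul_apply, ContinuousLinearMap.comp_apply, ContinuousLinearMap.id_apply, map_smul,
      smul_eq_mul]
    rw [mul_left_comm (c η), inv_mul_cancel_left₀ hμ]
  rw [h1, e]
  exact h5

end ParametricTools

section ConjugatedAmplitude

variable {n : ℕ} {ι : Type*} {φ : Rn n → Rn n → ℝ} {c : Rn n → ℝ}

/-- The amplitude obtained by applying a rescaled convolution operator to `S(x, η) e^{iλφ(x, η)}`
and factoring out the exponential; `κ` is the product of `λ` and the convolution scale `μ`. -/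
def conjAmp (φ : Rn n → Rn n → ℝ) (c : Rn n → ℝ) (Ψ : Rn n → ℂ) (S : Rn n × Rn n → ℂ)
    (κ μ : ℝ) (x η : Rn n) : ℂ :=
  ∫ v, Ψ v * S (x + μ • v, η) * cexp (I * ((κ * quotPhase φ c x μ v η : ℝ) : ℂ))

theorem UBd.cexp_mul_of_linear_growth {Θ : ι → Rn n × Rn n → ℝ}
    (hΘ : UBd Θ (fun _ p => 1 + ‖p.1‖) (fun _ _ => 1)) {κ r : ι → ℝ} (hκ : ∀ i, |κ i| ≤ r i)
    (hr : ∀ i, 1 ≤ r i) :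
    UBd (fun i p => cexp (I * ((κ i * Θ i p : ℝ) : ℂ))) (fun _ _ => 1)
      (fun i p => r i * (1 + ‖p.1‖)) := by
  have hr0 : ∀ i, 0 ≤ r i := fun i => zero_le_one.trans (hr i)
  refine UBd.cexp (fun i p => mul_nonneg (hr0 i) (by positivity))
    (fun i => contDiff_const.mul (hΘ.smooth i)) fun k hk => ?_
  obtain ⟨C, hC, h⟩ := hΘ.2 k
  refine ⟨C, hC, fun i p => ?_⟩
  have h1 := iteratedFDeriv_const_smul_apply' (a := κ i) ((hΘ.smooth' i k).contDiffAt (x := p))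
  simp only [smul_eq_mul] at h1
  rw [h1, norm_smul, Real.norm_eq_abs]
  have h2 : 1 ≤ r i * (1 + ‖p.1‖) := one_le_mul_of_one_le_of_one_le (hr i) (by simp)
  calc |κ i| * _ ≤ r i * (C * ((1 + ‖p.1‖) * 1 ^ k)) :=
        mul_le_mul (hκ i) (h i p) (norm_nonneg _) (hr0 i)
    _ = C * (r i * (1 + ‖p.1‖)) ^ 1 := by ring
    _ ≤ _ := by gcongr

theorem conjAmp_large (hφ : PhaseClass n 2 φ) (hs : SNDCondition n φ)
    {S : ι → Rn n × Rn n → ℂ} (hS : UBd S (fun _ _ => 1) (fun _ _ => 1))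
    (hsupp : ∀ i x η, S i (x, η) ≠ 0 → 1 / 4 ≤ ‖η‖ ∧ ‖η‖ ≤ 4) (Ψ : SchwartzMap (Rn n) ℂ)
    {κ μ : ι → ℝ} (hκ : ∀ i, 1 ≤ κ i) (hμ : ∀ i, 0 < μ i) (hμ1 : ∀ i, μ i ≤ 1)
    (x : ι → Rn n) (N : ℕ) :
    UBd (fun i η => conjAmp φ (annCut n (1 / 8) 8) Ψ (S i) (κ i) (μ i) (x i) η)
      (fun i _ => ((κ i) ^ N)⁻¹) (fun _ _ => 1) := by
  obtain ⟨k0, hk0, hlow⟩ := hφ.exists_partialFst_lower hs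
  have hc1 : ∀ η : Rn n, 1 / 4 ≤ ‖η‖ → ‖η‖ ≤ 4 → annCut n (1 / 8) 8 η = 1 := fun η h1 h2 =>
    annCut_eq_one (by norm_num) (by norm_num) (by linarith) (by linarith)
  have hcC := contDiff_annCut (n := n) (1 / 8) 8
  have hcs : HasCompactSupport (annCut n (1 / 8) 8) :=
    hasCompactSupport_annCut (by norm_num) (by norm_num)
  have hcU : tsupport (annCut n (1 / 8) 8) ⊆ {ξ | ξ ≠ 0} :=
    tsupport_annCut (by norm_num) (by norm_num)
  generalize annCut n (1 / 8) 8 = c at *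
  have habs : ∀ i, |μ i| ≤ 1 := fun i => by rw [abs_of_pos (hμ i)]; exact hμ1 i
  set Θ : ι → Rn n × Rn n → ℝ := fun i p => quotPhase φ c (x i) (μ i) p.1 p.2 with hΘdef
  have hΘ : UBd Θ (fun _ p => 1 + ‖p.1‖) (fun _ _ => 1) :=
    (hφ.UBd_quotPhase hcC hcs hcU).reindex fun i => (x i, ⟨μ i, habs i⟩)
  have hSc : UBd (fun i (p : Rn n × Rn n) => S i (x i + μ i • p.1, p.2)) (fun _ _ => 1)
      (fun _ _ => 1) := by
    have := hS.comp_affine (fun _ _ => zero_le_one) (fun _ _ => zero_le_one) (fun i : ι => i)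
      (fun i => ((μ i) • ContinuousLinearMap.fst ℝ (Rn n) (Rn n)).prod
        (ContinuousLinearMap.snd ℝ (Rn n) (Rn n))) (fun i => (x i, 0)) (fun _ => 1)
      (fun i => norm_dilate_le (habs i))
    simpa [add_comm] using this
  have hG : UBd (fun i (p : Rn n × Rn n) => c p.2 • partialFst φ (x i + μ i • p.1) p.2)
      (fun _ _ => 1) (fun _ _ => 1) := by
    have := (hφ.UBd_partialFst hcC hcs hcU).comp_affine (fun _ _ => zero_le_one)
      (fun _ _ => zero_le_one) (fun i : ι => ())
      (fun i => ((μ i) • ContinuousLinearMap.fst ℝ (Rn n) (Rn n)).prod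
        (ContinuousLinearMap.snd ℝ (Rn n) (Rn n))) (fun i => (x i, 0)) (fun _ => 1)
      (fun i => norm_dilate_le (habs i))
    simpa [add_comm] using this
  have hΨ : ∀ M : ℕ, UBd (fun (i : ι) (p : Rn n × Rn n) => Ψ p.1)
      (fun _ p => ((1 + ‖p.1‖) ^ M)⁻¹) (fun _ _ => 1) := fun M => by
    have := (UBd.of_schwartz (ι := Unit) Ψ M).comp_affine (fun _ _ => by positivity)
      (fun _ _ => zero_le_one) (fun _ : ι => ())
      (fun _ => ContinuousLinearMap.fst ℝ (Rn n) (Rn n)) (fun _ => 0) (fun _ => 1)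
      (fun _ => ContinuousLinearMap.norm_fst_le ℝ (Rn n) (Rn n))
    simpa using this
  set B : ι → Rn n × Rn n → ℂ := fun i p => Ψ p.1 * S i (x i + μ i • p.1, p.2) with hBdef
  have hB : ∀ M : ℕ, UBd B (fun _ p => ((1 + ‖p.1‖) ^ M)⁻¹) (fun _ _ => 1) := fun M => by
    have := (hΨ M).bilin (ContinuousLinearMap.mul ℝ ℂ) hSc (fun _ _ => by positivity)
      (fun _ _ => zero_le_one)
    simp only [mul_one] at this
    exact this
  set T : Set (Rn n × Rn n) := {p | 1 / 4 ≤ ‖p.2‖ ∧ ‖p.2‖ ≤ 4} with hT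
  obtain ⟨V, hV, hVW⟩ := (hG.clm_comp (sharp n)).exists_normalize (c := k0 / 4) (by positivity)
    (fun _ => T) (fun i p hp => by
      rw [norm_sharp, hc1 _ hp.1 hp.2, one_smul]
      refine le_trans ?_ (hlow _ _ (norm_ne_zero_iff.1 (by linarith [hp.1])))
      nlinarith [hp.1])
  have hder : ∀ i v η, HasFDerivAt (fun v' => Θ i (v', η))
      (c η • partialFst φ (x i + μ i • v) η) v := fun i v η =>
    hφ.hasFDerivAt_quotPhase hcC hcs hcU (x i) (hμ i).ne' v η
  obtain ⟨CG, hCG, hbG⟩ := hG.norm_le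
  have key : ∀ N : ℕ, ∃ D : ι → Rn n → ℂ, UBd D (fun _ _ => 1) (fun i _ => κ i) ∧
      ∀ i, conjAmp φ c Ψ (S i) (κ i) (μ i) (x i) = fun η => ((κ i : ℂ)⁻¹) ^ N * D i η := by
    intro N
    obtain ⟨B', hB', -, hintg⟩ := exists_nsp_forall_weight (hB (n + 1)) hV
      (fun _ _ => by positivity) (fun _ _ => integrable_weight n (Nat.lt_succ_self n))
      (fun i => hΘ.smooth i)
      (fun i η => ⟨CG, fun v => by
        rw [(hder i v η).fderiv]; simpa using hbG i (v, η)⟩)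
      (fun _ => T)
      (fun _ => (isClosed_le continuous_const continuous_snd.norm).inter
        (isClosed_le continuous_snd.norm continuous_const))
      (fun i p hp => by
        have : S i (x i + μ i • p.1, p.2) = 0 := by
          by_contra h
          exact hp (hsupp _ _ _ h)
        simp [hBdef, this])
      (fun i p hp => by
        have := hVW i p hp
        rw [inner_sharp] at this
        rw [(hder i p.1 p.2).fderiv]; exact this) N
    refine ⟨fun i η => ∫ v, B' i (v, η) * cexp (I * ((κ i * Θ i (v, η) : ℝ) : ℂ)), ?_,
      fun i => funext fun η => hintg i η (κ i) (by linarith [hκ i])⟩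
    refine UBd.integral_fst (F := fun i p => B' i p * cexp (I * ((κ i * Θ i p : ℝ) : ℂ)))
      fun M => ?_
    have h1 := (hB' _ (hB M)).mono (ρ' := fun i p => κ i * (1 + ‖p.1‖)) 1 zero_le_one
      (fun _ _ => by positivity) (fun _ _ => (one_mul _).ge) (fun _ _ => zero_le_one)
      (fun i p => one_le_mul_of_one_le_of_one_le (hκ i) (by simp))
    have h2 := hΘ.cexp_mul_of_linear_growth (κ := κ) (r := κ)
      (fun i => (abs_of_pos (by linarith [hκ i])).le) hκ
    have h3 := h1.bilin (ContinuousLinearMap.mul ℝ ℂ) h2 (fun _ _ => by positivity)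
      (fun i p => mul_nonneg (by linarith [hκ i]) (by positivity))
    simp only [mul_one] at h3
    exact h3
  refine ⟨fun i => ?_, fun l => ?_⟩
  · obtain ⟨D, hD, he⟩ := key 0
    show ContDiff ℝ _ (conjAmp φ c Ψ (S i) (κ i) (μ i) (x i))
    rw [he i]
    exact contDiff_const.mul (hD.smooth i)
  · obtain ⟨D, hD, he⟩ := key (N + l)
    obtain ⟨C, hC, h⟩ := (hD.const_mul fun i => ((κ i : ℂ)⁻¹) ^ (N + l)).2 l
    refine ⟨C, hC, fun i η => ?_⟩
    have h1 := h i η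
    have e : (fun (i : ι) v => ((κ i : ℂ)⁻¹) ^ (N + l) * D i v) i =
        conjAmp φ c Ψ (S i) (κ i) (μ i) (x i) := (he i).symm
    rw [e] at h1
    refine h1.trans_eq ?_
    have hk : 0 < κ i := by linarith [hκ i]
    simp only
    rw [norm_pow, norm_inv, Complex.norm_real, Real.norm_of_nonneg hk.le, inv_pow, pow_add, mul_inv]
    generalize κ i = t at hk
    rw [one_pow, mul_one, mul_one, mul_assoc (t ^ N)⁻¹, inv_mul_cancel₀ (by positivity), mul_one]

end ConjugatedAmplitude

section VanishingMoments

variable {n : ℕ} {ι : Type*} {φ : Rn n → Rn n → ℝ} {c : Rn n → ℝ}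

/-- `Ψ` is an `N`-fold iterated divergence of Schwartz functions. -/
def IsIteratedDiv (n : ℕ) : ℕ → SchwartzMap (Rn n) ℂ → Prop
  | 0, _ => True
  | N + 1, Ψ => ∃ Ψ' : Fin n → SchwartzMap (Rn n) ℂ, (∀ l, IsIteratedDiv n N (Ψ' l)) ∧
      ∀ v, Ψ v = ∑ l, fderiv ℝ (Ψ' l) v (EuclideanSpace.single l 1)

open FourierTransform LineDeriv SchwartzMap in
theorem isIteratedDiv_fourierInv {r : ℝ} (hr : 0 < r) (N : ℕ) (h : SchwartzMap (Rn n) ℂ)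
    (hc : HasCompactSupport h) (h0 : ∀ ξ, ‖ξ‖ < r → h ξ = 0) : IsIteratedDiv n N (𝓕⁻ h) := by
  induction N generalizing h with
  | zero => trivial
  | succ N ih =>
    have hg : ∀ l : Fin n, ContDiff ℝ (⊤ : ℕ∞) (fun ξ : Rn n =>
        (((2 * Real.pi * I)⁻¹ * ((smoothRecip (r ^ 2) (‖ξ‖ ^ 2) * ξ l : ℝ) : ℂ)) * h ξ)) := fun l =>
      (contDiff_const.mul (Complex.ofRealCLM.contDiff.comp
        (((contDiff_smoothRecip (by positivity)).comp (contDiff_norm_sq ℝ)).mul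
          (EuclideanSpace.proj l).contDiff))).mul (h.smooth _)
    have hgc : ∀ l : Fin n, HasCompactSupport (fun ξ : Rn n =>
        (((2 * Real.pi * I)⁻¹ * ((smoothRecip (r ^ 2) (‖ξ‖ ^ 2) * ξ l : ℝ) : ℂ)) * h ξ)) := fun l =>
      hc.mul_left
    refine ⟨fun l => 𝓕⁻ ((hgc l).toSchwartzMap (hg l)), fun l => ih _ (hgc l) fun ξ hξ => ?_,
      fun v => ?_⟩
    · show _ * h ξ = 0
      rw [h0 ξ hξ, mul_zero]
    · have h1 : ∀ l : Fin n, fderiv ℝ (𝓕⁻ ((hgc l).toSchwartzMap (hg l)) : SchwartzMap (Rn n) ℂ) v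
          (EuclideanSpace.single l 1) = (∂_{EuclideanSpace.single l (1 : ℝ)}
            (𝓕⁻ ((hgc l).toSchwartzMap (hg l)) : SchwartzMap (Rn n) ℂ)) v := fun l => rfl
      have h2 : h = ∑ l : Fin n, (2 * Real.pi * I) • smulLeftCLM ℂ
          (inner ℝ · (EuclideanSpace.single l (1 : ℝ))) ((hgc l).toSchwartzMap (hg l)) := by
        ext ξ
        rw [sum_apply]
        have ht : ∀ l : Fin n, (fun ξ : Rn n =>
            inner ℝ ξ (EuclideanSpace.single l (1 : ℝ))).HasTemperateGrowth := fun l =>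
          ((innerSL ℝ).flip _).hasTemperateGrowth
        by_cases hξ : ‖ξ‖ < r
        · rw [h0 ξ hξ]
          refine (Finset.sum_eq_zero fun l _ => ?_).symm
          rw [smul_apply, smulLeftCLM_apply_apply (ht l)]
          show _ • _ • (_ * h ξ) = 0
          rw [h0 ξ hξ]; simp
        · push Not at hξ
          have h3 : ∀ l : Fin n, ((2 * Real.pi * I) • smulLeftCLM ℂ
              (inner ℝ · (EuclideanSpace.single l (1 : ℝ)))
                ((hgc l).toSchwartzMap (hg l))) ξ =
              ((smoothRecip (r ^ 2) (‖ξ‖ ^ 2) * ξ l ^ 2 : ℝ) : ℂ) * h ξ := fun l => by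
            rw [smul_apply, smulLeftCLM_apply_apply (ht l)]
            show _ • _ • (((2 * Real.pi * I)⁻¹ * ((smoothRecip (r ^ 2) (‖ξ‖ ^ 2) * ξ l : ℝ) : ℂ))
              * h ξ) = _
            have : (2 * Real.pi * I : ℂ) ≠ 0 := by simp [Real.pi_ne_zero]
            rw [EuclideanSpace.inner_single_right]
            simp only [smul_eq_mul, Complex.real_smul]
            push_cast
            field_simp
            simp
            left
            ring
          rw [Finset.sum_congr rfl fun l _ => h3 l, ← Finset.sum_mul, ← Complex.ofReal_sum,
            ← Finset.mul_sum, ← EuclideanSpace.real_norm_sq_eq,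
            smoothRecip_of_le (by positivity) (by gcongr), one_div, inv_mul_cancel₀, ofReal_one,
            one_mul]
          have : 0 < ‖ξ‖ := hr.trans_le hξ
          positivity
      simp only [h1, lineDerivOp_fourierInv_eq]
      rw [← sum_apply]
      conv_lhs => rw [h2]
      congr 1
      exact map_sum (FourierTransform.fourierInvCLM ℂ (SchwartzMap (Rn n) ℂ)) _ _

theorem UBd.schwartz_mul_dilate (Ψ : SchwartzMap (Rn n) ℂ) {Q : ι → Rn n × Rn n → ℂ} {K : ℕ}
    (hQ : UBd Q (fun _ p => (1 + ‖p.1‖) ^ K) (fun _ p => 1 + ‖p.1‖))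
    {κ : ι → ℝ} (hκ : ∀ i, 0 < κ i) (hκ1 : ∀ i, κ i ≤ 1) (M : ℕ) :
    UBd (fun i (p : Rn n × Rn n) => Ψ p.1 * Q i (κ i • p.1, p.2)) (fun _ p => ((1 + ‖p.1‖) ^ M)⁻¹)
      (fun _ p => 1 * (1 + ‖p.1‖)) := by
  have hn : ∀ i (v : Rn n), ‖κ i • v‖ ≤ ‖v‖ := fun i v => by
    rw [norm_smul, Real.norm_of_nonneg (hκ i).le]
    exact mul_le_of_le_one_left (norm_nonneg _) (hκ1 i)
  have h1 := (UBd.of_schwartz (ι := Unit) Ψ (M + K)).comp_affine (fun _ _ => by positivity)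
      (fun _ _ => zero_le_one) (fun _ : ι => ())
      (fun _ => ContinuousLinearMap.fst ℝ (Rn n) (Rn n)) (fun _ => 0) (fun _ => 1)
      (fun _ => ContinuousLinearMap.norm_fst_le ℝ (Rn n) (Rn n))
  simp only [add_zero, mul_one] at h1
  have h1' := h1.mono (ρ' := fun _ p => 1 * (1 + ‖p.1‖)) 1 zero_le_one (fun _ _ => by positivity)
    (fun _ _ => (one_mul _).ge) (fun _ _ => zero_le_one) (fun _ p => by simp)
  have h2 := hQ.comp_affine (fun _ _ => by positivity) (fun _ _ => by positivity) (fun i : ι => i)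
      (fun i => ((κ i) • ContinuousLinearMap.fst ℝ (Rn n) (Rn n)).prod
        (ContinuousLinearMap.snd ℝ (Rn n) (Rn n))) (fun _ => 0) (fun _ => 1)
      (fun i => norm_dilate_le (by rw [abs_of_pos (hκ i)]; exact hκ1 i))
  simp only [add_zero, mul_one] at h2
  have h2' := h2.mono (w' := fun _ p => (1 + ‖p.1‖) ^ K) (ρ' := fun _ p => 1 * (1 + ‖p.1‖)) 1
    zero_le_one (fun _ _ => by positivity)
    (fun i p => by
      rw [one_mul]
      exact pow_le_pow_left₀ (by positivity) (add_le_add le_rfl (hn i p.1)) K)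
    (fun _ _ => by positivity) (fun i p => by
      rw [one_mul]; exact add_le_add le_rfl (hn i p.1))
  have h3 := h1'.bilin (ContinuousLinearMap.mul ℝ ℂ) h2' (fun _ _ => by positivity)
    (fun _ _ => by positivity)
  refine h3.mono 1 zero_le_one (fun _ _ => by positivity) (fun _ p => ?_)
    (fun _ _ => by positivity) fun _ _ => le_rfl
  have : (0 : ℝ) < 1 + ‖p.1‖ := by positivity
  show ((1 + ‖p.1‖) ^ (M + K))⁻¹ * (1 + ‖p.1‖) ^ K ≤ _
  rw [pow_add, mul_inv, inv_mul_cancel_right₀ (by positivity), one_mul]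

theorem UBd.integral_dilate (Ψ : SchwartzMap (Rn n) ℂ) {N : ℕ} (hΨ : IsIteratedDiv n N Ψ)
    {Q : ι → Rn n × Rn n → ℂ} {K : ℕ}
    (hQ : UBd Q (fun _ p => (1 + ‖p.1‖) ^ K) (fun _ p => 1 + ‖p.1‖))
    {κ : ι → ℝ} (hκ : ∀ i, 0 < κ i) (hκ1 : ∀ i, κ i ≤ 1) :
    UBd (fun i η => ∫ v, Ψ v * Q i (κ i • v, η)) (fun i _ => κ i ^ N) (fun _ _ => 1) := by
  induction N generalizing Ψ Q K with
  | zero =>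
    simp only [pow_zero]
    exact UBd.integral_fst (F := fun i p => Ψ p.1 * Q i (κ i • p.1, p.2)) (r := fun _ => 1)
      fun M => UBd.schwartz_mul_dilate Ψ hQ hκ hκ1 M
  | succ N ih =>
    obtain ⟨Ψ', hΨ', he⟩ := hΨ
    have hintg : ∀ (Ψ : SchwartzMap (Rn n) ℂ) {Q : ι → Rn n × Rn n → ℂ} {K : ℕ}
        (hQ : UBd Q (fun _ p => (1 + ‖p.1‖) ^ K) (fun _ p => 1 + ‖p.1‖)) i η,
        Integrable fun v => Ψ v * Q i (κ i • v, η) := by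
      intro Ψ Q K hQ i η
      have h1 := UBd.schwartz_mul_dilate Ψ hQ hκ hκ1 (n + 1)
      obtain ⟨C, hC, hb⟩ := h1.norm_le
      refine ((integrable_weight n (Nat.lt_succ_self n)).const_mul C).mono'
        ((h1.smooth i).continuous.comp (f := fun v => (v, η))
          (by fun_prop)).aestronglyMeasurable (Filter.Eventually.of_forall fun v => hb i (v, η))
    have hQ' : ∀ l : Fin n, UBd (fun i p => fderiv ℝ (Q i) p
        ((EuclideanSpace.single l (1 : ℝ), 0) : Rn n × Rn n))
        (fun _ p => (1 + ‖p.1‖) ^ (K + 1)) (fun _ p => 1 + ‖p.1‖) := fun l => by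
      have := hQ.lineDeriv_bound ((EuclideanSpace.single l (1 : ℝ), 0) : Rn n × Rn n)
      simpa only [pow_succ] using this
    have key : ∀ i η, ∫ v, Ψ v * Q i (κ i • v, η) = ∑ l, (-(κ i : ℂ)) * ∫ v, Ψ' l v *
        fderiv ℝ (Q i) (κ i • v, η) ((EuclideanSpace.single l (1 : ℝ), 0) : Rn n × Rn n) := by
      intro i η
      have hd : ∀ v, HasFDerivAt (fun v => Q i (κ i • v, η))
          ((fderiv ℝ (Q i) (κ i • v, η)).comp ((κ i • ContinuousLinearMap.id ℝ (Rn n)).prod 0))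
          v := fun v => by
        have h1 : HasFDerivAt (fun v : Rn n => (κ i • v, η))
            ((κ i • ContinuousLinearMap.id ℝ (Rn n)).prod 0) v :=
          ((hasFDerivAt_id v).const_smul (κ i)).prodMk (hasFDerivAt_const η v)
        exact (((hQ.smooth i).differentiable (by simp)) _).hasFDerivAt.comp v h1
      have hd' : ∀ l v, fderiv ℝ (fun v => Q i (κ i • v, η)) v (EuclideanSpace.single l (1 : ℝ)) =
          κ i * fderiv ℝ (Q i) (κ i • v, η) (EuclideanSpace.single l (1 : ℝ), 0) := fun l v => by
        rw [(hd v).fderiv, ContinuousLinearMap.comp_apply]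
        have : ((κ i • ContinuousLinearMap.id ℝ (Rn n)).prod 0)
            (EuclideanSpace.single l (1 : ℝ)) =
            κ i • ((EuclideanSpace.single l (1 : ℝ), 0) : Rn n × Rn n) := by
          simp
        rw [this, map_smul, Complex.real_smul]
      have hintg' := fun l => hintg (Ψ' l) (hQ' l) i η
      have h1 : ∀ l, Integrable fun v => Q i (κ i • v, η) *
          fderiv ℝ (Ψ' l) v (EuclideanSpace.single l (1 : ℝ)) := fun l => by
        have := hintg (LineDeriv.lineDerivOp (EuclideanSpace.single l (1 : ℝ)) (Ψ' l)) hQ i η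
        refine this.congr (Filter.Eventually.of_forall fun v => mul_comm _ _)
      simp only [he, Finset.sum_mul]
      rw [integral_finsetSum _ fun l _ => (h1 l).congr
        (Filter.Eventually.of_forall fun v => mul_comm _ _)]
      refine Finset.sum_congr rfl fun l _ => ?_
      have h2 := integral_mul_fderiv_eq_neg_fderiv_mul_of_integrable (μ := volume)
        (f := fun v => Q i (κ i • v, η)) (g := Ψ' l) (v := EuclideanSpace.single l (1 : ℝ))
        (by
          simp only [hd']
          refine ((hintg' l).const_mul (κ i : ℂ)).congr (Filter.Eventually.of_forall fun v => ?_)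
          show _ = _ * _
          ring)
        (h1 l) ((hintg (Ψ' l) hQ i η).congr (Filter.Eventually.of_forall fun v => mul_comm _ _))
        (fun v _ => (hd v).differentiableAt) (fun v _ => (Ψ' l).differentiableAt)
      rw [integral_congr_ae (Filter.Eventually.of_forall fun v => mul_comm _ _), h2, neg_mul,
        ← integral_const_mul]
      congr 1
      refine integral_congr_ae (Filter.Eventually.of_forall fun v => ?_)
      show fderiv ℝ (fun v => Q i (κ i • v, η)) v (EuclideanSpace.single l (1 : ℝ)) * _ = _
      rw [hd']; ring
    simp only [key]
    refine UBd.sum _ fun l _ => ?_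
    refine ((ih (Ψ' l) (hΨ' l) (hQ' l)).const_mul fun i => -(κ i : ℂ)).mono 1 zero_le_one
      (fun i _ => mul_nonneg (norm_nonneg _) (pow_nonneg (hκ i).le _)) (fun i _ => ?_)
      (fun _ _ => zero_le_one) fun _ _ => le_rfl
    rw [norm_neg, Complex.norm_real, Real.norm_of_nonneg (hκ i).le, pow_succ, one_mul, mul_comm]

theorem conjAmp_small (hφ : PhaseClass n 2 φ)
    (hc : ContDiff ℝ (⊤ : ℕ∞) c) (hcs : HasCompactSupport c) (hcU : tsupport c ⊆ {ξ | ξ ≠ 0})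
    {S : ι → Rn n × Rn n → ℂ} (hS : UBd S (fun _ _ => 1) (fun _ _ => 1))
    (Ψ : SchwartzMap (Rn n) ℂ) {N : ℕ} (hΨ : IsIteratedDiv n N Ψ)
    {κ μ lam : ι → ℝ} (hκ : ∀ i, 0 < κ i) (hκ1 : ∀ i, κ i ≤ 1) (hlam : ∀ i, 1 ≤ lam i)
    (hμ : ∀ i, κ i = lam i * μ i) (x : ι → Rn n) :
    UBd (fun i η => conjAmp φ c Ψ (S i) (κ i) (μ i) (x i) η)
      (fun i _ => κ i ^ N) (fun _ _ => 1) := by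
  have hl0 : ∀ i, lam i ≠ 0 := fun i => by linarith [hlam i]
  have habs : ∀ i, |(lam i)⁻¹| ≤ 1 := fun i => by
    rw [abs_of_pos (by have := hlam i; positivity)]; exact inv_le_one_of_one_le₀ (hlam i)
  have hΘ : UBd (fun i (p : Rn n × Rn n) => quotPhase φ c (x i) (lam i)⁻¹ p.1 p.2)
      (fun _ p => 1 + ‖p.1‖) (fun _ _ => 1) :=
    (hφ.UBd_quotPhase hc hcs hcU).reindex fun i => (x i, ⟨(lam i)⁻¹, habs i⟩)
  have hE := hΘ.cexp_mul_of_linear_growth (κ := fun _ => 1) (r := fun _ => 1) (by simp) (by simp)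
  have hSc : UBd (fun i (p : Rn n × Rn n) => S i (x i + (lam i)⁻¹ • p.1, p.2)) (fun _ _ => 1)
      (fun _ _ => 1) := by
    have := hS.comp_affine (fun _ _ => zero_le_one) (fun _ _ => zero_le_one) (fun i : ι => i)
      (fun i => ((lam i)⁻¹ • ContinuousLinearMap.fst ℝ (Rn n) (Rn n)).prod
        (ContinuousLinearMap.snd ℝ (Rn n) (Rn n))) (fun i => (x i, 0)) (fun _ => 1)
      (fun i => norm_dilate_le (habs i))
    simpa [add_comm] using this
  have hSc' := hSc.mono (ρ' := fun _ p => 1 * (1 + ‖p.1‖)) 1 zero_le_one (fun _ _ => zero_le_one)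
    (fun _ _ => (one_mul _).ge) (fun _ _ => zero_le_one) (fun _ p => by simp)
  have hQ := hSc'.bilin (ContinuousLinearMap.mul ℝ ℂ) hE (fun _ _ => zero_le_one)
    (fun _ _ => by positivity)
  simp only [one_mul, mul_one] at hQ
  have hQ0 := hQ.mono (w' := fun _ p => (1 + ‖p.1‖) ^ 0) 1 zero_le_one (fun _ _ => zero_le_one)
    (fun _ _ => by simp) (fun _ _ => by positivity) (fun _ _ => le_rfl)
  have h := UBd.integral_dilate Ψ hΨ hQ0 hκ hκ1
  have e : (fun i η => conjAmp φ c Ψ (S i) (κ i) (μ i) (x i) η) = fun i η => ∫ v, Ψ v *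
      (S i (x i + (lam i)⁻¹ • κ i • v, η) *
        cexp (I * ((quotPhase φ c (x i) (lam i)⁻¹ (κ i • v) η : ℝ) : ℂ))) := by
    ext i η
    refine integral_congr_ae (Filter.Eventually.of_forall fun v => ?_)
    show Ψ v * S i (x i + μ i • v, η) * _ = Ψ v * (S i (x i + (lam i)⁻¹ • κ i • v, η) *
      cexp (I * ((quotPhase φ c (x i) (lam i)⁻¹ (κ i • v) η : ℝ) : ℂ)))
    have e1 : (lam i)⁻¹ • κ i • v = μ i • v := by
      rw [smul_smul, hμ, inv_mul_cancel_left₀ (hl0 i)]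
    have e2 : quotPhase φ c (x i) (lam i)⁻¹ (κ i • v) η =
        κ i * quotPhase φ c (x i) (μ i) v η := by
      have h1 := hφ.mul_quotPhase hc hcs hcU (x i) (lam i)⁻¹ (κ i • v) η
      rw [e1, ← hφ.mul_quotPhase hc hcs hcU, inv_mul_eq_iff_eq_mul₀ (hl0 i)] at h1
      rw [h1, hμ]; ring
    rw [e1, e2]; ring
  rw [e]
  exact h

end VanishingMoments

section SymbolRescaling

variable {n : ℕ} {m : ℝ} {a : Rn n → Rn n → ℂ} {ψ0 : Rn n → ℝ}

theorem annCut_ne_zero {ξ : Rn n} (h : annCut n (1 / 2) 2 ξ ≠ 0) : 1 / 4 ≤ ‖ξ‖ ∧ ‖ξ‖ ≤ 4 := by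
  constructor
  · by_contra! h'
    exact h (annCut_eq_zero (by norm_num) (by norm_num) (Or.inl (by linarith)))
  · by_contra! h'
    exact h (annCut_eq_zero (by norm_num) (by norm_num) (Or.inr (by linarith)))

theorem tsupport_annCut_subset :
    tsupport (annCut n (1 / 2) 2) ⊆ {ξ : Rn n | 1 / 4 ≤ ‖ξ‖ ∧ ‖ξ‖ ≤ 4} :=
  closure_minimal (fun _ h => annCut_ne_zero h)
    ((isClosed_le continuous_const continuous_norm).inter
      (isClosed_le continuous_norm continuous_const))

theorem one_add_sq_rpow_le (e : ℝ) : ∃ D : ℝ, 0 ≤ D ∧ ∀ l r : ℝ, 1 ≤ l → 1 / 4 ≤ r → r ≤ 4 →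
    (1 + (l * r) ^ 2) ^ (e / 2) ≤ D * l ^ e := by
  refine ⟨(1 / 16) ^ (e / 2) + 17 ^ (e / 2), by positivity, fun l r hl hr hr' => ?_⟩
  have hl0 : 0 < l := by linarith
  have h1 : 1 + (l * r) ^ 2 = l ^ 2 * ((l⁻¹) ^ 2 + r ^ 2) := by field_simp
  have h2 : (l⁻¹) ^ 2 ≤ 1 := pow_le_one₀ (by positivity) (inv_le_one_of_one_le₀ hl)
  have h3 : (l ^ 2 : ℝ) ^ (e / 2) = l ^ e := by
    rw [← Real.rpow_natCast, ← Real.rpow_mul hl0.le]; congr 1; push_cast; ring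
  rw [h1, Real.mul_rpow (by positivity) (by positivity), h3, mul_comm]
  refine mul_le_mul_of_nonneg_right ?_ (by positivity)
  have h4 : 1 / 16 ≤ (l⁻¹) ^ 2 + r ^ 2 := by nlinarith [sq_nonneg l⁻¹]
  have h5 : (l⁻¹) ^ 2 + r ^ 2 ≤ 17 := by nlinarith
  rcases le_total 0 e with he | he
  · have := Real.rpow_le_rpow (by positivity) h5 (show 0 ≤ e / 2 by linarith)
    have : (0 : ℝ) ≤ (1 / 16) ^ (e / 2) := by positivity
    linarith
  · have := Real.rpow_le_rpow_of_nonpos (by norm_num) h4 (show e / 2 ≤ 0 by linarith)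
    have : (0 : ℝ) ≤ 17 ^ (e / 2) := by positivity
    linarith

theorem contDiff_iteratedFDeriv_fst (ha : ContDiff ℝ (⊤ : ℕ∞) fun p : Rn n × Rn n => a p.1 p.2)
    (b : ℕ) (x : Rn n) :
    ContDiff ℝ (⊤ : ℕ∞) fun ξ => iteratedFDeriv ℝ b (fun x' => a x' ξ) x := by
  have hs : ContDiff ℝ (⊤ : ℕ∞) fun p : Rn n × Rn n => a p.2 p.1 :=
    ha.comp (contDiff_snd.prodMk contDiff_fst)
  have h1 : ContDiff ℝ (⊤ : ℕ∞) (iteratedFDeriv ℝ b fun p : Rn n × Rn n => a p.2 p.1) :=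
    hs.iteratedFDeriv_right (by exact_mod_cast le_top)
  have e : (fun ξ => iteratedFDeriv ℝ b (fun x' => a x' ξ) x) = fun ξ =>
      (ContinuousMultilinearMap.compContinuousLinearMapL
        fun _ : Fin b => ContinuousLinearMap.inr ℝ (Rn n) (Rn n))
        (iteratedFDeriv ℝ b (fun p : Rn n × Rn n => a p.2 p.1) (ξ, x)) := by
    funext ξ
    exact iteratedFDeriv_slice (hs.of_le (by exact_mod_cast le_top)) ξ x
  rw [e]
  exact (ContinuousLinearMap.contDiff _).comp (h1.comp (contDiff_id.prodMk contDiff_const))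

theorem SymbolClass.mixedNorm_rescale_le (ha : SymbolClass n m a) (k l : ℕ) :
    ∃ C : ℝ, ∀ (t : {t : ℝ // 1 ≤ t}) (x : Rn n) (ξ : Rn n), 1 / 4 ≤ ‖ξ‖ → ‖ξ‖ ≤ 4 →
      mixedNorm k l (fun x η => (t : ℝ) ^ (-m) • a x ((t : ℝ) • η)) x ξ ≤ C := by
  obtain ⟨C, hC⟩ := ha.2 k l
  obtain ⟨D, hD, hDb⟩ := one_add_sq_rpow_le (m - k)
  refine ⟨|C| * D, fun ⟨t, ht⟩ x ξ h1 h2 => ?_⟩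
  have ht0 : 0 < t := by linarith
  have hG := contDiff_iteratedFDeriv_fst ha.1 l x
  have e1 : (fun η => iteratedFDeriv ℝ l (fun x' => t ^ (-m) • a x' (t • η)) x) =
      fun η => t ^ (-m) • iteratedFDeriv ℝ l (fun x' => a x' (t • η)) x := by
    funext η
    refine iteratedFDeriv_const_smul_apply' ?_
    exact ((ha.1.of_le (by exact_mod_cast le_top)).comp
      (contDiff_id.prodMk contDiff_const)).contDiffAt
  have hG' : ContDiff ℝ (⊤ : ℕ∞) fun η => iteratedFDeriv ℝ l (fun x' => a x' (t • η)) x :=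
    hG.comp (contDiff_const_smul t)
  have e2 := iteratedFDeriv_comp_const_smul (i := k) (f := fun ξ =>
    iteratedFDeriv ℝ l (fun x' => a x' ξ) x) t (hG.of_le (by exact_mod_cast le_top))
  rw [mixedNorm]
  simp only
  rw [e1, iteratedFDeriv_const_smul_apply' ((hG'.of_le (by exact_mod_cast le_top)).contDiffAt),
    congrFun e2 ξ, norm_smul, norm_smul, norm_pow, Real.norm_of_nonneg ht0.le,
    Real.norm_of_nonneg (by positivity)]
  have h3 := hC x (t • ξ)
  rw [norm_smul, Real.norm_of_nonneg ht0.le] at h3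
  calc _ ≤ t ^ (-m) * (t ^ k * (|C| * (D * t ^ (m - k)))) := by
        gcongr
        refine h3.trans ?_
        exact mul_le_mul (le_abs_self C) (hDb t _ ht h1 h2) (by positivity) (abs_nonneg C)
    _ = |C| * D * (t ^ (-m) * t ^ k * t ^ (m - k)) := by ring
    _ = |C| * D := by
        rw [← Real.rpow_natCast, ← Real.rpow_add ht0, ← Real.rpow_add ht0]
        simp

/-- The rescaled and localised symbol `λ^{-m} (1 - ψ₀(λη)) a(x, λη)`. -/
def symPiece (n : ℕ) (m : ℝ) (ψ0 : Rn n → ℝ) (a : Rn n → Rn n → ℂ) (t : ℝ) (p : Rn n × Rn n) : ℂ :=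
  (annCut n (1 / 2) 2 p.2 • (t ^ (-m) • a p.1 (t • p.2))) *
    (((annCut n (1 / 2) 2 p.2 * (1 - ψ0 (t • p.2)) : ℝ)) : ℂ)

theorem symPiece_ne_zero {t : ℝ} {x η : Rn n} (h : symPiece n m ψ0 a t (x, η) ≠ 0) :
    1 / 4 ≤ ‖η‖ ∧ ‖η‖ ≤ 4 := by
  refine annCut_ne_zero fun h0 => h ?_
  simp only [symPiece, h0, zero_smul, zero_mul]

theorem IsLPBase.hasCompactSupport (hψ : IsLPBase n ψ0) : HasCompactSupport ψ0 :=
  HasCompactSupport.of_support_subset_isCompact (isCompact_closedBall 0 2) fun ξ hξ => by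
    rw [mem_closedBall_zero_iff]
    by_contra! h
    exact hξ (hψ.2.2 ξ h)

theorem UBd_symPiece {ι : Type*} (hψ : IsLPBase n ψ0) (ha : SymbolClass n m a) {t : ι → ℝ}
    (ht : ∀ i, 1 ≤ t i) :
    UBd (fun i => symPiece n m ψ0 a (t i)) (fun _ _ => 1) (fun _ _ => 1) := by
  have hχ : ContDiff ℝ (⊤ : ℕ∞) (annCut n (1 / 2) 2) := contDiff_annCut _ _
  have hχs : HasCompactSupport (annCut n (1 / 2) 2) :=
    hasCompactSupport_annCut (by norm_num) (by norm_num)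
  have h1 := (UBd.of_cutoff (ι := {t : ℝ // 1 ≤ t}) (E₁ := Rn n) isOpen_univ hχ hχs
    (Set.subset_univ _) (g := fun t x η => (t : ℝ) ^ (-m) • a x ((t : ℝ) • η)) (fun t => by
      refine ContDiff.contDiffOn ?_
      show ContDiff ℝ (⊤ : ℕ∞) fun p : Rn n × Rn n => (t : ℝ) ^ (-m) • a p.1 ((t : ℝ) • p.2)
      exact (ha.1.comp (contDiff_fst.prodMk (contDiff_snd.const_smul (t : ℝ)))).const_smul _)
    (fun k l => by
      obtain ⟨C, hC⟩ := ha.mixedNorm_rescale_le k l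
      exact ⟨C, fun t x ξ hξ => hC t x ξ (tsupport_annCut_subset hξ).1
        (tsupport_annCut_subset hξ).2⟩)).reindex fun i => (⟨t i, ht i⟩ : {t : ℝ // 1 ≤ t})
  have hχ1 := UBd.of_hasCompactSupport (ι := ι) hχ hχs
  have hψ1 : UBd (fun i (η : Rn n) => ψ0 (t i • η)) (fun _ _ => 1) (fun i _ => t i) := by
    have := (UBd.of_hasCompactSupport (ι := ι) hψ.1 hψ.hasCompactSupport).comp_affine
      (fun _ _ => zero_le_one) (fun _ _ => zero_le_one) (fun i : ι => i)
      (fun i => t i • ContinuousLinearMap.id ℝ (Rn n)) (fun _ => 0) t (fun i => by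
        rw [norm_smul, Real.norm_of_nonneg (by linarith [ht i])]
        exact mul_le_of_le_one_right (by linarith [ht i]) ContinuousLinearMap.norm_id_le)
    simpa using this
  have h2 : UBd (fun i (η : Rn n) => annCut n (1 / 2) 2 η * ψ0 (t i • η)) (fun _ _ => 1)
      (fun _ _ => 1) := by
    have h3 := (hχ1.mono (ρ' := fun i _ => t i) 1 zero_le_one (fun _ _ => zero_le_one)
      (fun _ _ => (one_mul _).ge) (fun _ _ => zero_le_one) (fun i _ => ht i)).bilin
      (ContinuousLinearMap.mul ℝ ℝ) hψ1 (fun _ _ => zero_le_one) (fun i _ => by linarith [ht i])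
    refine h3.of_support (fun i => {η | 1 / 4 ≤ ‖η‖ ∧ t i * ‖η‖ ≤ 2}) (fun i =>
      (isClosed_le continuous_const continuous_norm).inter
        (isClosed_le (continuous_const.mul continuous_norm) continuous_const)) (fun i η hη => ?_)
      8 (by norm_num) (fun _ _ => by norm_num) (fun i _ => by linarith [ht i])
      (fun _ _ => zero_le_one) (fun _ _ => zero_le_one) (fun _ _ _ => by norm_num)
      (fun i η hη => ?_)
    · show annCut n (1 / 2) 2 η * ψ0 (t i • η) = 0
      by_contra h
      refine hη ⟨(annCut_ne_zero (left_ne_zero_of_mul h)).1, ?_⟩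
      by_contra! h'
      refine right_ne_zero_of_mul h (hψ.2.2 _ ?_)
      rwa [norm_smul, Real.norm_of_nonneg (by linarith [ht i])]
    · have h4 : t i * ‖η‖ ≤ 2 := hη.2
      have h5 : 1 / 4 ≤ ‖η‖ := hη.1
      nlinarith [ht i]
  have h3 : UBd (fun i (η : Rn n) => annCut n (1 / 2) 2 η * (1 - ψ0 (t i • η))) (fun _ _ => 1)
      (fun _ _ => 1) := by
    have := hχ1.add h2.neg
    simpa only [sub_eq_add_neg, mul_add, mul_one, mul_neg] using this
  have h4 := (h3.comp_affine (fun _ _ => zero_le_one) (fun _ _ => zero_le_one) (fun i : ι => i)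
    (fun _ => ContinuousLinearMap.snd ℝ (Rn n) (Rn n)) (fun _ => 0) (fun _ => 1)
    (fun _ => ContinuousLinearMap.norm_snd_le ℝ (Rn n) (Rn n))).clm_comp Complex.ofRealCLM
  simp only [add_zero, mul_one] at h4
  have h5 := h1.bilin (ContinuousLinearMap.mul ℝ ℂ) h4 (fun _ _ => zero_le_one)
    (fun _ _ => zero_le_one)
  simp only [mul_one] at h5
  exact h5

end SymbolRescaling

section LittlewoodPaleyKernels

variable {n : ℕ} {ψ0 : Rn n → ℝ}

open FourierTransform SchwartzMap in
theorem exists_schwartz_fourierInv_eq_invFT {h : Rn n → ℝ} (hh : ContDiff ℝ (⊤ : ℕ∞) h)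
    (hc : HasCompactSupport h) : ∃ H : SchwartzMap (Rn n) ℂ, HasCompactSupport H ∧
      (∀ ζ, H ζ = h (-(2 * Real.pi) • ζ)) ∧
      ∀ v, (𝓕⁻ H : SchwartzMap (Rn n) ℂ) v = invFT n h (-v) := by
  have hpi : -(2 * Real.pi) ≠ 0 := by simp [Real.pi_ne_zero]
  have h1 : HasCompactSupport fun ζ : Rn n => ((h (-(2 * Real.pi) • ζ) : ℝ) : ℂ) :=
    (hc.comp_smul hpi).comp_left (g := Complex.ofReal) Complex.ofReal_zero
  have h2 : ContDiff ℝ (⊤ : ℕ∞) fun ζ : Rn n => ((h (-(2 * Real.pi) • ζ) : ℝ) : ℂ) :=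
    Complex.ofRealCLM.contDiff.comp (hh.comp (contDiff_const_smul _))
  refine ⟨h1.toSchwartzMap h2, h1, fun ζ => rfl, fun v => ?_⟩
  rw [fourierInv_coe, Real.fourierInv_eq', invFT]
  have hcv := Measure.integral_comp_smul (volume : Measure (Rn n))
    (fun ξ => cexp (I * ((⟪-v, ξ⟫_ℝ : ℝ) : ℂ)) * ((h ξ : ℝ) : ℂ)) (-(2 * Real.pi))
  rw [finrank_euclideanSpace_fin, abs_inv, abs_pow, abs_neg,
    abs_of_pos (by positivity : (0 : ℝ) < 2 * Real.pi)] at hcv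
  rw [← Complex.real_smul, ← hcv]
  refine integral_congr_ae (Filter.Eventually.of_forall fun ζ => ?_)
  show _ • _ = cexp (I * ((⟪-v, -(2 * Real.pi) • ζ⟫_ℝ : ℝ) : ℂ)) *
    ((h (-(2 * Real.pi) • ζ) : ℝ) : ℂ)
  rw [inner_smul_right, inner_neg_left, real_inner_comm, smul_eq_mul]
  congr 2
  push_cast
  ring

theorem lpPiece_succ (j : ℕ) (ξ : Rn n) : lpPiece n ψ0 (j + 1) ξ =
    ψ0 (((2 : ℝ) ^ (j + 1))⁻¹ • ξ) - ψ0 (((2 : ℝ) ^ j)⁻¹ • ξ) := by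
  rw [lpPiece, if_neg (Nat.succ_ne_zero j)]
  have e1 : (2 : ℝ) ^ (-((j + 1 : ℕ) : ℤ)) = ((2 : ℝ) ^ (j + 1))⁻¹ := by
    rw [zpow_neg, zpow_natCast]
  have e2 : (2 : ℝ) ^ (-((j + 1 : ℕ) : ℤ) + 1) = ((2 : ℝ) ^ j)⁻¹ := by
    rw [Nat.cast_succ, neg_add_rev, neg_add_cancel_comm, zpow_neg, zpow_natCast]
  rw [e1, e2]

theorem lpPiece_zero : lpPiece n ψ0 0 = ψ0 := funext fun _ => if_pos rfl

theorem contDiff_lpPiece (hψ : IsLPBase n ψ0) (j : ℕ) :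
    ContDiff ℝ (⊤ : ℕ∞) (lpPiece n ψ0 j) := by
  cases j with
  | zero => rw [lpPiece_zero]; exact hψ.1
  | succ j =>
    rw [funext (lpPiece_succ (ψ0 := ψ0) j)]
    exact (hψ.1.comp (contDiff_const_smul _)).sub (hψ.1.comp (contDiff_const_smul _))

theorem lpPiece_eq_zero_of_large (hψ : IsLPBase n ψ0) (j : ℕ) {ξ : Rn n}
    (h : 2 * (2 : ℝ) ^ j < ‖ξ‖) : lpPiece n ψ0 j ξ = 0 := by
  have key : ∀ i ≤ j, ψ0 (((2 : ℝ) ^ i)⁻¹ • ξ) = 0 := fun i hi => by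
    refine hψ.2.2 _ ?_
    rw [norm_smul, norm_inv, norm_pow, Real.norm_two, ← div_eq_inv_mul,
      lt_div_iff₀ (by positivity)]
    refine lt_of_le_of_lt ?_ h
    gcongr
    norm_num
  cases j with
  | zero => rw [lpPiece_zero]; simpa using key 0 le_rfl
  | succ j => rw [lpPiece_succ, key _ le_rfl, key _ (Nat.le_succ j), sub_zero]

theorem lpPiece_succ_eq_zero_of_small (hψ : IsLPBase n ψ0) (j : ℕ) {ξ : Rn n}
    (h : ‖ξ‖ ≤ (2 : ℝ) ^ j) : lpPiece n ψ0 (j + 1) ξ = 0 := by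
  have key : ∀ i, j ≤ i → ψ0 (((2 : ℝ) ^ i)⁻¹ • ξ) = 1 := fun i hi => by
    refine hψ.2.1 _ ?_
    rw [norm_smul, norm_inv, norm_pow, Real.norm_two, inv_mul_le_one₀ (by positivity)]
    exact h.trans (pow_le_pow_right₀ (by norm_num) hi)
  rw [lpPiece_succ, key _ le_rfl, key _ (Nat.le_succ j), sub_self]

theorem hasCompactSupport_lpPiece (hψ : IsLPBase n ψ0) (j : ℕ) :
    HasCompactSupport (lpPiece n ψ0 j) :=
  HasCompactSupport.of_support_subset_isCompact (isCompact_closedBall 0 (2 * 2 ^ j)) fun ξ hξ => by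
    rw [mem_closedBall_zero_iff]
    by_contra! h
    exact hξ (lpPiece_eq_zero_of_large hψ j h)

theorem sum_lpPiece (K : ℕ) (ξ : Rn n) :
    ∑ k ∈ Finset.range (K + 1), lpPiece n ψ0 k ξ = ψ0 (((2 : ℝ) ^ K)⁻¹ • ξ) := by
  induction K with
  | zero => simp [lpPiece_zero]
  | succ K ih => rw [Finset.sum_range_succ, ih, lpPiece_succ]; ring

theorem invFT_comp_smul {h : Rn n → ℝ} {t : ℝ} (ht : 0 < t) (v : Rn n) :
    invFT n (fun ξ => h (t⁻¹ • ξ)) (t⁻¹ • v) = ((t ^ n : ℝ) : ℂ) * invFT n h v := by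
  have hcv := Measure.integral_comp_smul (volume : Measure (Rn n))
    (fun ξ => cexp (I * ((⟪v, ξ⟫_ℝ : ℝ) : ℂ)) * ((h ξ : ℝ) : ℂ)) t⁻¹
  rw [finrank_euclideanSpace_fin, inv_pow, inv_inv, abs_of_pos (by positivity)] at hcv
  rw [invFT, invFT, mul_left_comm, ← Complex.real_smul (x := t ^ n), ← hcv]
  congr 1
  refine integral_congr_ae (Filter.Eventually.of_forall fun ζ => ?_)
  show _ * _ = _ * _
  rw [inner_smul_left, inner_smul_right]
  rfl

theorem exists_lpKernel (hψ : IsLPBase n ψ0) : ∃ Ψ : ℕ → SchwartzMap (Rn n) ℂ,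
    (∀ j, 1 ≤ j → Ψ j = Ψ 1) ∧ (∀ N, IsIteratedDiv n N (Ψ 1)) ∧
    ∀ j v, invFT n (lpPiece n ψ0 j) (-(((2 : ℝ) ^ j)⁻¹ • v)) =
      ((((2 : ℝ) ^ j) ^ n : ℝ) : ℂ) * Ψ j v := by
  obtain ⟨H, -, -, hH⟩ := exists_schwartz_fourierInv_eq_invFT hψ.1 hψ.hasCompactSupport
  obtain ⟨H', hc', hH0', hH'⟩ := exists_schwartz_fourierInv_eq_invFT
    (h := fun ξ => lpPiece n ψ0 1 ((2 : ℝ) • ξ))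
    ((contDiff_lpPiece hψ 1).comp (contDiff_const_smul _))
    ((hasCompactSupport_lpPiece hψ 1).comp_smul two_ne_zero)
  refine ⟨fun j => if j = 0 then FourierTransform.fourierInv H else FourierTransform.fourierInv H',
    fun j hj => (if_neg (by omega)).trans (if_neg one_ne_zero).symm, fun N => ?_, fun j v => ?_⟩
  · simp only [if_neg one_ne_zero]
    refine isIteratedDiv_fourierInv (r := (4 * Real.pi)⁻¹) (by positivity) N H' hc' fun ξ hξ => ?_
    have h1 : ‖(2 : ℝ) • -(2 * Real.pi) • ξ‖ ≤ (2 : ℝ) ^ 0 := by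
      have h2 : 4 * Real.pi * ‖ξ‖ ≤ 1 := by
        rw [← one_div, lt_div_iff₀ (by positivity)] at hξ
        linarith
      rw [norm_smul, norm_smul, norm_neg, Real.norm_two, Real.norm_of_nonneg (by positivity),
        pow_zero]
      linarith
    rw [hH0', lpPiece_succ_eq_zero_of_small hψ 0 h1, Complex.ofReal_zero]
  · cases j with
    | zero => simp [lpPiece_zero, hH]
    | succ j =>
      simp only [if_neg (Nat.succ_ne_zero j)]
      rw [hH', ← smul_neg, ← invFT_comp_smul (by positivity)]
      congr 1
      funext ξ
      have h1 := lpPiece_succ (n := n) (ψ0 := ψ0) 0 ((2 : ℝ) • ((2 : ℝ) ^ (j + 1))⁻¹ • ξ)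
      simp only [zero_add, pow_one, pow_zero, inv_one, one_smul] at h1
      rw [h1, lpPiece_succ, inv_smul_smul₀ two_ne_zero, smul_smul 2, pow_succ, mul_inv_rev,
        mul_inv_cancel_left₀ two_ne_zero]

end LittlewoodPaleyKernels

section DyadicAmplitude

variable {n : ℕ} {m : ℝ} {φ : Rn n → Rn n → ℝ} {c : Rn n → ℝ} {a : Rn n → Rn n → ℂ} {ψ0 : Rn n → ℝ}

theorem UBd.of_subtype {ι X G : Type*} [NormedAddCommGroup X] [NormedSpace ℝ X]
    [NormedAddCommGroup G] [NormedSpace ℝ G] {f : ι → X → G} {w ρ : ι → X → ℝ}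
    (hw : ∀ i v, 0 ≤ w i v) (hρ : ∀ i v, 0 ≤ ρ i v) (P : ι → Prop)
    (h1 : UBd (fun i : {i // P i} => f i) (fun i => w i) (fun i => ρ i))
    (h2 : UBd (fun i : {i // ¬ P i} => f i) (fun i => w i) (fun i => ρ i)) : UBd f w ρ := by
  refine ⟨fun i => ?_, fun k => ?_⟩
  · by_cases h : P i
    · exact h1.1 ⟨i, h⟩
    · exact h2.1 ⟨i, h⟩
  · obtain ⟨C₁, hC₁, hb₁⟩ := h1.2 k
    obtain ⟨C₂, hC₂, hb₂⟩ := h2.2 k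
    refine ⟨C₁ + C₂, by positivity, fun i v => ?_⟩
    have h3 : 0 ≤ w i v * ρ i v ^ k := mul_nonneg (hw i v) (pow_nonneg (hρ i v) k)
    by_cases h : P i
    · exact (hb₁ ⟨i, h⟩ v).trans (mul_le_mul_of_nonneg_right (by linarith) h3)
    · exact (hb₂ ⟨i, h⟩ v).trans (mul_le_mul_of_nonneg_right (by linarith) h3)

theorem PhaseClass.continuous_quotPhase (hφ : PhaseClass n 2 φ)
    (hc : ContDiff ℝ (⊤ : ℕ∞) c) (hcs : HasCompactSupport c) (hcU : tsupport c ⊆ {ξ | ξ ≠ 0})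
    (μ : ℝ) (v : Rn n) : Continuous fun p : Rn n × Rn n => quotPhase φ c p.1 μ v p.2 := by
  have h1 := (hφ.contDiff_partialFst hc hcs hcU).continuous
  have h2 := continuous_parametric_integral_of_continuous (μ := (volume : Measure unitInterval))
    (f := fun (p : Rn n × Rn n) (s : unitInterval) =>
      (c p.2 • partialFst φ (p.1 + ((s : ℝ) * μ) • v) p.2) v)
    ((h1.comp (f := fun q : (Rn n × Rn n) × unitInterval =>
      (q.1.1 + ((q.2 : ℝ) * μ) • v, q.1.2)) (by fun_prop)).clm_apply continuous_const)
    isCompact_univ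
  simp only [Measure.restrict_univ] at h2
  exact h2

theorem PhaseClass.continuous_conjAmp (hφ : PhaseClass n 2 φ)
    (hc : ContDiff ℝ (⊤ : ℕ∞) c) (hcs : HasCompactSupport c) (hcU : tsupport c ⊆ {ξ | ξ ≠ 0})
    (Ψ : SchwartzMap (Rn n) ℂ) {S : Rn n × Rn n → ℂ} (hS : Continuous S) {M : ℝ}
    (hM : ∀ p, ‖S p‖ ≤ M) (κ μ : ℝ) :
    Continuous fun p : Rn n × Rn n => conjAmp φ c Ψ S κ μ p.1 p.2 := by
  unfold conjAmp
  refine continuous_of_dominated (bound := fun v => ‖Ψ v‖ * M) (fun p => ?_) (fun p => ?_) ?_ ?_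
  · have h1 : Continuous fun v => quotPhase φ c p.1 μ v p.2 := by
      have hc1 := (hφ.contDiff_partialFst hc hcs hcU).continuous
      have h2 := continuous_parametric_integral_of_continuous
        (μ := (volume : Measure unitInterval))
        (f := fun (v : Rn n) (s : unitInterval) =>
          (c p.2 • partialFst φ (p.1 + ((s : ℝ) * μ) • v) p.2) v)
        ((hc1.comp (f := fun q : Rn n × unitInterval =>
          (p.1 + ((q.2 : ℝ) * μ) • q.1, p.2)) (by fun_prop)).clm_apply continuous_fst)
        isCompact_univ
      simp only [Measure.restrict_univ] at h2
      exact h2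
    have h2 : Continuous fun v => S (p.1 + μ • v, p.2) := hS.comp (by fun_prop)
    exact ((Ψ.continuous.mul h2).mul (by fun_prop)).aestronglyMeasurable
  · refine Filter.Eventually.of_forall fun v => ?_
    rw [norm_mul, norm_cexp_I_mul, mul_one, norm_mul]
    exact mul_le_mul_of_nonneg_left (hM _) (norm_nonneg _)
  · exact Ψ.integrable.norm.mul_const M
  · refine Filter.Eventually.of_forall fun v => ?_
    have h1 := hφ.continuous_quotPhase hc hcs hcU μ v
    have h2 : Continuous fun p : Rn n × Rn n => S (p.1 + μ • v, p.2) := hS.comp (by fun_prop)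
    exact (continuous_const.mul h2).mul (by fun_prop)

theorem conjAmp_ne_zero {Ψ : Rn n → ℂ} {S : Rn n × Rn n → ℂ} {κ μ : ℝ} {x η : Rn n}
    (h : conjAmp φ c Ψ S κ μ x η ≠ 0) : ∃ y, S (y, η) ≠ 0 := by
  by_contra! h0
  exact h (by simp [conjAmp, h0])

/-- The normalised amplitude of the interaction between output frequency `2^j` and
input frequency `2^k`. -/
def dyadicAmp (n : ℕ) (m : ℝ) (ψ0 : Rn n → ℝ) (a : Rn n → Rn n → ℂ) (φ : Rn n → Rn n → ℝ)
    (Ψ : ℕ → SchwartzMap (Rn n) ℂ) (N : ℕ) (i : ℕ × ℕ) (x η : Rn n) : ℂ :=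
  (2 : ℂ) ^ (N * Nat.dist i.1 i.2) * conjAmp φ (annCut n (1 / 8) 8) (Ψ i.1)
    (symPiece n m ψ0 a (2 ^ i.2)) (2 ^ i.2 * (2 ^ i.1)⁻¹) (2 ^ i.1)⁻¹ x η

theorem dyadicAmp_ne_zero {Ψ : ℕ → SchwartzMap (Rn n) ℂ} {N : ℕ} {i : ℕ × ℕ} {x η : Rn n}
    (h : dyadicAmp n m ψ0 a φ Ψ N i x η ≠ 0) : 1 / 4 ≤ ‖η‖ ∧ ‖η‖ ≤ 4 := by
  obtain ⟨y, hy⟩ := conjAmp_ne_zero (right_ne_zero_of_mul h)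
  exact symPiece_ne_zero hy

theorem continuous_dyadicAmp (hφ : PhaseClass n 2 φ) (hψ : IsLPBase n ψ0)
    (ha : SymbolClass n m a) (Ψ : ℕ → SchwartzMap (Rn n) ℂ) (N : ℕ) (i : ℕ × ℕ) :
    Continuous fun p : Rn n × Rn n => dyadicAmp n m ψ0 a φ Ψ N i p.1 p.2 := by
  have hS := UBd_symPiece (ι := Unit) hψ ha (t := fun _ => 2 ^ i.2)
    fun _ => one_le_pow₀ one_le_two
  obtain ⟨C, -, hC⟩ := hS.norm_le
  refine continuous_const.mul (hφ.continuous_conjAmp (contDiff_annCut _ _)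
    (hasCompactSupport_annCut (by norm_num) (by norm_num))
    (tsupport_annCut (by norm_num) (by norm_num)) _ (hS.smooth ()).continuous (M := C)
    (fun p => by simpa using hC () p) _ _)

theorem UBd_dyadicAmp_large (hφ : PhaseClass n 2 φ) (hs : SNDCondition n φ) (hψ : IsLPBase n ψ0)
    (ha : SymbolClass n m a) {Ψ : ℕ → SchwartzMap (Rn n) ℂ} (Ψ' : SchwartzMap (Rn n) ℂ) (N : ℕ)
    {J : Type} (j k : J → ℕ) (x : J → Rn n) (hle : ∀ i, j i ≤ k i) (he : ∀ i, Ψ (j i) = Ψ') :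
    UBd (fun i η => dyadicAmp n m ψ0 a φ Ψ N (j i, k i) (x i) η) (fun _ _ => 1)
      (fun _ _ => 1) := by
  have h2 : ∀ k : ℕ, (1 : ℝ) ≤ 2 ^ k := fun k => one_le_pow₀ one_le_two
  have h3 : ∀ i, (2 : ℝ) ^ k i * (2 ^ j i)⁻¹ = 2 ^ (k i - j i) :=
    fun i => by rw [pow_sub₀ _ two_ne_zero (hle i)]
  have h := (conjAmp_large hφ hs (UBd_symPiece (ι := J) hψ ha (t := fun i => 2 ^ k i)
    fun _ => h2 _) (fun _ _ _ h => symPiece_ne_zero h) Ψ'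
    (κ := fun i => 2 ^ k i * (2 ^ j i)⁻¹) (μ := fun i => (2 ^ j i)⁻¹)
    (fun i => by rw [h3]; exact h2 _) (fun i => by positivity)
    (fun i => inv_le_one_of_one_le₀ (h2 _)) x N).const_mul
    fun i => (2 : ℂ) ^ (N * Nat.dist (j i) (k i))
  have e : (fun (i : J) η => dyadicAmp n m ψ0 a φ Ψ N (j i, k i) (x i) η) = fun i η =>
      (2 : ℂ) ^ (N * Nat.dist (j i) (k i)) *
        conjAmp φ (annCut n (1 / 8) 8) Ψ' (symPiece n m ψ0 a (2 ^ k i))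
          (2 ^ k i * (2 ^ j i)⁻¹) (2 ^ j i)⁻¹ (x i) η := by
    funext i η
    rw [dyadicAmp, he]
  rw [e]
  refine h.mono 1 zero_le_one (fun _ _ => by positivity) (fun i _ => ?_)
    (fun _ _ => zero_le_one) (fun _ _ => le_rfl)
  rw [h3, norm_pow, Complex.norm_ofNat, Nat.dist_eq_sub_of_le (hle i), ← pow_mul, mul_comm N,
    mul_inv_cancel₀ (by positivity), one_mul]

theorem UBd_dyadicAmp_small (hφ : PhaseClass n 2 φ) (hψ : IsLPBase n ψ0)
    (ha : SymbolClass n m a) {Ψ : ℕ → SchwartzMap (Rn n) ℂ} {Ψ' : SchwartzMap (Rn n) ℂ} {N : ℕ}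
    (hΨ' : IsIteratedDiv n N Ψ')
    {J : Type} (j k : J → ℕ) (x : J → Rn n) (hle : ∀ i, k i ≤ j i) (he : ∀ i, Ψ (j i) = Ψ') :
    UBd (fun i η => dyadicAmp n m ψ0 a φ Ψ N (j i, k i) (x i) η) (fun _ _ => 1)
      (fun _ _ => 1) := by
  have h2 : ∀ k : ℕ, (1 : ℝ) ≤ 2 ^ k := fun k => one_le_pow₀ one_le_two
  have h3 : ∀ i, (2 : ℝ) ^ k i * (2 ^ j i)⁻¹ = (2 ^ (j i - k i))⁻¹ :=
    fun i => by rw [pow_sub₀ _ two_ne_zero (hle i), mul_inv, inv_inv, mul_comm]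
  have h := (conjAmp_small hφ (contDiff_annCut (1 / 8) 8)
    (hasCompactSupport_annCut (by norm_num) (by norm_num))
    (tsupport_annCut (by norm_num) (by norm_num))
    (UBd_symPiece (ι := J) hψ ha (t := fun i => 2 ^ k i) fun _ => h2 _) Ψ' hΨ'
    (κ := fun i => 2 ^ k i * (2 ^ j i)⁻¹) (μ := fun i => (2 ^ j i)⁻¹)
    (lam := fun i => 2 ^ k i)
    (fun i => by positivity) (fun i => by rw [h3]; exact inv_le_one_of_one_le₀ (h2 _))
    (fun i => h2 _) (fun i => rfl) x).const_mul
    fun i => (2 : ℂ) ^ (N * Nat.dist (j i) (k i))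
  have e : (fun (i : J) η => dyadicAmp n m ψ0 a φ Ψ N (j i, k i) (x i) η) = fun i η =>
      (2 : ℂ) ^ (N * Nat.dist (j i) (k i)) *
        conjAmp φ (annCut n (1 / 8) 8) Ψ' (symPiece n m ψ0 a (2 ^ k i))
          (2 ^ k i * (2 ^ j i)⁻¹) (2 ^ j i)⁻¹ (x i) η := by
    funext i η
    rw [dyadicAmp, he]
  rw [e]
  refine h.mono 1 zero_le_one (fun _ _ => by positivity) (fun i _ => ?_)
    (fun _ _ => zero_le_one) (fun _ _ => le_rfl)
  rw [h3, norm_pow, Complex.norm_ofNat, Nat.dist_eq_sub_of_le_right (hle i), inv_pow, ← pow_mul,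
    mul_comm N, mul_inv_cancel₀ (by positivity), one_mul]

theorem UBd_dyadicAmp (hφ : PhaseClass n 2 φ) (hs : SNDCondition n φ) (hψ : IsLPBase n ψ0)
    (ha : SymbolClass n m a) {Ψ : ℕ → SchwartzMap (Rn n) ℂ} (hΨ1 : ∀ j, 1 ≤ j → Ψ j = Ψ 1) (N : ℕ)
    (hΨ : IsIteratedDiv n N (Ψ 1)) :
    UBd (fun (i : (ℕ × ℕ) × Rn n) η => dyadicAmp n m ψ0 a φ Ψ N i.1 i.2 η) (fun _ _ => 1)
      (fun _ _ => 1) := by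
  have key : ∀ g : ℕ → ℕ → Rn n → Rn n → ℂ,
      (∀ {J : Type} (j k : J → ℕ) (x : J → Rn n), (∀ i, j i = 0) →
        UBd (fun i η => g (j i) (k i) (x i) η) (fun _ _ => 1) (fun _ _ => 1)) →
      (∀ {J : Type} (j k : J → ℕ) (x : J → Rn n), (∀ i, j i ≠ 0) → (∀ i, j i ≤ k i) →
        UBd (fun i η => g (j i) (k i) (x i) η) (fun _ _ => 1) (fun _ _ => 1)) →
      (∀ {J : Type} (j k : J → ℕ) (x : J → Rn n), (∀ i, j i ≠ 0) → (∀ i, k i ≤ j i) →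
        UBd (fun i η => g (j i) (k i) (x i) η) (fun _ _ => 1) (fun _ _ => 1)) →
      UBd (fun (i : (ℕ × ℕ) × Rn n) η => g i.1.1 i.1.2 i.2 η) (fun _ _ => 1) (fun _ _ => 1) := by
    intro g h1 h2 h3
    refine UBd.of_subtype (fun _ _ => zero_le_one) (fun _ _ => zero_le_one) (fun i => i.1.1 = 0)
      ?_ (UBd.of_subtype (fun _ _ => zero_le_one) (fun _ _ => zero_le_one)
        (fun i => i.1.1.1 ≤ i.1.1.2) ?_ ?_)
    · exact h1 (J := {i : (ℕ × ℕ) × Rn n // i.1.1 = 0})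
        (fun i => i.1.1.1) (fun i => i.1.1.2) (fun i => i.1.2) fun i => i.2
    · exact h2 (J := {i : {i : (ℕ × ℕ) × Rn n // ¬ i.1.1 = 0} // i.1.1.1 ≤ i.1.1.2})
        (fun i => i.1.1.1.1) (fun i => i.1.1.1.2) (fun i => i.1.1.2) (fun i => i.1.2)
        fun i => i.2
    · exact h3 (J := {i : {i : (ℕ × ℕ) × Rn n // ¬ i.1.1 = 0} // ¬ i.1.1.1 ≤ i.1.1.2})
        (fun i => i.1.1.1.1) (fun i => i.1.1.1.2) (fun i => i.1.1.2) (fun i => i.1.2)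
        fun i => (not_le.1 i.2).le
  exact key (fun j k x η => dyadicAmp n m ψ0 a φ Ψ N (j, k) x η)
    (fun j k x h => UBd_dyadicAmp_large hφ hs hψ ha (Ψ 0) N j k x
      (fun i => (h i).trans_le (Nat.zero_le _)) fun i => congrArg Ψ (h i))
    (fun j k x h hle => UBd_dyadicAmp_large hφ hs hψ ha (Ψ 1) N j k x hle
      fun i => hΨ1 _ (Nat.one_le_iff_ne_zero.2 (h i)))
    (fun j k x h hle => UBd_dyadicAmp_small hφ hψ ha hΨ j k x hle
      fun i => hΨ1 _ (Nat.one_le_iff_ne_zero.2 (h i)))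

end DyadicAmplitude

section FrequencyLocalisation

variable {n : ℕ} {ψ0 : Rn n → ℝ}

theorem invFT_comp_neg (h : Rn n → ℝ) (v : Rn n) :
    invFT n (fun ξ => h (-ξ)) (-v) = invFT n h v := by
  rw [invFT, invFT]
  congr 1
  rw [← integral_neg_eq_self (μ := volume)
    fun ξ => cexp (I * ((⟪v, ξ⟫_ℝ : ℝ) : ℂ)) * ((h ξ : ℝ) : ℂ)]
  simp only [inner_neg_left, inner_neg_right]

open FourierTransform in
theorem exists_schwartz_smoothOp {h : Rn n → ℝ} (hh : ContDiff ℝ (⊤ : ℕ∞) h)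
    (hc : HasCompactSupport h) (f : SchwartzMap (Rn n) ℂ) :
    ∃ g : SchwartzMap (Rn n) ℂ, (∀ x, smoothOp n h f x = g x) ∧
      ∀ ξ, ftransform n g ξ = h ξ * ftransform n f ξ := by
  obtain ⟨H, -, hH, hHi⟩ := exists_schwartz_fourierInv_eq_invFT (h := fun ξ => h (-ξ))
    (hh.comp contDiff_neg) (hc.comp_homeomorph (Homeomorph.neg _))
  refine ⟨SchwartzMap.convolution (ContinuousLinearMap.mul ℂ ℂ) (FourierTransform.fourierInv H) f,
    fun x => ?_, fun ξ => ?_⟩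
  · rw [SchwartzMap.convolution_apply, convolution_eq_swap, smoothOp]
    refine integral_congr_ae (Filter.Eventually.of_forall fun y => ?_)
    simp only [ContinuousLinearMap.mul_apply']
    rw [hHi, invFT_comp_neg]
  · have h1 : ξ = (2 * Real.pi) • (2 * Real.pi)⁻¹ • ξ := by
      rw [smul_smul, mul_inv_cancel₀ (by positivity), one_smul]
    rw [h1, ftransform_eq_fourier, ftransform_eq_fourier, ← SchwartzMap.fourier_coe,
      SchwartzMap.fourier_convolution, SchwartzMap.pairing_apply_apply,
      FourierTransform.fourier_fourierInv_eq, ContinuousLinearMap.mul_apply', hH,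
      SchwartzMap.fourier_coe, neg_smul, neg_neg]

theorem smoothOp_lpPiece_eq {Ψ : ℕ → SchwartzMap (Rn n) ℂ}
    (hΨ : ∀ j v, invFT n (lpPiece n ψ0 j) (-(((2 : ℝ) ^ j)⁻¹ • v)) =
      ((((2 : ℝ) ^ j) ^ n : ℝ) : ℂ) * Ψ j v) (j : ℕ) (g : Rn n → ℂ) (x : Rn n) :
    smoothOp n (lpPiece n ψ0 j) g x = ∫ v, Ψ j v * g (x + ((2 : ℝ) ^ j)⁻¹ • v) := by
  have h2 : (0 : ℝ) < 2 ^ j := by positivity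
  have h1 := Measure.integral_comp_smul (volume : Measure (Rn n))
    (fun y => invFT n (lpPiece n ψ0 j) (-y) * g (x + y)) ((2 : ℝ) ^ j)⁻¹
  rw [finrank_euclideanSpace_fin, inv_pow, inv_inv, abs_of_pos (by positivity)] at h1
  simp only [hΨ] at h1
  have h3 : smoothOp n (lpPiece n ψ0 j) g x =
      ∫ y, invFT n (lpPiece n ψ0 j) (-y) * g (x + y) := by
    rw [smoothOp, ← integral_add_left_eq_self (μ := volume) _ x]
    simp only [sub_add_cancel_left]
  have h4 : ((((2 : ℝ) ^ j) ^ n : ℝ) : ℂ) ≠ 0 := by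
    rw [Complex.ofReal_ne_zero]
    positivity
  rw [← h3] at h1
  simp only [mul_assoc] at h1
  rw [integral_const_mul, Complex.real_smul] at h1
  exact (mul_left_cancel₀ h4 h1).symm

theorem integrable_weight_mul_ftransform (f : SchwartzMap (Rn n) ℂ) (m : ℝ) :
    Integrable fun ξ => (1 + ‖ξ‖ ^ 2) ^ (m / 2) * ‖ftransform n f ξ‖ := by
  have h2 : (2 * Real.pi) ≠ 0 := by positivity
  have hg := (Function.hasTemperateGrowth_one_add_norm_sq_rpow (Rn n) (m / 2)).comp
    ((2 * Real.pi) • ContinuousLinearMap.id ℝ (Rn n)).hasTemperateGrowth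
  rw [← integrable_comp_smul_iff volume _ h2]
  have h1 := (SchwartzMap.smulLeftCLM ℂ ((fun ξ : Rn n => (1 + ‖ξ‖ ^ 2) ^ (m / 2)) ∘
    ((2 * Real.pi) • ContinuousLinearMap.id ℝ (Rn n)))
      (FourierTransform.fourier f)).integrable (μ := volume).norm
  refine h1.congr (Filter.Eventually.of_forall fun ζ => ?_)
  show ‖_‖ = (1 + ‖(2 * Real.pi) • ζ‖ ^ 2) ^ (m / 2) * ‖ftransform n f ((2 * Real.pi) • ζ)‖
  rw [SchwartzMap.smulLeftCLM_apply_apply hg, norm_smul, ftransform_eq_fourier,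
    SchwartzMap.fourier_coe, Real.norm_of_nonneg (by simp only [Function.comp]; positivity)]
  rfl

theorem enorm_integral_le_tsum_lpPiece (hψ : IsLPBase n ψ0) {Φ : Rn n → ℂ} (hΦ : Integrable Φ) :
    ‖∫ ξ, Φ ξ‖ₑ ≤ ∑' k, ‖∫ ξ, Φ ξ * ((lpPiece n ψ0 k ξ : ℝ) : ℂ)‖ₑ := by
  obtain ⟨M, hM⟩ := hψ.hasCompactSupport.exists_bound_of_continuous hψ.1.continuous
  have hintg : ∀ k, Integrable fun ξ => Φ ξ * ((lpPiece n ψ0 k ξ : ℝ) : ℂ) := fun k => by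
    obtain ⟨M', hM'⟩ := (hasCompactSupport_lpPiece hψ k).exists_bound_of_continuous
      (contDiff_lpPiece hψ k).continuous
    refine hΦ.mul_bdd (c := M')
      (Complex.continuous_ofReal.comp (contDiff_lpPiece hψ k).continuous).aestronglyMeasurable
      (Filter.Eventually.of_forall fun ξ => ?_)
    rw [Complex.norm_real]
    exact hM' ξ
  have hlim : Filter.Tendsto (fun K : ℕ => ∫ ξ, Φ ξ * ((ψ0 (((2 : ℝ) ^ K)⁻¹ • ξ) : ℝ) : ℂ))
      Filter.atTop (nhds (∫ ξ, Φ ξ)) := by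
    refine tendsto_integral_of_dominated_convergence (fun ξ => ‖Φ ξ‖ * M) (fun K => ?_)
      (hΦ.norm.mul_const M) (fun K => Filter.Eventually.of_forall fun ξ => ?_)
      (Filter.Eventually.of_forall fun ξ => ?_)
    · exact hΦ.aestronglyMeasurable.mul (Complex.continuous_ofReal.comp
        (hψ.1.continuous.comp (continuous_const_smul _))).aestronglyMeasurable
    · rw [norm_mul, Complex.norm_real]
      exact mul_le_mul_of_nonneg_left (hM _) (norm_nonneg _)
    · refine tendsto_const_nhds.congr' ?_
      have h1 := (tendsto_pow_atTop_atTop_of_one_lt (one_lt_two (α := ℝ))).eventually_ge_atTop ‖ξ‖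
      filter_upwards [h1] with K hK
      rw [hψ.2.1, Complex.ofReal_one, mul_one]
      rw [norm_smul, Real.norm_of_nonneg (by positivity)]
      exact inv_mul_le_one_of_le₀ hK (by positivity)
  refine le_of_tendsto hlim.enorm (Filter.Eventually.of_forall fun K => ?_)
  have h1 : ∫ ξ, Φ ξ * ((ψ0 (((2 : ℝ) ^ K)⁻¹ • ξ) : ℝ) : ℂ) =
      ∑ k ∈ Finset.range (K + 1), ∫ ξ, Φ ξ * ((lpPiece n ψ0 k ξ : ℝ) : ℂ) := by
    rw [← integral_finsetSum _ fun k _ => hintg k]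
    refine integral_congr_ae (Filter.Eventually.of_forall fun ξ => ?_)
    show _ = ∑ k ∈ Finset.range (K + 1), Φ ξ * ((lpPiece n ψ0 k ξ : ℝ) : ℂ)
    rw [← Finset.mul_sum, ← Complex.ofReal_sum, sum_lpPiece]
  rw [h1]
  exact (enorm_sum_le _ _).trans (ENNReal.sum_le_tsum _)

/-- The operator with kernel `A` acting on the Fourier side, localised to output frequency `2^j`. -/
theorem smoothOp_lpPiece_integral_mul {Ψ : ℕ → SchwartzMap (Rn n) ℂ}
    (hΨ : ∀ j v, invFT n (lpPiece n ψ0 j) (-(((2 : ℝ) ^ j)⁻¹ • v)) =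
      ((((2 : ℝ) ^ j) ^ n : ℝ) : ℂ) * Ψ j v) (j : ℕ) {A : Rn n → Rn n → ℂ} {F : Rn n → ℂ}
    (hA : Continuous fun p : Rn n × Rn n => A p.1 p.2) (hF : Continuous F) {w : Rn n → ℝ}
    (hw : ∀ x ξ, ‖A x ξ‖ ≤ w ξ) (hwF : Integrable fun ξ => w ξ * ‖F ξ‖) (c : ℂ) (x : Rn n) :
    Integrable (fun ξ => (∫ v, Ψ j v * A (x + ((2 : ℝ) ^ j)⁻¹ • v) ξ) * F ξ) ∧
    smoothOp n (lpPiece n ψ0 j) (fun x => c * ∫ ξ, A x ξ * F ξ) x =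
      c * ∫ ξ, (∫ v, Ψ j v * A (x + ((2 : ℝ) ^ j)⁻¹ • v) ξ) * F ξ := by
  have hi : Integrable (fun q : Rn n × Rn n =>
      Ψ j q.1 * (A (x + ((2 : ℝ) ^ j)⁻¹ • q.1) q.2 * F q.2)) (volume.prod volume) := by
    refine ((Ψ j).integrable.norm.mul_prod hwF).mono' ?_ (Filter.Eventually.of_forall fun q => ?_)
    · have h1 : Continuous fun q : Rn n × Rn n => A (x + ((2 : ℝ) ^ j)⁻¹ • q.1) q.2 :=
        hA.comp (f := fun q : Rn n × Rn n => (x + ((2 : ℝ) ^ j)⁻¹ • q.1, q.2)) (by fun_prop)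
      exact (((Ψ j).continuous.comp continuous_fst).mul
        (h1.mul (hF.comp continuous_snd))).aestronglyMeasurable
    · rw [norm_mul, norm_mul]
      gcongr
      exact hw _ _
  have h2 : ∀ ξ, ∫ v, Ψ j v * (A (x + ((2 : ℝ) ^ j)⁻¹ • v) ξ * F ξ) =
      (∫ v, Ψ j v * A (x + ((2 : ℝ) ^ j)⁻¹ • v) ξ) * F ξ := fun ξ => by
    rw [← integral_mul_const]
    simp only [mul_assoc]
  constructor
  · have h3 := hi.integral_prod_right
    simp only [h2] at h3
    exact h3
  · rw [smoothOp_lpPiece_eq hΨ]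
    have h3 := integral_integral_swap
      (f := fun v ξ => Ψ j v * (A (x + ((2 : ℝ) ^ j)⁻¹ • v) ξ * F ξ)) hi
    simp only [h2] at h3
    rw [← h3, ← integral_const_mul]
    refine integral_congr_ae (Filter.Eventually.of_forall fun v => ?_)
    simp only [integral_const_mul]
    ring

end FrequencyLocalisation

section DyadicReduction

variable {n : ℕ} {m : ℝ} {ψ0 : Rn n → ℝ} {a : Rn n → Rn n → ℂ} {φ : Rn n → Rn n → ℝ}

/-- The product of the high-frequency amplitude and the oscillating factor. -/
def highFreqAmp (n : ℕ) (ψ0 : Rn n → ℝ) (a : Rn n → Rn n → ℂ) (φ : Rn n → Rn n → ℝ)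
    (x ξ : Rn n) : ℂ :=
  (((1 - ψ0 ξ : ℝ)) : ℂ) * a x ξ * cexp (I * ((φ x ξ : ℝ) : ℂ))

theorem highFreqAmp_eq_zero (hψ : IsLPBase n ψ0) (x : Rn n) {ξ : Rn n} (h : ‖ξ‖ ≤ 1) :
    highFreqAmp n ψ0 a φ x ξ = 0 := by
  rw [highFreqAmp, hψ.2.1 ξ h]
  simp

theorem continuous_highFreqAmp (hψ : IsLPBase n ψ0) (ha : SymbolClass n m a)
    (hφ : PhaseSmoothHomog n φ) :
    Continuous fun p : Rn n × Rn n => highFreqAmp n ψ0 a φ p.1 p.2 := by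
  have h1 : Continuous fun p : Rn n × Rn n => (((1 - ψ0 p.2 : ℝ)) : ℂ) * a p.1 p.2 :=
    (Complex.continuous_ofReal.comp
      (continuous_const.sub (hψ.1.continuous.comp continuous_snd))).mul ha.1.continuous
  rw [continuous_iff_continuousAt]
  rintro ⟨x, ξ⟩
  by_cases hξ : ξ = 0
  · have h2 : ∀ᶠ p : Rn n × Rn n in nhds (x, ξ), highFreqAmp n ψ0 a φ p.1 p.2 = 0 := by
      have h3 : ∀ᶠ p : Rn n × Rn n in nhds (x, ξ), ‖p.2‖ < 1 :=
        (continuous_norm.comp continuous_snd).continuousAt.eventually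
          (gt_mem_nhds (by simp [hξ]))
      filter_upwards [h3] with p hp
      exact highFreqAmp_eq_zero hψ _ hp.le
    exact (continuousAt_const (y := (0 : ℂ))).congr (h2.mono fun p hp => hp.symm)
  · have h2 : IsOpen {p : Rn n × Rn n | p.2 ≠ 0} := isOpen_ne.preimage continuous_snd
    have h3 : ContinuousAt (fun p : Rn n × Rn n => φ p.1 p.2) (x, ξ) :=
      hφ.1.continuousOn.continuousAt (h2.mem_nhds hξ)
    have h4 : Continuous fun t : ℝ => cexp (I * (t : ℂ)) := by fun_prop
    exact h1.continuousAt.mul (h4.continuousAt.comp h3)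

theorem exists_norm_highFreqAmp_le (hψ : IsLPBase n ψ0) (ha : SymbolClass n m a) :
    ∃ C : ℝ, ∀ x ξ, ‖highFreqAmp n ψ0 a φ x ξ‖ ≤ C * (1 + ‖ξ‖ ^ 2) ^ (m / 2) := by
  obtain ⟨M, hM⟩ := hψ.hasCompactSupport.exists_bound_of_continuous hψ.1.continuous
  obtain ⟨C, hC⟩ := ha.2 0 0
  refine ⟨(1 + M) * C, fun x ξ => ?_⟩
  have h1 : ‖a x ξ‖ ≤ C * (1 + ‖ξ‖ ^ 2) ^ (m / 2) := by
    have h := hC x ξ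
    rw [norm_iteratedFDeriv_zero, norm_iteratedFDeriv_zero, Nat.cast_zero, sub_zero] at h
    exact h
  rw [highFreqAmp, norm_mul, norm_cexp_I_mul, mul_one, norm_mul, Complex.norm_real, mul_assoc]
  have h2 : ‖1 - ψ0 ξ‖ ≤ 1 + M := (norm_sub_le _ _).trans (by rw [norm_one]; linarith [hM ξ])
  exact mul_le_mul h2 h1 (norm_nonneg _) ((norm_nonneg _).trans h2)

theorem symPiece_eq_of_lpPiece_ne_zero (hψ : IsLPBase n ψ0) {k : ℕ} {ξ : Rn n}
    (h : lpPiece n ψ0 k ξ ≠ 0) (x : Rn n) :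
    symPiece n m ψ0 a (2 ^ k) (x, ((2 : ℝ) ^ k)⁻¹ • ξ) =
      ((((2 : ℝ) ^ k) ^ (-m) : ℝ) : ℂ) * ((((1 - ψ0 ξ : ℝ)) : ℂ) * a x ξ) := by
  have h2 : (0 : ℝ) < 2 ^ k := by positivity
  have hξ : (2 : ℝ) ^ k • ((2 : ℝ) ^ k)⁻¹ • ξ = ξ := by
    rw [smul_smul, mul_inv_cancel₀ h2.ne', one_smul]
  rw [symPiece, hξ]
  by_cases h1 : ‖ξ‖ ≤ 1
  · rw [hψ.2.1 ξ h1]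
    simp
  · have h3 : ‖((2 : ℝ) ^ k)⁻¹ • ξ‖ = ((2 : ℝ) ^ k)⁻¹ * ‖ξ‖ := by
      rw [norm_smul, Real.norm_of_nonneg (by positivity)]
    have h4 : annCut n (1 / 2) 2 (((2 : ℝ) ^ k)⁻¹ • ξ) = 1 := by
      refine annCut_eq_one (by norm_num) (by norm_num) ?_ ?_
      · rw [h3, ← div_eq_inv_mul, le_div_iff₀ h2]
        cases k with
        | zero => rw [pow_zero]; push Not at h1; linarith
        | succ k =>
          by_contra! h5
          refine h (lpPiece_succ_eq_zero_of_small hψ k ?_)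
          rw [pow_succ] at h5
          linarith
      · rw [h3, ← div_eq_inv_mul, div_le_iff₀ h2]
        by_contra! h5
        exact h (lpPiece_eq_zero_of_large hψ k h5)
    rw [h4, one_smul, one_mul, Complex.real_smul]
    ring

theorem integral_highFreqAmp_mul_lpPiece (hψ : IsLPBase n ψ0) (hφ : PhaseClass n 2 φ)
    (Ψ : ℕ → SchwartzMap (Rn n) ℂ) (N j k : ℕ) (x ξ : Rn n) :
    (∫ v, Ψ j v * highFreqAmp n ψ0 a φ (x + ((2 : ℝ) ^ j)⁻¹ • v) ξ) *
        ((lpPiece n ψ0 k ξ : ℝ) : ℂ) =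
      (((((2 : ℝ) ^ k) ^ m * (2 ^ (N * Nat.dist j k))⁻¹ : ℝ)) : ℂ) *
        (dyadicAmp n m ψ0 a φ Ψ N (j, k) x (((2 : ℝ) ^ k)⁻¹ • ξ) * cexp (I * ((φ x ξ : ℝ) : ℂ)) *
          ((lpPiece n ψ0 k ξ : ℝ) : ℂ)) := by
  by_cases h : lpPiece n ψ0 k ξ = 0
  · simp [h]
  have h2 : (0 : ℝ) < 2 ^ k := by positivity
  have hξ : (2 : ℝ) ^ k • ((2 : ℝ) ^ k)⁻¹ • ξ = ξ := by
    rw [smul_smul, mul_inv_cancel₀ h2.ne', one_smul]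
  rw [← mul_assoc]
  congr 1
  have hd : (2 : ℂ) ^ (N * Nat.dist j k) ≠ 0 := pow_ne_zero _ two_ne_zero
  have hm : (((((2 : ℝ) ^ k) ^ m : ℝ)) : ℂ) * ((((2 : ℝ) ^ k) ^ (-m) : ℝ) : ℂ) = 1 := by
    rw [← Complex.ofReal_mul, ← Real.rpow_add h2, add_neg_cancel, Real.rpow_zero,
      Complex.ofReal_one]
  have e : dyadicAmp n m ψ0 a φ Ψ N (j, k) x (((2 : ℝ) ^ k)⁻¹ • ξ) *
      cexp (I * ((φ x ξ : ℝ) : ℂ)) = (2 : ℂ) ^ (N * Nat.dist j k) *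
        (((((2 : ℝ) ^ k) ^ (-m) : ℝ) : ℂ) *
          ∫ v, Ψ j v * highFreqAmp n ψ0 a φ (x + ((2 : ℝ) ^ j)⁻¹ • v) ξ) := by
    rw [dyadicAmp, conjAmp, mul_assoc, ← integral_mul_const,
      ← integral_const_mul ((((2 : ℝ) ^ k) ^ (-m) : ℝ) : ℂ)]
    congr 1
    refine integral_congr_ae (Filter.Eventually.of_forall fun v => ?_)
    show Ψ j v * symPiece n m ψ0 a (2 ^ k) (x + ((2 : ℝ) ^ j)⁻¹ • v, ((2 : ℝ) ^ k)⁻¹ • ξ) *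
      cexp (I * (((2 ^ k * (2 ^ j)⁻¹) * quotPhase φ (annCut n (1 / 8) 8) x (2 ^ j)⁻¹ v
        (((2 : ℝ) ^ k)⁻¹ • ξ) : ℝ) : ℂ)) * cexp (I * ((φ x ξ : ℝ) : ℂ)) =
      ((((2 : ℝ) ^ k) ^ (-m) : ℝ) : ℂ) *
        (Ψ j v * highFreqAmp n ψ0 a φ (x + ((2 : ℝ) ^ j)⁻¹ • v) ξ)
    rw [symPiece_eq_of_lpPiece_ne_zero hψ h, highFreqAmp]
    by_cases h1 : ‖ξ‖ ≤ 1
    · rw [hψ.2.1 ξ h1]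
      simp
    have h3 : ‖((2 : ℝ) ^ k)⁻¹ • ξ‖ = ((2 : ℝ) ^ k)⁻¹ * ‖ξ‖ := by
      rw [norm_smul, Real.norm_of_nonneg (by positivity)]
    have h4 : annCut n (1 / 8) 8 (((2 : ℝ) ^ k)⁻¹ • ξ) = 1 := by
      refine annCut_eq_one (by norm_num) (by norm_num) ?_ ?_
      · rw [h3, ← div_eq_inv_mul, le_div_iff₀ h2]
        cases k with
        | zero => rw [pow_zero]; push Not at h1; linarith
        | succ k =>
          by_contra! h5
          refine h (lpPiece_succ_eq_zero_of_small hψ k ?_)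
          rw [pow_succ] at h5
          nlinarith
      · rw [h3, ← div_eq_inv_mul, div_le_iff₀ h2]
        by_contra! h5
        exact h (lpPiece_eq_zero_of_large hψ k (by linarith))
    have h5 : 2 ^ k * (2 ^ j)⁻¹ * quotPhase φ (annCut n (1 / 8) 8) x (2 ^ j)⁻¹ v
        (((2 : ℝ) ^ k)⁻¹ • ξ) = φ (x + ((2 : ℝ) ^ j)⁻¹ • v) ξ - φ x ξ := by
      rw [mul_assoc, hφ.mul_quotPhase (contDiff_annCut (1 / 8) 8)
        (hasCompactSupport_annCut (by norm_num) (by norm_num))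
        (tsupport_annCut (by norm_num) (by norm_num)), h4, one_mul, mul_sub,
        ← hφ.1.2 _ _ _ h2, ← hφ.1.2 _ _ _ h2, hξ]
    rw [h5]
    have h6 : cexp (I * ((φ (x + ((2 : ℝ) ^ j)⁻¹ • v) ξ : ℝ) : ℂ)) =
        cexp (I * ((φ (x + ((2 : ℝ) ^ j)⁻¹ • v) ξ - φ x ξ : ℝ) : ℂ)) *
          cexp (I * ((φ x ξ : ℝ) : ℂ)) := by
      rw [← Complex.exp_add]
      congr 1
      push_cast
      ring
    rw [h6]
    ring
  rw [e, Complex.ofReal_mul, Complex.ofReal_inv, Complex.ofReal_pow, Complex.ofReal_ofNat]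
  generalize (∫ v, Ψ j v * highFreqAmp n ψ0 a φ (x + ((2 : ℝ) ^ j)⁻¹ • v) ξ) = J
  calc J = ((((((2 : ℝ) ^ k) ^ m : ℝ)) : ℂ) * ((((2 : ℝ) ^ k) ^ (-m) : ℝ) : ℂ)) *
        (((2 : ℂ) ^ (N * Nat.dist j k))⁻¹ * (2 : ℂ) ^ (N * Nat.dist j k)) * J := by
        rw [hm, inv_mul_cancel₀ hd, one_mul, one_mul]
    _ = _ := by ring

/-- The constituent of the operator mapping input frequency `2^k` to output frequency `2^j`. -/
def dyadicTerm (n : ℕ) (m : ℝ) (ψ0 : Rn n → ℝ) (a : Rn n → Rn n → ℂ) (φ : Rn n → Rn n → ℝ)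
    (Ψ : ℕ → SchwartzMap (Rn n) ℂ) (N : ℕ) (f : Rn n → ℂ) (j k : ℕ) : Rn n → ℂ :=
  kerOp volume (oscKernel n φ (2 ^ k) (dyadicAmp n m ψ0 a φ Ψ N (j, k)))
    (smoothOp n (lpPiece n ψ0 k) f)

theorem kerOp_oscKernel_eq_integral (hφ : PhaseSmoothHomog n φ) {b : Rn n → Rn n → ℂ}
    (hb : ∀ x, ContDiff ℝ (⊤ : ℕ∞) (b x)) (hsupp : ∀ x η, b x η ≠ 0 → 1 / 4 ≤ ‖η‖ ∧ ‖η‖ ≤ 4)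
    {lam : ℝ} (hlam : 0 < lam) {g : Rn n → ℂ} (hg : Integrable g) (x : Rn n) :
    kerOp volume (oscKernel n φ lam b) g x =
      ∫ ξ, b x (lam⁻¹ • ξ) * cexp (I * ((φ x ξ : ℝ) : ℂ)) * ftransform n g ξ := by
  have h0 : ∀ x, b x 0 = 0 := fun x => by
    by_contra h
    have := (hsupp x 0 h).1
    rw [norm_zero] at this
    linarith
  obtain ⟨h1, h2⟩ := contDiff_rescaled_amplitude hφ (hb x) (by norm_num) hlam (hsupp x) x
  have h3 := integral_ftransform_mul (h1.continuous.integrable_of_hasCompactSupport h2) hg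
  simp only [← oscKernel_eq_ftransform hφ h0 hlam] at h3
  exact h3

theorem dyadicTerm_eq_integral (hψ : IsLPBase n ψ0) (hφ : PhaseClass n 2 φ)
    {Ψ : ℕ → SchwartzMap (Rn n) ℂ} {N : ℕ}
    (hb : ∀ i x, ContDiff ℝ (⊤ : ℕ∞) (dyadicAmp n m ψ0 a φ Ψ N i x)) (j k : ℕ)
    (f : SchwartzMap (Rn n) ℂ) (x : Rn n) :
    dyadicTerm n m ψ0 a φ Ψ N f j k x =
      ∫ ξ, dyadicAmp n m ψ0 a φ Ψ N (j, k) x (((2 : ℝ) ^ k)⁻¹ • ξ) *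
        cexp (I * ((φ x ξ : ℝ) : ℂ)) * ((lpPiece n ψ0 k ξ : ℝ) : ℂ) * ftransform n f ξ := by
  obtain ⟨g, hg, hgF⟩ := exists_schwartz_smoothOp (contDiff_lpPiece hψ k)
    (hasCompactSupport_lpPiece hψ k) f
  rw [dyadicTerm, funext hg, kerOp_oscKernel_eq_integral hφ.1 (hb (j, k))
    (fun x η => dyadicAmp_ne_zero) (by positivity) g.integrable]
  refine integral_congr_ae (Filter.Eventually.of_forall fun ξ => ?_)
  simp only [hgF, mul_assoc]

theorem enorm_smoothOp_fio_le (hψ : IsLPBase n ψ0) (ha : SymbolClass n m a)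
    (hφ : PhaseClass n 2 φ) {Ψ : ℕ → SchwartzMap (Rn n) ℂ}
    (hΨ : ∀ j v, invFT n (lpPiece n ψ0 j) (-(((2 : ℝ) ^ j)⁻¹ • v)) =
      ((((2 : ℝ) ^ j) ^ n : ℝ) : ℂ) * Ψ j v) {N : ℕ}
    (hb : ∀ i x, ContDiff ℝ (⊤ : ℕ∞) (dyadicAmp n m ψ0 a φ Ψ N i x)) (j : ℕ)
    (f : SchwartzMap (Rn n) ℂ) (x : Rn n) :
    ‖smoothOp n (lpPiece n ψ0 j)
        (fio n (fun x ξ => (((1 - ψ0 ξ : ℝ)) : ℂ) * a x ξ) φ f) x‖ₑ ≤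
      ∑' k, ENNReal.ofReal (((2 * Real.pi) ^ n)⁻¹ *
        (((2 : ℝ) ^ k) ^ m * (2 ^ (N * Nat.dist j k))⁻¹)) *
          ‖dyadicTerm n m ψ0 a φ Ψ N f j k x‖ₑ := by
  obtain ⟨C, hC⟩ := exists_norm_highFreqAmp_le (φ := φ) hψ ha
  have hwF : Integrable fun ξ => C * (1 + ‖ξ‖ ^ 2) ^ (m / 2) * ‖ftransform n f ξ‖ := by
    simp only [mul_assoc]
    exact (integrable_weight_mul_ftransform f m).const_mul C
  obtain ⟨h1, h2⟩ := smoothOp_lpPiece_integral_mul hΨ j (continuous_highFreqAmp hψ ha hφ.1)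
    (continuous_ftransform f.integrable) hC hwF ((((2 * Real.pi) ^ n)⁻¹ : ℝ) : ℂ) x
  have h3 : fio n (fun x ξ => (((1 - ψ0 ξ : ℝ)) : ℂ) * a x ξ) φ f =
      fun x => ((((2 * Real.pi) ^ n)⁻¹ : ℝ) : ℂ) *
        ∫ ξ, highFreqAmp n ψ0 a φ x ξ * ftransform n f ξ := rfl
  rw [h3, h2, enorm_mul]
  refine (mul_le_mul_right (enorm_integral_le_tsum_lpPiece hψ h1) _).trans_eq ?_
  rw [← ENNReal.tsum_mul_left]
  refine tsum_congr fun k => ?_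
  rw [ENNReal.ofReal_mul (by positivity), mul_assoc, dyadicTerm_eq_integral hψ hφ hb]
  have h4 : ∀ r : ℝ, 0 ≤ r → ‖(r : ℂ)‖ₑ = ENNReal.ofReal r := fun r hr => by
    rw [← ofReal_norm, Complex.norm_real, Real.norm_of_nonneg hr]
  rw [h4 _ (by positivity), ← h4 (((2 : ℝ) ^ k) ^ m * _) (by positivity), ← enorm_mul,
    ← integral_const_mul]
  congr 2
  refine integral_congr_ae (Filter.Eventually.of_forall fun ξ => ?_)
  have h5 := integral_highFreqAmp_mul_lpPiece (m := m) (a := a) hψ hφ Ψ N j k x ξ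
  simp only
  rw [mul_right_comm, h5, mul_assoc]

end DyadicReduction

section AlmostDiagonalSums

theorem sum_pow_dist_le {x : ℝ≥0∞} (hx : x ≤ 1) (j : ℕ) :
    ∑ k ∈ Finset.range j, x ^ Nat.dist j k ≤ (1 - x)⁻¹ := by
  have hd : ∀ k, k < j → Nat.dist j (j - 1 - k) = k + 1 := fun k hk => by
    rw [Nat.dist_eq_sub_of_le_right (by omega)]
    omega
  generalize Nat.dist j = d at hd
  rw [← Finset.sum_range_reflect (fun k => x ^ d k) j, ← ENNReal.tsum_geometric]
  refine (Finset.sum_le_sum fun k hk => ?_).trans (ENNReal.sum_le_tsum (Finset.range j))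
  rw [hd k (Finset.mem_range.1 hk), pow_succ]
  exact mul_le_of_le_one_right' hx

theorem tsum_pow_dist_add (x : ℝ≥0∞) (j : ℕ) :
    ∑' k, x ^ Nat.dist j (k + j) = (1 - x)⁻¹ := by
  rw [← ENNReal.tsum_geometric]
  refine tsum_congr fun k => ?_
  rw [Nat.dist_eq_sub_of_le (Nat.le_add_left j k), Nat.add_sub_cancel]

theorem ENNReal.sum_range_add_tsum (f : ℕ → ℝ≥0∞) (j : ℕ) :
    ∑ k ∈ Finset.range j, f k + ∑' k, f (k + j) = ∑' k, f k :=
  ENNReal.summable.sum_add_tsum_nat_add'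

theorem tsum_pow_dist_le {x : ℝ≥0∞} (hx : x ≤ 1) (j : ℕ) :
    ∑' k, x ^ Nat.dist j k ≤ 2 * (1 - x)⁻¹ := by
  have h1 := add_le_add (sum_pow_dist_le hx j) (tsum_pow_dist_add x j).le
  rwa [ENNReal.sum_range_add_tsum (fun k => x ^ Nat.dist j k) j, ← two_mul] at h1

/-- The sum of the weights `2^{-r|j-k|}`, up to a factor. -/
def distWeight (r : ℝ) : ℝ≥0∞ := 2 * (1 - (2⁻¹ : ℝ≥0∞) ^ r)⁻¹

theorem distWeight_ne_top {r : ℝ} (hr : 0 < r) : distWeight r ≠ ∞ := by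
  have h1 : (2⁻¹ : ℝ≥0∞) ^ r < 1 := ENNReal.rpow_lt_one (by norm_num) hr
  have h2 : (1 - (2⁻¹ : ℝ≥0∞) ^ r)⁻¹ ≠ ∞ := by
    rw [ENNReal.inv_ne_top]
    exact (tsub_pos_of_lt h1).ne'
  rw [distWeight]
  finiteness

theorem tsum_inv_pow_dist_rpow_le {r : ℝ} (hr : 0 < r) (j : ℕ) :
    ∑' k, (((2 : ℝ≥0∞) ^ Nat.dist j k)⁻¹) ^ r ≤ distWeight r := by
  have h1 : (2⁻¹ : ℝ≥0∞) ^ r ≤ 1 := ENNReal.rpow_le_one (by norm_num) hr.le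
  refine le_trans (le_of_eq (tsum_congr fun k => ?_)) (tsum_pow_dist_le h1 j)
  rw [ENNReal.inv_pow, ← ENNReal.rpow_natCast, ← ENNReal.rpow_natCast, ← ENNReal.rpow_mul,
    ← ENNReal.rpow_mul, mul_comm]

theorem ENNReal.iSup_rpow_le_tsum {ι : Type*} {r : ℝ} (hr : 0 < r) (u : ι → ℝ≥0∞) :
    (⨆ k, u k) ^ r ≤ ∑' k, u k ^ r := by
  rw [← ENNReal.orderIsoRpow_apply r hr, OrderIso.map_iSup]
  exact iSup_le fun k => by
    rw [ENNReal.orderIsoRpow_apply]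
    exact ENNReal.le_tsum k

theorem tsum_le_iSup_dist (j : ℕ) (u : ℕ → ℝ≥0∞) :
    ∑' k, u k ≤ distWeight 1 * ⨆ k, 2 ^ Nat.dist j k * u k := by
  have h1 : ∀ k, u k ≤ (((2 : ℝ≥0∞) ^ Nat.dist j k)⁻¹) ^ (1 : ℝ) *
      ⨆ k, 2 ^ Nat.dist j k * u k := fun k => by
    calc u k = (((2 : ℝ≥0∞) ^ Nat.dist j k)⁻¹) * (2 ^ Nat.dist j k * u k) := by
          rw [← mul_assoc, ENNReal.inv_mul_cancel (by positivity) (by finiteness), one_mul]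
      _ ≤ _ := by
          rw [ENNReal.rpow_one]
          gcongr
          exact le_iSup (fun k => 2 ^ Nat.dist j k * u k) k
  refine (ENNReal.tsum_le_tsum h1).trans ?_
  rw [ENNReal.tsum_mul_right]
  gcongr
  exact tsum_inv_pow_dist_rpow_le one_pos j

theorem lqSum_le_of_dist {q : ℝ≥0∞} (hq : 0 < q) (C : ℝ≥0) :
    ∃ C' : ℝ≥0, ∀ u v : ℕ → ℝ≥0∞,
      (∀ j, u j ≤ C * ⨆ k, ((2 : ℝ≥0∞) ^ Nat.dist j k)⁻¹ * v k) → lqSum q u ≤ C' * lqSum q v := by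
  by_cases hqt : q = ∞
  · refine ⟨C, fun u v h => ?_⟩
    rw [lqSum, lqSum, if_pos hqt, if_pos hqt]
    refine iSup_le fun j => (h j).trans ?_
    gcongr with k
    refine mul_le_of_le_one_left' ?_
    rw [ENNReal.inv_le_one]
    exact one_le_pow₀ (by norm_num)
  · have hr : 0 < q.toReal := ENNReal.toReal_pos hq.ne' hqt
    set r := q.toReal with hrdef
    refine ⟨C * (distWeight r ^ (1 / r)).toNNReal, fun u v h => ?_⟩
    rw [lqSum, lqSum, if_neg hqt, if_neg hqt, ENNReal.coe_mul, ENNReal.coe_toNNReal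
      (ENNReal.rpow_ne_top_of_nonneg (by positivity) (distWeight_ne_top hr))]
    have h1 : ∑' j, u j ^ r ≤ (C : ℝ≥0∞) ^ r * (distWeight r * ∑' k, v k ^ r) := by
      calc ∑' j, u j ^ r
          ≤ ∑' j, (C : ℝ≥0∞) ^ r * ∑' k, (((2 : ℝ≥0∞) ^ Nat.dist j k)⁻¹) ^ r * v k ^ r := by
            refine ENNReal.tsum_le_tsum fun j => ?_
            refine (ENNReal.rpow_le_rpow (h j) hr.le).trans ?_
            rw [ENNReal.mul_rpow_of_nonneg _ _ hr.le]
            gcongr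
            refine (ENNReal.iSup_rpow_le_tsum hr _).trans_eq (tsum_congr fun k => ?_)
            rw [ENNReal.mul_rpow_of_nonneg _ _ hr.le]
        _ = (C : ℝ≥0∞) ^ r * ∑' k, ∑' j, (((2 : ℝ≥0∞) ^ Nat.dist k j)⁻¹) ^ r * v k ^ r := by
            rw [ENNReal.tsum_mul_left, ENNReal.tsum_comm]
            simp only [Nat.dist_comm]
        _ ≤ _ := by
            refine mul_le_mul_right ?_ _
            rw [← ENNReal.tsum_mul_left]
            refine ENNReal.tsum_le_tsum fun k => ?_
            rw [ENNReal.tsum_mul_right]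
            exact mul_le_mul_left (tsum_inv_pow_dist_rpow_le hr k) _
    refine (ENNReal.rpow_le_rpow h1 (by positivity)).trans_eq ?_
    rw [ENNReal.mul_rpow_of_nonneg _ _ (by positivity),
      ENNReal.mul_rpow_of_nonneg _ _ (by positivity), ← ENNReal.rpow_mul,
      mul_one_div_cancel hr.ne', ENNReal.rpow_one, mul_assoc]

theorem eLpNorm_le_iSup_dist {α : Type*} [MeasurableSpace α] {μ : Measure α} {p : ℝ≥0∞}
    (hp : 0 < p) : ∃ C : ℝ≥0, ∀ (j : ℕ) (T : α → ℂ) (g : ℕ → α → ℂ) (W : ℕ → ℝ≥0∞),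
      (∀ k, Measurable (g k)) → (∀ x, ‖T x‖ₑ ≤ ∑' k, W k * ‖g k x‖ₑ) →
        eLpNorm T p μ ≤ C * ⨆ k, 4 ^ Nat.dist j k * (W k * eLpNorm (g k) p μ) := by
  have h4 : ∀ d : ℕ, (4 : ℝ≥0∞) ^ d = 2 ^ d * 2 ^ d := fun d => by
    rw [← mul_pow]
    norm_num
  by_cases hpt : p = ∞
  · subst hpt
    refine ⟨(distWeight 1).toNNReal, fun j T g W hg hT => ?_⟩
    rw [ENNReal.coe_toNNReal (distWeight_ne_top one_pos)]
    simp only [eLpNorm_exponent_top]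
    refine essSup_le_of_ae_le _ ?_
    have h1 : ∀ᵐ x ∂μ, ∀ k, ‖g k x‖ₑ ≤ eLpNormEssSup (g k) μ :=
      ae_all_iff.2 fun k => ae_le_eLpNormEssSup
    filter_upwards [h1] with x hx
    refine (hT x).trans ((tsum_le_iSup_dist j _).trans ?_)
    gcongr with k
    · norm_num
    · exact hx k
  · have hr : 0 < p.toReal := ENNReal.toReal_pos hp.ne' hpt
    refine ⟨(distWeight 1 * distWeight p.toReal ^ (1 / p.toReal)).toNNReal,
      fun j T g W hg hT => ?_⟩
    have hfin : distWeight p.toReal ^ (1 / p.toReal) ≠ ∞ :=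
      ENNReal.rpow_ne_top_of_nonneg (by positivity) (distWeight_ne_top hr)
    rw [ENNReal.coe_toNNReal (ENNReal.mul_ne_top (distWeight_ne_top one_pos) hfin)]
    have hL : ∀ h : α → ℂ, eLpNorm h p μ = (∫⁻ x, ‖h x‖ₑ ^ p.toReal ∂μ) ^ (1 / p.toReal) :=
      fun h => eLpNorm_eq_lintegral_rpow_enorm_toReal hp.ne' hpt
    have hL' : ∀ h : α → ℂ, ∫⁻ x, ‖h x‖ₑ ^ p.toReal ∂μ = eLpNorm h p μ ^ p.toReal := fun h => by
      rw [hL, ← ENNReal.rpow_mul, one_div_mul_cancel hr.ne', ENNReal.rpow_one]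
    set r := p.toReal with hrdef
    set S := ⨆ k, 4 ^ Nat.dist j k * (W k * eLpNorm (g k) p μ) with hS
    have h1 : ∀ x, ‖T x‖ₑ ^ r ≤
        distWeight 1 ^ r * ∑' k, (2 ^ Nat.dist j k * W k) ^ r * ‖g k x‖ₑ ^ r := fun x => by
      refine (ENNReal.rpow_le_rpow ((hT x).trans (tsum_le_iSup_dist j _)) hr.le).trans ?_
      rw [ENNReal.mul_rpow_of_nonneg _ _ hr.le]
      gcongr
      refine (ENNReal.iSup_rpow_le_tsum hr _).trans_eq (tsum_congr fun k => ?_)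
      rw [← mul_assoc, ENNReal.mul_rpow_of_nonneg _ _ hr.le]
    have hm : ∀ k, Measurable fun x => ‖g k x‖ₑ ^ r := fun k => (hg k).enorm.pow_const r
    have h2 : ∫⁻ x, ‖T x‖ₑ ^ r ∂μ ≤ distWeight 1 ^ r * (distWeight r * S ^ r) := by
      calc ∫⁻ x, ‖T x‖ₑ ^ r ∂μ
          ≤ ∫⁻ x, distWeight 1 ^ r *
              ∑' k, (2 ^ Nat.dist j k * W k) ^ r * ‖g k x‖ₑ ^ r ∂μ := lintegral_mono h1
        _ = distWeight 1 ^ r *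
              ∑' k, (2 ^ Nat.dist j k * W k) ^ r * eLpNorm (g k) p μ ^ r := by
            rw [lintegral_const_mul _ (Measurable.tsum fun k => (hm k).const_mul _),
              lintegral_tsum fun k => ((hm k).const_mul _).aemeasurable]
            congr 1
            refine tsum_congr fun k => ?_
            rw [lintegral_const_mul _ (hm k), hL']
        _ ≤ distWeight 1 ^ r * ∑' k, (((2 : ℝ≥0∞) ^ Nat.dist j k)⁻¹) ^ r * S ^ r := by
            refine mul_le_mul_right (ENNReal.tsum_le_tsum fun k => ?_) _
            rw [← ENNReal.mul_rpow_of_nonneg _ _ hr.le, ← ENNReal.mul_rpow_of_nonneg _ _ hr.le]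
            refine ENNReal.rpow_le_rpow ?_ hr.le
            calc 2 ^ Nat.dist j k * W k * eLpNorm (g k) p μ
                = ((2 : ℝ≥0∞) ^ Nat.dist j k)⁻¹ *
                  (4 ^ Nat.dist j k * (W k * eLpNorm (g k) p μ)) := by
                  rw [h4, mul_assoc ((2 : ℝ≥0∞) ^ Nat.dist j k) (2 ^ Nat.dist j k), ← mul_assoc
                    ((2 : ℝ≥0∞) ^ Nat.dist j k)⁻¹, ENNReal.inv_mul_cancel (by positivity)
                    (by finiteness), one_mul, mul_assoc]
              _ ≤ _ := by
                  gcongr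
                  exact le_iSup (fun k => 4 ^ Nat.dist j k * (W k * eLpNorm (g k) p μ)) k
        _ ≤ _ := by
            rw [ENNReal.tsum_mul_right]
            gcongr
            exact tsum_inv_pow_dist_rpow_le hr j
    rw [hL]
    refine (ENNReal.rpow_le_rpow h2 (by positivity)).trans_eq ?_
    rw [ENNReal.mul_rpow_of_nonneg _ _ (by positivity),
      ENNReal.mul_rpow_of_nonneg _ _ (by positivity), ← ENNReal.rpow_mul, ← ENNReal.rpow_mul,
      mul_one_div_cancel hr.ne', ENNReal.rpow_one, ENNReal.rpow_one, mul_assoc]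

end AlmostDiagonalSums

section BesovBound

theorem dyadic_weight_le (j k N : ℕ) (s m c : ℝ) (hN : |s| + 3 ≤ N) :
    (2 : ℝ) ^ ((j : ℝ) * s) * 4 ^ Nat.dist j k *
        (((2 : ℝ) ^ k) ^ m * (2 ^ (N * Nat.dist j k))⁻¹ * ((2 : ℝ) ^ k) ^ (-c)) ≤
      (2 ^ Nat.dist j k)⁻¹ * 2 ^ ((k : ℝ) * (s + m - c)) := by
  have hd : |(j : ℝ) - k| = (Nat.dist j k : ℕ) := by
    rcases le_total j k with h | h
    · rw [Nat.dist_eq_sub_of_le h, Nat.cast_sub h, abs_of_nonpos (by simpa using h)]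
      ring
    · rw [Nat.dist_eq_sub_of_le_right h, Nat.cast_sub h, abs_of_nonneg (by simpa using h)]
  generalize Nat.dist j k = d at hd ⊢
  have h2 : (0 : ℝ) < 2 := two_pos
  have e1 : (4 : ℝ) ^ d = 2 ^ (2 * (d : ℝ)) := by
    rw [Real.rpow_mul h2.le, Real.rpow_natCast]
    norm_num
  have e2 : ∀ r : ℝ, ((2 : ℝ) ^ k) ^ r = 2 ^ ((k : ℝ) * r) := fun r => by
    rw [Real.rpow_mul h2.le, Real.rpow_natCast]
  have e3 : ((2 : ℝ) ^ (N * d))⁻¹ = 2 ^ (-((N : ℝ) * d)) := by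
    rw [Real.rpow_neg h2.le, ← Nat.cast_mul, Real.rpow_natCast]
  have e4 : ((2 : ℝ) ^ d)⁻¹ = 2 ^ (-(d : ℝ)) := by
    rw [Real.rpow_neg h2.le, Real.rpow_natCast]
  rw [e1, e2, e2, e3, e4]
  simp only [← Real.rpow_add h2]
  refine Real.rpow_le_rpow_of_exponent_le one_le_two ?_
  have h3 : ((j : ℝ) - k) * s ≤ d * |s| := by
    rw [← hd, ← abs_mul]
    exact le_abs_self _
  have h4 : (d : ℝ) * (|s| + 3) ≤ d * N := mul_le_mul_of_nonneg_left hN (Nat.cast_nonneg d)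
  linarith

theorem besov_term_le {j k N : ℕ} {s m c b : ℝ} (hN : |s| + 3 ≤ N) (hb : 0 ≤ b) (C A X : ℝ≥0∞)
    (hA : A ≤ C * ENNReal.ofReal (((2 : ℝ) ^ k) ^ (-c)) * X) :
    ENNReal.ofReal ((2 : ℝ) ^ ((j : ℝ) * s)) * (4 ^ Nat.dist j k *
        (ENNReal.ofReal (b * (((2 : ℝ) ^ k) ^ m * (2 ^ (N * Nat.dist j k))⁻¹)) * A)) ≤
      C * ENNReal.ofReal b * (((2 : ℝ≥0∞) ^ Nat.dist j k)⁻¹ *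
        (ENNReal.ofReal ((2 : ℝ) ^ ((k : ℝ) * (s + m - c))) * X)) := by
  have h := ENNReal.ofReal_le_ofReal (dyadic_weight_le j k N s m c hN)
  generalize Nat.dist j k = d at h ⊢
  have e4 : (4 : ℝ≥0∞) ^ d = ENNReal.ofReal (4 ^ d) := by
    rw [ENNReal.ofReal_pow (by norm_num)]
    norm_num
  have e2 : ((2 : ℝ≥0∞) ^ d)⁻¹ = ENNReal.ofReal ((2 ^ d)⁻¹) := by
    rw [ENNReal.ofReal_inv_of_pos (by positivity), ENNReal.ofReal_pow (by norm_num)]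
    norm_num
  rw [ENNReal.ofReal_mul (by positivity), ENNReal.ofReal_mul (by positivity),
    ENNReal.ofReal_mul (p := (2 ^ k) ^ m * (2 ^ (N * d))⁻¹) (by positivity),
    ENNReal.ofReal_mul (p := (2 ^ d)⁻¹) (by positivity)] at h
  rw [e4, e2, ENNReal.ofReal_mul hb]
  calc _ ≤ ENNReal.ofReal ((2 : ℝ) ^ ((j : ℝ) * s)) * (ENNReal.ofReal (4 ^ d) *
        (ENNReal.ofReal b * ENNReal.ofReal (((2 : ℝ) ^ k) ^ m * (2 ^ (N * d))⁻¹) *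
          (C * ENNReal.ofReal (((2 : ℝ) ^ k) ^ (-c)) * X))) := by gcongr
    _ = C * ENNReal.ofReal b * X * (ENNReal.ofReal ((2 : ℝ) ^ ((j : ℝ) * s)) *
        ENNReal.ofReal (4 ^ d) * (ENNReal.ofReal (((2 : ℝ) ^ k) ^ m * (2 ^ (N * d))⁻¹) *
          ENNReal.ofReal (((2 : ℝ) ^ k) ^ (-c)))) := by ring
    _ ≤ C * ENNReal.ofReal b * X * (ENNReal.ofReal ((2 ^ d)⁻¹) *
        ENNReal.ofReal ((2 : ℝ) ^ ((k : ℝ) * (s + m - c)))) := mul_le_mul_right h _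
    _ = _ := by ring

end BesovBound

/-- High-frequency global Besov–Lipschitz boundedness: for `a ∈ S^m`,
an SND phase `φ ∈ Φ²` and `σ(x,ξ) = (1 - ψ₀(ξ)) a(x,ξ)`, the operator `T_σ^φ` maps
`B^{s+m-m_c(p)}_{p,q}` into `B^s_{p,q}` for all `0 < p, q ≤ ∞` and `s ∈ ℝ`. -/
theorem high_frequency_besov_boundedness
    (n : ℕ) (hn : 1 ≤ n) (s m : ℝ) (p q : ℝ≥0∞) (hp : 0 < p) (hq : 0 < q)
    (ψ0 : Rn n → ℝ) (hψ0 : IsLPBase n ψ0)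
    (a : Rn n → Rn n → ℂ) (ha : SymbolClass n m a)
    (φ : Rn n → Rn n → ℝ) (hφ : PhaseClass n 2 φ) (hφSND : SNDCondition n φ) :
    ∃ C : ℝ≥0, ∀ f : SchwartzMap (Rn n) ℂ,
      besovNorm n ψ0 s p q (fio n (fun x ξ => (((1 - ψ0 ξ : ℝ)) : ℂ) * a x ξ) φ ⇑f) ≤
        (C : ℝ≥0∞) * besovNorm n ψ0 (s + m - criticalOrder n p) p q ⇑f := by
  obtain ⟨Ψ, hΨ1, hΨd, hΨ⟩ := exists_lpKernel hψ0
  obtain ⟨N, hN⟩ := exists_nat_ge (|s| + 3)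
  have hU := UBd_dyadicAmp hφ hφSND hψ0 ha hΨ1 N (hΨd N)
  obtain ⟨C1, hC1⟩ := eLpNorm_oscKernel_le hn hφ hφSND (lam := fun i : ℕ × ℕ => (2 : ℝ) ^ i.2)
    (fun i => one_le_pow₀ one_le_two) hU (fun i x η h => dyadicAmp_ne_zero h) hp
    (fun i => continuous_dyadicAmp hφ hψ0 ha Ψ N i)
  obtain ⟨C2, hC2⟩ := eLpNorm_le_iSup_dist (μ := (volume : Measure (Rn n))) hp
  obtain ⟨C3, hC3⟩ := lqSum_le_of_dist hq
    (C2 * (C1 * (((2 * Real.pi) ^ n)⁻¹ : ℝ).toNNReal))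
  refine ⟨C3, fun f => hC3 _ _ fun j => ?_⟩
  have hterm : ∀ k, Measurable (dyadicTerm n m ψ0 a φ Ψ N f j k) ∧
      eLpNorm (dyadicTerm n m ψ0 a φ Ψ N f j k) p volume ≤
        C1 * ENNReal.ofReal (((2 : ℝ) ^ k) ^ (-criticalOrder n p)) *
          eLpNorm (smoothOp n (lpPiece n ψ0 k) f) p volume := fun k => by
    obtain ⟨g, hg, hgf⟩ := exists_schwartz_smoothOp (contDiff_lpPiece hψ0 k)
      (hasCompactSupport_lpPiece hψ0 k) f
    have hgeq : smoothOp n (lpPiece n ψ0 k) f = g := funext hg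
    rw [dyadicTerm, hgeq]
    refine ⟨measurable_kerOp (measurable_oscKernel hφ.1 (continuous_dyadicAmp hφ hψ0 ha Ψ N (j, k))
      (fun x η h => dyadicAmp_ne_zero h) _) g.continuous.measurable, ?_⟩
    refine hC1 (j, k) g g.continuous g.integrable ⟨_, SchwartzMap.norm_le_seminorm ℝ g⟩
      fun ξ hξ => ?_
    rw [hgf, lpPiece_eq_zero_of_large hψ0 k hξ, ofReal_zero, zero_mul]
  have hb : (0 : ℝ) ≤ ((2 * Real.pi) ^ n)⁻¹ := by positivity
  calc _ ≤ ENNReal.ofReal ((2 : ℝ) ^ ((j : ℝ) * s)) * (C2 * ⨆ k, 4 ^ Nat.dist j k *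
        (ENNReal.ofReal (((2 * Real.pi) ^ n)⁻¹ * (((2:ℝ) ^ k) ^ m * (2 ^ (N * Nat.dist j k))⁻¹)) *
          eLpNorm (dyadicTerm n m ψ0 a φ Ψ N f j k) p volume)) :=
        mul_le_mul_right (hC2 j _ _ _ (fun k => (hterm k).1) fun x =>
          enorm_smoothOp_fio_le hψ0 ha hφ hΨ (fun i x => hU.smooth (i, x)) j f x) _
    _ = C2 * ⨆ k, ENNReal.ofReal ((2 : ℝ) ^ ((j : ℝ) * s)) * (4 ^ Nat.dist j k *
        (ENNReal.ofReal (((2 * Real.pi) ^ n)⁻¹ * (((2:ℝ) ^ k) ^ m * (2 ^ (N * Nat.dist j k))⁻¹)) *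
          eLpNorm (dyadicTerm n m ψ0 a φ Ψ N f j k) p volume)) := by
        rw [mul_left_comm, ENNReal.mul_iSup]
    _ ≤ C2 * ⨆ k, C1 * ENNReal.ofReal (((2 * Real.pi) ^ n)⁻¹) * (((2 : ℝ≥0∞) ^ Nat.dist j k)⁻¹ *
        (ENNReal.ofReal ((2 : ℝ) ^ ((k : ℝ) * (s + m - criticalOrder n p))) *
          eLpNorm (smoothOp n (lpPiece n ψ0 k) f) p volume)) :=
        mul_le_mul_right (iSup_mono fun k => besov_term_le hN hb _ _ _ (hterm k).2) _
    _ = _ := by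
        rw [← ENNReal.mul_iSup, ← mul_assoc, ENNReal.coe_mul, ENNReal.coe_mul]
        rfl
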